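/- There exists q₀ such that for every integer q ≥ q₀ the following holds: for any subset D ⊆ {0, 1, …, q−1} with #D ≤ q^{23/80}, let B_Q^{(4)} be the set of primes p ≤ Q none of whose digits in base q lies in D. Let ν ≥ 2 and let P(X) = c_ν X^ν + ⋯ + c_1 X ∈ ℤ[X] have nonzero discriminant. Then the limiting pair correlation of the sequence (M_{B_Q^{(4)},P})_{Q ∈ ℕ} exists and is Poissonian: for every Λ > 0, lim_{Q→∞} S_{M_{B_Q^{(4)},P}}(Λ) = Λ. -/

import Mathlib

open Finset Filter

/-- The pairs `(a, q)` with `1 ≤ a ≤ q ≤ Q` and `gcd (P(a), q) = 1`, indexing the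
polynomial Farey fractions `a / q` of order `Q`. -/
def fareyPairs (P : Polynomial ℤ) (Q : ℕ) : Finset (ℕ × ℕ) :=
  (Finset.Icc 1 Q ×ˢ Finset.Icc 1 Q).filter
    (fun x => x.1 ≤ x.2 ∧ Int.gcd (P.eval (x.1 : ℤ)) (x.2 : ℤ) = 1)

/-- The set of polynomial Farey fractions of order `Q`. -/
def fareySet (P : Polynomial ℤ) (Q : ℕ) : Finset ℚ :=
  (fareyPairs P Q).image (fun x => (x.1 : ℚ) / (x.2 : ℚ))

/-- `f_P(m)` is the number of `1 ≤ d ≤ m` with `P(d) ≡ 0 (mod m)`. -/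
def fP (P : Polynomial ℤ) (m : ℕ) : ℕ :=
  ((Finset.Icc 1 m).filter (fun d : ℕ => (m : ℤ) ∣ P.eval (d : ℤ))).card

/-- `β_P = ∏_p (1 - f_P(p)/p²)`, the product over all primes. -/
noncomputable def betaP (P : Polynomial ℤ) : ℝ :=
  ∏' p : Nat.Primes, (1 - (fP P (p : ℕ) : ℝ) / ((p : ℕ) : ℝ) ^ 2)

open scoped Classical in
/-- Pair correlation measure `S_F(Λ)` of a finite set `F ⊂ ℝ/ℤ` (represented by
rationals): `(1/N) · #{(a,b) ∈ F² : a ≠ b, a - b ∈ (1/N)(0,Λ) + ℤ}`. -/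
noncomputable def pairCorr (F : Finset ℚ) (Λ : ℝ) : ℝ :=
  (((F ×ˢ F).filter (fun x => x.1 ≠ x.2 ∧
      ∃ k : ℤ, ((x.1 : ℝ) - (x.2 : ℝ) - (k : ℝ)) * (F.card : ℝ) ∈ Set.Ioo 0 Λ)).card : ℝ) /
    (F.card : ℝ)

/-- The polynomial Farey fractions with prime denominators in `B`:
`M_{B,P} = {a/p : 1 ≤ a ≤ p, gcd(P(a), p) = 1, p ∈ B}`. -/
def fareyPrimeSet (P : Polynomial ℤ) (B : Finset ℕ) : Finset ℚ :=
  B.biUnion fun p =>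
    ((Finset.Icc 1 p).filter fun a : ℕ => Int.gcd (P.eval (a : ℤ)) (p : ℤ) = 1).image
      fun a : ℕ => (a : ℚ) / (p : ℚ)

open scoped Classical in
/-- The set of primes `p ≤ Q` none of whose base-`q` digits lies in `D`. -/
noncomputable def restrictedDigitPrimes (q : ℕ) (D : Finset ℕ) (Q : ℕ) : Finset ℕ :=
  (Finset.Icc 1 Q).filter fun p => Nat.Prime p ∧ ∀ d ∈ Nat.digits q p, d ∉ D

namespace RD
scoped notation "pv" => (by positivity)
scoped notation "om" => (by omega)
scoped notation "nm" => (by norm_num)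
scoped notation "li" => (by linarith)
scoped notation "rg" => (by ring)
scoped notation "lg" => Real.log
scoped notation "xp" => Real.exp
scoped notation "πi" => Real.pi
scoped notation "mœ" => ArithmeticFunction.moebius
scoped notation "vM" => ArithmeticFunction.vonMangoldt
scoped prefix:max "§" => (Nat.cast : ℕ → ℝ)
alias Ma := mul_le_mul_of_nonneg_left
alias Mb := mul_le_mul_of_nonneg_right
alias Mc := mem_filter
alias Md := mem_range
alias Me := sum_congr
alias Mf := sum_le_sum
alias Mg := sum_le_sum_of_subset_of_nonneg
alias Mh := Nat.pow_le_pow_right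
alias Mi := norm_nonneg
alias Mj := nsmul_eq_mul
alias Mk := sum_add_distrib
alias Ml := pow_le_pow_right₀
alias Mm := Real.log_natCast_nonneg
alias Mn := card_le_card
alias Mo := Nat.mul_le_mul_right
alias Mp := Nat.prime_of_mem_primeFactors
alias Mq := card_range
alias Mr := Nat.pos_of_ne_zero
alias Ms := sum_const
alias Mt := Nat.cast_nonneg
alias Mu := mul_nonneg
alias Mv := div_le_div_of_nonneg_right
alias Mw := Real.log_pow
alias Mx := mul_le_mul
alias My := pow_le_pow_left₀
alias Mz := Real.log_le_log
alias Na := le_div_iff₀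
alias Nb := sum_nonneg
alias Nc := add_le_add
alias Nd := Nat.pow_le_pow_left
alias Nf := Nat.mul_le_mul
alias Ng := Nat.le_of_dvd
alias Nh := sum_sub_distrib
alias Ni := sum_filter
alias Nj := div_le_iff₀
alias Nk := mem_product
alias Nl := abs_nonneg
alias Nm := eventually_ge_atTop
alias Nn := mul_assoc
alias No := Complex.norm_real
alias Np := Nat.totient_pos
alias Nq := norm_sum_le
alias Nr := Int.eq_zero_of_abs_lt_dvd
alias Ns := Nat.mul_le_mul_left
alias Nt := Nat.lt_mul_div_succ
alias Nu := abs_of_pos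
alias Nv := Nat.gcd_dvd_right
alias Nw := Nat.dvd_lcm_right
alias Nx := div_le_div_iff₀
alias Ny := Complex.norm_natCast
alias Nz := one_le_pow₀
alias Lc := ArithmeticFunction.vonMangoldt_nonneg
alias Ld := Real.le_sqrt_of_sq_le
alias Le := Real.norm_eq_abs
alias Lf := prod_nonneg
alias Lg := Real.sqrt_mul
alias Lh := Nat.mem_divisorsAntidiagonal
alias Li := Nat.le_mul_of_pos_right
alias Lj := Nat.cast_pow
alias Lk := Real.le_log_iff_exp_le
alias Ll := abs_of_nonneg
alias Lm := dvd_mul_right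
alias Ln := filter_subset
alias Lo := Real.sqrt_nonneg
alias Lp := mem_image
alias Lr := Nat.coprime_one_right
alias Ls := le_mul_of_one_le_left
alias Lt := Nat.eq_zero_or_pos
alias Lu := Nat.lt_floor_add_one
alias Lv := one_div_le_one_div_of_le
alias Lw := Nat.gcd_pos_of_pos_left
alias Lx := Nat.mul_div_cancel_left
alias Ly := Finset.prod_le_prod
alias Lz := Nat.div_mul_le_self
alias Ka := Nat.dvd_lcm_left
alias Kb := div_le_one
alias Kc := mul_le_of_le_one_right
alias Kd := Nat.floor_le
alias Ke := card_sdiff_add_card_eq_card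
alias Kf := Nat.div_mul_cancel
alias Kg := Real.mul_self_sqrt
alias Kh := Real.exp_one_lt_d9
alias Ki := mul_div_assoc
alias Kj := Nat.prime_dvd_prime_iff_eq
alias Kk := Real.sqrt_le_left
alias Kl := sum_le_card_nsmul
alias Km := Nat.add_mul_mod_self_left
alias Kn := Nat.eq_of_mul_eq_mul_left
alias Ko := div_le_div_of_nonneg_left
alias Kp := sum_mul_sum
alias Kq := Nat.one_le_pow
alias Kr := Nat.div_eq_of_lt
alias Ks := prod_mul_distrib
alias Kt := Nat.gcd_dvd_left
alias Ku := Complex.conj_ofReal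
alias Kv := Nat.dvd_of_mem_divisors
alias Kw := prod_range_succ
alias Kx := range_subset_range
alias Ky := Nat.le_self_pow
alias Kz := Real.log_nonneg
alias Ja := Complex.ofReal_sum
alias Jb := Nat.modEq_zero_iff_dvd
alias Jc := le_of_mul_le_mul_right
alias Jd := div_le_one_of_le₀
alias Je := dvd_mul_left
alias Jf := Nat.le_div_iff_mul_le
alias Jg := lt_of_lt_of_le
alias Jh := Nat.add_mul_div_left
alias Ji := Finset.mem_sdiff
alias Jj := Nat.mem_divisors
alias Jk := sum_eq_zero
alias Jl := Nat.div_le_self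
alias Jm := Real.sq_sqrt
alias Jn := Nat.abs_cast
alias Jo := Real.log_pos
alias Jp := Real.log_two_gt_d9
alias Jq := abs_sum_le_sum_abs
alias Jr := prod_range_add
alias Js := Nat.lcm_dvd
alias Jt := single_le_sum
alias Ju := Nat.mod_eq_of_lt
alias Jv := Int.cast_natCast
alias Jw := div_mul_div_comm
alias Jx := Real.sqrt_le_iff
alias Jy := Nat.cast_one
alias Jz := Nat.div_add_mod
alias Ta := Nat.card_Ico
alias Tb := Nat.le_pow_clog
alias Tc := Nat.cast_div_le
alias Td := le_self_pow₀
alias Te := le_max_right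
alias Tf := prod_le_one
alias Tg := mul_one_div
alias Th := Nat.cast_zero
alias Ti := Nat.mod_lt
alias Tj := Real.exp_add
alias Tk := Real.sqrt_sq
alias Tm := Real.pi_pos
alias Tn := Nat.lcm_pos
noncomputable def ee (x : Real) : Complex := Complex.exp ((2 * πi * x : Real) * Complex.I)
lemma ee_add (x y : Real) : ee (x + y) = ee x * ee y := by
  unfold ee; rw [← Complex.exp_add]; congr 1; push_cast; ring
lemma norm_ee (x : Real) : ‖ee x‖ = 1 := Complex.norm_exp_ofReal_mul_I _
lemma ee_int (n : Int) : ee n = 1 := by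
  unfold ee; rw [Complex.exp_eq_one_iff]; exact ⟨n, by push_cast; ring⟩
lemma ee_zero : ee 0 = 1 := by simpa using ee_int 0
lemma ee_add_int (x : Real) (n : Int) : ee (x + n) = ee x := by rw [ee_add, ee_int, mul_one]
lemma ee_nat_mul (n : Nat) (x : Real) : ee (n * x) = ee x ^ n := by
  unfold ee; rw [← Complex.exp_nat_mul]; congr 1; push_cast; ring
lemma ee_neg (x : Real) : ee (-x) = (starRingEnd Complex) (ee x) := by
  unfold ee; rw [← Complex.exp_conj]; congr 1; rw [map_mul, Ku, Complex.conj_I]; push_cast; ring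
lemma ee_lip (x y : Real) : ‖ee x - ee y‖ ≤ 2 * πi * |x - y| := by
  have h : ee x - ee y = ee y * (ee (x - y) - 1) := by
    rw [mul_sub, ← ee_add]; simp
  rw [h, norm_mul, norm_ee, one_mul]
  have := Real.norm_exp_I_mul_ofReal_sub_one_le (x := 2 * πi * (x - y))
  unfold ee; rw [mul_comm (((2 * πi * (x - y) : Real)) : Complex)]
  refine this.trans (le_of_eq ?_)
  rw [Le, abs_mul, Nu Real.two_pi_pos]
noncomputable def nn (x : Real) : Real := |x - round x|
lemma nn_nonneg (x : Real) : 0 ≤ nn x := Nl _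
lemma nn_le_half (x : Real) : nn x ≤ 1 / 2 := abs_sub_round x
lemma nn_le (x : Real) (n : Int) : nn x ≤ |x - n| := round_le x n
lemma nn_lip (x y : Real) : nn x ≤ nn y + |x - y| := by
  have := nn_le x (round y)
  have h2 := abs_sub_le x y (round y)
  unfold nn at *; linarith
lemma nn_add_int (x : Real) (n : Int) : nn (x + n) = nn x := by
  unfold nn; rw [round_add_intCast]; push_cast; congr 1; ring
lemma one_sub_ee (x : Real) : 4 * nn x ≤ ‖1 - ee x‖ := by
  have h : ee x = ee (x - round x) := by
    have := ee_add_int (x - round x) (round x); simpa using this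
  rw [h, nn]
  set y := x - round x with hy
  have hy2 : |y| ≤ 1 / 2 := abs_sub_round x
  have : ‖1 - ee y‖ = 2 * |Real.sin (πi * y)| := by
    rw [norm_sub_rev]; unfold ee
    rw [mul_comm (((2 * πi * y : Real)) : Complex), Complex.norm_exp_I_mul_ofReal_sub_one]
    rw [norm_mul, Le, Le, abs_two]; congr 3; ring
  rw [this]
  have h3 : 2 * |y| ≤ |Real.sin (πi * y)| := by
    have := Real.mul_abs_le_abs_sin (x := πi * y) (by
      rw [abs_mul, Nu Tm]; nlinarith [Tm])
    rw [abs_mul, Nu Tm] at this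
    refine le_trans (le_of_eq ?_) this
    field_simp
  linarith
lemma geom_le (N : Nat) (x : Real) (hx : 0 < nn x) : ‖∑ n ∈ range N, ee (n * x)‖ ≤ 1 / (2 * nn x) := by
  have h := one_sub_ee x
  have h0 : 0 < ‖1 - ee x‖ := li
  have hne : ee x ≠ 1 := by intro h; rw [h] at h0; simp at h0
  simp_rw [ee_nat_mul]
  rw [geom_sum_eq hne, norm_div, norm_sub_rev (ee x)]
  have h2 : ‖ee x ^ N - 1‖ ≤ 2 := by
    refine (norm_sub_le _ _).trans ?_
    rw [norm_pow, norm_ee]; norm_num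
  rw [Nx h0 li]
  nlinarith
lemma geom_le_N (N : Nat) (x : Real) : ‖∑ n ∈ range N, ee (n * x)‖ ≤ N := by
  refine (Nq _ _).trans ?_
  simp [norm_ee]
lemma orth (X : Nat) (hX : 0 < X) (n : Int) :
    ∑ a ∈ range X, ee (a * (n / X)) = if (X : Int) ∣ n then (X : Complex) else 0 := by
  have hX' : (X : Real) ≠ 0 := pv
  split_ifs with h
  · obtain ⟨m, rfl⟩ := h
    have : ∀ a ∈ range X, ee (a * (((X * m : Int) : Real) / X)) = 1 := fun a _ => by
      rw [← ee_int (a * m)]; congr 1; push_cast; field_simp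
    rw [Me rfl this]; simp
  · simp_rw [ee_nat_mul]
    have hne : ee (n / X) ≠ 1 := by
      intro h1
      unfold ee at h1
      rw [Complex.exp_eq_one_iff] at h1
      obtain ⟨m, hm⟩ := h1
      apply h
      refine ⟨m, ?_⟩
      have h2 : ((n / X : Real) : Complex) = m := by
        have : (2 * πi * Complex.I : Complex) ≠ 0 := Complex.two_pi_I_ne_zero
        apply mul_right_cancel₀ this
        rw [← hm]; push_cast; ring
      have h3 : (n / X : Real) = m := mod_cast h2
      rw [div_eq_iff hX'] at h3
      have : (n : Real) = ((X * m : Int) : Real) := by push_cast; linarith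
      exact_mod_cast this
    rw [geom_sum_eq hne, ← ee_nat_mul]
    have : (X : Real) * (n / X) = n := by field_simp
    rw [this, ee_int]; simp
lemma sum_range_mul_add {M : Type*} [AddCommMonoid M] (f : Nat → M) (a b : Nat) :
    ∑ n ∈ range (a * b), f n = ∑ c ∈ range b, ∑ n ∈ range a, f (n + a * c) := by
  induction b with
  | zero => simp
  | succ b ih =>
    rw [Nat.mul_succ, sum_range_add, ih, sum_range_succ]
    congr 1; apply Me rfl; intros; rw [add_comm]
lemma digprod (q : Nat) (hq : 0 < q) (M : Nat → Nat → Real) (B : Nat → Real) (hM : ∀ u c, 0 ≤ M u c) (i : Nat)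
    (hB : ∀ u < i, ∀ c < q ^ u, ∑ t ∈ range q, M (u+1) (c + q ^ u * t) ≤ B u) :
    ∑ c ∈ range (q ^ i), ∏ u ∈ range i, M (u+1) (c % q ^ (u+1)) ≤ ∏ u ∈ range i, B u := by
  induction i with
  | zero => simp
  | succ i ih =>
    have ih := ih (fun u hu => hB u om)
    have hB0 : ∀ u < i + 1, 0 ≤ B u := fun u hu =>
      (Nb (fun t _ => hM _ _)).trans (hB u hu 0 pv)
    rw [pow_succ, sum_range_mul_add, sum_comm, Kw]
    calc _ = ∑ c ∈ range (q ^ i), (∏ u ∈ range i, M (u+1) (c % q ^ (u+1))) *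
          ∑ t ∈ range q, M (i+1) (c + q ^ i * t) := by
          apply Me rfl; intro c hc
          rw [Md] at hc
          rw [mul_sum]; apply Me rfl; intro t ht
          rw [Md] at ht
          rw [Kw]
          congr 1
          · apply prod_congr rfl; intro u hu
            rw [Md] at hu
            obtain ⟨v, hv⟩ := Nat.exists_eq_add_of_le (om : u + 1 ≤ i)
            rw [hv, pow_add, Nn, Km]
          · rw [Ju]
            calc c + q ^ i * t < q ^ i + q ^ i * t := om
              _ = q ^ i * (t + 1) := rg
              _ ≤ q ^ (i+1) := by rw [pow_succ]; exact Ns _ ht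
      _ ≤ ∑ c ∈ range (q ^ i), (∏ u ∈ range i, M (u+1) (c % q ^ (u+1))) * B i := by
          apply Mf; intro c hc
          exact Ma (hB i om c (Md.1 hc))
            (Lf fun _ _ => hM _ _)
      _ ≤ _ := by
          rw [← sum_mul]; exact Mb ih (hB0 i om)
noncomputable def dw (q : Nat) (g : Nat → Nat → Real) (k n : Nat) : Real := ∏ l ∈ range k, g l (n / q ^ l % q)
noncomputable def df (q : Nat) (g : Nat → Nat → Real) (l : Nat) (x : Real) : Complex :=
  (1 / q : Complex) * ∑ c ∈ range q, (g l c : Complex) * ee (c * x)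
noncomputable def FF (q : Nat) (f : Nat → Real → Complex) (k : Nat) (x : Real) : Complex := ∏ l ∈ range k, f l (q ^ l * x)
lemma dw_fourier (q : Nat) (hq : 0 < q) (g : Nat → Nat → Real) (k : Nat) (x : Real) :
    ∑ n ∈ range (q ^ k), (dw q g k n : Complex) * ee (n * x) = q ^ k * FF q (df q g) k x := by
  have hq' : (q : Complex) ≠ 0 := mod_cast hq.ne'
  induction k with
  | zero => simp [dw, FF, ee_zero]
  | succ k ih =>
    rw [pow_succ, sum_range_mul_add]
    have : ∀ c ∈ range q, ∀ n ∈ range (q ^ k), (dw q g (k+1) (n + q ^ k * c) : Complex) * ee ((n + q ^ k * c : Nat) * x)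
        = ((g k c : Complex) * ee (c * (q ^ k * x))) * ((dw q g k n : Complex) * ee (n * x)) := by
      intro c hc n hn
      rw [Md] at hc hn
      have h1 : dw q g (k+1) (n + q ^ k * c) = dw q g k n * g k c := by
        unfold dw; rw [Kw]; congr 1
        · apply prod_congr rfl; intro l hl
          rw [Md] at hl
          obtain ⟨v, hv⟩ := Nat.exists_eq_add_of_le (om : l + 1 ≤ k)
          congr 1
          rw [hv, pow_add, pow_succ, Nn, Nn, Jh _ _ pv,
            Km]
        · rw [Jh _ _ pv, Kr hn, zero_add,
            Ju hc]
      rw [h1]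
      have h2 : §(n + q ^ k * c) * x = c * (q ^ k * x) + n * x := by push_cast; ring
      rw [h2, ee_add]; push_cast; ring
    rw [Me rfl fun c hc => (Me rfl (this c hc))]
    simp_rw [← mul_sum]
    rw [← sum_mul, ih]
    unfold FF; rw [Kw]
    generalize ∏ l ∈ range k, df q g l (q ^ l * x) = Z
    unfold df
    generalize ∑ c ∈ range q, (g k c : Complex) * ee (c * (q ^ k * x)) = Y
    field_simp
    ring
lemma nn_div (m : Int) (r : Nat) (hr : 0 < r) (h : ¬ (r : Int) ∣ m) : 1 / (r : Real) ≤ nn (m / r) := by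
  have hr' : (0 : Real) < r := mod_cast hr
  unfold nn
  generalize round ((m : Real) / r) = n
  have h1 : (m : Real) / r - n = ((m - n * r : Int) : Real) / r := by push_cast; field_simp
  rw [h1, abs_div, Nu hr']
  gcongr
  have : m - n * r ≠ 0 := fun h0 => h ⟨n, li⟩
  exact_mod_cast Int.one_le_abs this
lemma spacing {ι : Type*} (I : Finset ι) (x : ι → Real) (δ N : Real) (hδ : 0 < δ) (hδ1 : δ ≤ 1) (hN : 0 ≤ N)
    (hs : ∀ i ∈ I, ∀ j ∈ I, i ≠ j → δ ≤ nn (x i - x j)) (φ : ι → Real)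
    (h1 : ∀ i ∈ I, φ i ≤ N) (h2 : ∀ i ∈ I, 0 < nn (x i) → φ i ≤ 1 / (2 * nn (x i))) :
    ∑ i ∈ I, φ i ≤ 2 * N + (1 / δ) * (1 + lg (1 / δ)) := by
  classical
  set key : ι → Bool × Nat := fun i => (decide (0 ≤ x i - round (x i)), ⌊nn (x i) / δ⌋₊) with hkey
  set ψ : Bool × Nat → Real := fun p => if p.2 = 0 then N else 1 / (2 * δ) * (1 / p.2) with hψ
  set J := ⌊1 / δ⌋₊ with hJ
  have hinj : Set.InjOn key I := by
    intro i hi j hj hij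
    by_contra hne
    have hd := hs i hi j hj hne
    simp only [hkey, Prod.mk.injEq, decide_eq_decide] at hij
    obtain ⟨ha, hb⟩ := hij
    have e1 := Kd (div_nonneg (nn_nonneg (x i)) hδ.le)
    have e2 := Lu (nn (x i) / δ)
    have e3 := Kd (div_nonneg (nn_nonneg (x j)) hδ.le)
    have e4 := Lu (nn (x j) / δ)
    rw [hb] at e1 e2
    have e5 : |nn (x i) / δ - nn (x j) / δ| < 1 := by rw [abs_lt]; constructor <;> linarith
    rw [← sub_div, abs_div, Nu hδ, div_lt_one hδ] at e5
    have e6 := nn_le (x i - x j) (round (x i) - round (x j))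
    have e7 : |x i - x j - ((round (x i) - round (x j) : Int) : Real)| = |nn (x i) - nn (x j)| := by
      unfold nn
      by_cases h0 : 0 ≤ x i - round (x i)
      · rw [Ll h0, Ll (ha.1 h0)]; congr 1; push_cast; ring
      · have h0' : ¬ 0 ≤ x j - round (x j) := fun h => h0 (ha.2 h)
        push Not at h0 h0'
        rw [abs_of_neg h0, abs_of_neg h0', ← abs_neg]; congr 1; push_cast; ring
    linarith
  have hle : ∀ i ∈ I, φ i ≤ ψ (key i) := by
    intro i hi
    simp only [hψ, hkey]
    split_ifs with h0
    · exact h1 i hi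
    · have hp : 0 < ⌊nn (x i) / δ⌋₊ := Mr h0
      have e1 := Kd (div_nonneg (nn_nonneg (x i)) hδ.le)
      have hp' : (0 : Real) < ⌊nn (x i) / δ⌋₊ := mod_cast hp
      rw [Na hδ] at e1
      have : 0 < nn (x i) := by nlinarith
      refine (h2 i hi this).trans ?_
      rw [one_div_mul_one_div]
      apply Lv <;> nlinarith
  have hψ0 : ∀ p, 0 ≤ ψ p := by
    intro p; simp only [hψ]; split_ifs
    · exact hN
    · positivity
  calc ∑ i ∈ I, φ i ≤ ∑ i ∈ I, ψ (key i) := Mf hle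
    _ = ∑ p ∈ I.image key, ψ p := (sum_image hinj).symm
    _ ≤ ∑ p ∈ (univ : Finset Bool) ×ˢ range (J + 1), ψ p := by
        apply Mg
        · intro p hp
          obtain ⟨i, hi, rfl⟩ := Lp.1 hp
          simp only [hkey, Nk, mem_univ, true_and, Md, hJ]
          apply Nat.lt_succ_of_le
          apply Nat.floor_le_floor
          have := nn_le_half (x i)
          gcongr; linarith
        · intros; exact hψ0 _
    _ = 2 * (N + ∑ j ∈ range J, 1 / (2 * δ) * (1 / §(j + 1))) := by
        rw [sum_product]; simp only [hψ, Ms, card_univ, Fintype.card_bool]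
        rw [sum_range_succ']; simp; ring
    _ = 2 * N + (1 / δ) * (harmonic J : Real) := by
        rw [← mul_sum]; unfold harmonic; push_cast; simp only [one_div]; field_simp
    _ ≤ _ := by
        have := harmonic_le_one_add_log J
        gcongr
        refine this.trans ?_
        gcongr
        · have : 1 ≤ J := Nat.le_floor (by rw [Jy, Na hδ]; linarith)
          exact_mod_cast this
        · exact Kd pv
lemma parseval (q : Nat) (hq : 0 < q) (D : Finset Nat) (hD : D ⊆ range q) (x : Real) :
    ∑ c ∈ range q, ‖∑ n ∈ D, ee (n * (x + c / q))‖ ^ 2 = q * D.card := by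
  have hq' : (q : Real) ≠ 0 := pv
  have h : ∀ c ∈ range q, (((‖∑ n ∈ D, ee (n * (x + c / q))‖ ^ 2 : Real)) : Complex) =
      ∑ n ∈ D, ∑ m ∈ D, ee ((n - m : Int) * x) * ee (c * ((n - m : Int) / q)) := by
    intro c _
    rw [← Complex.normSq_eq_norm_sq, Complex.normSq_eq_conj_mul_self, mul_comm, map_sum, Kp]
    apply Me rfl; intro n _; apply Me rfl; intro m _
    rw [← ee_neg, ← ee_add, ← ee_add]; congr 1; push_cast; field_simp; ring
  have h2 : ((∑ c ∈ range q, ‖∑ n ∈ D, ee (n * (x + c / q))‖ ^ 2 : Real) : Complex) = ((q * D.card : Real) : Complex) := by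
    push_cast
    have h' := Me (rfl : range q = range q) h
    push_cast at h'
    rw [h', sum_comm]
    have : ∀ n ∈ D, ∑ c ∈ range q, ∑ m ∈ D, ee ((n - m) * x) * ee (c * ((n - m) / q)) = (q : Complex) := by
      intro n hn
      rw [sum_comm]
      have : ∀ m ∈ D, ∑ c ∈ range q, ee ((n - m) * x) * ee (c * ((n - m) / q)) = if m = n then (q : Complex) else 0 := by
        intro m hm
        have ho := orth q hq (n - m)
        push_cast at ho
        rw [← mul_sum, ho]
        have hn' := Md.1 (hD hn)
        have hm' := Md.1 (hD hm)
        by_cases hmn : m = n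
        · subst hmn; simp [ee_zero]
        · rw [if_neg, if_neg hmn, mul_zero]
          intro hd
          apply hmn
          have := Nr hd (by rw [abs_lt]; constructor <;> omega)
          omega
      rw [Me rfl this, sum_ite_eq' D n]; simp [hn]
    rw [Me rfl this]; simp [mul_comm]
  exact_mod_cast h2
lemma cs_le {ι : Type*} (I : Finset ι) (y : ι → Real) (hy : ∀ i ∈ I, 0 ≤ y i) (a b : Real)
    (ha : ∑ i ∈ I, y i ≤ a) (hb : ∑ i ∈ I, y i ^ 2 ≤ b) : ∑ i ∈ I, y i * √(y i) ≤ √(a * b) := by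
  apply Ld
  have h := sum_mul_sq_le_sq_mul_sq I y (fun i => √(y i))
  have : ∑ i ∈ I, √(y i) ^ 2 = ∑ i ∈ I, y i := Me rfl fun i hi => Jm (hy i hi)
  rw [this] at h
  have h0 : 0 ≤ ∑ i ∈ I, y i := Nb hy
  have h1 : 0 ≤ ∑ i ∈ I, y i ^ 2 := Nb fun i _ => sq_nonneg _
  nlinarith
lemma dirichlet_l1 (q : Nat) (hq : 0 < q) (x : Real) :
    ∑ c ∈ range q, ‖∑ n ∈ range q, ee (n * (x + c / q))‖ ≤ q * (3 + lg q) := by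
  have h := spacing (range q) (fun c => x + c / q) (1 / q) q pv
    (by rw [Kb pv]; exact_mod_cast hq) pv
    (by
      intro i hi j hj hij
      have : x + §i / q - (x + j / q) = ((i - j : Int) : Real) / q := by push_cast; ring
      rw [this]; apply nn_div _ _ hq
      intro hd
      rw [Md] at hi hj
      have := Nr hd (by rw [abs_lt]; constructor <;> omega)
      omega)
    (fun c => ‖∑ n ∈ range q, ee (n * (x + c / q))‖)
    (fun c _ => geom_le_N _ _) (fun c _ hc => geom_le _ _ hc)
  refine h.trans (le_of_eq ?_)
  rw [one_div_one_div]; ring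
noncomputable def af (E : Finset Nat) (x : Real) : Complex := (1 / E.card : Complex) * ∑ n ∈ E, ee (n * x)
lemma sqrt3 (a b : Real) (ha : 0 ≤ a) (hb : 0 ≤ b) : (a + b) * √(a + b) ≤ 3 * (a * √a + b * √b) := by
  wlog h : b ≤ a generalizing a b
  · have := this b a hb ha li; rw [add_comm a b]; linarith
  have h1 : √(a + b) ≤ √2 * √a := by
    rw [← Lg nm]; apply Real.sqrt_le_sqrt; linarith
  have h2 : √2 ≤ 3 / 2 := by rw [Kk nm]; norm_num
  have h4 := Lo b
  calc (a + b) * √(a + b) ≤ (2 * a) * (3 / 2 * √a) := by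
        apply Mx li (h1.trans (by gcongr)) (Lo _) li
    _ ≤ _ := by nlinarith [Mu hb h4]
section
variable (q : Nat) (hq : 0 < q) (E : Finset Nat) (hE : E ⊆ range q) (s : Real)
  (hs : §(range q \ E).card ≤ s) (hs2 : 2 * s ≤ q)
include hq hE hs hs2
lemma card_ge : §q / 2 ≤ E.card := by
  have h := Ke hE
  rw [Mq] at h
  have : §(range q \ E).card + E.card = q := mod_cast h
  linarith
lemma af_norm (x : Real) : ‖af E x‖ ≤ (2 / q) * (‖∑ n ∈ range q, ee (n * x)‖ + ‖∑ n ∈ range q \ E, ee (n * x)‖) := by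
  have hc := card_ge q hq E hE s hs hs2
  have hq' : 0 < §q := mod_cast hq
  have h1 : ∑ n ∈ E, ee (n * x) = ∑ n ∈ range q, ee (n * x) - ∑ n ∈ range q \ E, ee (n * x) := by
    rw [← sum_sdiff hE]; ring
  unfold af; rw [h1, norm_mul, norm_div, norm_one, Ny]
  apply Mx _ (norm_sub_le _ _) (Mi _) pv
  rw [Nx li hq']; linarith
lemma dhat_l1 (x : Real) : ∑ c ∈ range q, ‖∑ n ∈ range q \ E, ee (n * (x + c / q))‖ ≤ q * √s := by
  have h := parseval q hq (range q \ E) sdiff_subset x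
  have h1 := sum_mul_sq_le_sq_mul_sq (range q) (fun _ => (1:Real)) (fun c => ‖∑ n ∈ range q \ E, ee (n * (x + c / q))‖)
  rw [h] at h1
  simp only [one_mul, one_pow, Ms, Mq, Mj, mul_one] at h1
  apply le_of_sq_le_sq _ pv
  refine h1.trans ?_
  have hs0 : (0:Real) ≤ s := le_trans pv hs
  rw [mul_pow, Jm hs0, sq, Nn]
  gcongr
lemma af_l1 (x : Real) : ∑ c ∈ range q, ‖af E (x + c / q)‖ ≤ 2 * (3 + lg q + √s) := by
  refine (Mf fun c _ => af_norm q hq E hE s hs hs2 _).trans ?_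
  rw [← mul_sum, Mk]
  have h1 := dirichlet_l1 q hq x
  have h2 := dhat_l1 q hq E hE s hs hs2 x
  calc _ ≤ 2 / q * (q * (3 + lg q) + q * √s) := by gcongr
    _ = _ := by field_simp
lemma af_l32 (x : Real) : ∑ c ∈ range q, ‖af E (x + c / q)‖ * √‖af E (x + c / q)‖ ≤
    9 * (√(3 + lg q) + √(√s * s / q)) := by
  have hq' : 0 < §q := mod_cast hq
  set u : Nat → Real := fun c => ‖∑ n ∈ range q, ee (n * (x + c / q))‖
  set v : Nat → Real := fun c => ‖∑ n ∈ range q \ E, ee (n * (x + c / q))‖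
  have hu : ∀ c, 0 ≤ u c := fun c => Mi _
  have hv : ∀ c, 0 ≤ v c := fun c => Mi _
  have h1 := cs_le (range q) u (fun _ _ => Mi _) _ _ (dirichlet_l1 q hq x) (parseval q hq (range q) subset_rfl x).le
  have h2 := cs_le (range q) v (fun _ _ => Mi _) _ (q * s) (dhat_l1 q hq E hE s hs hs2 x)
    ((parseval q hq (range q \ E) sdiff_subset x).le.trans (by gcongr))
  have h3 : ∀ c ∈ range q, ‖af E (x + c / q)‖ * √‖af E (x + c / q)‖ ≤
      (2 / q * √(2 / q)) * (3 * (u c * √(u c) + v c * √(v c))) := by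
    intro c _
    have h := af_norm q hq E hE s hs hs2 (x + c / q)
    calc _ ≤ (2 / q * (u c + v c)) * √(2 / q * (u c + v c)) := by gcongr
      _ = (2 / q * √(2 / q)) * ((u c + v c) * √(u c + v c)) := by
          rw [Lg pv]; ring
      _ ≤ _ := Ma (sqrt3 _ _ (hu c) (hv c)) pv
  refine (Mf h3).trans ?_
  rw [← mul_sum, ← mul_sum, Mk]
  rw [Mq] at h1
  have h5 : √2 ≤ 3 / 2 := by rw [Kk nm]; norm_num
  have e1 : √(q * (3 + lg q) * (q * q)) = q * √q * √(3 + lg q) := by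
    rw [show (q * (3 + lg q) * (q * q) : Real) = (q * q) * (q * (3 + lg q)) by ring,
      Lg pv, Real.sqrt_mul_self hq'.le, Lg hq'.le]; ring
  have e2 : √(q * √s * (q * s)) = q * √q * √(√s * s / q) := by
    rw [show (q * √s * (q * s) : Real) = (q * q) * (q * (√s * s / q)) by field_simp,
      Lg pv, Real.sqrt_mul_self hq'.le, Lg hq'.le]; ring
  rw [e1] at h1; rw [e2] at h2
  have e3 : √(2 / q : Real) * √q = √2 := by rw [← Lg pv]; congr 1; field_simp
  calc _ ≤ 2 / q * √(2 / q) * (3 * (q * √q * √(3 + lg q) + q * √q * √(√s * s / q))) := by gcongr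
    _ = 6 * (√(2 / q) * √q) * (√(3 + lg q) + √(√s * s / q)) := by field_simp; ring
    _ ≤ _ := by rw [e3]; gcongr; linarith
lemma af_dec (hs3 : 2 * s + 1 < q) (x : Real) (hx : 1 / (2 * q : Real) ≤ nn x) : ‖af E x‖ ≤ 1 - 1 / q ^ 3 := by
  have hc := card_ge q hq E hE s hs hs2
  obtain ⟨n, hn, hn1⟩ : ∃ n ∈ E, n + 1 ∈ E := by
    by_contra hcon
    push Not at hcon
    have h1 : E.image (· + 1) ⊆ range (q + 1) \ E := by
      intro m hm
      obtain ⟨n, hn, rfl⟩ := Lp.1 hm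
      rw [Ji]
      exact ⟨Md.2 (by have := Md.1 (hE hn); omega), hcon n hn⟩
    have h2 := Mn h1
    have h3 := Ke (show E ⊆ range (q + 1) from hE.trans (range_mono (Nat.le_succ q)))
    rw [card_image_of_injective _ (add_left_injective 1)] at h2
    have h4 := Ke hE
    rw [Mq] at h3 h4
    have h5 : §E.card + E.card ≤ q + 1 := mod_cast om
    have h6 : §(range q \ E).card + E.card = q := mod_cast h4
    linarith
  have hcE : (0 : Real) < E.card := li
  have h1 : ‖1 + ee x‖ ≤ 2 - 1 / q ^ 2 := by
    have hp := parallelogram_law_with_norm Complex 1 (ee x)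
    rw [norm_one, norm_ee] at hp
    have h4 := one_sub_ee x
    have h5 : 2 / §q ≤ ‖1 - ee x‖ := by
      refine le_trans ?_ h4
      calc (2:Real) / q = 4 * (1 / (2 * q)) := by field_simp; norm_num
        _ ≤ _ := by gcongr
    have hq1 : 1 / §q ^ 2 ≤ 1 := by
      rw [Kb pv]; apply Nz; exact_mod_cast hq
    apply le_of_sq_le_sq _ li
    have h6 : (2 / §q) ^ 2 ≤ ‖1 - ee x‖ ^ 2 := by gcongr
    have h7 : (2 / §q) ^ 2 = 4 * (1 / q ^ 2) := by field_simp; norm_num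
    nlinarith [sq_nonneg (1 / §q^2)]
  have h2 : ∑ m ∈ E, ee (m * x) = ∑ m ∈ (E.erase n).erase (n + 1), ee (m * x) + ee (n * x) * (1 + ee x) := by
    rw [← add_sum_erase _ _ hn, ← add_sum_erase (E.erase n) _ (mem_erase.2 ⟨om, hn1⟩)]
    have : ee ((n + 1 : Nat) * x) = ee (n * x) * ee x := by rw [← ee_add]; congr 1; push_cast; ring
    rw [this]; ring
  have h3 : ‖∑ m ∈ E, ee (m * x)‖ ≤ E.card - 1 / q ^ 2 := by
    rw [h2]
    refine (norm_add_le _ _).trans ?_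
    rw [norm_mul, norm_ee, one_mul]
    have h4 : ‖∑ m ∈ (E.erase n).erase (n + 1), ee (m * x)‖ ≤ E.card - 2 := by
      refine (Nq _ _).trans ?_
      simp only [norm_ee, Ms, Mj, mul_one]
      have a1 := card_erase_add_one hn
      have a2 := card_erase_add_one (mem_erase.2 ⟨om, hn1⟩ : n + 1 ∈ E.erase n)
      have : (((E.erase n).erase (n + 1)).card : Real) + 2 = E.card := mod_cast om
      linarith
    linarith
  unfold af
  rw [norm_mul, norm_div, norm_one, Ny]
  have h8 : §E.card ≤ q := by
    have := Mn hE; rw [Mq] at this; exact_mod_cast this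
  calc 1 / §E.card * ‖∑ m ∈ E, ee (m * x)‖ ≤ 1 / §E.card * (E.card - 1 / q ^ 2) := by gcongr
    _ = 1 - 1 / (q ^ 2 * E.card) := by field_simp
    _ ≤ _ := by
      have : 1 / §q ^ 3 ≤ 1 / (q ^ 2 * E.card) := by
        apply Lv pv
        calc §q ^ 2 * E.card ≤ q ^ 2 * q := by gcongr
          _ = _ := rg
      linarith
end
structure DF (q : Nat) (A1 A2 : Real) (f : Nat → Real → Complex) : Prop where
  per : ∀ l x (n : Int), f l (x + n) = f l x
  le1 : ∀ l x, ‖f l x‖ ≤ 1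
  lip : ∀ l x y, ‖f l x - f l y‖ ≤ 2 * πi * q * |x - y|
  at0 : ∀ l, f l 0 = 1
  l1 : ∀ l, 1 ≤ l → ∀ x, ∑ c ∈ range q, ‖f l (x + c / q)‖ ≤ A1
  l32 : ∀ l, 1 ≤ l → ∀ x, ∑ c ∈ range q, ‖f l (x + c / q)‖ * √‖f l (x + c / q)‖ ≤ A2
  dec : ∀ l, 1 ≤ l → ∀ x, 1 / (2 * q : Real) ≤ nn x → ‖f l x‖ ≤ 1 - 1 / q ^ 3
lemma mkDF (q : Nat) (hq : 0 < q) (E : Nat → Finset Nat) (hE : ∀ l, E l ⊆ range q) (hne : ∀ l, (E l).Nonempty)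
    (s : Real) (hs : ∀ l, 1 ≤ l → §(range q \ E l).card ≤ s) (hs3 : 2 * s + 1 < q) :
    DF q (2 * (3 + lg q + √s)) (9 * (√(3 + lg q) + √(√s * s / q))) (fun l => af (E l)) := by
  have hc : ∀ l, (0:Real) < (E l).card := fun l => mod_cast (hne l).card_pos
  have hs2 : 2 * s ≤ q := li
  refine ⟨?_, ?_, ?_, ?_, ?_, ?_, ?_⟩
  · intro l x n
    unfold af; congr 1; apply Me rfl; intro m _
    rw [← ee_add_int (m * x) (m * n)]; congr 1; push_cast; ring
  · intro l x
    unfold af; rw [norm_mul, norm_div, norm_one, Ny]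
    have : ‖∑ m ∈ E l, ee (m * x)‖ ≤ (E l).card := by
      refine (Nq _ _).trans ?_
      simp [norm_ee]
    calc _ ≤ 1 / §(E l).card * (E l).card := by gcongr
      _ = 1 := by have := (hc l).ne'; field_simp
  · intro l x y
    unfold af; rw [← mul_sub, ← Nh, norm_mul, norm_div, norm_one, Ny]
    have : ‖∑ m ∈ E l, (ee (m * x) - ee (m * y))‖ ≤ (E l).card * (2 * πi * q * |x - y|) := by
      refine (Nq _ _).trans ?_
      rw [← Mj]
      apply Kl
      intro m hm
      refine (ee_lip _ _).trans ?_
      rw [← mul_sub, abs_mul, Jn, ← Nn]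
      have : §m ≤ q := mod_cast (Md.1 (hE l hm)).le
      gcongr
    calc _ ≤ 1 / §(E l).card * ((E l).card * (2 * πi * q * |x - y|)) := by gcongr
      _ = _ := by have := (hc l).ne'; field_simp
  · intro l
    unfold af; have := (hc l).ne'
    have : ((E l).card : Complex) ≠ 0 := mod_cast this
    simp [ee_zero, this]
  · intro l hl x
    exact af_l1 q hq (E l) (hE l) s (hs l hl) hs2 x
  · intro l hl x
    exact af_l32 q hq (E l) (hE l) s (hs l hl) hs2 x
  · intro l hl x hx
    exact af_dec q hq (E l) (hE l) s (hs l hl) hs2 hs3 x hx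
section
variable {q : Nat} {A1 A2 : Real} {f : Nat → Real → Complex}
lemma DF.A1_nonneg (h : DF q A1 A2 f) : 0 ≤ A1 :=
  (Nb fun _ _ => Mi _).trans (h.l1 1 le_rfl 0)
lemma DF.cell (h : DF q A1 A2 f) (hq : 2 ≤ q) (i : Nat) (x : Nat → Real)
    (hx : ∀ c < q ^ i, |x c - c / q ^ i| ≤ 1 / q ^ i) :
    ∑ c ∈ range (q ^ i), ∏ l ∈ range i, ‖f l (q ^ l * x c)‖ ≤ q ^ 2 * (A1 + 7) ^ i := by
  have hq0 : 0 < §q := mod_cast om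
  have hA := h.A1_nonneg
  set M : Nat → Nat → Real := fun u c => if u = 1 ∨ u = i then 1 else
    ‖f (i - u) (c / q ^ u)‖ + 2 * πi * q / q ^ u with hM
  set B : Nat → Real := fun u => if u + 1 = 1 ∨ u + 1 = i then q else A1 + 7 with hB
  have hM0 : ∀ u c, 0 ≤ M u c := by
    intro u c; simp only [hM]; split_ifs
    · norm_num
    · positivity
  have key := digprod q om M B hM0 i (by
    intro u hu c hc
    simp only [hM, hB]
    split_ifs with h1
    · simp
    · have hl : 1 ≤ i - (u + 1) := om
      have := h.l1 _ hl (c / q ^ (u+1))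
      rw [Mk]
      have e : ∀ t ∈ range q, ‖f (i - (u+1)) (§(c + q ^ u * t) / q ^ (u+1))‖ =
          ‖f (i - (u+1)) (§c / q ^ (u+1) + t / q)‖ := by
        intro t _; congr 2; push_cast; field_simp; ring
      rw [Me rfl e]
      have h2 : ∑ t ∈ range q, 2 * πi * q / q ^ (u+1) ≤ 7 := by
        rw [Ms, Mq, Mj]
        have h3 : §q ^ 2 ≤ q ^ (u + 1) := by
          apply Ml _ om
          exact_mod_cast om
        have h4 := Real.pi_lt_d2
        rw [mul_div_assoc', Nj pv]
        nlinarith [Tm]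
      linarith)
  refine le_trans ?_ (key.trans ?_)
  · apply Mf; intro c hc
    rw [Md] at hc
    rw [← prod_range_reflect]
    apply Ly
    · intros; positivity
    · intro u hu
      rw [Md] at hu
      simp only [hM]
      split_ifs with h1
      · exact h.le1 _ _
      · have hl : i - 1 - u = i - (u+1) := om
        rw [hl]
        set l := i - (u+1) with hl'
        have hi : i = l + (u+1) := om
        have hdm := Jz c (q ^ (u+1))
        have e1 : f l (q ^ l * x c) = f l (q ^ l * x c - ((c / q ^ (u+1) : Nat) : Int)) := by
          rw [← h.per l (q ^ l * x c - ((c / q ^ (u+1) : Nat) : Int)) ((c / q ^ (u+1) : Nat) : Int)]; simp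
        rw [e1]
        have h2 := h.lip l (q ^ l * x c - ((c / q ^ (u+1) : Nat) : Int)) (§(c % q ^ (u+1)) / q ^ (u+1))
        have h3 := norm_le_norm_add_norm_sub' (f l (q ^ l * x c - ((c / q ^ (u+1) : Nat) : Int))) (f l (§(c % q ^ (u+1)) / q ^ (u+1)))
        refine h3.trans ?_
        gcongr
        refine h2.trans ?_
        have h4 : q ^ l * x c - (((c / q ^ (u+1) : Nat) : Int) : Real) - §(c % q ^ (u+1)) / q ^ (u+1)
            = q ^ l * (x c - c / q ^ i) := by
          have : §c = q ^ (u+1) * §(c / q ^ (u+1)) + §(c % q ^ (u+1)) := by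
            exact_mod_cast hdm.symm
          rw [show §c / q ^ i = (q ^ (u+1) * §(c / q ^ (u+1)) + §(c % q ^ (u+1))) / q ^ i by rw [← this]]
          rw [hi, pow_add, Jv]; field_simp; ring
        rw [h4, abs_mul, Nu pv]
        calc _ ≤ 2 * πi * q * (q ^ l * (1 / q ^ i)) := by gcongr; exact hx c hc
          _ = _ := by rw [hi, pow_add]; field_simp
  · have : ∀ u ∈ range i, B u ≤ (if u = 0 then §q else 1) * (if u = i - 1 then §q else 1) * (A1 + 7) := by
      intro u hu
      rw [Md] at hu
      have hq1 : 1 ≤ §q := mod_cast om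
      simp only [hB]
      split_ifs <;> first | omega | nlinarith
    calc _ ≤ ∏ u ∈ range i, (if u = 0 then §q else 1) * (if u = i - 1 then §q else 1) * (A1 + 7) := by
          apply Ly _ this
          intro u _; simp only [hB]; split_ifs <;> positivity
      _ ≤ q * q * (A1 + 7) ^ i := by
          have hq1 : 1 ≤ §q := mod_cast om
          rw [Ks, Ks, prod_ite_eq', prod_ite_eq', prod_const, Mq]
          gcongr <;> split_ifs <;> linarith
      _ = _ := rg
lemma DF.cellW (h : DF q A1 A2 f) (hq : 2 ≤ q) (i : Nat) {ι : Type*} (I : Finset ι) (x : ι → Real) (wt : ι → Real)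
    (hx0 : ∀ j ∈ I, 0 ≤ x j) (hx1 : ∀ j ∈ I, x j < 1) (hw : ∀ j ∈ I, 0 ≤ wt j) (M : Real) (hM0 : 0 ≤ M)
    (hM : ∀ c < q ^ i, ∑ j ∈ I with ⌊x j * q ^ i⌋₊ = c, wt j ≤ M) :
    ∑ j ∈ I, wt j * ∏ l ∈ range i, ‖f l (q ^ l * x j)‖ ≤ M * (q ^ 2 * (A1 + 7) ^ i) := by
  classical
  have hq0 : 0 < §q := mod_cast om
  set Φ : Real → Real := fun y => ∏ l ∈ range i, ‖f l (q ^ l * y)‖ with hΦ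
  have hΦ0 : ∀ y, 0 ≤ Φ y := fun y => Lf fun _ _ => Mi _
  have hch : ∀ c : Nat, ∃ y : Real, |y - c / q ^ i| ≤ 1 / q ^ i ∧ ∀ j ∈ I, ⌊x j * q ^ i⌋₊ = c → Φ (x j) ≤ Φ y := by
    intro c
    by_cases hne : (I.filter fun j => ⌊x j * q ^ i⌋₊ = c).Nonempty
    · obtain ⟨j, hj, hmax⟩ := exists_max_image _ (fun j => Φ (x j)) hne
      rw [Mc] at hj
      refine ⟨x j, ?_, fun j' hj' hc => hmax j' (Mc.2 ⟨hj', hc⟩)⟩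
      have e1 := Kd (Mu (hx0 j hj.1) (pow_nonneg hq0.le i))
      have e2 := Lu (x j * q ^ i)
      rw [hj.2] at e1 e2
      have : x j - c / q ^ i = (x j * q ^ i - c) / q ^ i := by field_simp
      rw [this, abs_div, Nu (pv : 0 < §q ^ i)]
      gcongr
      rw [abs_le]; constructor <;> linarith
    · refine ⟨c / q ^ i, by simp, fun j hj hc => (hne ⟨j, Mc.2 ⟨hj, hc⟩⟩).elim⟩
  choose y hy1 hy2 using hch
  have hmaps : ∀ j ∈ I, ⌊x j * q ^ i⌋₊ ∈ range (q ^ i) := by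
    intro j hj
    rw [Md, Nat.floor_lt (Mu (hx0 j hj) (pow_nonneg hq0.le i))]
    push_cast
    have := hx1 j hj
    have hp : 0 < §q ^ i := pv
    nlinarith
  rw [← sum_fiberwise_of_maps_to hmaps]
  calc _ ≤ ∑ c ∈ range (q ^ i), M * Φ (y c) := by
        apply Mf; intro c hc
        calc _ ≤ ∑ j ∈ I with ⌊x j * q ^ i⌋₊ = c, wt j * Φ (y c) := by
              apply Mf; intro j hj
              rw [Mc] at hj
              exact Ma (hy2 c j hj.1 hj.2) (hw j hj.1)
          _ ≤ _ := by
              rw [← sum_mul]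
              exact Mb (hM c (Md.1 hc)) (hΦ0 _)
    _ ≤ _ := by
        rw [← mul_sum]
        exact Ma (h.cell hq i y fun c _ => hy1 c) hM0
noncomputable def Fhi (q : Nat) (f : Nat → Real → Complex) (k i a : Nat) : Real := ∏ u ∈ range i, ‖f (k - (u + 1)) (a / q ^ (u+1))‖
lemma DF.Fhi_mod (h : DF q A1 A2 f) (hq : 2 ≤ q) (k i a : Nat) :
    Fhi q f k i a = ∏ u ∈ range i, ‖f (k - (u + 1)) ((a % q ^ (u+1) : Nat) / q ^ (u+1))‖ := by
  apply prod_congr rfl; intro u _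
  have hdm : §a = q ^ (u+1) * §(a / q ^ (u+1)) + §(a % q ^ (u+1)) := by
    exact_mod_cast (Jz a (q ^ (u+1))).symm
  rw [← h.per _ (§(a % q ^ (u+1)) / q ^ (u+1)) ((a / q ^ (u+1) : Nat) : Int)]
  congr 2; simp only [Jv]; field_simp; linarith
lemma DF.hi (h : DF q A1 A2 f) (hq : 2 ≤ q) (k i : Nat) (hi : i < k) (S : Finset Nat)
    (hS : ∀ a ∈ S, ∀ b ∈ S, a < b + q ^ i) : ∑ a ∈ S, Fhi q f k i a ≤ A1 ^ i := by
  classical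
  set g : Nat → Real := fun c => ∏ u ∈ range i, ‖f (k - (u + 1)) ((c % q ^ (u+1) : Nat) / q ^ (u+1))‖ with hg
  have key := digprod q om (fun u c => ‖f (k - u) (c / q ^ u)‖) (fun _ => A1) (fun _ _ => Mi _) i (by
    intro u hu c hc
    refine le_trans (le_of_eq ?_) (h.l1 (k - (u+1)) om (c / q ^ (u+1)))
    apply Me rfl; intro t _; congr 2; push_cast; field_simp; ring)
  rw [prod_const, Mq] at key
  refine le_trans ?_ key
  have hinj : Set.InjOn (fun a => a % q ^ i) S := by
    intro a ha b hb hab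
    have h1 := hS a ha b hb
    have h2 := hS b hb a ha
    have h3 : a ≡ b [MOD q ^ i] := hab
    rcases le_total a b with hle | hle
    · have := (Nat.modEq_iff_dvd' hle).1 h3
      have := Nat.eq_zero_of_dvd_of_lt this om
      omega
    · have := (Nat.modEq_iff_dvd' hle).1 h3.symm
      have := Nat.eq_zero_of_dvd_of_lt this om
      omega
  have e : ∀ a ∈ S, Fhi q f k i a = g (a % q ^ i) := by
    intro a _
    rw [h.Fhi_mod hq]; simp only [hg]
    apply prod_congr rfl; intro u hu
    rw [Md] at hu
    rw [Nat.mod_mod_of_dvd _ (pow_dvd_pow q om)]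
  rw [Me rfl e, ← sum_image (f := g) hinj]
  apply Mg
  · intro c hc
    obtain ⟨a, _, rfl⟩ := Lp.1 hc
    exact Md.2 (Ti _ pv)
  · intros; exact Lf fun _ _ => Mi _
lemma DF.FF_split (h : DF q A1 A2 f) (hq : 2 ≤ q) (k i j a : Nat) (hij : i + j ≤ k) :
    ‖FF q f k (a / q ^ k)‖ ≤ Fhi q f k j a * ∏ l ∈ range i, ‖f l (q ^ l * (a / q ^ k))‖ := by
  unfold FF Fhi
  rw [norm_prod]
  obtain ⟨m, rfl⟩ : ∃ m, k = i + m + j := ⟨k - i - j, om⟩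
  rw [Jr, Jr, mul_comm (∏ u ∈ range j, _)]
  have e : ∏ x ∈ range j, ‖f (i + m + x) (q ^ (i + m + x) * (a / q ^ (i + m + j)))‖ =
      ∏ u ∈ range j, ‖f (i + m + j - (u + 1)) (a / q ^ (u + 1))‖ := by
    rw [← prod_range_reflect]
    apply prod_congr rfl; intro u hu
    rw [Md] at hu
    obtain ⟨v, rfl⟩ : ∃ v, j = v + (u + 1) := ⟨j - (u+1), om⟩
    have : i + m + (v + (u + 1) - 1 - u) = i + m + v := om
    rw [this, show i + m + (v + (u + 1)) - (u + 1) = i + m + v by omega]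
    congr 2
    rw [show i + m + (v + (u+1)) = (i + m + v) + (u + 1) by ring, pow_add _ (i+m+v)]; field_simp
  rw [e]
  refine Mb ?_ (Lf fun _ _ => Mi _)
  apply Kc (Lf fun _ _ => Mi _)
  exact Tf (fun _ _ => Mi _) fun _ _ => h.le1 _ _
end
open scoped Classical in
noncomputable def Ap (q k t : Nat) : Finset Nat :=
  (range (q ^ k)).filter fun a => ∃ (r : Nat) (b : Int), 1 ≤ r ∧ r ≤ q ^ t ∧ |§r * a - b * q ^ k| ≤ q ^ t
lemma frac_sep {r r' : Nat} {b b' : Int} (hr : 1 ≤ r) (hr' : 1 ≤ r') (hne : (b : Real) / r ≠ b' / r') :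
    1 / ((r : Real) * r') ≤ |(b : Real) / r - b' / r'| := by
  have e : (b : Real) / r - b' / r' = ((b * r' - b' * r : Int) : Real) / (r * r') := by
    push_cast; field_simp
  have hz : b * r' - b' * r ≠ 0 := by
    intro h; apply hne; rw [← sub_eq_zero, e, h]; simp
  rw [e, abs_div, Nu (pv : (0:Real) < r * r')]
  gcongr
  rw [← Int.cast_abs]
  exact_mod_cast Int.one_le_abs hz
section
variable {q : Nat} {A1 A2 : Real} {f : Nat → Real → Complex}
lemma DF.sumAp (h : DF q A1 A2 f) (hq : 3 ≤ q) (k t : Nat) (ht : 3 * t + 2 ≤ k) :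
    ∑ a ∈ Ap q k t, ‖FF q f k (a / q ^ k)‖ ≤ 2 * A1 ^ (t + 1) * (q ^ 2 * (A1 + 7) ^ (2 * t)) := by
  classical
  have hq3 : 3 ≤ §q := mod_cast hq
  have hA := h.A1_nonneg
  have hX : 0 < §q ^ k := pv
  have hXt : 3 * §q ^ t * (q ^ t * q ^ t) ≤ q ^ k := by
    calc _ ≤ q * §q ^ t * (q ^ t * q ^ t) := by gcongr
      _ = §q ^ (3 * t + 1) := rg
      _ ≤ _ := Ml li om
  have hdt : 0 < §q ^ t := pv
  calc _ ≤ ∑ a ∈ Ap q k t, Fhi q f k (t+1) a * ∏ l ∈ range (2 * t), ‖f l (q ^ l * ((fun a : Nat => (a / q ^ k : Real)) a))‖ :=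
        Mf fun a _ => h.FF_split om k (2 * t) (t + 1) a om
    _ ≤ _ := by
      have hmem : ∀ a ∈ Ap q k t, §a < q ^ k ∧ ∃ (r : Nat) (b : Int), 1 ≤ r ∧ r ≤ q ^ t ∧ |§r * a - b * q ^ k| ≤ q ^ t := by
        intro a ha
        rw [Ap, Mc, Md] at ha
        exact ⟨mod_cast ha.1, ha.2⟩
      apply h.cellW om
      · intros; positivity
      · intro a ha; rw [div_lt_one hX]; exact (hmem a ha).1
      · intros; exact Lf fun _ _ => Mi _
      · positivity
      · intro c _
        have hch : ∀ a : Nat, ∃ (r : Nat) (b : Int), a ∈ Ap q k t → 1 ≤ r ∧ r ≤ q ^ t ∧ |§r * a - b * q ^ k| ≤ q ^ t := by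
          intro a
          by_cases ha : a ∈ Ap q k t
          · obtain ⟨r, b, hh⟩ := (hmem a ha).2; exact ⟨r, b, fun _ => hh⟩
          · exact ⟨0, 0, fun h => (ha h).elim⟩
        choose r b hrb using hch
        set S := (Ap q k t).filter fun a : Nat => ⌊(a / q ^ k : Real) * q ^ (2 * t)⌋₊ = c with hS
        have hnear : ∀ a ∈ S, |§a / q ^ k - b a / r a| ≤ 1 / (3 * q ^ t * q ^ t) := by
          intro a ha
          obtain ⟨h1, h2, h3⟩ := hrb a (Mc.1 ha).1
          have h1' : (1:Real) ≤ r a := mod_cast h1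
          have e : §a / q ^ k - b a / r a = (r a * a - b a * q ^ k) / (q ^ k * r a) := by
            field_simp
          rw [e, abs_div, Nu (pv : 0 < §q ^ k * r a), Nx pv pv]
          calc _ ≤ §q ^ t * (3 * q ^ t * q ^ t) := by gcongr
            _ ≤ q ^ k := li
            _ ≤ _ := by nlinarith
        have hcell : ∀ a ∈ S, ∀ a' ∈ S, |§a / q ^ k - a' / q ^ k| < 1 / (q ^ t * q ^ t) := by
          have hh : ∀ a ∈ S, §c / (q ^ t * q ^ t) ≤ a / q ^ k ∧ §a / q ^ k < (c + 1) / (q ^ t * q ^ t) := by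
            intro a ha
            have hc := (Mc.1 ha).2
            have e1 := Kd (pv : (0:Real) ≤ (a / q ^ k : Real) * q ^ (2 * t))
            have e2 := Lu ((a / q ^ k : Real) * q ^ (2 * t))
            rw [hc] at e1 e2
            have e3 : §q ^ (2 * t) = q ^ t * q ^ t := rg
            rw [e3] at e1 e2
            exact ⟨by rwa [Nj pv], by rwa [lt_div_iff₀ pv]⟩
          intro a ha a' ha'
          obtain ⟨u1, u2⟩ := hh a ha
          obtain ⟨v1, v2⟩ := hh a' ha'
          rw [add_div] at u2 v2
          rw [abs_lt]; constructor <;> linarith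
        have hsep : ∀ a ∈ S, ∀ a' ∈ S, (b a : Real) / r a ≠ b a' / r a' → 1 / (§q ^ t * q ^ t) ≤ |(b a : Real) / r a - b a' / r a'| := by
          intro a ha a' ha' hne
          obtain ⟨h1, h2, h3⟩ := hrb a (Mc.1 ha).1
          obtain ⟨h1', h2', h3'⟩ := hrb a' (Mc.1 ha').1
          refine le_trans ?_ (frac_sep h1 h1' hne)
          have : (0:Real) < r a := mod_cast h1
          have : (0:Real) < r a' := mod_cast h1'
          have h2 : (r a : Real) ≤ q ^ t := mod_cast h2
          have h2' : (r a' : Real) ≤ q ^ t := mod_cast h2'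
          gcongr
        have hsame : ∀ a ∈ S, ∀ a' ∈ S, (b a : Real) / r a = b a' / r a' → a < a' + q ^ (t + 1) := by
          have hh : ∀ a ∈ S, |§a - b a / r a * q ^ k| ≤ q ^ t := by
            intro a ha
            obtain ⟨h1, h2, h3⟩ := hrb a (Mc.1 ha).1
            have h1' : (1:Real) ≤ r a := mod_cast h1
            have e : §a - b a / r a * q ^ k = (r a * a - b a * q ^ k) / r a := by field_simp
            rw [e, abs_div, Nu (pv : (0:Real) < r a)]
            exact (div_le_self (Nl _) h1').trans h3
          intro a ha a' ha' he
          have u := abs_le.1 (hh a ha)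
          have v := abs_le.1 (hh a' ha')
          rw [← he] at v
          have : §a < a' + q ^ (t + 1) := by
            rw [pow_succ]; nlinarith
          exact_mod_cast this
        rcases S.eq_empty_or_nonempty with he | ⟨a1, ha1⟩
        · rw [he, sum_empty]; positivity
        · rw [← sum_filter_add_sum_filter_not S (fun a => (b a : Real) / r a = b a1 / r a1), mul_comm 2, mul_two]
          refine Nc ?_ ?_
          · apply h.hi om k (t+1) om
            intro a ha a' ha'
            rw [Mc] at ha ha'
            exact hsame a ha.1 a' ha'.1 (ha.2.trans ha'.2.symm)
          · apply h.hi om k (t+1) om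
            intro a ha a' ha'
            rw [Mc] at ha ha'
            apply hsame a ha.1 a' ha'.1
            by_contra hne
            have s1 := hsep a ha.1 a' ha'.1 hne
            have s2 := hsep a ha.1 a1 ha1 ha.2
            have s3 := hsep a' ha'.1 a1 ha1 ha'.2
            have n1 := abs_le.1 (hnear a ha.1)
            have n2 := abs_le.1 (hnear a' ha'.1)
            have n3 := abs_le.1 (hnear a1 ha1)
            have c1 := abs_lt.1 (hcell a ha.1 a' ha'.1)
            have c2 := abs_lt.1 (hcell a ha.1 a1 ha1)
            have c3 := abs_lt.1 (hcell a' ha'.1 a1 ha1)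
            have e : 1 / (3 * §q ^ t * q ^ t) = 1 / 3 * (1 / (q ^ t * q ^ t)) := by field_simp
            rw [e] at n1 n2 n3
            set δ := 1 / (§q ^ t * q ^ t)
            rcases le_abs.1 s1 with s1 | s1 <;> rcases le_abs.1 s2 with s2 | s2 <;> rcases le_abs.1 s3 with s3 | s3 <;> linarith
lemma DF.sum32 (h : DF q A1 A2 f) (hq : 2 ≤ q) (k : Nat) (hA2 : 1 ≤ A2) :
    ∑ a ∈ range (q ^ k), ‖FF q f k (a / q ^ k)‖ * √‖FF q f k (a / q ^ k)‖ ≤ q * A2 ^ k := by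
  have hq1 : 1 ≤ §q := mod_cast om
  set B : Nat → Real := fun u => if u + 1 = k then q else A2 with hB
  have key := digprod q om (fun u c => ‖f (k - u) (c / q ^ u)‖ * √‖f (k - u) (c / q ^ u)‖) B
    (fun _ _ => pv) k (by
    intro u hu c hc
    simp only [hB]
    split_ifs with h1
    · calc _ ≤ ∑ t ∈ range q, (1:Real) := by
            apply Mf; intro t _
            have := h.le1 (k - (u+1)) (§(c + q ^ u * t) / q ^ (u+1))
            apply mul_le_one₀ this (Lo _)
            exact Real.sqrt_le_one.2 this
        _ ≤ _ := by simp
    · refine le_trans (le_of_eq ?_) (h.l32 (k - (u+1)) om (c / q ^ (u+1)))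
      apply Me rfl; intro t _
      have e : §(c + q ^ u * t) / q ^ (u+1) = §c / q ^ (u+1) + t / q := by
        push_cast; field_simp; ring
      rw [e])
  refine le_trans (Mf fun a _ => ?_) (key.trans ?_)
  · have h1 := h.FF_split hq k 0 k a om
    rw [range_zero, prod_empty, mul_one, h.Fhi_mod hq] at h1
    have h2 := Real.sqrt_le_sqrt h1
    rw [Real.sqrt_prod _ (fun _ _ => Mi _)] at h2
    rw [Ks]
    exact Mx h1 h2 (Lo _) (Lf fun _ _ => Mi _)
  · calc _ ≤ ∏ u ∈ range k, (if u = k - 1 then §q else 1) * A2 := by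
          apply Ly
          · intro u _; simp only [hB]; split_ifs <;> positivity
          · intro u hu
            rw [Md] at hu
            simp only [hB]
            split_ifs <;> first | omega | nlinarith
      _ ≤ _ := by
          rw [Ks, prod_ite_eq', prod_const, Mq]
          gcongr; split_ifs <;> linarith
lemma nn_mul_nat (q : Nat) (x : Real) (hq : 2 ≤ q) (h : nn x < 1 / (2 * q)) : nn (q * x) = q * nn x := by
  have hq0 : 0 < §q := mod_cast om
  have e : §q * x = q * (x - round x) + ((q * round x : Int) : Real) := by push_cast; ring
  rw [e, nn_add_int]
  have h1 : |§q * (x - round x)| < 1 / 2 := by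
    rw [abs_mul, Nu hq0]
    have : |x - round x| < 1 / (2 * q) := h
    calc _ < §q * (1 / (2 * q)) := by gcongr
      _ = _ := by field_simp
  have h2 : round (§q * (x - round x)) = 0 := by
    rw [round_eq_zero_iff]; rw [abs_lt] at h1; constructor <;> linarith
  unfold nn; rw [h2]; simp [abs_mul]
lemma window (q : Nat) (hq : 2 ≤ q) (t l : Nat) (ht : 1 ≤ t) (θ : Real) (h : 1 / (2 * §q ^ t) ≤ nn (q ^ l * θ)) :
    ∃ i < t, 1 / (2 * §q) ≤ nn (q ^ (l + i) * θ) := by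
  by_contra! hc
  have key : ∀ i, i ≤ t - 1 → nn (q ^ (l + i) * θ) = q ^ i * nn (q ^ l * θ) := by
    intro i
    induction i with
    | zero => simp
    | succ i ih =>
      intro hi
      have := nn_mul_nat q (q ^ (l + i) * θ) hq (hc i om)
      rw [ih om] at this
      rw [show §q ^ (l + (i + 1)) * θ = q * (q ^ (l + i) * θ) by ring, this]; ring
  have h1 := hc (t - 1) om
  rw [key (t-1) le_rfl] at h1
  obtain ⟨s, rfl⟩ : ∃ s, t = s + 1 := ⟨t - 1, om⟩
  simp only [Nat.add_sub_cancel] at h1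
  have : §q ^ s * (1 / (2 * q ^ (s+1))) ≤ q ^ s * nn (q ^ l * θ) := by gcongr
  have e : §q ^ s * (1 / (2 * q ^ (s+1))) = 1 / (2 * q) := by rw [pow_succ]; field_simp
  linarith
lemma DF.tiny (h : DF q A1 A2 f) (hq : 2 ≤ q) (k t m : Nat) (ht : 1 ≤ t) (hm : 1 + m * t ≤ k) (θ : Real)
    (hθ : ∀ l < 1 + m * t, 1 / (2 * §q ^ t) ≤ nn (q ^ l * θ)) :
    ‖FF q f k θ‖ ≤ (1 - 1 / §q ^ 3) ^ m := by
  have hq1 : 1 ≤ §q := mod_cast om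
  have hρ : (0:Real) ≤ 1 - 1 / §q ^ 3 := by
    rw [sub_nonneg, Kb pv]; exact Nz hq1
  have key : ∀ m', m' ≤ m → ∏ l ∈ range (1 + m' * t), ‖f l (q ^ l * θ)‖ ≤ (1 - 1 / §q ^ 3) ^ m' := by
    intro m'
    induction m' with
    | zero => intro _; simpa using h.le1 _ _
    | succ m' ih =>
      intro hm'
      have h1 := ih om
      have hle : m' * t + t ≤ m * t := by
        calc _ = (m' + 1) * t := rg
          _ ≤ _ := Mo _ hm'
      have ha : 1 + (m' + 1) * t = (1 + m' * t) + t := rg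
      rw [ha, Jr, pow_succ]
      obtain ⟨i, hi, hi2⟩ := window q hq t (1 + m' * t) ht θ (hθ _ om)
      have h2 := h.dec (1 + m' * t + i) om _ hi2
      refine Mx h1 ?_ (Lf fun _ _ => Mi _) (pow_nonneg hρ _)
      rw [← mul_prod_erase _ _ (Md.2 hi)]
      refine le_trans (Kc (Mi _) ?_) h2
      exact Tf (fun _ _ => Mi _) fun _ _ => h.le1 _ _
  unfold FF
  rw [norm_prod]
  obtain ⟨s, rfl⟩ : ∃ s, k = 1 + m * t + s := ⟨k - (1 + m * t), om⟩
  rw [Jr]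
  refine le_trans (Kc (Lf fun _ _ => Mi _) ?_) (key m le_rfl)
  exact Tf (fun _ _ => Mi _) fun _ _ => h.le1 _ _
lemma DF.FF_le1 (h : DF q A1 A2 f) (k : Nat) (θ : Real) : ‖FF q f k θ‖ ≤ 1 := by
  unfold FF; rw [norm_prod]; exact Tf (fun _ _ => Mi _) fun _ _ => h.le1 _ _
lemma DF.diff {f' : Nat → Real → Complex} (h : DF q A1 A2 f) (h' : DF q A1 A2 f') (hq : 2 ≤ q) (k j i1 : Nat) (hj : j ≤ k)
    (hij : i1 ≤ j) (b : Int) (β : Real) (heq : ∀ l, l < j ∨ k - j ≤ l → f l = f' l) :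
    ‖FF q f k (b / q ^ i1 + β) - FF q f' k (b / q ^ i1 + β)‖ ≤ 4 * πi * q * q ^ (k - j) * |β| := by
  set θ := (b:Real) / q ^ i1 + β with hθ
  have tele : ∀ n, ‖FF q f n θ - FF q f' n θ‖ ≤ ∑ l ∈ range n, ‖f l (q ^ l * θ) - f' l (q ^ l * θ)‖ := by
    intro n
    induction n with
    | zero => simp [FF]
    | succ n ih =>
      unfold FF at *
      rw [Kw, Kw, sum_range_succ]
      set a := ∏ l ∈ range n, f l (q ^ l * θ) with ha
      set c := ∏ l ∈ range n, f' l (q ^ l * θ) with hc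
      have e : a * f n (q ^ n * θ) - c * f' n (q ^ n * θ) = (a - c) * f n (q ^ n * θ) + c * (f n (q ^ n * θ) - f' n (q ^ n * θ)) := rg
      rw [e]
      refine (norm_add_le _ _).trans ?_
      rw [norm_mul, norm_mul]
      have h1 := h.le1 n (q ^ n * θ)
      have h2 : ‖c‖ ≤ 1 := h'.FF_le1 n θ
      have h3 := Mi (a - c)
      have h4 := Mi (f n (q ^ n * θ) - f' n (q ^ n * θ))
      nlinarith
  refine (tele k).trans ?_
  have hz : ∀ (g : Nat → Real → Complex), DF q A1 A2 g → ∀ l, i1 ≤ l → ‖g l (q ^ l * θ) - 1‖ ≤ 2 * πi * q * (q ^ l * |β|) := by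
    intro g hg l hl
    obtain ⟨s, rfl⟩ : ∃ s, l = i1 + s := ⟨l - i1, om⟩
    have e : §q ^ (i1 + s) * θ = q ^ (i1 + s) * β + ((b * q ^ s : Int) : Real) := by
      rw [hθ]; push_cast; rw [pow_add]; field_simp; ring
    rw [e, hg.per, ← hg.at0 (i1 + s)]
    refine (hg.lip _ _ _).trans (le_of_eq ?_)
    rw [sub_zero, abs_mul, Nu (pv : 0 < §q ^ (i1 + s))]
  calc _ ≤ ∑ l ∈ range (k - j), ‖f l (q ^ l * θ) - f' l (q ^ l * θ)‖ := by
        apply le_of_eq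
        symm
        apply sum_subset (Kx.2 om)
        intro l _ hl
        rw [Md, not_lt] at hl
        rw [heq l (Or.inr hl)]; simp
    _ ≤ ∑ l ∈ range (k - j), 4 * πi * q * |β| * q ^ l := by
        apply Mf; intro l _
        by_cases hl : l < j
        · rw [heq l (Or.inl hl)]; simp; positivity
        · have h1 := hz f h l om
          have h2 := hz f' h' l om
          rw [norm_sub_rev] at h2
          have := norm_sub_le_norm_sub_add_norm_sub (f l (q ^ l * θ)) 1 (f' l (q ^ l * θ))
          linarith
    _ ≤ _ := by
        rw [← mul_sum]
        have : ∑ l ∈ range (k - j), §q ^ l ≤ q ^ (k - j) := by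
          have := Nat.geomSum_lt (m := q) (n := k - j) (s := range (k - j)) hq (by simp)
          exact_mod_cast this.le
        calc _ ≤ 4 * πi * q * |β| * q ^ (k - j) := by gcongr
          _ = _ := rg
end
lemma tau_sq (n : Nat) (hn : Squarefree n) : (n.divisors.card) ^ 10 ≤ 1024 ^ 1024 * n := by
  have h0 : n ≠ 0 := hn.ne_zero
  have h1 : n.divisors.card = ∏ p ∈ n.primeFactors, 2 := by
    rw [Nat.card_divisors h0]
    apply prod_congr rfl; intro p hp
    rw [hn.natFactorization_le_one p |>.antisymm ((Mp hp).factorization_pos_of_dvd h0 (Nat.dvd_of_mem_primeFactors hp))]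
  rw [h1, ← prod_pow]
  calc _ ≤ ∏ p ∈ n.primeFactors, ((if p < 1024 then 1024 else 1) * p) := by
        apply Finset.prod_le_prod' ; intro p hp
        have := (Mp hp).pos
        split_ifs <;> omega
    _ = (∏ p ∈ n.primeFactors, (if p < 1024 then 1024 else 1)) * n := by
        rw [Ks, Nat.prod_primeFactors_of_squarefree hn]
    _ ≤ _ := by
        gcongr
        rw [prod_ite, prod_const, prod_const_one, mul_one]
        apply Mh nm
        refine (Mn (t := range 1024) ?_).trans (by simp)
        intro p hp; rw [Mc] at hp; exact Md.2 hp.2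
noncomputable def CT : Real := √((1024:Real) ^ 1024)
lemma CT_nonneg : 0 ≤ CT := Lo _
lemma tau5 (n : Nat) (hn : Squarefree n) : §n.divisors.card ^ 5 ≤ CT * √n := by
  have hτ' : (§n.divisors.card ^ 5) ^ 2 ≤ 1024 ^ 1024 * n := by
    rw [← pow_mul]; exact_mod_cast tau_sq n hn
  have := Ld hτ'
  rwa [Lg pv] at this
lemma tau_mul (m n : Nat) : (m * n).divisors.card ≤ m.divisors.card * n.divisors.card := by
  rw [Nat.divisors_mul]; exact card_mul_le
open scoped Classical in
lemma harm_le (M : Nat) : ∑ m ∈ Icc 1 M, (1:Real) / m ≤ 1 + lg M := by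
  have := harmonic_le_one_add_log M
  rw [harmonic_eq_sum_Icc] at this
  push_cast at this
  simpa using this
lemma tau_sum_step (M j : Nat) : ∑ m ∈ Icc 1 M, §m.divisors.card ^ (j+1) / m ≤ (∑ m ∈ Icc 1 M, §m.divisors.card ^ j / m) ^ 2 := by
  classical
  rw [sq, Kp, ← sum_product']
  calc _ ≤ ∑ m ∈ Icc 1 M, ∑ x ∈ m.divisorsAntidiagonal, (§x.1.divisors.card ^ j / x.1 * (§x.2.divisors.card ^ j / x.2)) := by
        apply Mf; intro m hm
        rw [mem_Icc] at hm
        have hc : §m.divisors.card = ∑ x ∈ m.divisorsAntidiagonal, 1 := by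
          rw [Ms, Mj, mul_one, ← Nat.map_div_right_divisors, card_map]
        rw [pow_succ, mul_div_right_comm]
        nth_rw 2 [hc]
        rw [mul_sum]
        apply Mf; intro x hx
        rw [Lh] at hx
        have h1 := tau_mul x.1 x.2
        rw [← hx.1]
        push_cast
        rw [mul_one, Jw, ← mul_pow]
        gcongr
        exact_mod_cast h1
    _ = ∑ y ∈ (Icc 1 M).sigma (fun m => m.divisorsAntidiagonal), (§y.2.1.divisors.card ^ j / y.2.1 * (§y.2.2.divisors.card ^ j / y.2.2)) := by
        rw [sum_sigma]
    _ = ∑ x ∈ ((Icc 1 M).sigma (fun m => m.divisorsAntidiagonal)).image (fun y => y.2), (§x.1.divisors.card ^ j / x.1 * (§x.2.divisors.card ^ j / x.2)) := by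
        rw [sum_image]
        rintro ⟨m, x⟩ h1 ⟨m', x'⟩ h2 h3
        simp only [coe_sigma, Set.mem_sigma_iff, SetLike.mem_coe, Lh] at h1 h2
        simp only at h3
        subst h3
        have : m = m' := h1.2.1.symm.trans h2.2.1
        subst this; rfl
    _ ≤ _ := by
        apply Mg
        · intro x hx
          simp only [Lp, mem_sigma, mem_Icc, Lh] at hx
          obtain ⟨⟨m, y⟩, ⟨⟨h1, h2⟩, h3, h4⟩, rfl⟩ := hx
          simp only at *
          have a1 : 0 < y.1 := Mr (by rintro h; rw [h] at h3; omega)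
          have a2 : 0 < y.2 := Mr (by rintro h; rw [h] at h3; omega)
          rw [Nk, mem_Icc, mem_Icc]
          refine ⟨⟨a1, ?_⟩, a2, ?_⟩
          · nlinarith
          · nlinarith
        · intros; positivity
lemma tau_sum (M j : Nat) : ∑ m ∈ Icc 1 M, §m.divisors.card ^ j / m ≤ (1 + lg M) ^ (2 ^ j) := by
  induction j with
  | zero => simpa using harm_le M
  | succ j ih =>
    refine (tau_sum_step M j).trans ?_
    rw [pow_succ 2 j, pow_mul]
    apply My (Nb fun _ _ => pv) ih
section
variable {q : Nat} {A1 A2 : Real} {f : Nat → Real → Complex}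
lemma DF.sumFrac (h : DF q A1 A2 f) (hq : 2 ≤ q) (k t : Nat) (ht : 2 * t ≤ k) (I : Finset (Nat × Nat))
    (hI : ∀ x ∈ I, x.1 < x.2 ∧ x.2 ≤ q ^ t ∧ x.1.Coprime x.2) :
    ∑ x ∈ I, ‖FF q f k (x.1 / x.2)‖ ≤ q ^ 2 * (A1 + 7) ^ (2 * t) := by
  classical
  have key := h.cellW hq (2 * t) I (fun x => §x.1 / x.2) (fun _ => 1) (fun x _ => pv)
    (fun x hx => by
      have := hI x hx
      rw [div_lt_one (mod_cast om)]; exact_mod_cast this.1) (fun _ _ => nm) 1 nm (by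
      intro c _
      rw [Ms, Mj, mul_one]
      norm_cast
      rw [card_le_one]
      intro x hx y hy
      rw [Mc] at hx hy
      obtain ⟨hx, hxc⟩ := hx
      obtain ⟨hy, hyc⟩ := hy
      obtain ⟨x1, x2, x3⟩ := hI x hx
      obtain ⟨y1, y2, y3⟩ := hI y hy
      have px : (0:Real) < x.2 := mod_cast om
      have py : (0:Real) < y.2 := mod_cast om
      by_cases he : ((x.1 : Int) : Real) / x.2 = ((y.1 : Int) : Real) / y.2
      · rw [div_eq_div_iff px.ne' py.ne'] at he
        have he : x.1 * y.2 = y.1 * x.2 := mod_cast he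
        have d1 : x.2 ∣ y.2 := (x3.symm).dvd_of_dvd_mul_left (he ▸ Je _ _)
        have d2 : y.2 ∣ x.2 := (y3.symm).dvd_of_dvd_mul_left (he ▸ Je _ _)
        have e := Nat.dvd_antisymm d1 d2
        rw [e] at he
        exact Prod.ext (Nat.eq_of_mul_eq_mul_right om he) e
      · have s := frac_sep om om he
        have e1 := Kd (pv : (0:Real) ≤ (x.1 / x.2 : Real) * q ^ (2 * t))
        have e2 := Lu ((x.1 / x.2 : Real) * q ^ (2 * t))
        have e3 := Kd (pv : (0:Real) ≤ (y.1 / y.2 : Real) * q ^ (2 * t))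
        have e4 := Lu ((y.1 / y.2 : Real) * q ^ (2 * t))
        push_cast at hxc hyc
        rw [hxc] at e1 e2
        rw [hyc] at e3 e4
        simp only [Jv] at s
        have hs : 1 / §q ^ (2 * t) ≤ 1 / ((x.2:Real) * y.2) := by
          have x2 : §x.2 ≤ q ^ t := mod_cast x2
          have y2 : §y.2 ≤ q ^ t := mod_cast y2
          rw [two_mul, pow_add]; gcongr
        have s2 := hs.trans s
        have hP : 0 < §q ^ (2 * t) := pv
        rw [Nj hP, ← Nu hP, ← abs_mul] at s2
        have : |((x.1:Real) / x.2 - y.1 / y.2) * q ^ (2 * t)| < 1 := by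
          rw [sub_mul, abs_lt]; constructor <;> linarith
        linarith)
  simp only [one_mul] at key
  refine le_trans (Mf fun x _ => ?_) key
  unfold FF
  rw [norm_prod]
  obtain ⟨s, rfl⟩ : ∃ s, k = 2 * t + s := ⟨k - 2 * t, om⟩
  rw [Jr]
  refine Kc (Lf fun _ _ => Mi _) ?_
  exact Tf (fun _ _ => Mi _) fun _ _ => h.le1 _ _
open scoped Classical in
noncomputable def JJ (q Y : Nat) : Finset (Nat × Nat) := ((range (Y+1)) ×ˢ (range (Y+1))).filter fun x =>
  1 ≤ x.1 ∧ x.1 < x.2 ∧ x.1.Coprime x.2 ∧ Squarefree x.2 ∧ x.2.Coprime q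
lemma typeI_red (F : Real → Real) (hF : ∀ x, 0 ≤ F x) (Y : Nat) (I : Finset Nat) (hI : ∀ e ∈ I, 1 ≤ e ∧ e ≤ Y ∧ Squarefree e ∧ e.Coprime q) :
    ∑ e ∈ I, §e.divisors.card ^ 5 / e * ∑ b ∈ Ico 1 e, F (b / e) ≤
      (1 + lg Y) ^ 32 * ∑ x ∈ JJ q Y, §x.2.divisors.card ^ 5 / x.2 * F (x.1 / x.2) := by
  classical
  refine le_trans ?_ (Mb (tau_sum Y 5) (Nb fun x _ => Mu pv (hF _)))
  rw [Kp, ← sum_product']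
  simp_rw [mul_sum]
  rw [sum_sigma']
  set φ : (Σ _ : Nat, Nat) → Nat × (Nat × Nat) := fun y => (Nat.gcd y.2 y.1, (y.2 / Nat.gcd y.2 y.1, y.1 / Nat.gcd y.2 y.1)) with hφ
  have hinj : Set.InjOn φ (I.sigma fun e => Ico 1 e) := by
    rintro ⟨e, b⟩ h1 ⟨e', b'⟩ h2 h3
    simp only [hφ, Prod.mk.injEq] at h3
    obtain ⟨g1, g2, g3⟩ := h3
    rw [← g1] at g2 g3
    have a1 := Kf (Nv b e)
    have a2 := Kf (Kt b e)
    have a3 := Kf (Nv b' e')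
    have a4 := Kf (Kt b' e')
    rw [← g1, ← g3, a1] at a3
    rw [← g1, ← g2, a2] at a4
    subst a3; subst a4; rfl
  calc _ ≤ ∑ y ∈ I.sigma fun e => Ico 1 e, (fun z : Nat × (Nat × Nat) => §z.1.divisors.card ^ 5 / z.1 * (§z.2.2.divisors.card ^ 5 / z.2.2 * F (z.2.1 / z.2.2))) (φ y) := by
        apply Mf
        rintro ⟨e, b⟩ hy
        simp only [mem_sigma, mem_Ico] at hy
        obtain ⟨he, hb⟩ := hy
        simp only [hφ]
        have hg : 0 < Nat.gcd b e := Lw _ om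
        have a1 := Kf (Nv b e)
        have a2 := Kf (Kt b e)
        set g := Nat.gcd b e
        set e' := e / g
        set b' := b / g
        have he' : 0 < e' := Mr (by rintro h; rw [h] at a1; omega)
        have ef : §b / e = b' / e' := by
          rw [← a1, ← a2]; push_cast; field_simp
        rw [ef, ← Nn]
        apply Mb _ (hF _)
        have h1 := tau_mul e' g
        rw [a1] at h1
        rw [Jw, ← mul_pow]
        have : §e = g * e' := by rw [← a1]; push_cast; ring
        rw [this]
        gcongr
        rw [mul_comm]
        exact_mod_cast h1
    _ = ∑ z ∈ (I.sigma fun e => Ico 1 e).image φ, §z.1.divisors.card ^ 5 / z.1 * (§z.2.2.divisors.card ^ 5 / z.2.2 * F (z.2.1 / z.2.2)) := by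
        rw [sum_image hinj]
    _ ≤ _ := by
        apply Mg
        · intro z hz
          obtain ⟨⟨e, b⟩, hy, rfl⟩ := Lp.1 hz
          simp only [mem_sigma, mem_Ico] at hy
          obtain ⟨he, hb⟩ := hy
          obtain ⟨h1, h2, h3, h4⟩ := hI e he
          have hg : 0 < Nat.gcd b e := Lw _ om
          have gle' : Nat.gcd b e ≤ b := Ng om (Kt _ _)
          have a1 : e / Nat.gcd b e ≤ e := Jl _ _
          have a2 : b / Nat.gcd b e ≤ b := Jl _ _
          have hd : e / Nat.gcd b e ∣ e := Nat.div_dvd_of_dvd (Nv _ _)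
          simp only [hφ, Nk, mem_Icc, JJ, Mc, Md]
          refine ⟨⟨om, om⟩, ⟨om, om⟩, Nat.div_pos gle' hg, Nat.div_lt_div_of_lt_of_dvd (Nv _ _) hb.2, Nat.coprime_div_gcd_div_gcd hg, h3.squarefree_of_dvd hd, Nat.Coprime.coprime_dvd_left hd h4⟩
        · intros; exact Mu pv (Mu pv (hF _))
lemma DF.typeI_fin (h : DF q A1 A2 f) (hq : 2 ≤ q) (k s m : Nat) (hs : 1 ≤ s) (hm : 1 + m * s ≤ k) (hA : (A1 + 7) ^ 3 ≤ √q / 2)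
    (hk : 4 ≤ k) :
    ∑ x ∈ JJ q (q ^ (k / 4 + 1) - 1), §x.2.divisors.card ^ 5 / x.2 * ‖FF q f k (x.1 / x.2)‖ ≤
      k * (§q ^ (6 * s) * (1 - 1 / §q ^ 3) ^ m) + k * (CT * q ^ 3 * (1 / 2) ^ s) := by
  classical
  have hq0 : 0 < §q := mod_cast om
  have hq1 : 1 ≤ §q := mod_cast om
  have hA1 := h.A1_nonneg
  set C : Real := CT with hC
  have hC0 : 0 ≤ C := CT_nonneg
  have hρ : (0:Real) ≤ 1 - 1 / §q ^ 3 := by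
    rw [sub_nonneg, Kb pv]; exact Nz hq1
  set J := JJ q (q ^ (k / 4 + 1) - 1) with hJ
  have hJm : ∀ x ∈ J, x.2 < q ^ (k / 4 + 1) ∧ 1 ≤ x.1 ∧ x.1 < x.2 ∧ x.1.Coprime x.2 ∧ Squarefree x.2 ∧ x.2.Coprime q := by
    intro x hx
    simp only [hJ, JJ, Mc, Nk, Md] at hx
    refine ⟨?_, hx.2⟩
    have : 0 < q ^ (k / 4 + 1) := pv
    omega
  have hmaps : ∀ x ∈ J, Nat.log q x.2 ∈ range k := by
    intro x hx
    have := hJm x hx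
    rw [Md]
    have := Nat.log_lt_of_lt_pow om this.1
    omega
  rw [← sum_fiberwise_of_maps_to hmaps]
  have hfib : ∀ t ∈ range k, ∑ x ∈ J with Nat.log q x.2 = t, §x.2.divisors.card ^ 5 / x.2 * ‖FF q f k (x.1 / x.2)‖ ≤
      §q ^ (6 * s) * (1 - 1 / §q ^ 3) ^ m + C * q ^ 3 * (1 / 2) ^ s := by
    intro t _
    set I := J.filter fun x => Nat.log q x.2 = t with hI
    have hIm : ∀ x ∈ I, q ^ t ≤ x.2 ∧ x.2 < q ^ (t + 1) := by
      intro x hx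
      rw [hI, Mc] at hx
      have := hJm x hx.1
      rw [← hx.2]
      exact ⟨Nat.pow_log_le_self q om, Nat.lt_pow_succ_log_self om _⟩
    by_cases hts : t < s
    · have : ∑ x ∈ I, §x.2.divisors.card ^ 5 / x.2 * ‖FF q f k (x.1 / x.2)‖ ≤ ∑ x ∈ I, §q ^ (4 * s) * (1 - 1 / §q ^ 3) ^ m := by
        apply Mf; intro x hx
        obtain ⟨i1, i2⟩ := hIm x hx
        obtain ⟨j1, j2, j3, j4, j5, j6⟩ := hJm x (Mc.1 hx).1
        have hx2 : x.2 ≤ q ^ s := i2.le.trans (Mh om hts)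
        have hx2' : §x.2 ≤ q ^ s := mod_cast hx2
        have hx0 : (0:Real) < x.2 := mod_cast om
        have hd : §x.2.divisors.card ≤ x.2 := mod_cast Nat.card_divisors_le_self _
        apply Mx _ _ (Mi _) pv
        · calc _ ≤ §x.2 ^ 5 / x.2 := by gcongr
            _ = §x.2 ^ 4 := by field_simp
            _ ≤ (§q ^ s) ^ 4 := by gcongr
            _ = _ := rg
        · apply h.tiny hq k s m hs hm
          intro l _
          have e : §q ^ l * (x.1 / x.2) = ((q ^ l * x.1 : Int) : Real) / x.2 := by push_cast; ring
          rw [e]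
          refine le_trans ?_ (nn_div _ _ om ?_)
          · gcongr; nlinarith [pow_pos hq0 s]
          · intro hdv
            have hdv : x.2 ∣ q ^ l * x.1 := mod_cast hdv
            have := (Nat.Coprime.pow_right l j6).dvd_of_dvd_mul_left hdv
            have := Ng om this
            omega
      refine this.trans ?_
      rw [Ms, Mj]
      have hcard : §I.card ≤ §q ^ (2 * s) := by
        have : I ⊆ range (q ^ s) ×ˢ range (q ^ s) := by
          intro x hx
          obtain ⟨i1, i2⟩ := hIm x hx
          obtain ⟨j1, j2, j3, j4, j5, j6⟩ := hJm x (Mc.1 hx).1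
          have hx2 : q ^ (t + 1) ≤ q ^ s := (Mh om hts)
          rw [Nk, Md, Md]; constructor <;> omega
        have := Mn this
        rw [card_product, Mq] at this
        rw [two_mul, pow_add]
        exact_mod_cast this
      calc _ ≤ §q ^ (2 * s) * (§q ^ (4 * s) * (1 - 1 / §q ^ 3) ^ m) := by gcongr
        _ = §q ^ (6 * s) * (1 - 1 / §q ^ 3) ^ m := rg
        _ ≤ _ := by
          have : 0 ≤ C * q ^ 3 * (1 / 2) ^ s := pv
          linarith
    · by_cases ht4 : t + 1 ≤ k / 4 + 1
      · have h1 : ∑ x ∈ I, ‖FF q f k (x.1 / x.2)‖ ≤ q ^ 2 * (A1 + 7) ^ (2 * (t + 1)) := by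
          apply h.sumFrac hq k (t + 1) om
          intro x hx
          obtain ⟨i1, i2⟩ := hIm x hx
          obtain ⟨j1, j2, j3, j4, j5, j6⟩ := hJm x (Mc.1 hx).1
          exact ⟨j3, i2.le, j4⟩
        have h2 : ∑ x ∈ I, §x.2.divisors.card ^ 5 / x.2 * ‖FF q f k (x.1 / x.2)‖ ≤ ∑ x ∈ I, C / (√q) ^ t * ‖FF q f k (x.1 / x.2)‖ := by
          apply Mf; intro x hx
          obtain ⟨i1, i2⟩ := hIm x hx
          obtain ⟨j1, j2, j3, j4, j5, j6⟩ := hJm x (Mc.1 hx).1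
          have hx0 : (0:Real) < x.2 := mod_cast om
          refine Mb ?_ (Mi _)
          have := tau5 x.2 j5
          calc _ ≤ C * √x.2 / x.2 := by gcongr
            _ = C / √x.2 := by
              rw [div_eq_div_iff hx0.ne' (Real.sqrt_pos.2 hx0).ne', Nn, Kg hx0.le]
            _ ≤ _ := by
              gcongr
              apply Ld
              rw [← pow_mul, mul_comm t, pow_mul, Jm hq0.le]; exact_mod_cast i1
        rw [← mul_sum] at h2
        have hsq1 : √q ≤ q := Jx.2 ⟨hq0.le, by nlinarith⟩
        have hA2 : (A1 + 7) ^ 2 ≤ √q / 2 := le_trans (Ml li nm) hA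
        calc _ ≤ C / (√q) ^ t * (q ^ 2 * (A1 + 7) ^ (2 * (t + 1))) := h2.trans (by gcongr)
          _ ≤ C / (√q) ^ t * (q ^ 2 * (√q / 2) ^ (t + 1)) := by rw [pow_mul]; gcongr
          _ = C * q ^ 2 * √q / 2 * (1 / 2) ^ t := by
              rw [pow_succ (√q / 2), div_pow, div_pow]; field_simp; simp
          _ ≤ C * q ^ 2 * q / 1 * (1 / 2) ^ s := by
              have : (1 / 2 : Real) ^ t ≤ (1 / 2) ^ s := pow_le_pow_of_le_one nm nm om
              gcongr
              norm_num
          _ = C * q ^ 3 * (1 / 2) ^ s := rg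
          _ ≤ _ := by
            have : 0 ≤ §q ^ (6 * s) * (1 - 1 / §q ^ 3) ^ m := Mu pv (pow_nonneg hρ m)
            linarith
      · have : I = ∅ := by
          rw [eq_empty_iff_forall_notMem]
          intro x hx
          have i := hIm x hx
          have j := (hJm x (Mc.1 hx).1).1
          have : q ^ (k / 4 + 1) ≤ q ^ t := Mh om om
          omega
        rw [this, sum_empty]
        have := pow_nonneg hρ m
        positivity
  refine (Mf hfib).trans (le_of_eq ?_)
  rw [Ms, Mq, Mj]; ring
end
lemma lim1 (a : Nat) (ρ : Real) (h0 : 0 < ρ) (h1 : ρ < 1) : Tendsto (fun s : Nat => (§s + 1) ^ a * ρ ^ s) atTop (nhds 0) := by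
  have h := tendsto_pow_const_mul_const_pow_of_abs_lt_one a (r := ρ) (by rwa [Nu h0])
  have h2 := ((tendsto_add_atTop_iff_nat 1).2 h).mul_const (1 / ρ)
  rw [zero_mul] at h2
  refine h2.congr fun s => ?_
  push_cast; rw [pow_succ ρ]; field_simp
lemma lim2 (a : Nat) (Q ρ : Real) (hQ : 0 < Q) (h0 : 0 < ρ) (h1 : ρ < 1) :
    Tendsto (fun s : Nat => (§s + 1) ^ a * (Q ^ s * ρ ^ (s ^ 2))) atTop (nhds 0) := by
  have h := lim1 a ρ h0 h1
  have hev : ∀ᶠ s : Nat in atTop, Q * ρ ^ s ≤ ρ := by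
    have := (tendsto_pow_atTop_nhds_zero_of_lt_one h0.le h1).const_mul Q
    rw [mul_zero] at this
    exact this.eventually (ge_mem_nhds h0) 
  refine squeeze_zero' (Eventually.of_forall fun s => pv) ?_ h
  filter_upwards [hev] with s hs
  have : Q ^ s * ρ ^ (s ^ 2) = (Q * ρ ^ s) ^ s := by rw [mul_pow, sq, pow_mul]
  rw [this]
  gcongr
def ss (k : Nat) : Nat := Nat.sqrt (Nat.sqrt k)
lemma ss_le (k : Nat) : (ss k) ^ 4 ≤ k := by
  have h1 := Nat.sqrt_le' k
  have h2 := Nat.sqrt_le' (Nat.sqrt k)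
  calc _ = (ss k ^ 2) ^ 2 := rg
    _ ≤ (Nat.sqrt k) ^ 2 := Nd h2 2
    _ ≤ k := h1
lemma lt_ss (k : Nat) : k < (ss k + 1) ^ 4 := by
  have h1 := Nat.lt_succ_sqrt' k
  have h2 := Nat.lt_succ_sqrt' (Nat.sqrt k)
  calc _ < (Nat.sqrt k + 1) ^ 2 := h1
    _ ≤ ((ss k + 1) ^ 2) ^ 2 := Nd h2 2
    _ = _ := rg
lemma ss_tendsto : Tendsto ss atTop atTop := by
  apply tendsto_atTop.2
  intro b
  filter_upwards [Nm (b ^ 4)] with k hk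
  have h := lt_ss k
  by_contra hc
  have : (ss k + 1) ^ 4 ≤ b ^ 4 := Nd om 4
  omega
lemma typeI (q : Nat) (hq : 2 ≤ q) (A1 A2 : Real) (hA : (A1 + 7) ^ 3 ≤ √q / 2) (ε : Real) (hε : 0 < ε) :
    ∀ᶠ k : Nat in atTop, ∀ f, DF q A1 A2 f → ∀ I : Finset Nat, (∀ e ∈ I, 1 ≤ e ∧ e ^ 4 ≤ q ^ k ∧ Squarefree e ∧ e.Coprime q) →
      ∑ e ∈ I, §e.divisors.card ^ 5 / e * ∑ b ∈ Ico 1 e, ‖FF q f k (b / e)‖ ≤ ε / k := by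
  have hq0 : 0 < §q := mod_cast om
  have hq2 : 2 ≤ §q := mod_cast hq
  set ρ : Real := 1 - 1 / §q ^ 3 with hρ
  have h8 : (1:Real) / q ^ 3 ≤ 1 / 2 := by
    gcongr
    calc 2 ≤ §q := hq2
      _ = q ^ 1 := rg
      _ ≤ q ^ 3 := Ml li nm
  have h0 : 0 < ρ := li
  have h1 : ρ < 1 := by have : (0:Real) < 1 / q ^ 3 := pv
                        linarith
  set C : Real := CT * q ^ 3 with hC
  have hC0 : 0 ≤ C := Mu CT_nonneg pv
  have L : Tendsto (fun s : Nat => (2 * §q) ^ 32 * ((§s + 1) ^ 136 * ((§q ^ 6) ^ s * ρ ^ (s ^ 2)) + C * ((§s + 1) ^ 136 * (1/2) ^ s))) atTop (nhds 0) := by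
    have a := lim2 136 (§q ^ 6) ρ pv h0 h1
    have b := (lim1 136 (1/2) nm nm).const_mul C
    have := (a.add b).const_mul ((2 * §q) ^ 32)
    simpa using this
  have L2 := (L.comp ss_tendsto).eventually (ge_mem_nhds hε)
  filter_upwards [L2, ss_tendsto.eventually_ge_atTop 2, Nm 4] with k hk1 hk2 hk4 f hf I hI
  simp only [Function.comp] at hk1
  have hk0 : 0 < §k := mod_cast om
  rw [Na hk0]
  refine le_trans ?_ hk1
  set s := ss k with hs
  set m := (k - 1) / s with hm
  have hms : 1 + m * s ≤ k := by
    have := Lz (k - 1) s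
    rw [← hm] at this
    omega
  have hm2 : s ^ 2 ≤ m := by
    rw [hm, Jf om]
    have := ss_le k
    rw [← hs] at this
    have h3 : 2 * (s ^ 2 * s) ≤ s ^ 4 := by
      calc _ ≤ s * (s ^ 2 * s) := Mo _ hk2
        _ = _ := rg
    have : 0 < s ^ 2 * s := pv
    omega
  have t1 := typeI_red (q := q) (fun x => ‖FF q f k x‖) (fun _ => Mi _) (q ^ (k / 4 + 1) - 1) I (by
    intro e he
    obtain ⟨e1, e2, e3, e4⟩ := hI e he
    refine ⟨e1, ?_, e3, e4⟩
    have : e < q ^ (k / 4 + 1) := by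
      by_contra! hc
      have h1 : (q ^ (k / 4 + 1)) ^ 4 ≤ e ^ 4 := Nd hc 4
      rw [← pow_mul] at h1
      have h2 : q ^ k < q ^ ((k / 4 + 1) * 4) := Nat.pow_lt_pow_right om om
      omega
    omega)
  have t2 := hf.typeI_fin hq k s m om hms hA hk4
  have hlog : 1 + lg §(q ^ (k / 4 + 1) - 1) ≤ 2 * q * k := by
    have h2q : 2 ≤ q ^ (k/4+1) := hq.trans (Ky om q)
    have : lg §(q ^ (k / 4 + 1) - 1) ≤ lg (§q ^ (k / 4 + 1)) := by
      apply Mz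
      · exact_mod_cast (om : 0 < q ^ (k/4+1) - 1)
      · exact_mod_cast (om : q ^ (k/4+1) - 1 ≤ q ^ (k/4+1))
    rw [Mw] at this
    have h5 : lg q ≤ q := (Real.log_le_sub_one_of_pos hq0).trans li
    have h6 : §(k / 4 + 1) ≤ k := mod_cast om
    have h7 : §(k / 4 + 1) * lg q ≤ k * q := Mx h6 h5 (Kz li) hk0.le
    have h8 : 1 ≤ §k := mod_cast om
    have h9 : 1 ≤ §k * q := one_le_mul_of_one_le_of_one_le h8 li
    linarith
  have hks : §k ≤ (§s + 1) ^ 4 := mod_cast (lt_ss k).le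
  have hρm : ρ ^ m ≤ ρ ^ (s ^ 2) := pow_le_pow_of_le_one h0.le h1.le hm2
  have e6 : §q ^ (6 * s) = (§q ^ 6) ^ s := pow_mul _ _ _
  calc _ ≤ (2 * q * k) ^ 32 * (k * (§q ^ (6 * s) * ρ ^ m) + k * (C * (1 / 2) ^ s)) * k := by
        gcongr
        refine t1.trans ?_
        apply Mx _ t2 (Nb fun _ _ => pv) pv
        gcongr
    _ = (2 * q) ^ 32 * (k ^ 34 * ((§q ^ 6) ^ s * ρ ^ m) + C * (k ^ 34 * (1 / 2) ^ s)) := by rw [e6]; ring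
    _ ≤ (2 * q) ^ 32 * (((§s + 1) ^ 4) ^ 34 * ((§q ^ 6) ^ s * ρ ^ (s ^ 2)) + C * (((§s + 1) ^ 4) ^ 34 * (1 / 2) ^ s)) := by gcongr
    _ = _ := by rw [← pow_mul]
def PP (q z : Nat) : Finset Nat := (range z).filter fun p => p.Prime ∧ ¬ p ∣ q
def Pi (q z : Nat) : Nat := ∏ p ∈ PP q z, p
def HH (q z R : Nat) : Finset Nat := (Pi q z).divisors.filter fun h => h ≤ R
noncomputable def iφ (h : Nat) : Real := 1 / §h.totient
noncomputable def GG (q z R : Nat) : Real := ∑ h ∈ HH q z R, iφ h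
noncomputable def lam (q z R d : Nat) : Real := (mœ d : Real) * (d / GG q z R) * ∑ h ∈ HH q z R with d ∣ h, iφ h
noncomputable def nu (q z R n : Nat) : Real := (∑ d ∈ HH q z R with d ∣ n, lam q z R d) ^ 2
def rough (q z n : Nat) : Prop := ∀ p ∈ PP q z, ¬ p ∣ n
lemma PP_prime (h : p ∈ PP q z) : p.Prime := (Mc.1 h).2.1
lemma Pi_sqf (q z : Nat) : Squarefree (Pi q z) := by
  refine Finset.squarefree_prod_of_pairwise_isCoprime (fun _ hp _ hq hpq ↦ ?_)
    fun _ hp ↦ (PP_prime hp).squarefree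
  simp only [← Nat.coprime_iff_isRelPrime]
  exact (Nat.coprime_primes (PP_prime hp) (PP_prime hq)).2 hpq
lemma Pi_ne (q z : Nat) : Pi q z ≠ 0 := (Pi_sqf q z).ne_zero
lemma Pi_cop (q z : Nat) : (Pi q z).Coprime q := by
  refine Nat.Coprime.prod_left fun p hp => ?_
  exact (Nat.Prime.coprime_iff_not_dvd (PP_prime hp)).2 (Mc.1 hp).2.2
lemma mem_HH : h ∈ HH q z R ↔ h ∣ Pi q z ∧ h ≤ R := by
  simp [HH, Pi_ne]
lemma HH_sqf (hh : h ∈ HH q z R) : Squarefree h := (Pi_sqf q z).squarefree_of_dvd (mem_HH.1 hh).1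
lemma HH_pos (hh : h ∈ HH q z R) : 0 < h := Mr (HH_sqf hh).ne_zero
lemma HH_dvd (hh : h ∈ HH q z R) (hd : d ∣ h) : d ∈ HH q z R :=
  mem_HH.2 ⟨hd.trans (mem_HH.1 hh).1, (Ng (HH_pos hh) hd).trans (mem_HH.1 hh).2⟩
lemma one_mem_HH (hR : 1 ≤ R) : 1 ∈ HH q z R := mem_HH.2 ⟨one_dvd _, hR⟩
lemma iφ_nonneg (h : Nat) : 0 ≤ iφ h := by unfold iφ; positivity
lemma iφ_mul (h : a.Coprime b) : iφ (a * b) = iφ a * iφ b := by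
  unfold iφ; rw [Nat.totient_mul h]; push_cast; rw [one_div_mul_one_div]
lemma GG_ge1 (hR : 1 ≤ R) : 1 ≤ GG q z R := by
  have := Jt (f := iφ) (fun h _ => iφ_nonneg h) (one_mem_HH (q := q) (z := z) hR)
  simpa [iφ, GG] using this
lemma lam_one (hR : 1 ≤ R) : lam q z R 1 = 1 := by
  have : GG q z R ≠ 0 := by linarith [GG_ge1 (q := q) (z := z) hR]
  have h : lam q z R 1 = (GG q z R)⁻¹ * GG q z R := by simp [lam, GG]
  rw [h, inv_mul_cancel₀ this]
lemma le_tau_totient (_hd : 0 < d) : d ≤ d.divisors.card * d.totient := by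
  conv_lhs => rw [← Nat.sum_totient d]
  refine (Kl _ _ d.totient fun e he => ?_).trans (by simp)
  exact Ng (Np.2 _hd) (Nat.totient_dvd_of_dvd (Kv he))
lemma lam_le (hR : 1 ≤ R) (hd : d ∈ HH q z R) : |lam q z R d| ≤ §d.divisors.card := by
  have hG := GG_ge1 (q := q) (z := z) hR
  have hd0 := HH_pos hd
  have hφ : (0:Real) < d.totient := mod_cast Np.2 hd0
  have h1 : ∑ h ∈ HH q z R with d ∣ h, iφ h ≤ iφ d * GG q z R := by
    unfold GG; rw [mul_sum]
    have : ∀ h ∈ (HH q z R).filter (d ∣ ·), iφ h = iφ d * iφ (h / d) := by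
      intro h hh
      obtain ⟨hh, e, rfl⟩ := Mc.1 hh
      rw [Lx _ hd0]
      exact iφ_mul (Nat.coprime_of_squarefree_mul (HH_sqf hh))
    rw [Me rfl this, ← sum_image (f := fun m => iφ d * iφ m) (g := fun h => h / d)]
    · refine Mg ?_ fun _ _ _ => Mu (iφ_nonneg _) (iφ_nonneg _)
      intro m hm
      obtain ⟨h, hh, rfl⟩ := Lp.1 hm
      exact HH_dvd (Mc.1 hh).1 (Nat.div_dvd_of_dvd (Mc.1 hh).2)
    · intro a ha b hb hab
      obtain ⟨_, e, rfl⟩ := Mc.1 ha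
      obtain ⟨_, e', rfl⟩ := Mc.1 hb
      simp only [Lx _ hd0] at hab
      rw [hab]
  have h2 : 0 ≤ ∑ h ∈ HH q z R with d ∣ h, iφ h := Nb fun _ _ => iφ_nonneg _
  have h3 : |((mœ d : Int) : Real)| ≤ 1 := by
    exact_mod_cast ArithmeticFunction.abs_moebius_le_one
  unfold lam
  rw [abs_mul, abs_mul, Ll h2, Ll (pv : 0 ≤ §d / GG q z R)]
  calc _ ≤ 1 * (§d / GG q z R) * (iφ d * GG q z R) := by gcongr
    _ = d / d.totient := by unfold iφ; field_simp
    _ ≤ _ := by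
      rw [Nj hφ]; exact_mod_cast le_tau_totient hd0
lemma sum_mu (hm : Squarefree m) (hh : h ∣ m) :
    ∑ d ∈ m.divisors with h ∣ d, (mœ d : Real) = if m = h then (mœ h : Real) else 0 := by
  obtain ⟨e, rfl⟩ := hh
  have h0 : 0 < h := Mr (left_ne_zero_of_mul hm.ne_zero)
  have e0 : 0 < e := Mr (right_ne_zero_of_mul hm.ne_zero)
  have hc := Nat.coprime_of_squarefree_mul hm
  have : (h * e).divisors.filter (h ∣ ·) = e.divisors.image (h * ·) := by
    ext d; simp only [Mc, Jj, Lp]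
    constructor
    · rintro ⟨⟨hd, -⟩, c, rfl⟩
      exact ⟨c, ⟨Nat.dvd_of_mul_dvd_mul_left h0 hd, e0.ne'⟩, rfl⟩
    · rintro ⟨c, ⟨hc, -⟩, rfl⟩
      exact ⟨⟨mul_dvd_mul_left _ hc, hm.ne_zero⟩, Lm _ _⟩
  rw [this, sum_image (fun a _ b _ hab => Kn h0 hab)]
  have h2 : ∀ c ∈ e.divisors, ((mœ (h * c) : Int) : Real) = (mœ h : Real) * (mœ c : Real) := by
    intro c hc'
    rw [ArithmeticFunction.isMultiplicative_moebius.map_mul_of_coprime (hc.coprime_dvd_right (Kv hc'))]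
    push_cast; rfl
  rw [Me rfl h2, ← mul_sum]
  have h3 : ∑ c ∈ e.divisors, (mœ c) = if e = 1 then 1 else 0 := by
    rw [← ArithmeticFunction.coe_mul_zeta_apply, ArithmeticFunction.moebius_mul_coe_zeta]
    exact ArithmeticFunction.one_apply
  have h3' : ∑ c ∈ e.divisors, (mœ c : Real) = if e = 1 then 1 else 0 := by
    exact_mod_cast h3
  rw [h3']
  have : h * e = h ↔ e = 1 := by
    constructor
    · intro hh; exact Kn h0 li
    · rintro rfl; simp
  simp [this]
lemma yy (q z R h : Nat) :
    ∑ d ∈ HH q z R with h ∣ d, lam q z R d / d = if h ∈ HH q z R then (mœ h : Real) * iφ h / GG q z R else 0 := by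
  have h1 : ∀ d ∈ (HH q z R).filter (h ∣ ·), lam q z R d / d = ∑ m ∈ HH q z R, if d ∣ m then (mœ d : Real) * iφ m / GG q z R else 0 := by
    intro d hd
    have : §d ≠ 0 := mod_cast (HH_pos (Mc.1 hd).1).ne'
    unfold lam
    rw [← Ni, ← sum_div, ← mul_sum]
    field_simp
  rw [Me rfl h1, sum_comm]
  have h2 : ∀ m ∈ HH q z R, (∑ d ∈ HH q z R with h ∣ d, if d ∣ m then (mœ d : Real) * iφ m / GG q z R else 0) = if m = h then (mœ h : Real) * iφ h / GG q z R else 0 := by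
    intro m hm
    rw [← Ni, ← sum_div, ← sum_mul]
    have : (((HH q z R).filter (h ∣ ·)).filter (· ∣ m)) = m.divisors.filter (h ∣ ·) := by
      ext d; simp only [Mc, Jj]
      constructor
      · rintro ⟨⟨_, h1⟩, h2⟩; exact ⟨⟨h2, (HH_pos hm).ne'⟩, h1⟩
      · rintro ⟨⟨h1, _⟩, h2⟩; exact ⟨⟨HH_dvd hm h1, h2⟩, h1⟩
    rw [this]
    by_cases hhm : h ∣ m
    · rw [sum_mu (HH_sqf hm) hhm]
      split_ifs with hc
      · rw [hc]
      · simp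
    · have : m.divisors.filter (h ∣ ·) = ∅ := by
        refine filter_false_of_mem fun d hd hc => hhm (hc.trans (Kv hd))
      rw [this, if_neg (by rintro rfl; exact hhm dvd_rfl)]; simp
  rw [Me rfl h2]
  simp
noncomputable def UU (q z R p : Nat) : Real := ∑ x ∈ HH q z R ×ˢ HH q z R, lam q z R x.1 * lam q z R x.2 / (p.lcm (x.1.lcm x.2) : Nat)
lemma UU_diag (hp : p = 1 ∨ p.Prime) :
    UU q z R p = (1 / p) * ∑ h ∈ HH q z R with h.Coprime p, §h.totient * (∑ d ∈ HH q z R with h ∣ d, lam q z R d * (d.gcd p) / d) ^ 2 := by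
  have p0 : 0 < p := by rcases hp with rfl | hp; · norm_num
                        exact hp.pos
  have key : ∀ x ∈ HH q z R ×ˢ HH q z R, lam q z R x.1 * lam q z R x.2 / (p.lcm (x.1.lcm x.2) : Nat) =
      ∑ h ∈ HH q z R with h.Coprime p, if h ∣ x.1 ∧ h ∣ x.2 then (1/p:Real) * (§h.totient * ((lam q z R x.1 * (x.1.gcd p) / x.1) * (lam q z R x.2 * (x.2.gcd p) / x.2))) else 0 := by
    rintro ⟨a, b⟩ hx
    obtain ⟨ha, hb⟩ := Nk.1 hx
    simp only at ha hb ⊢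
    have a0 := HH_pos ha
    have b0 := HH_pos hb
    rw [← Ni]
    obtain ⟨a', ha'⟩ := Kt a p
    obtain ⟨b', hb'⟩ := Kt b p
    set ga := a.gcd p with hga
    set gb := b.gcd p with hgb
    have ga0 : 0 < ga := Lw _ a0
    have gb0 : 0 < gb := Lw _ b0
    have a'0 : 0 < a' := Mr fun h => by simp [h] at ha'; omega
    have b'0 : 0 < b' := Mr fun h => by simp [h] at hb'; omega
    have cop : ∀ a a' : Nat, Squarefree a → a = a.gcd p * a' → a'.Coprime p := by
      intro a a' hs he
      rcases hp with rfl | hp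
      · exact Lr _
      · rw [Nat.coprime_comm, hp.coprime_iff_not_dvd]
        intro hd
        have h1 : p ∣ a := by rw [he]; exact hd.mul_left _
        rw [Nat.gcd_eq_right h1] at he
        have : p * p ∣ a := by rw [he]; exact mul_dvd_mul_left _ hd
        have := hs p this
        rw [Nat.isUnit_iff] at this
        exact hp.one_lt.ne' this
    have ca : a'.Coprime p := cop a a' (HH_sqf ha) ha'
    have cb : b'.Coprime p := cop b b' (HH_sqf hb) hb'
    have hset : ((HH q z R).filter (·.Coprime p)).filter (fun h => h ∣ a ∧ h ∣ b) = (a'.gcd b').divisors := by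
      ext h
      simp only [Mc, Jj, Nat.dvd_gcd_iff]
      constructor
      · rintro ⟨⟨_, hc⟩, h1, h2⟩
        refine ⟨⟨?_, ?_⟩, (Lw _ a'0).ne'⟩
        · rw [ha'] at h1
          exact Nat.Coprime.dvd_of_dvd_mul_left (hc.coprime_dvd_right (Nv a p)) h1
        · rw [hb'] at h2
          exact Nat.Coprime.dvd_of_dvd_mul_left (hc.coprime_dvd_right (Nv b p)) h2
      · rintro ⟨⟨h1, h2⟩, -⟩
        have h3 : h ∣ a := by rw [ha']; exact h1.mul_left _
        have h4 : h ∣ b := by rw [hb']; exact h2.mul_left _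
        exact ⟨⟨HH_dvd ha h3, ca.coprime_dvd_left h1⟩, h3, h4⟩
    rw [hset, ← mul_sum, ← sum_mul]
    have htot : (∑ h ∈ (a'.gcd b').divisors, (h.totient : Real)) = §(a'.gcd b') := by
      exact_mod_cast Nat.sum_totient (a'.gcd b')
    rw [htot]
    have hl : p.lcm (a.lcm b) * a'.gcd b' = p * (a' * b') := by
      have : p.lcm (a.lcm b) = p * a'.lcm b' := by
        have hcop : p.Coprime (a'.lcm b') := ((Nat.Coprime.mul_left ca cb).coprime_dvd_left (Nat.lcm_dvd_mul a' b')).symm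
        apply Nat.dvd_antisymm
        · refine Js (Lm _ _) (Js ?_ ?_)
          · rw [ha']; exact mul_dvd_mul (Nv _ _) (Ka _ _)
          · rw [hb']; exact mul_dvd_mul (Nv _ _) (Nw _ _)
        · refine hcop.mul_dvd_of_dvd_of_dvd (Ka _ _) (Js ?_ ?_)
          · refine Dvd.dvd.trans ?_ ((Ka a b).trans (Nw _ _))
            exact Dvd.intro_left _ ha'.symm
          · refine Dvd.dvd.trans ?_ ((Nw a b).trans (Nw _ _))
            exact Dvd.intro_left _ hb'.symm
      rw [this, Nn, mul_comm (a'.lcm b'), Nat.gcd_mul_lcm]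
    have hl' : §(p.lcm (a.lcm b)) * §(a'.gcd b') = p * (a' * b') := mod_cast hl
    have hL : §(p.lcm (a.lcm b)) ≠ 0 := by
      have := Tn p0 (Tn a0 b0)
      exact_mod_cast this.ne'
    have q1 : §a = ga * a' := mod_cast ha'
    have q2 : §b = gb * b' := mod_cast hb'
    have p0' : §p ≠ 0 := mod_cast p0.ne'
    have n1 : §ga ≠ 0 := mod_cast ga0.ne'
    have n2 : §gb ≠ 0 := mod_cast gb0.ne'
    have n3 : §a' ≠ 0 := mod_cast a'0.ne'
    have n4 : §b' ≠ 0 := mod_cast b'0.ne'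
    rw [q1, q2]
    have : §(a'.gcd b') = p * (a' * b') / §(p.lcm (a.lcm b)) := by
      rw [eq_div_iff hL, mul_comm]; exact hl'
    rw [this]
    field_simp
  unfold UU
  rw [Me rfl key, sum_comm, mul_sum]
  refine Me rfl fun h _ => ?_
  rw [sq, Kp, ← sum_product', ← filter_product, mul_sum, mul_sum, ← Ni]
lemma UU_one (hR : 1 ≤ R) : UU q z R 1 = 1 / GG q z R := by
  have hG := GG_ge1 (q := q) (z := z) hR
  rw [UU_diag (Or.inl rfl)]
  have hf : (HH q z R).filter (·.Coprime 1) = HH q z R := filter_true_of_mem fun h _ => Lr h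
  rw [hf]
  simp only [Nat.gcd_one_right, Jy, mul_one, div_one, one_mul]
  simp_rw [yy]
  have : ∀ h ∈ HH q z R, §h.totient * (if h ∈ HH q z R then (mœ h : Real) * iφ h / GG q z R else 0) ^ 2 = iφ h / GG q z R ^ 2 := by
    intro h hh
    have hφ : (h.totient : Real) ≠ 0 := mod_cast (Np.2 (HH_pos hh)).ne'
    have hm : ((mœ h : Int) : Real) ^ 2 = 1 := by
      exact_mod_cast ArithmeticFunction.moebius_sq_eq_one_of_squarefree (HH_sqf hh)
    rw [if_pos hh, div_pow, mul_pow, hm]; unfold iφ; field_simp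
  rw [Me rfl this, ← sum_div, ← GG, sq]; field_simp
noncomputable def TT (q z R p : Nat) : Real := ∑ h ∈ HH q z R with R < h * p, iφ h
lemma UU_prime (hR : 1 ≤ R) (hp : p ∈ PP q z) : UU q z R p ≤ (1 / p) * TT q z R p / GG q z R ^ 2 := by
  have hG := GG_ge1 (q := q) (z := z) hR
  have pp := PP_prime hp
  rw [UU_diag (Or.inr pp), Ki]
  gcongr
  unfold TT
  rw [sum_div, ← sum_subset (s₁ := ((HH q z R).filter (·.Coprime p)).filter fun h => R < h * p) (Ln _ _)]
  · refine (Mf (g := fun h => iφ h / GG q z R ^ 2) ?_).trans (Mg ?_ ?_)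
    · intro h hh
      obtain ⟨hh, hlt⟩ := Mc.1 hh
      obtain ⟨hh, hc⟩ := Mc.1 hh
      have hφ : (h.totient : Real) ≠ 0 := mod_cast (Np.2 (HH_pos hh)).ne'
      have hm : ((mœ h : Int) : Real) ^ 2 = 1 := by
        exact_mod_cast ArithmeticFunction.moebius_sq_eq_one_of_squarefree (HH_sqf hh)
      have : ∑ d ∈ HH q z R with h ∣ d, lam q z R d * (d.gcd p) / d = ∑ d ∈ HH q z R with h ∣ d, lam q z R d / d := by
        refine Me rfl fun d hd => ?_
        obtain ⟨hd, hhd⟩ := Mc.1 hd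
        have : d.gcd p = 1 := by
          rw [← Nat.coprime_iff_gcd_eq_one, Nat.coprime_comm, pp.coprime_iff_not_dvd]
          intro hpd
          have := Ng (HH_pos hd) (hc.mul_dvd_of_dvd_of_dvd hhd hpd)
          have := (mem_HH.1 hd).2
          omega
        rw [this]; simp
      rw [this, yy, if_pos hh, div_pow, mul_pow, hm]; unfold iφ; apply le_of_eq; field_simp
    · intro h hh
      simp only [Mc] at hh ⊢
      exact ⟨hh.1.1, hh.2⟩
    · intro h _ _; exact div_nonneg (iφ_nonneg _) pv
  · intro h hh hn
    obtain ⟨hh1, hc⟩ := Mc.1 hh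
    have hle : h * p ≤ R := by
      by_contra hlt
      exact hn (Mc.2 ⟨hh, not_le.1 hlt⟩)
    have hmem : h * p ∈ HH q z R := mem_HH.2 ⟨hc.mul_dvd_of_dvd_of_dvd (mem_HH.1 hh1).1 (dvd_prod_of_mem _ hp), hle⟩
    have e1 : ∑ d ∈ HH q z R with h ∣ d, lam q z R d * (d.gcd p) / d =
        ∑ d ∈ HH q z R with h ∣ d, lam q z R d / d + (p - 1) * ∑ d ∈ HH q z R with h * p ∣ d, lam q z R d / d := by
      have : (HH q z R).filter (h * p ∣ ·) = ((HH q z R).filter (h ∣ ·)).filter (p ∣ ·) := by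
        rw [filter_filter]
        refine filter_congr fun d _ => ⟨fun hd => ⟨(Lm _ _).trans hd, (Je _ _).trans hd⟩, fun hd => hc.mul_dvd_of_dvd_of_dvd hd.1 hd.2⟩
      rw [this, Ni (p := (p ∣ ·)), mul_sum, ← Mk]
      refine Me rfl fun d _ => ?_
      split_ifs with hpd
      · rw [Nat.gcd_eq_right hpd]; ring
      · have : d.gcd p = 1 := by
          rw [← Nat.coprime_iff_gcd_eq_one, Nat.coprime_comm, pp.coprime_iff_not_dvd]; exact hpd
        rw [this]; simp
    rw [e1, yy, yy, if_pos hh1, if_pos hmem, iφ_mul hc, ArithmeticFunction.isMultiplicative_moebius.map_mul_of_coprime hc, ArithmeticFunction.moebius_apply_prime pp]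
    have : iφ p = 1 / (§p - 1) := by
      unfold iφ; rw [Nat.totient_prime pp, Nat.cast_pred pp.pos]
    have h1 : §p - 1 ≠ 0 := by
      have : 1 < §p := mod_cast pp.one_lt
      linarith
    rw [this]; push_cast
    field_simp; ring_nf
lemma nu_nonneg (q z R n : Nat) : 0 ≤ nu q z R n := sq_nonneg _
lemma nu_rough (hR : 1 ≤ R) (hn : rough q z n) : nu q z R n = 1 := by
  have : (HH q z R).filter (· ∣ n) = {1} := by
    ext d; simp only [Mc, mem_singleton]
    constructor
    · rintro ⟨hd, hdn⟩
      by_contra h1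
      obtain ⟨p, hp, hpd⟩ := Nat.exists_prime_and_dvd h1
      have : p ∣ Pi q z := hpd.trans (mem_HH.1 hd).1
      obtain ⟨r, hr, hpr⟩ := (Prime.dvd_finsetProd_iff hp.prime _).1 this
      rw [(Kj hp (PP_prime hr)).1 hpr] at hpd
      exact hn r hr (hpd.trans hdn)
    · rintro rfl; exact ⟨one_mem_HH hR, one_dvd _⟩
  unfold nu; rw [this, sum_singleton, lam_one hR]; norm_num
lemma rough_le_nu (n : Nat) (hR : 1 ≤ R) [Decidable (rough q z n)] : (if rough q z n then (1:Real) else 0) ≤ nu q z R n := by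
  split_ifs with h
  · rw [nu_rough hR h]
  · exact nu_nonneg _ _ _ _
lemma nu_sub_le (n : Nat) (hR : 1 ≤ R) [Decidable (rough q z n)] :
    nu q z R n - ∑ p ∈ PP q z, (if p ∣ n then nu q z R n else 0) ≤ (if rough q z n then (1:Real) else 0) := by
  have h0 : ∀ p ∈ PP q z, 0 ≤ (if p ∣ n then nu q z R n else 0) := by
    intro p _; split_ifs; exacts [nu_nonneg _ _ _ _, le_rfl]
  split_ifs with h
  · rw [nu_rough hR h]
    have := Nb h0
    rw [nu_rough hR h] at this; linarith
  · unfold rough at h; push Not at h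
    obtain ⟨p, hp, hpn⟩ := h
    have := Jt h0 hp
    rw [if_pos hpn] at this; linarith
lemma nu_eq (q z R n : Nat) : nu q z R n = ∑ x ∈ HH q z R ×ˢ HH q z R, lam q z R x.1 * lam q z R x.2 * (if x.1.lcm x.2 ∣ n then 1 else 0) := by
  unfold nu
  rw [sq, Ni, Kp, ← sum_product']
  refine Me rfl fun x _ => ?_
  simp only [Nat.lcm_dvd_iff]
  split_ifs <;> simp_all
noncomputable def WW (q z : Nat) : Real := ∑ h ∈ (Pi q z).divisors, iφ h
noncomputable def Tl (q z : Nat) (y : Real) : Real := ∑ h ∈ (Pi q z).divisors with y < (h : Nat), iφ h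
lemma prod_pow_phi (q z : Nat) (ε : Real) :
    ∑ h ∈ (Pi q z).divisors, §h ^ ε * iφ h = ∏ p ∈ PP q z, (1 + §p ^ ε * iφ p) := by
  let f : ArithmeticFunction Real := ⟨fun h => §h ^ ε * iφ h, by simp [iφ]⟩
  have hf : f.IsMultiplicative := by
    constructor
    · show §(1) ^ ε * iφ 1 = 1
      simp [iφ]
    · intro m n h
      show §(m * n) ^ ε * iφ (m * n) = (§m ^ ε * iφ m) * (§n ^ ε * iφ n)
      rw [iφ_mul h, Nat.cast_mul, Real.mul_rpow (Mt _) (Mt _)]; ring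
  have := hf.prodPrimeFactors_one_add_of_squarefree (Pi_sqf q z)
  rw [Pi, Nat.primeFactors_prod (fun p hp => PP_prime hp), ← Pi] at this
  exact this.symm
lemma iφ_p (hp : p.Prime) : iφ p = 1 / (§p - 1) := by
  unfold iφ; rw [Nat.totient_prime hp, Nat.cast_pred hp.pos]
lemma WW_prod (q z : Nat) : WW q z = ∏ p ∈ PP q z, (1 - (p:Real)⁻¹)⁻¹ := by
  have := prod_pow_phi q z 0
  simp only [Real.rpow_zero, one_mul] at this
  unfold WW; rw [this]
  refine prod_congr rfl fun p hp => ?_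
  have pp := PP_prime hp
  have h1 : 1 < §p := mod_cast pp.one_lt
  rw [iφ_p pp]
  have : §p - 1 ≠ 0 := li
  field_simp
  ring
lemma mertens (hz : 1 ≤ z) : ∑ p ∈ range z with p.Prime, lg p / p ≤ lg z + lg 4 := by
  have z0 : 0 < §z := mod_cast hz
  have h1 : ∑ p ∈ range z with p.Prime, lg p * §(z / p) ≤ z * lg z := by
    have : ∀ p ∈ (range z).filter Nat.Prime, lg p * §(z / p) = ∑ m ∈ range z, if p ∣ m + 1 then lg p else 0 := by
      intro p _
      rw [← Nat.card_multiples, ← Ni, Ms, Mj, mul_comm]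
    rw [Me rfl this, sum_comm]
    calc _ ≤ ∑ m ∈ range z, lg z := by
          refine Mf fun m hm => ?_
          rw [← Ni, filter_filter]
          have hm' := Md.1 hm
          calc _ ≤ ∑ p ∈ (m+1).primeFactors, lg p := by
                refine Mg ?_ fun p _ _ => Mm _
                intro p hp
                simp only [Mc, Md] at hp
                exact Nat.mem_primeFactors.2 ⟨hp.2.1, hp.2.2, om⟩
            _ = lg §(∏ p ∈ (m+1).primeFactors, p) := by
                rw [Nat.cast_prod, Real.log_prod]
                intro p hp
                exact_mod_cast (Mp hp).ne_zero
            _ ≤ _ := by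
                apply Mz
                · exact_mod_cast prod_pos fun p hp => (Mp hp).pos
                · exact_mod_cast (Ng om (Nat.prod_primeFactors_dvd (m+1))).trans om
      _ = _ := by simp
  have h2 : ∑ p ∈ range z with p.Prime, lg p ≤ lg 4 * z := by
    refine le_trans ?_ (Chebyshev.theta_le_log4_mul_x z0.le)
    unfold Chebyshev.theta
    rw [Nat.floor_natCast]
    refine Mg ?_ fun p _ _ => Mm _
    intro p hp
    simp only [Mc, Md, mem_Ioc] at hp ⊢
    exact ⟨⟨hp.2.pos, hp.1.le⟩, hp.2⟩
  have h3 : z * ∑ p ∈ range z with p.Prime, lg p / p ≤ (∑ p ∈ range z with p.Prime, lg p * §(z / p)) + ∑ p ∈ range z with p.Prime, lg p := by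
    rw [← Mk, mul_sum]
    refine Mf fun p hp => ?_
    have pp := (Mc.1 hp).2
    have p0 : 0 < §p := mod_cast pp.pos
    have : §z / p ≤ §(z / p) + 1 := by
      rw [Nj p0]
      exact_mod_cast (Nat.lt_div_mul_add pp.pos |>.le.trans (by ring_nf; rfl) : z ≤ (z / p + 1) * p)
    calc §z * (lg p / p) = lg p * (z / p) := rg
      _ ≤ lg p * (§(z / p) + 1) := by gcongr
      _ = _ := rg
  have : z * ∑ p ∈ range z with p.Prime, lg p / p ≤ z * (lg z + lg 4) := li
  exact le_of_mul_le_mul_left this z0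
lemma PP_sub (q z : Nat) : PP q z ⊆ (range z).filter Nat.Prime := by
  intro p hp; simp only [PP, Mc] at hp ⊢; exact ⟨hp.1, hp.2.1⟩
lemma mertensP (hz : 1 ≤ z) : ∑ p ∈ PP q z, lg p / p ≤ lg z + lg 4 :=
  (Mg (PP_sub q z) fun p _ _ => div_nonneg (Mm _) (Mt _)).trans (mertens hz)
lemma WW_ge {q z : Nat} (hq : 1 ≤ q) (hz : 1 ≤ z) : §q.totient / q * lg z ≤ WW q z := by
  have fac : ∀ p : Nat, p.Prime → (0:Real) < 1 - (p:Real)⁻¹ ∧ 1 - (p:Real)⁻¹ ≤ 1 := by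
    intro p pp
    have h1 : 1 < §p := mod_cast pp.one_lt
    have := inv_lt_one_of_one_lt₀ h1
    have : 0 < (p:Real)⁻¹ := pv
    constructor <;> linarith
  have htot : §q.totient / q = ∏ p ∈ q.primeFactors, (1 - (p:Real)⁻¹) := by
    have := Nat.totient_eq_mul_prod_factors q
    have h2 : §q.totient = q * ∏ p ∈ q.primeFactors, (1 - (p:Real)⁻¹) := by
      have h3 := congrArg (Rat.cast : ℚ → Real) this
      push_cast at h3; exact h3
    rw [h2]; field_simp
  have hlog : lg z ≤ ∏ p ∈ z.primesBelow, (1 - (p:Real)⁻¹)⁻¹ := by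
    let f : Nat →* Real := ⟨⟨fun n => (n:Real)⁻¹, by simp⟩, by intro a b; simp [mul_comm]⟩
    have hs := EulerProduct.summable_and_hasSum_smoothNumbers_prod_primesBelow_geometric (f := f) (by
      intro p pp
      show ‖(p:Real)⁻¹‖ < 1
      have h1 : 1 < §p := mod_cast pp.one_lt
      rw [norm_inv, Real.norm_natCast]
      exact inv_lt_one_of_one_lt₀ h1) z
    have h1 : HasSum (fun m : z.smoothNumbers => ((m:Nat):Real)⁻¹) (∏ p ∈ z.primesBelow, (1 - (p:Real)⁻¹)⁻¹) := hs.2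
    have h2 := log_add_one_le_harmonic (z - 1)
    rw [Nat.sub_add_cancel hz] at h2
    refine h2.trans ?_
    have h3 : ((harmonic (z-1) : ℚ) : Real) = ∑ i : Fin (z-1), ((i:Nat) + 1 : Real)⁻¹ := by
      rw [Fin.sum_univ_eq_sum_range (fun i => (§i+1)⁻¹)]
      simp [harmonic]
    rw [h3]
    let g : Fin (z-1) ↪ z.smoothNumbers := ⟨fun i => ⟨i + 1, Nat.mem_smoothNumbers_of_lt om (by have := i.2; omega)⟩, by
      intro a b hab
      simp only [Subtype.mk.injEq] at hab
      ext; omega⟩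
    have h4 := sum_le_hasSum (univ.map g) (fun i _ => pv) h1
    rw [sum_map] at h4
    refine le_trans (le_of_eq (Me rfl fun i _ => ?_)) h4
    show ((i:Nat) + 1 : Real)⁻¹ = (((i:Nat) + 1 : Nat) : Real)⁻¹
    push_cast; rfl
  have hle : ∏ p ∈ z.primesBelow, (1 - (p:Real)⁻¹)⁻¹ ≤ WW q z * ∏ p ∈ q.primeFactors, (1 - (p:Real)⁻¹)⁻¹ := by
    rw [WW_prod]
    have hdis : Disjoint (PP q z) q.primeFactors := by
      rw [disjoint_left]; intro p hp hp'
      exact (Mc.1 hp).2.2 (Nat.dvd_of_mem_primeFactors hp')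
    rw [← prod_union hdis]
    refine prod_le_prod_of_subset_of_one_le ?_ ?_ ?_
    · intro p hp
      rw [Nat.mem_primesBelow] at hp
      by_cases h : p ∣ q
      · exact mem_union_right _ (Nat.mem_primeFactors.2 ⟨hp.2, h, om⟩)
      · exact mem_union_left _ (Mc.2 ⟨Md.2 hp.1, hp.2, h⟩)
    · intro p hp
      exact (inv_pos.2 (fac p (Nat.mem_primesBelow.1 hp).2).1).le
    · intro p hp _
      have pp : p.Prime := by
        rcases mem_union.1 hp with h | h
        · exact PP_prime h
        · exact Mp h
      exact (one_le_inv₀ (fac p pp).1).2 (fac p pp).2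
  rw [htot]
  have hpos : 0 < ∏ p ∈ q.primeFactors, (1 - (p:Real)⁻¹) := prod_pos fun p hp => (fac p (Mp hp)).1
  rw [prod_inv_distrib (f := fun p : Nat => 1 - (p:Real)⁻¹) (s := q.primeFactors)] at hle
  calc _ ≤ (∏ p ∈ q.primeFactors, (1 - (p:Real)⁻¹)) * (WW q z * (∏ p ∈ q.primeFactors, (1 - (p:Real)⁻¹))⁻¹) := by
        gcongr; exact hlog.trans hle
    _ = WW q z := by rw [mul_left_comm, mul_inv_cancel₀ hpos.ne', mul_one]
lemma WW_pos (q z : Nat) : 0 < WW q z := by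
  refine Jg one_pos ?_
  have := Jt (f := iφ) (fun h _ => iφ_nonneg h) (Nat.one_mem_divisors.2 (Pi_ne q z))
  simpa [iφ, WW] using this
lemma Tl_le (hz : 4 ≤ z) {y : Real} (hy : 0 < y) :
    Tl q z y ≤ xp 4 * xp (-(lg y / lg z)) * WW q z := by
  have z4 : 4 ≤ §z := mod_cast hz
  have hl4 : lg 4 ≤ lg z := Mz nm z4
  have hl40 : 0 < lg 4 := Jo nm
  have hL : 0 < lg z := li
  set ε := 1 / lg z with hε
  have hε0 : 0 < ε := pv
  have h1 : Tl q z y ≤ y ^ (-ε) * ∑ h ∈ (Pi q z).divisors, §h ^ ε * iφ h := by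
    unfold Tl
    rw [mul_sum]
    refine (Mf (g := fun h : Nat => y ^ (-ε) * (§h ^ ε * iφ h)) ?_).trans (Mg (Ln _ _) ?_)
    · intro h hh
      have hh := (Mc.1 hh).2
      rw [← Nn]
      refine Ls (iφ_nonneg _) ?_
      rw [Real.rpow_neg hy.le, ← div_eq_inv_mul, one_le_div pv]
      exact Real.rpow_le_rpow hy.le hh.le hε0.le
    · intro h _ _
      have := iφ_nonneg h
      positivity
  have h2 : ∑ h ∈ (Pi q z).divisors, §h ^ ε * iφ h ≤ WW q z * xp 4 := by
    rw [prod_pow_phi, WW_prod]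
    calc _ ≤ ∏ p ∈ PP q z, ((1 - (p:Real)⁻¹)⁻¹ * xp (2 * ε * (lg p / p))) := by
          refine Ly (fun p _ => by have := iφ_nonneg p; positivity) fun p hp => ?_
          have pp := PP_prime hp
          have h1 : 1 < §p := mod_cast pp.one_lt
          have hpz : §p ≤ z := mod_cast (Md.1 (Mc.1 hp).1).le
          have hlp : 0 < lg p := Jo h1
          have hlpz : lg p ≤ lg z := Mz li hpz
          have hx : §p ^ ε ≤ 1 + 2 * (ε * lg p) := by
            rw [Real.rpow_def_of_pos li]
            have hu : lg p * ε ≤ 1 := by rw [hε, Tg, Kb hL]; exact hlpz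
            have hu0 : 0 ≤ lg p * ε := pv
            have := Real.abs_exp_sub_one_le (x := lg p * ε) (by rw [Ll hu0]; exact hu)
            rw [Ll hu0] at this
            have := (abs_le.1 this).2
            linarith
          have e1 : 1 + (1 + 2 * (ε * lg p)) * (1 / (§p - 1)) = (1 - (p:Real)⁻¹)⁻¹ * (1 + 2 * ε * (lg p / p)) := by
            have : §p - 1 ≠ 0 := li
            field_simp
            ring
          rw [iφ_p pp]
          have hinv : 0 < 1 - (p:Real)⁻¹ := by
            have := inv_lt_one_of_one_lt₀ h1; linarith
          calc _ ≤ 1 + (1 + 2 * (ε * lg p)) * (1 / (§p - 1)) := by gcongr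
            _ = _ := e1
            _ ≤ _ := by
              gcongr
              have := Real.add_one_le_exp (2 * ε * (lg p / p)); linarith
      _ = (∏ p ∈ PP q z, (1 - (p:Real)⁻¹)⁻¹) * xp (2 * ε * ∑ p ∈ PP q z, lg p / p) := by
          rw [Ks, mul_sum, Real.exp_sum]
      _ ≤ _ := by
          rw [← WW_prod]
          have := (WW_pos q z).le
          gcongr
          have hm := mertensP (q := q) (z := z) om
          calc 2 * ε * ∑ p ∈ PP q z, lg p / p ≤ 2 * ε * (2 * lg z) := by gcongr; linarith
            _ = 4 := by rw [hε]; field_simp; norm_num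
  have h3 : y ^ (-ε) = xp (-(lg y / lg z)) := by
    rw [Real.rpow_def_of_pos hy]; congr 1; rw [hε]; ring
  rw [h3] at h1
  calc _ ≤ _ := h1
    _ ≤ xp (-(lg y / lg z)) * (WW q z * xp 4) := by gcongr
    _ = _ := rg
lemma exp_big : xp (-4) ≤ 1/2 := by
  rw [Real.exp_neg]
  have := Real.add_one_le_exp (4:Real)
  rw [inv_le_comm₀ (Real.exp_pos _) nm]; linarith
lemma GG_ge (hz : 4 ≤ z) (hR : z ^ 8 ≤ R) : WW q z / 2 ≤ GG q z R := by
  have hR1 : 1 ≤ R := (Kq _ _ om).trans hR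
  have R0 : 0 < §R := mod_cast hR1
  have z1 : 1 < §z := mod_cast om
  have hs : WW q z = GG q z R + Tl q z R := by
    unfold WW GG HH Tl
    rw [← sum_filter_add_sum_filter_not (Pi q z).divisors (fun h => h ≤ R)]
    congr 2
    ext h; simp
  have ht := Tl_le (q := q) hz R0
  have hl : 8 ≤ lg R / lg z := by
    rw [Na (Jo z1)]
    have : lg (§z^8) ≤ lg R := Mz pv (mod_cast hR)
    rw [Mw] at this; exact_mod_cast this
  have : xp 4 * xp (-(lg R / lg z)) ≤ 1/2 := by
    rw [← Tj]
    exact (Real.exp_le_exp.2 li).trans exp_big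
  have hW := WW_pos q z
  nlinarith
lemma pigeon {q z I : Nat} (hz : 4 ≤ z) (hI : 1 ≤ I) :
    ∃ i, I ≤ i ∧ i < 2 * I ∧ ∑ p ∈ PP q z, (1 / §p) * TT q z (2^i) p ≤ 6 * lg z * Tl q z ((2:Real)^I / z) / I := by
  have z1 : 1 < §z := mod_cast om
  have I0 : 0 < §I := mod_cast hI
  have key : ∑ i ∈ Ico I (2 * I), ∑ p ∈ PP q z, (1 / §p) * TT q z (2^i) p ≤ ∑ i ∈ Ico I (2*I), 6 * lg z * Tl q z ((2:Real)^I / z) / I := by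
    rw [Ms, Ta, show 2 * I - I = I by omega, Mj, mul_div_cancel₀ _ I0.ne', sum_comm]
    have hT0 : 0 ≤ Tl q z ((2:Real)^I / z) := Nb fun _ _ => iφ_nonneg _
    have h1 : ∀ p ∈ PP q z, ∑ i ∈ Ico I (2*I), (1 / §p) * TT q z (2^i) p ≤ 3 * (lg p / p) * Tl q z ((2:Real)^I / z) := by
      intro p hp
      have pp := PP_prime hp
      have p0 : 0 < §p := mod_cast pp.pos
      have hpz : p < z := Md.1 (Mc.1 hp).1
      rw [← mul_sum]
      have : ∑ i ∈ Ico I (2*I), TT q z (2^i) p ≤ (Nat.clog 2 p) * Tl q z ((2:Real)^I / z) := by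
        have e1 : ∀ i ∈ Ico I (2*I), TT q z (2^i) p = ∑ h ∈ (Pi q z).divisors with ((2:Real)^I / z) < (h:Nat), if h ≤ 2^i ∧ 2^i < h * p then iφ h else 0 := by
          intro i hi
          unfold TT HH
          rw [filter_filter, ← Ni, filter_filter]
          refine Me (filter_congr fun h hh => ⟨fun hc => ⟨?_, hc⟩, fun hc => hc.2⟩) fun _ _ => rfl
          rw [div_lt_iff₀ li]
          have h2 : 2^I ≤ 2^i := Mh nm (mem_Ico.1 hi).1
          have h3 : h * p ≤ h * z := Ns _ hpz.le
          have : 2^I < h * z := om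
          exact_mod_cast this
        rw [Me rfl e1, sum_comm]
        unfold Tl; rw [mul_sum]
        refine Mf fun h hh => ?_
        rw [← Ni, Ms, Mj]
        gcongr
        · exact iφ_nonneg _
        have hsub : (Ico I (2*I)).filter (fun i => h ≤ 2^i ∧ 2^i < h * p) ⊆ Ico (Nat.clog 2 h) (Nat.clog 2 h + Nat.clog 2 p) := by
          intro i hi
          obtain ⟨_, h1, h2⟩ := Mc.1 hi
          rw [mem_Ico]
          refine ⟨(Nat.clog_le_iff_le_pow nm).2 h1, ?_⟩
          refine ((Nat.lt_clog_iff_pow_lt nm).2 h2).trans_le ?_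
          rw [Nat.clog_le_iff_le_pow nm, pow_add]
          exact Nf (Tb nm _) (Tb nm _)
        exact (Mn hsub).trans (by simp)
      have hcl : (Nat.clog 2 p : Real) ≤ 3 * lg p := by
        have hc := Nat.pow_pred_clog_lt_self (b := 2) nm pp.one_lt
        have hc1 : 1 ≤ Nat.clog 2 p := Nat.clog_pos nm pp.one_lt
        have h2 : ((2:Real)^(Nat.clog 2 p - 1)) < p := mod_cast hc
        have h3 := Real.log_lt_log pv h2
        rw [Mw, Nat.cast_sub hc1] at h3
        have h4 := Jp
        have h5 : lg 2 ≤ lg p := Mz nm (mod_cast pp.two_le)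
        push_cast at h3
        nlinarith
      calc _ ≤ (1 / §p) * ((3 * lg p) * Tl q z ((2:Real)^I / z)) := by
            refine Ma (this.trans ?_) pv
            gcongr
        _ = _ := rg
    refine (Mf h1).trans ?_
    rw [← sum_mul, ← mul_sum]
    have hm := mertensP (q := q) (z := z) om
    have hl4 : lg 4 ≤ lg z := Mz nm (mod_cast hz)
    refine Mb ?_ hT0
    linarith
  obtain ⟨i, hi, h⟩ := exists_le_of_sum_le (nonempty_Ico.2 om) key
  exact ⟨i, (mem_Ico.1 hi).1, (mem_Ico.1 hi).2, h⟩
lemma sieve_ex {q z I : Nat} (hq : 1 ≤ q) (hz : 4 ≤ z) (hI : z ^ 8 ≤ 2 ^ I) :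
    ∃ i, I ≤ i ∧ i < 2 * I ∧ ∑ p ∈ PP q z, UU q z (2^i) p ≤ 24 * xp 5 * xp (-(I * lg 2 / lg z)) * (q / q.totient) / I := by
  have z1 : 1 < §z := mod_cast om
  have hI1 : 1 ≤ I := by
    rcases Lt I with rfl | h
    · have := Nd hz 8; norm_num at this hI; omega
    · exact h
  obtain ⟨i, h1, h2, h3⟩ := pigeon (q := q) hz hI1
  refine ⟨i, h1, h2, ?_⟩
  have hL : 0 < lg z := Jo z1
  have hG := GG_ge (q := q) hz (hI.trans (Mh nm h1))
  have hW := WW_pos q z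
  have hWg := WW_ge (q := q) (z := z) hq om
  have hφ : (0:Real) < q.totient := mod_cast Np.2 hq
  have q0 : 0 < §q := mod_cast hq
  have hTl := Tl_le (q := q) hz (y := (2:Real)^I / z) pv
  have hex : xp 4 * xp (-(lg ((2:Real)^I / z) / lg z)) = xp 5 * xp (-(I * lg 2 / lg z)) := by
    rw [← Tj, ← Tj, Real.log_div pv pv, Mw]
    congr 1; field_simp; ring
  rw [hex] at hTl
  set Ex := xp 5 * xp (-(I * lg 2 / lg z)) with hEx
  have hE0 : 0 < Ex := pv
  calc _ ≤ ∑ p ∈ PP q z, (1 / §p) * TT q z (2^i) p / GG q z (2^i) ^ 2 :=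
        Mf fun p hp => UU_prime Nat.one_le_two_pow hp
    _ = (∑ p ∈ PP q z, (1 / §p) * TT q z (2^i) p) / GG q z (2^i) ^ 2 := by rw [sum_div]
    _ ≤ (6 * lg z * (Ex * WW q z) / I) / (WW q z / 2) ^ 2 := by
        gcongr
        exact h3.trans (by gcongr)
    _ = 24 * Ex / I * (lg z / WW q z) := by field_simp; norm_num
    _ ≤ 24 * Ex / I * (q / q.totient) := by
        refine Ma ?_ pv
        rw [Nx hW hφ]
        have := Ma hWg q0.le
        calc _ = q * (q.totient / q * lg z) := by field_simp
          _ ≤ _ := this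
    _ = _ := by rw [hEx]; ring
structure FW (q k : Nat) (f : Nat → Real → Complex) (w : Nat → Real) : Prop where
  nonneg : ∀ n, 0 ≤ w n
  four : ∀ x : Real, ∑ n ∈ range (q ^ k), (w n : Complex) * ee (n * x) = (q:Complex) ^ k * FF q f k x
lemma DF.FF_zero {A1 A2 : Real} {f : Nat → Real → Complex} (h : DF q A1 A2 f) (k : Nat) : FF q f k 0 = 1 := by
  unfold FF; refine prod_eq_one fun l _ => ?_
  rw [mul_zero, h.at0]
lemma FW.div {A1 A2 : Real} {f : Nat → Real → Complex} {w : Nat → Real} (hw : FW q k f w) (h : DF q A1 A2 f) (he : 0 < e) :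
    |(∑ n ∈ range (q ^ k), if e ∣ n then w n else 0) - §q ^ k / e| ≤ §q^k * (1 / e * ∑ b ∈ Ico 1 e, ‖FF q f k (b / e)‖) := by
  have e0 : (e:Complex) ≠ 0 := mod_cast he.ne'
  have h1 : ((∑ n ∈ range (q ^ k), if e ∣ n then w n else 0 : Real) : Complex) = (q:Complex)^k * (1 / e * ∑ b ∈ range e, FF q f k (b / e)) := by
    have : ∀ n ∈ range (q^k), ((if e ∣ n then w n else 0 : Real) : Complex) = ∑ b ∈ range e, 1 / e * ((w n : Complex) * ee (n * (b / e))) := by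
      intro n _
      have := orth e he n
      rw [← mul_sum, ← mul_sum]
      have e1 : ∑ b ∈ range e, ee (n * (b / e)) = ∑ a ∈ range e, ee (↑a * (((n:Int):Real) / e)) := by
        refine Me rfl fun b _ => ?_
        congr 1; push_cast; ring
      rw [e1, this]
      simp only [Int.natCast_dvd_natCast]
      split_ifs
      · field_simp
      · simp
    rw [Ja, Me rfl this, sum_comm, mul_left_comm, mul_sum, mul_sum]
    refine Me rfl fun b _ => ?_
    rw [← mul_sum, hw.four]
  have h2 : ((∑ n ∈ range (q ^ k), if e ∣ n then w n else 0 : Real) : Complex) - (q:Complex)^k / e = (q:Complex)^k * (1 / e * ∑ b ∈ Ico 1 e, FF q f k (b / e)) := by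
    rw [h1, range_eq_Ico, sum_eq_sum_Ico_succ_bot he]
    simp only [Th, zero_div, h.FF_zero]; ring
  have h3 : ‖((∑ n ∈ range (q ^ k), if e ∣ n then w n else 0 : Real) : Complex) - (q:Complex)^k / e‖ = |(∑ n ∈ range (q ^ k), if e ∣ n then w n else 0) - §q ^ k / e| := by
    rw [← Le, ← No]; push_cast; rfl
  rw [← h3, h2, norm_mul, norm_mul, norm_pow, norm_div, norm_one, Ny, Ny]
  gcongr
  exact Nq _ _
lemma tau_mono (h : a ∣ b) (hb : b ≠ 0) : a.divisors.card ≤ b.divisors.card :=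
  Mn (Nat.divisors_subset_of_dvd hb h)
lemma sieve_typeI (q : Nat) (hq : 2 ≤ q) (A1 A2 : Real) (hA : (A1 + 7) ^ 3 ≤ √q / 2) (ε : Real) (hε : 0 < ε) :
    ∀ᶠ k : Nat in atTop, ∀ f w, DF q A1 A2 f → FW q k f w → ∀ z R : Nat, 1 ≤ R → 2 ≤ z → (z * R ^ 2) ^ 4 ≤ q ^ k →
      ∑ p ∈ insert 1 (PP q z), |(∑ n ∈ range (q^k), if p ∣ n then w n * nu q z R n else 0) - §q^k * UU q z R p| ≤ §q^k * (ε / k) := by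
  filter_upwards [typeI q hq A1 A2 hA ε hε] with k hk f w hf hw z R hR hz hzR
  set H := HH q z R with hH
  let T : Finset (Nat × Nat × Nat) := insert 1 (PP q z) ×ˢ (H ×ˢ H)
  let L : Nat × Nat × Nat → Nat := fun x => x.1.lcm (x.2.1.lcm x.2.2)
  let ff : Nat → Real := fun e => 1 / e * ∑ b ∈ Ico 1 e, ‖FF q f k (b / e)‖
  have ff0 : ∀ e, 0 ≤ ff e := fun e => Mu pv (Nb fun _ _ => Mi _)
  have hpP : ∀ p ∈ insert 1 (PP q z), p ∣ Pi q z ∧ p ≤ z := by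
    intro p hp
    rcases mem_insert.1 hp with rfl | hp
    · exact ⟨one_dvd _, om⟩
    · exact ⟨dvd_prod_of_mem _ hp, (Md.1 (Mc.1 hp).1).le⟩
  have hLP : ∀ x ∈ T, L x ∣ Pi q z := by
    rintro ⟨p, a, b⟩ hx
    obtain ⟨h1, h2⟩ := Nk.1 hx
    obtain ⟨h2, h3⟩ := Nk.1 h2
    exact Js (hpP p h1).1 (Js (mem_HH.1 h2).1 (mem_HH.1 h3).1)
  have step1 : ∀ p ∈ insert 1 (PP q z), |(∑ n ∈ range (q^k), if p ∣ n then w n * nu q z R n else 0) - §q^k * UU q z R p| ≤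
      ∑ y ∈ H ×ˢ H, §q^k * ((((L (p,y)).divisors.card : Real)) ^ 2 * ff (L (p,y))) := by
    intro p hp
    have e1 : (∑ n ∈ range (q^k), if p ∣ n then w n * nu q z R n else 0) = ∑ y ∈ H ×ˢ H, lam q z R y.1 * lam q z R y.2 * ∑ n ∈ range (q^k), if L (p, y) ∣ n then w n else 0 := by
      simp_rw [mul_sum]
      rw [sum_comm]
      refine Me rfl fun n _ => ?_
      rw [nu_eq, mul_sum]
      by_cases hpn : p ∣ n
      · rw [if_pos hpn]
        refine Me rfl fun y _ => ?_
        simp only [L, Nat.lcm_dvd_iff (m := p), hpn, true_and]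
        split_ifs <;> ring
      · rw [if_neg hpn]
        symm
        refine Jk fun y _ => ?_
        have : ¬ L (p, y) ∣ n := fun h => hpn ((Ka _ _).trans h)
        rw [if_neg this, mul_zero]
    rw [e1, UU, mul_sum, ← Nh]
    refine (Jq _ _).trans (Mf fun y hy => ?_)
    have hxT : (p, y) ∈ T := Nk.2 ⟨hp, hy⟩
    have hL0 : L (p, y) ≠ 0 := fun h => Pi_ne q z (zero_dvd_iff.1 (h ▸ hLP _ hxT))
    obtain ⟨hy1, hy2⟩ := Nk.1 hy
    have hd := hw.div hf (Mr hL0)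
    have l1 := lam_le hR hy1
    have l2 := lam_le hR hy2
    have d1 : §y.1.divisors.card ≤ ((L (p,y)).divisors.card : Real) := by
      exact_mod_cast tau_mono ((Ka _ _).trans (Nw _ _)) hL0
    have d2 : §y.2.divisors.card ≤ ((L (p,y)).divisors.card : Real) := by
      exact_mod_cast tau_mono ((Nw _ _).trans (Nw _ _)) hL0
    have e2 : lam q z R y.1 * lam q z R y.2 * (∑ n ∈ range (q^k), if L (p, y) ∣ n then w n else 0) - §q^k * (lam q z R y.1 * lam q z R y.2 / (p.lcm (y.1.lcm y.2) : Nat))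
        = lam q z R y.1 * lam q z R y.2 * ((∑ n ∈ range (q^k), if L (p, y) ∣ n then w n else 0) - §q^k / (L (p,y))) := by
      simp only [L]; ring
    rw [e2, abs_mul, abs_mul]
    calc _ ≤ ((L (p,y)).divisors.card : Real) * ((L (p,y)).divisors.card : Real) * (§q^k * ff (L (p,y))) := by
          gcongr
          · exact l1.trans d1
          · exact l2.trans d2
      _ = _ := rg
  refine (Mf step1).trans ?_
  rw [← sum_product' (f := fun p y => §q^k * ((((L (p,y)).divisors.card : Real)) ^ 2 * ff (L (p,y)))), ← mul_sum]
  refine Ma ?_ pv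
  have hI : ∀ e ∈ T.image L, 1 ≤ e ∧ e ^ 4 ≤ q ^ k ∧ Squarefree e ∧ e.Coprime q := by
    intro e he
    obtain ⟨x, hx, rfl⟩ := Lp.1 he
    have hd := hLP x hx
    have hs := (Pi_sqf q z).squarefree_of_dvd hd
    refine ⟨Mr hs.ne_zero, ?_, hs, (Pi_cop q z).coprime_dvd_left hd⟩
    refine (Nd ?_ 4).trans hzR
    obtain ⟨p, a, b⟩ := x
    obtain ⟨h1, h2⟩ := Nk.1 hx
    obtain ⟨h2, h3⟩ := Nk.1 h2
    have lm : ∀ m n : Nat, 0 < m → 0 < n → m.lcm n ≤ m * n := fun m n hm hn => Ng (Nat.mul_pos hm hn) (Nat.lcm_dvd_mul m n)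
    have p0 : 0 < p := Nat.pos_of_dvd_of_pos (hpP p h1).1 (Mr (Pi_ne q z))
    calc p.lcm (a.lcm b) ≤ p * a.lcm b := lm _ _ p0 (Tn (HH_pos h2) (HH_pos h3))
      _ ≤ p * (a * b) := Ns _ (lm _ _ (HH_pos h2) (HH_pos h3))
      _ ≤ z * (R * R) := Nf (hpP p h1).2 (Nf (mem_HH.1 h2).2 (mem_HH.1 h3).2)
      _ = z * R ^ 2 := rg
  refine le_trans ?_ (hk f hf (T.image L) hI)
  rw [← sum_fiberwise_of_maps_to (s := T) (t := T.image L) (g := L) (fun x hx => mem_image_of_mem _ hx)]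
  refine Mf fun e he => ?_
  have he0 : e ≠ 0 := by have := (hI e he).1; omega
  have c1 : (T.filter (L · = e)).card ≤ e.divisors.card ^ 3 := by
    have hsub : T.filter (L · = e) ⊆ e.divisors ×ˢ (e.divisors ×ˢ e.divisors) := by
      rintro ⟨p, a, b⟩ hx
      have hx := (Mc.1 hx).2
      simp only [Nk, Jj]
      rw [← hx]
      have hL0 : L (p, a, b) ≠ 0 := hx ▸ he0
      exact ⟨⟨Ka _ _, hL0⟩, ⟨(Ka _ _).trans (Nw _ _), hL0⟩, ⟨(Nw _ _).trans (Nw _ _), hL0⟩⟩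
    refine (Mn hsub).trans (le_of_eq ?_)
    rw [card_product, card_product]; ring
  calc _ = ∑ x ∈ T.filter (L · = e), (§e.divisors.card ^ 2 * ff e) := by
        refine Me rfl fun x hx => ?_
        have hx' : L (x.1, x.2) = e := (Mc.1 hx).2
        rw [hx']
    _ = ((T.filter (L · = e)).card : Real) * (§e.divisors.card ^ 2 * ff e) := by rw [Ms, Mj]
    _ ≤ (§e.divisors.card ^ 3) * (§e.divisors.card ^ 2 * ff e) := by
        refine Mb (mod_cast c1) (Mu pv (ff0 e))
    _ = _ := by simp only [ff]; ring
open scoped Classical in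
lemma rough_diff (q : Nat) (hq : 2 ≤ q) (A1 A2 : Real) (hA : (A1 + 7) ^ 3 ≤ √q / 2) (ε : Real) (hε : 0 < ε) :
    ∀ᶠ k : Nat in atTop, ∀ f w, DF q A1 A2 f → FW q k f w → ∀ z R : Nat, 1 ≤ R → 2 ≤ z → (z * R ^ 2) ^ 4 ≤ q ^ k →
      |(∑ n ∈ range (q^k), if rough q z n then w n else 0) - §q^k * UU q z R 1| ≤ §q^k * ((∑ p ∈ PP q z, UU q z R p) + ε / k)
      ∧ 0 ≤ ∑ p ∈ PP q z, UU q z R p := by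
  filter_upwards [sieve_typeI q hq A1 A2 hA ε hε] with k hk f w hf hw z R hR hz hzR
  have hs := hk f w hf hw z R hR hz hzR
  have h1n : 1 ∉ PP q z := fun h => Nat.not_prime_one (PP_prime h)
  rw [sum_insert h1n] at hs
  simp only [one_dvd, if_true] at hs
  set S0 := ∑ n ∈ range (q^k), w n * nu q z R n with hS0
  let Sp : Nat → Real := fun p => ∑ n ∈ range (q^k), if p ∣ n then w n * nu q z R n else 0
  have hup : (∑ n ∈ range (q^k), if rough q z n then w n else 0) ≤ S0 := by
    refine Mf fun n _ => ?_
    have := Ma (rough_le_nu (q := q) (z := z) n hR) (hw.nonneg n)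
    refine le_trans (le_of_eq ?_) this
    split_ifs <;> simp
  have hlo : S0 - ∑ p ∈ PP q z, Sp p ≤ ∑ n ∈ range (q^k), if rough q z n then w n else 0 := by
    simp only [Sp]
    rw [sum_comm, hS0, ← Nh]
    refine Mf fun n _ => ?_
    have := Ma (nu_sub_le (q := q) (z := z) n hR) (hw.nonneg n)
    refine le_trans (le_of_eq ?_) (this.trans (le_of_eq ?_))
    · rw [mul_sub, mul_sum]; congr 1
      refine Me rfl fun p _ => ?_
      split_ifs <;> simp
    · split_ifs <;> simp
  have h2 : ∑ p ∈ PP q z, Sp p - §q^k * ∑ p ∈ PP q z, UU q z R p ≤ ∑ p ∈ PP q z, |Sp p - §q^k * UU q z R p| := by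
    rw [mul_sum, ← Nh]
    exact Mf fun p _ => le_abs_self _
  have h3 : 0 ≤ ∑ p ∈ PP q z, UU q z R p := by
    refine Nb fun p hp => ?_
    rw [UU_diag (Or.inr (PP_prime hp))]
    exact Mu pv (Nb fun h _ => pv)
  have h5 := abs_le.1 (le_refl |S0 - §q^k * UU q z R 1|)
  refine ⟨?_, h3⟩
  rw [abs_le, mul_add]
  constructor <;> linarith [h5.1, h5.2]
/-! sieve weights: level of distribution facts -/
lemma xe {x : Nat × Nat} (hx : x ∈ HH q z R ×ˢ HH q z R) :
    0 < x.1.lcm x.2 ∧ x.1.lcm x.2 ≤ R ^ 2 ∧ x.1.lcm x.2 ∣ Pi q z := by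
  obtain ⟨h1, h2⟩ := Nk.1 hx
  refine ⟨Tn (HH_pos h1) (HH_pos h2), ?_, Js (mem_HH.1 h1).1 (mem_HH.1 h2).1⟩
  refine (Ng (Nat.mul_pos (HH_pos h1) (HH_pos h2)) (Nat.lcm_dvd_mul _ _)).trans ?_
  rw [sq]; exact Nf (mem_HH.1 h1).2 (mem_HH.1 h2).2
lemma HH_card (q z R : Nat) : (HH q z R).card ≤ R := by
  have : HH q z R ⊆ Icc 1 R := fun h hh => mem_Icc.2 ⟨HH_pos hh, (mem_HH.1 hh).2⟩
  simpa using Mn this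
lemma GG_le (q z R : Nat) : GG q z R ≤ R := by
  have : GG q z R ≤ ∑ h ∈ HH q z R, (1:Real) := by
    refine Mf fun h hh => ?_
    unfold iφ
    refine Jd ?_ pv
    exact_mod_cast Np.2 (HH_pos hh)
  refine this.trans ?_
  rw [Ms, Mj, mul_one]; exact_mod_cast HH_card q z R
lemma L_sum (hR : 1 ≤ R) : ∑ x ∈ HH q z R ×ˢ HH q z R, |lam q z R x.1 * lam q z R x.2| ≤ §R ^ 4 := by
  have h1 : ∑ d ∈ HH q z R, |lam q z R d| ≤ §R ^ 2 := by
    calc _ ≤ ∑ d ∈ HH q z R, §R := by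
          refine Mf fun d hd => (lam_le hR hd).trans ?_
          exact_mod_cast (Nat.card_divisors_le_self d).trans (mem_HH.1 hd).2
      _ ≤ _ := by
          rw [Ms, Mj, sq]
          gcongr; exact_mod_cast HH_card q z R
  calc _ = (∑ d ∈ HH q z R, |lam q z R d|) * ∑ d ∈ HH q z R, |lam q z R d| := by
        rw [Kp, sum_product]; simp only [abs_mul]
    _ ≤ R ^ 2 * R ^ 2 := by gcongr
    _ = _ := rg
lemma L_inv (hR : 1 ≤ R) : ∑ x ∈ HH q z R ×ˢ HH q z R, lam q z R x.1 * lam q z R x.2 / (x.1.lcm x.2 : Nat) = 1 / GG q z R := by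
  rw [← UU_one hR]; unfold UU; simp only [Nat.lcm_one_left]
lemma ap_count (he : 0 < e) (h : e.Coprime r) (a B : Nat) :
    |(∑ b ∈ range B, if e ∣ a + r * b then (1:Real) else 0) - B / e| ≤ 1 := by
  obtain ⟨v, hv⟩ : ∃ v, e ∣ a + r * v := by
    obtain ⟨u, hu⟩ := Int.mod_coprime h.symm
    refine ⟨((-(a:Int) * u) % e).toNat, ?_⟩
    have he' : (0:Int) < e := mod_cast he
    have h1 : (((-(a:Int) * u) % e).toNat : Int) = (-(a:Int) * u) % e := Int.toNat_of_nonneg (Int.emod_nonneg _ he'.ne')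
    zify; rw [h1]
    have h2 : (-(a:Int) * u) % e ≡ -(a:Int) * u [ZMOD e] := Int.mod_modEq _ _
    have h3 : (a:Int) + r * ((-(a:Int) * u) % e) ≡ a + r * (-(a:Int) * u) [ZMOD e] := Int.ModEq.add_left _ (Int.ModEq.mul_left _ h2)
    have h4 : (a:Int) + r * (-(a:Int) * u) ≡ 0 [ZMOD e] := by
      have := (hu.mul_left (-(a:Int))).add_left (a:Int)
      calc (a:Int) + r * (-(a:Int) * u) = a + -a * (r * u) := rg
        _ ≡ a + -a * 1 [ZMOD e] := this
        _ = 0 := rg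
    exact Int.modEq_zero_iff_dvd.1 (h3.trans h4)
  have heq : ∀ b, e ∣ a + r * b ↔ b ≡ v [MOD e] := by
    intro b
    constructor
    · intro hb
      have h1 : r * b ≡ r * v [MOD e] := Nat.ModEq.add_left_cancel' a ((Jb.2 hb).trans (Jb.2 hv).symm)
      exact Nat.ModEq.cancel_left_of_coprime h h1
    · intro hb
      exact Jb.1 (((hb.mul_left r).add_left a).trans (Jb.2 hv))
  have h1 : (∑ b ∈ range B, if e ∣ a + r * b then (1:Real) else 0) = (Nat.count (· ≡ v [MOD e]) B : Nat) := by
    simp only [heq]; rw [Nat.count_eq_card_filter_range, ← sum_boole]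
  rw [h1, Nat.count_modEq_card B he v]
  have h2 : §(B / e) ≤ B / e := Tc
  have h3 : §B / e ≤ §(B / e) + 1 := by
    rw [Nj (mod_cast he)]
    exact_mod_cast (Nt B he).le.trans (by rw [mul_comm])
  by_cases hx : v % e < B % e
  · rw [if_pos hx]; rw [Nat.cast_add]; norm_num only [Jy, Th, add_zero]
    have h4 : §(B / e) + (v % e : Nat)/ e + 1/e ≤ B / e := by
      have : e * (B / e) + v % e + 1 ≤ B := by have := Jz B e; omega
      have h5 : §e * (B / e : Nat) + (v % e : Nat) + 1 ≤ B := mod_cast this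
      have he0 : 0 < §e := mod_cast he
      rw [Na he0]
      have : (§(B / e) + (v % e : Nat)/ e + 1/e) * e = §e * (B / e : Nat) + (v % e : Nat) + 1 := by field_simp
      rw [this]; exact h5
    rw [abs_le]; constructor <;> linarith
  · rw [if_neg hx]; rw [Nat.cast_add]; norm_num only [Jy, Th, add_zero]
    rw [abs_le]; constructor <;> linarith
lemma BT (hR : 1 ≤ R) (hr : (Pi q z).Coprime r) (a B : Nat) :
    ∑ b ∈ range B, nu q z R (a + r * b) ≤ B / GG q z R + R ^ 4 := by
  have h1 : ∑ b ∈ range B, nu q z R (a + r * b) = ∑ x ∈ HH q z R ×ˢ HH q z R, lam q z R x.1 * lam q z R x.2 * ∑ b ∈ range B, (if x.1.lcm x.2 ∣ a + r * b then (1:Real) else 0) := by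
    simp only [nu_eq, mul_sum]; rw [sum_comm]
  have h2 : §B / GG q z R = ∑ x ∈ HH q z R ×ˢ HH q z R, lam q z R x.1 * lam q z R x.2 * (§B / (x.1.lcm x.2 : Nat)) := by
    rw [div_eq_mul_one_div, ← L_inv hR, mul_sum]; refine Me rfl fun x _ => rg
  rw [h1]
  have h3 : (∑ x ∈ HH q z R ×ˢ HH q z R, lam q z R x.1 * lam q z R x.2 * ∑ b ∈ range B, (if x.1.lcm x.2 ∣ a + r * b then (1:Real) else 0)) - B / GG q z R ≤ R ^ 4 := by
    rw [h2, ← Nh]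
    refine le_trans (Mf fun x hx => ?_) (L_sum (q := q) (z := z) hR)
    rw [← mul_sub]
    refine (le_abs_self _).trans ?_
    rw [abs_mul]
    exact Kc (Nl _) (ap_count (xe hx).1 (hr.coprime_dvd_left (xe hx).2.2) a B)
  linarith
lemma Ie_eq (he : 0 < e) (N : Nat) (φ : Real) :
    ∑ m ∈ range N, (if e ∣ m then ee (m * φ) else 0) = ∑ m ∈ range ((N + e - 1) / e), ee (m * (e * φ)) := by
  rw [← Ni]
  symm
  refine sum_bij (fun m _ => e * m) ?_ ?_ ?_ ?_
  · intro m hm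
    simp only [Mc, Md, Lm, and_true]
    have := Md.1 hm
    have h1 : m + 1 ≤ (N + e - 1) / e := this
    rw [Jf he] at h1
    nlinarith [Nat.sub_add_cancel (om : 1 ≤ N + e)]
  · intro a _ b _ h; exact Kn he h
  · intro b hb
    simp only [Mc, Md] at hb
    obtain ⟨hb, c, rfl⟩ := hb
    refine ⟨c, Md.2 ?_, rfl⟩
    show c + 1 ≤ _
    rw [Jf he]
    have : (c+1)*e = e * c + e := rg
    omega
  · intro m _; push_cast; congr 1; ring
lemma Ie_le1 {e : Nat} (he : 0 < e) (N : Nat) (φ : Real) (h : 0 < nn (e * φ)) :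
    ‖∑ m ∈ range N, (if e ∣ m then ee (m * φ) else 0)‖ ≤ 1 / (2 * nn (e * φ)) := by
  rw [Ie_eq he]; exact geom_le _ _ h
lemma Ie_le2 {e : Nat} (he : 0 < e) (N : Nat) (φ : Real) :
    ‖∑ m ∈ range N, (if e ∣ m then ee (m * φ) else 0) - 1 / e * ∑ m ∈ range N, ee (m * φ)‖ ≤ 2 * πi * N * |φ| + 2 := by
  have e0 : 0 < §e := mod_cast he
  have e0c : (e:Complex) ≠ 0 := mod_cast he.ne'
  set g : Nat → Complex := fun m => (if e ∣ m then ee (m * φ) else 0) - 1 / e * ee (m * φ) with hg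
  have h0 : ∑ m ∈ range N, (if e ∣ m then ee (m * φ) else 0) - 1 / e * ∑ m ∈ range N, ee (m * φ) = ∑ m ∈ range N, g m := by
    rw [hg, Nh, mul_sum]
  rw [h0]
  have hN : N = e * (N / e) + N % e := (Jz N e).symm
  rw [show ∑ m ∈ range N, g m = ∑ m ∈ range (e * (N / e) + N % e), g m by rw [← hN], sum_range_add, sum_range_mul_add]
  have hblock : ∀ c ∈ range (N / e), ‖∑ n ∈ range e, g (n + e * c)‖ ≤ 2 * πi * e * |φ| := by
    intro c _
    have h1 : ∑ n ∈ range e, g (n + e * c) = 1 / e * ∑ n ∈ range e, (ee ((e * c : Nat) * φ) - ee ((n + e * c : Nat) * φ)) := by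
      simp only [hg]
      rw [Nh, ← mul_sum, Nh, mul_sub, Ms, Mq, Mj]
      congr 1
      rw [sum_eq_single 0]
      · simp only [zero_add, Lm, if_true]
        field_simp
      · intro b hb hb0
        rw [if_neg]
        rw [Nat.dvd_add_left (Lm _ _)]
        exact fun hd => absurd (Ng om hd) (by have := Md.1 hb; omega)
      · intro h; simp at h; omega
    rw [h1, norm_mul, norm_div, norm_one, Ny]
    calc _ ≤ 1 / §e * ∑ n ∈ range e, 2 * πi * e * |φ| := by
          refine Ma ((Nq _ _).trans (Mf fun n hn => (ee_lip _ _).trans ?_)) pv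
          rw [show §(e * c) * φ - §(n + e * c) * φ = -(n * φ) by push_cast; ring, abs_neg, abs_mul, Jn, Nn (2 * πi)]
          refine Ma (Mb ?_ (Nl _)) pv
          exact_mod_cast (Md.1 hn).le
      _ = _ := by rw [Ms, Mq, Mj]; field_simp
  have hrem : ‖∑ x ∈ range (N % e), g (e * (N / e) + x)‖ ≤ 2 := by
    have hr : N % e < e := Ti _ he
    calc _ ≤ ∑ x ∈ range (N % e), ((if x = 0 then 1 else 0) + 1 / §e) := by
          refine (Nq _ _).trans (Mf fun x hx => ?_)
          simp only [hg]
          refine (norm_sub_le _ _).trans (Nc ?_ ?_)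
          · simp only [Nat.dvd_add_right (Lm e (N / e))]
            by_cases hx0 : x = 0
            · simp [hx0, norm_ee]
            · rw [if_neg, if_neg hx0]; · simp
              exact fun hd => absurd (Ng om hd) (by have := Md.1 hx; omega)
          · rw [norm_mul, norm_ee, norm_div, norm_one, Ny, mul_one]
      _ ≤ 1 + 1 := by
          rw [Mk]
          refine Nc ?_ ?_
          · rw [sum_ite_eq']; split_ifs <;> norm_num
          · rw [Ms, Mq, Mj, Tg, Kb e0]; exact_mod_cast hr.le
      _ = 2 := nm
  refine (norm_add_le _ _).trans (Nc ?_ hrem)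
  calc _ ≤ ∑ c ∈ range (N / e), 2 * πi * e * |φ| := (Nq _ _).trans (Mf hblock)
    _ = 2 * πi * (§(N / e) * e) * |φ| := by rw [Ms, Mq, Mj]; ring
    _ ≤ _ := by
      refine Mb (Ma ?_ pv) (Nl _)
      exact_mod_cast Lz N e
noncomputable def KK (v : Nat → Real) (N : Nat) (φ : Real) : Complex := ∑ m ∈ range N, (v m : Complex) * ee (m * φ)
lemma KK_nu (q z R N : Nat) (φ : Real) : KK (nu q z R) N φ = ∑ x ∈ HH q z R ×ˢ HH q z R, ((lam q z R x.1 * lam q z R x.2 : Real):Complex) * ∑ m ∈ range N, (if x.1.lcm x.2 ∣ m then ee (m * φ) else 0) := by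
  unfold KK; simp only [mul_sum]; rw [sum_comm]
  refine Me rfl fun m _ => ?_
  rw [nu_eq, Ja, sum_mul]
  refine Me rfl fun x _ => ?_
  split_ifs <;> simp
lemma KK_le1 (hR : 1 ≤ R) (N : Nat) (φ : Real) {ρ : Real} (hρ : 0 < ρ) (h : ∀ e, 0 < e → e ≤ R ^ 2 → e ∣ Pi q z → ρ ≤ nn (e * φ)) :
    ‖KK (nu q z R) N φ‖ ≤ R ^ 4 * (1 / (2 * ρ)) := by
  rw [KK_nu]
  calc _ ≤ ∑ x ∈ HH q z R ×ˢ HH q z R, |lam q z R x.1 * lam q z R x.2| * (1 / (2 * ρ)) := by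
        refine (Nq _ _).trans (Mf fun x hx => ?_)
        rw [norm_mul, No, Le]
        have h1 := h _ (xe hx).1 (xe hx).2.1 (xe hx).2.2
        refine Ma ((Ie_le1 (xe hx).1 N φ (hρ.trans_le h1)).trans ?_) (Nl _)
        gcongr
    _ ≤ _ := by rw [← sum_mul]; exact Mb (L_sum hR) pv
lemma KK_le2 (hR : 1 ≤ R) (N : Nat) (φ : Real) :
    ‖KK (nu q z R) N φ‖ ≤ 1 / GG q z R * ‖∑ m ∈ range N, ee (m * φ)‖ + R ^ 4 * (2 * πi * N * |φ| + 2) := by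
  have h1 : KK (nu q z R) N φ = ((1 / GG q z R : Real):Complex) * ∑ m ∈ range N, ee (m * φ) + ∑ x ∈ HH q z R ×ˢ HH q z R, ((lam q z R x.1 * lam q z R x.2 : Real):Complex) * (∑ m ∈ range N, (if x.1.lcm x.2 ∣ m then ee (m * φ) else 0) - 1 / (x.1.lcm x.2 : Nat) * ∑ m ∈ range N, ee (m * φ)) := by
    rw [KK_nu, ← L_inv hR, Ja, sum_mul, ← Mk]
    refine Me rfl fun x _ => ?_
    push_cast; ring
  have hG : 0 ≤ 1 / GG q z R := by have := GG_ge1 (q := q) (z := z) hR; positivity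
  rw [h1]
  refine (norm_add_le _ _).trans (Nc ?_ ?_)
  · rw [norm_mul, No, Le, Ll hG]
  · calc _ ≤ ∑ x ∈ HH q z R ×ˢ HH q z R, |lam q z R x.1 * lam q z R x.2| * (2 * πi * N * |φ| + 2) := by
          refine (Nq _ _).trans (Mf fun x hx => ?_)
          rw [norm_mul, No, Le]
          exact Ma (Ie_le2 (xe hx).1 N φ) (Nl _)
      _ ≤ _ := by rw [← sum_mul]; exact Mb (L_sum hR) pv
noncomputable def SS (α β : Nat → Real) (P P' N : Nat) (θ : Real) : Complex :=
  ∑ d ∈ Ico P P', ∑ m ∈ range N, (α d : Complex) * β m * ee (d * m * θ)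
lemma KK_neg (v : Nat → Real) (N : Nat) (φ : Real) : ‖KK v N (-φ)‖ = ‖KK v N φ‖ := by
  have : KK v N (-φ) = starRingEnd Complex (KK v N φ) := by
    unfold KK; rw [map_sum]
    refine Me rfl fun m _ => ?_
    rw [map_mul, Ku, mul_neg, ee_neg]
  rw [this, Complex.norm_conj]
lemma sq_wsum {ι : Type*} (s : Finset ι) (v a : ι → Real) (hv : ∀ i, 0 ≤ v i) :
    (∑ i ∈ s, v i * a i) ^ 2 ≤ (∑ i ∈ s, v i) * ∑ i ∈ s, v i * a i ^ 2 := by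
  have := sum_mul_sq_le_sq_mul_sq s (fun i => √(v i)) (fun i => √(v i) * a i)
  have e1 : ∀ i, √(v i) * (√(v i) * a i) = v i * a i := fun i => by rw [← Nn, Kg (hv i)]
  have e2 : ∀ i, √(v i) ^ 2 = v i := fun i => Jm (hv i)
  simpa only [e1, e2, mul_pow] using this
lemma SS_cs (α β v : Nat → Real) (P P' N : Nat) (θ : Real) (hv : ∀ m, |β m| ≤ v m) :
    ‖SS α β P P' N θ‖ ^ 2 ≤ (∑ m ∈ range N, v m) * (2 * ∑ d ∈ Ico P P', |α d| * ∑ h ∈ range (P' - d), |α (d + h)| * ‖KK v N (h * θ)‖) := by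
  have hv0 : ∀ m, 0 ≤ v m := fun m => (Nl _).trans (hv m)
  set T : Nat → Complex := fun m => ∑ d ∈ Ico P P', (α d : Complex) * ee (d * m * θ) with hT
  have h1 : ‖SS α β P P' N θ‖ ≤ ∑ m ∈ range N, v m * ‖T m‖ := by
    unfold SS; rw [sum_comm]
    refine (Nq _ _).trans (Mf fun m _ => ?_)
    rw [show ∑ d ∈ Ico P P', (α d : Complex) * β m * ee (d * m * θ) = β m * T m by
      rw [hT, mul_sum]; exact Me rfl fun d _ => rg, norm_mul, No]
    exact Mb (hv m) (Mi _)
  have h2 : ((∑ m ∈ range N, v m * ‖T m‖ ^ 2 : Real) : Complex) = ∑ d ∈ Ico P P', ∑ d' ∈ Ico P P', (α d : Complex) * α d' * KK v N ((§d - d') * θ) := by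
    have : ∀ m, ((v m * ‖T m‖ ^ 2 : Real) : Complex) = ∑ d ∈ Ico P P', ∑ d' ∈ Ico P P', (α d : Complex) * α d' * (v m * ee (m * ((§d - d') * θ))) := by
      intro m
      push_cast
      rw [← Complex.mul_conj', hT, map_sum, Kp, mul_sum]
      refine Me rfl fun d _ => ?_
      rw [mul_sum]; refine Me rfl fun d' _ => ?_
      rw [map_mul, Ku, ← ee_neg, show §m * ((§d - d') * θ) = d * m * θ + -(d' * m * θ) by ring, ee_add]
      ring
    rw [Ja, Me rfl fun m _ => this m, sum_comm]
    refine Me rfl fun d _ => ?_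
    rw [sum_comm]; refine Me rfl fun d' _ => ?_
    rw [← mul_sum]; rfl
  set F : Nat → Nat → Real := fun d d' => |α d| * |α d'| * ‖KK v N ((§d - d') * θ)‖ with hF
  have Fsym : ∀ d d', F d d' = F d' d := by
    intro d d'; simp only [hF]
    rw [← KK_neg, show -((§d - d') * θ) = (§d' - d) * θ by ring]; ring
  have F0 : ∀ d d', 0 ≤ F d d' := fun d d' => by simp only [hF]; positivity
  have h3 : ∑ m ∈ range N, v m * ‖T m‖ ^ 2 ≤ ∑ d ∈ Ico P P', ∑ d' ∈ Ico P P', F d d' := by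
    have h0 : 0 ≤ ∑ m ∈ range N, v m * ‖T m‖ ^ 2 := Nb fun m _ => Mu (hv0 m) pv
    rw [← Ll h0, ← Le, ← No, h2]
    refine (Nq _ _).trans (Mf fun d _ => (Nq _ _).trans (Mf fun d' _ => ?_))
    rw [norm_mul, norm_mul, No, No]; exact le_rfl
  have h4 : ∑ d ∈ Ico P P', ∑ d' ∈ Ico P P', F d d' ≤ 2 * ∑ d ∈ Ico P P', ∑ d' ∈ Ico P P', if d ≤ d' then F d d' else 0 := by
    have e1 : ∑ d ∈ Ico P P', ∑ d' ∈ Ico P P', (if d ≤ d' then F d d' else 0) = ∑ d ∈ Ico P P', ∑ d' ∈ Ico P P', if d' ≤ d then F d d' else 0 := by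
      rw [sum_comm]; refine Me rfl fun d _ => Me rfl fun d' _ => ?_
      rw [Fsym]
    rw [two_mul]; nth_rewrite 2 [e1]
    rw [← Mk]
    refine Mf fun d _ => ?_
    rw [← Mk]
    refine Mf fun d' _ => ?_
    have := F0 d d'
    rcases le_total d d' with h | h
    · rw [if_pos h]; split_ifs <;> linarith
    · rw [if_pos h]; split_ifs <;> linarith
  have h5 : ∀ d ∈ Ico P P', (∑ d' ∈ Ico P P', if d ≤ d' then F d d' else 0) = |α d| * ∑ h ∈ range (P' - d), |α (d + h)| * ‖KK v N (h * θ)‖ := by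
    intro d hd
    rw [← Ni, show (Ico P P').filter (fun d' => d ≤ d') = Ico d P' by
      ext x; simp only [Mc, mem_Ico] at hd ⊢; omega, sum_Ico_eq_sum_range, mul_sum]
    refine Me rfl fun h _ => ?_
    simp only [hF]
    rw [← KK_neg, show -((§d - (d + h : Nat)) * θ) = h * θ by push_cast; ring, Nn]
  rw [Me rfl h5] at h4
  calc _ ≤ (∑ m ∈ range N, v m * ‖T m‖) ^ 2 := by gcongr
    _ ≤ (∑ m ∈ range N, v m) * ∑ m ∈ range N, v m * ‖T m‖ ^ 2 := sq_wsum _ _ _ hv0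
    _ ≤ _ := Ma (h3.trans h4) (Nb fun m _ => hv0 m)
lemma ap_g (hR : 1 ≤ R) (hr : (Pi q z).Coprime r) (d B Y : Nat) (hB : 0 < B) (hBT : §R ^ 5 ≤ B) (N A : Real) (hN : 0 ≤ N) (hA : 0 ≤ A) :
    ∑ h ∈ range (B * Y), nu q z R (d + r * h) * (if h < B then N else A / h) ≤ 2 / GG q z R * (N * B + A * (1 + lg Y)) := by
  have hG := GG_ge1 (q := q) (z := z) hR
  have hG0 : 0 < GG q z R := li
  have hT : §R ^ 4 ≤ B / GG q z R := by
    rw [Na hG0]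
    refine le_trans ?_ hBT
    rw [pow_succ _ 4]; exact Ma (GG_le q z R) pv
  rw [sum_range_mul_add]
  have h1 : ∀ c ∈ range Y, ∑ n ∈ range B, nu q z R (d + r * (n + B * c)) * (if n + B * c < B then N else A / (n + B * c : Nat)) ≤ 2 * B / GG q z R * (if c = 0 then N else A / B * (1 / c)) := by
    intro c _
    calc _ ≤ ∑ n ∈ range B, nu q z R ((d + r * (B * c)) + r * n) * (if c = 0 then N else A / B * (1 / c)) := by
          refine Mf fun n hn => ?_
          have hn' := Md.1 hn
          rw [show d + r * (n + B * c) = (d + r * (B * c)) + r * n by ring]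
          refine Ma ?_ (nu_nonneg _ _ _ _)
          by_cases hc : c = 0
          · subst hc; rw [if_pos rfl, if_pos (by simpa using hn')]
          · have : 1 ≤ c := om
            have h2 : B ≤ B * c := Li B this
            rw [if_neg hc, if_neg om, Jw, mul_one]
            have h3 : 0 < §B * c := pv
            refine Ko hA h3 ?_
            push_cast; nlinarith
      _ ≤ _ := by
          rw [← sum_mul]
          refine Mb ?_ (by split_ifs <;> positivity)
          refine (BT hR hr _ _).trans ?_
          rw [Ki]; linarith
  refine (Mf h1).trans ?_
  rw [← mul_sum]
  rcases Lt Y with rfl | hY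
  · simp; positivity
  have h2 : ∑ c ∈ range Y, (if c = 0 then N else A / B * (1 / c)) ≤ N + A / B * (1 + lg Y) := by
    rw [range_eq_Ico, sum_eq_sum_Ico_succ_bot hY, if_pos rfl]
    refine Nc le_rfl ?_
    calc _ = A / B * ∑ c ∈ Ico (0+1) Y, (1 / §c) := by
          rw [mul_sum]; refine Me rfl fun c hc => ?_
          rw [if_neg]; have := (mem_Ico.1 hc).1; omega
      _ ≤ _ := by
          refine Ma (le_trans ?_ (harm_le Y)) pv
          refine Mg ?_ fun _ _ _ => pv
          intro c; simp only [mem_Ico, mem_Icc]; omega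
  calc _ ≤ 2 * B / GG q z R * (N + A / B * (1 + lg Y)) := Ma h2 pv
    _ = _ := by field_simp
lemma KK_per (v : Nat → Real) (N : Nat) (φ : Real) (n : Int) : KK v N (n + φ) = KK v N φ := by
  unfold KK; refine Me rfl fun m _ => ?_
  rw [show §m * (n + φ) = m * φ + ((m * n : Int):Real) by push_cast; ring, ee_add_int]
lemma nn_eq {x : Real} (h : |x| < 1/2) : nn x = |x| := by
  unfold nn; rw [show round x = 0 by rw [round_eq_zero_iff]; constructor <;> linarith [abs_lt.1 h |>.1, abs_lt.1 h |>.2]]; simp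
set_option maxHeartbeats 2000000 in
lemma case3 {q z R k t P P' N r : Nat} (hq : 2 ≤ q) (hR : 1 ≤ R) (hr : (Pi q z).Coprime r) (hr0 : 0 < r)
    (b : Int) (hb : IsCoprime b (r:Int)) (θ β' : Real) (hθ : θ = b / r + β') (hβ : |β'| ≤ q ^ (t+1) / (r * q ^ k))
    (hdich : q ^ t < r ∨ §q ^ t / (r * q ^ k) < |β'|) (hPP : (P' - P) * q ≤ P) (hX1 : q ^ k ≤ N * P) (hX2 : N * P ≤ 2 * q ^ k)
    (hN : 60 * R ^ 6 * q ^ (2*t+1) ≤ N) (hP : R ^ 5 * q ^ t ≤ P) (hrq : r ≤ q ^ (t+1))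
    (α β : Nat → Real) (hα : ∀ d, |α d| ≤ nu q z R d) (hα1 : ∀ d, |α d| ≤ 1) (hβ' : ∀ m, |β m| ≤ nu q z R m) :
    ‖SS α β P P' N θ‖ ^ 2 ≤ 16 * §q ^ (2*k) * (10 + t * lg q) / (q ^ t * GG q z R ^ 4) := by
  have hG := GG_ge1 (q := q) (z := z) hR
  have hGR := GG_le q z R
  set G := GG q z R with hGd
  have hG0 : 0 < G := li
  have q0 : 0 < §q := pv
  have q2 : 2 ≤ §q := mod_cast hq
  have R1 : 1 ≤ §R := mod_cast hR
  set X : Real := §q^k with hX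
  set Qt : Real := §q^t with hQt
  have X0 : 0 < X := pv
  have Qp : 0 < Qt := pv
  have hX2' : §N * P ≤ 2 * X := by rw [hX]; exact_mod_cast hX2
  have Q1 : 1 ≤ Qt := Nz li
  clear_value G X Qt
  have hN' : 60 * §R ^ 6 * (Qt ^ 2 * q) ≤ N := by rw [hQt, ← pow_mul, ← pow_succ, mul_comm t 2]; exact_mod_cast hN
  have hP' : §R ^ 5 * Qt ≤ P := by rw [hQt]; exact_mod_cast hP
  have hR6 : 1 ≤ §R ^ 6 := Nz R1
  have Qq : 2 * Qt ≤ Qt * q := by linarith [Ma q2 Qp.le]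
  have hQ2 : 2 * Qt ≤ Qt ^ 2 * q := by linarith [Mb (Ma Q1 Qp.le) q0.le]
  have hR6Q := Ma hQ2 (pv : 0 ≤ §R ^ 6)
  have hR6q := Mb hR6 Qp.le
  have hR5 : 1 ≤ §R ^ 5 := Nz R1
  have hR5q := Ls Qp.le hR5
  have hR5q' := le_mul_of_one_le_right (pv : 0 ≤ §R ^ 5) Q1
  have N0 : 0 < §N := Jg pv hN'
  have P0 : 0 < §P := Jg pv hP'
  have hβX : |β'| * (r * X) ≤ Qt * q := by
    rw [Na pv] at hβ; rwa [pow_succ, ← hQt] at hβ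
  have hhβ : ∀ h : Nat, h < P' - P → ∀ Z : Real, 0 ≤ Z → Z * (h * |β'|) * (r * N) ≤ Z * (2 * Qt) := by
    intro h hh Z hZ
    have h1 : §h * q ≤ P := mod_cast (Mo q hh.le).trans hPP
    have h2 : h * |β'| * (r * N) * (q * X) ≤ (2 * Qt) * (q * X) := by
      calc _ = (h * q) * N * (|β'| * (r * X)) := rg
        _ ≤ P * N * (Qt * q) := by gcongr
        _ = (N * P) * (Qt * q) := rg
        _ ≤ (2 * X) * (Qt * q) := by gcongr
        _ = _ := rg
    have := Jc h2 pv
    rw [Nn]; exact Ma this hZ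
  set B : Nat := P / q ^ t + 1 with hB
  set A : Real := X / (2 * Qt) with hA
  have A0 : 0 < A := pv
  clear_value A
  set g0 : Nat → Real := fun h => if h < B then §N else A / h with hg0
  have g00 : ∀ h, 0 ≤ g0 h := fun h => by simp only [hg0]; split_ifs <;> positivity
  set E : Real := 15 * R ^ 4 * (Qt * q) with hE
  have E0 : 0 < E := pv
  clear_value E
  have key : ∀ h : Nat, h < P' - P → ‖KK (nu q z R) N (h * θ)‖ ≤ E + if r ∣ h then 1 / G * g0 (h / r) else 0 := by
    intro h hh
    have r1 : 1 ≤ §r := mod_cast hr0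
    have hrq' : §r ≤ Qt * q := by rw [hQt, ← pow_succ]; exact_mod_cast hrq
    by_cases hrh : r ∣ h
    · obtain ⟨h', rfl⟩ := hrh
      rw [if_pos (Lm _ _), Lx _ hr0]
      set φ : Real := §(r * h') * β' with hφ
      have e1 : §(r * h') * θ = ((h' * b : Int):Real) + φ := by
        rw [hφ, hθ]; push_cast; field_simp
      rw [e1, KK_per]
      have hab : |φ| = (r * h' : Nat) * |β'| := by rw [hφ, abs_mul, Jn]
      have hs : N * |φ| ≤ 2 * Qt := by
        have := hhβ _ hh 1 zero_le_one
        rw [one_mul, one_mul, ← hab] at this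
        refine le_trans ?_ this
        rw [show |φ| * (r * N) = r * (N * |φ|) by ring]; exact Ls pv r1
      refine (KK_le2 hR N φ).trans ?_
      rw [add_comm, ← hGd]
      refine Nc ?_ (Ma ?_ pv)
      · rw [hE, show 15 * §R^4 * (Qt * q) = R ^ 4 * (15 * (Qt * q)) by ring]
        refine Ma ?_ pv
        have := Real.pi_lt_d2
        have h3 : 2 * πi * N * |φ| ≤ 2 * 3.15 * (2 * Qt) := by
          rw [Nn (2 * πi)]
          refine Mx li hs pv nm
        linarith
      · simp only [hg0]
        split_ifs with hlt
        · exact geom_le_N _ _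
        · have hB' : q ^ t * h' > P := by
            have : P / q^t < h' := om
            have := (Nat.div_lt_iff_lt_mul pv).1 this
            rw [mul_comm]; exact this
          have hh2 : r * h' * q ≤ P := (Mo q hh.le).trans hPP
          rcases hdich with hd | hd
          · exfalso
            have : q ^ t * h' ≤ r * h' * q := by
              calc _ ≤ r * h' := Mo _ hd.le
                _ ≤ _ := Li _ om
            omega
          · have hh0 : 0 < §h' := by
              have : 0 < h' := by by_contra h0; have : h' = 0 := om
                                  subst this; simp at hB'
              exact_mod_cast this
            rw [div_lt_iff₀ pv] at hd
            have hlow : Qt * h' ≤ |φ| * X := by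
              rw [hab]; push_cast
              calc Qt * h' ≤ |β'| * (r * X) * h' := by gcongr
                _ = _ := rg
            have hφ0 : 0 < |φ| := by
              by_contra hc
              have : |φ| ≤ 0 := not_lt.1 hc
              linarith [mul_nonpos_of_nonpos_of_nonneg this X0.le, mul_pos Qp hh0]
            have hsmall : |φ| < 1/2 := by
              by_contra hc
              linarith [Ma (not_lt.1 hc) N0.le]
            rw [← nn_eq hsmall] at hφ0
            refine (geom_le _ _ hφ0).trans ?_
            rw [nn_eq hsmall] at hφ0 ⊢
            rw [hA, div_div, Nx pv pv]
            linarith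
    · rw [if_neg hrh, add_zero]
      have := KK_le1 (q := q) (z := z) hR N (h * θ) (ρ := 1 / (2 * r)) pv ?_
      · refine this.trans ?_
        rw [hE, show 1 / (2 * (1 / (2 * §r))) = r by field_simp]
        linarith [show 0 ≤ §R^4 * (Qt * q) by positivity, Ma hrq' (pv : 0 ≤ §R ^ 4)]
      · intro e he heR hePi
        have hnd : ¬ (r:Int) ∣ (e * h * b : Int) := by
          intro hdv
          have h1 : (r:Int) ∣ e * h := hb.symm.dvd_of_dvd_mul_right hdv
          have h2 : r ∣ e * h := mod_cast h1
          exact hrh ((hr.coprime_dvd_left hePi).symm.dvd_of_dvd_mul_left h2)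
        have h1 := nn_div _ r hr0 hnd
        have h2 := nn_lip (((e * h * b : Int):Real) / r) (e * (h * θ))
        have h3 : ((e * h * b : Int):Real) / r - e * (h * θ) = -(e * (h * β')) := by
          rw [hθ]; push_cast; field_simp; ring
        rw [h3, abs_neg, abs_mul, abs_mul, Jn, Jn] at h2
        have h4 : §e * (h * |β'|) ≤ 1 / (2 * r) := by
          have := hhβ h hh e pv
          rw [Na pv]
          have heR' : §e ≤ R ^ 2 := mod_cast heR
          have h5 : §e * (2 * Qt) * 2 ≤ N := by
            refine le_trans ?_ hN'
            have : §R^2 ≤ R^6 := Ml R1 nm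
            calc _ ≤ §R^6 * (2 * Qt) * 2 := by gcongr; exact heR'.trans this
              _ ≤ _ := by
                rw [show §R^6 * (2 * Qt) * 2 = R^6 * (4 * Qt) by ring, show 60 * §R ^ 6 * (Qt ^ 2 * q) = R^6 * (60 * (Qt ^ 2 * q)) by ring]
                refine Ma ?_ pv
                linarith
          refine Jc (a := §N) ?_ N0
          linarith
        have : 1 / §r = 1 / (2 * r) + 1 / (2 * r) := by field_simp; norm_num
        linarith
  have hB0 : 0 < B := Nat.succ_pos _
  have hBr : §P / Qt ≤ B := by
    rw [hB, Nj pv, hQt]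
    exact_mod_cast (Nt P (pv : 0 < q^t)).le.trans (by rw [mul_comm])
  have hBr2 : §B ≤ 2 * (P / Qt) := by
    rw [hB, two_mul]; rw [Nat.cast_add, Jy]
    refine Nc ?_ ?_
    · rw [hQt]; exact_mod_cast Tc (α := Real) (m := P) (n := q^t)
    · rw [Na pv]
      linarith
  have hBT : §R^5 ≤ B := by
    refine le_trans ?_ hBr; rwa [Na pv]
  set Lq := t * lg q with hLq
  have hLq0 : 0 ≤ Lq := pv
  clear_value Lq
  have inner : ∀ d ∈ Ico P P', ∑ h ∈ range (P' - d), |α (d + h)| * ‖KK (nu q z R) N (h * θ)‖ ≤ X / (Qt * G ^ 2) * (10 + Lq) := by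
    intro d hd
    have hd' := mem_Ico.1 hd
    have hlen : P' - d ≤ P' - P := om
    have h1 : ∑ h ∈ range (P' - d), |α (d + h)| * ‖KK (nu q z R) N (h * θ)‖ ≤ ∑ h ∈ range (P' - d), (E + 1 / G * (if r ∣ h then nu q z R (d + h) * g0 (h / r) else 0)) := by
      refine Mf fun h hh => ?_
      have hk := key h ((Md.1 hh).trans_le hlen)
      calc _ ≤ |α (d+h)| * (E + if r ∣ h then 1 / G * g0 (h / r) else 0) := Ma hk (Nl _)
        _ = |α (d+h)| * E + |α (d+h)| * (if r ∣ h then 1 / G * g0 (h / r) else 0) := rg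
        _ ≤ _ := by
          refine Nc (mul_le_of_le_one_left pv (hα1 _)) ?_
          split_ifs
          · rw [mul_left_comm]
            exact Ma (Mb (hα _) (g00 _)) pv
          · simp
    have h2 : ∑ h ∈ range (P' - d), (if r ∣ h then nu q z R (d + h) * g0 (h / r) else 0) ≤ ∑ h ∈ range (B * q ^ t), nu q z R (d + r * h) * g0 h := by
      rw [← Ni]
      refine le_trans (le_of_eq ?_) (Mg (s := ((range (P' - d)).filter (r ∣ ·)).image (· / r)) ?_ ?_)
      · rw [sum_image]
        · refine Me rfl fun h hh => ?_
          rw [Nat.mul_div_cancel' (Mc.1 hh).2]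
        · intro x hx y hy hxy
          have h3 := (Mc.1 hx).2; have h4 := (Mc.1 hy).2
          rw [← Nat.mul_div_cancel' h3, ← Nat.mul_div_cancel' h4]; simp only at hxy; rw [hxy]
      · intro y hy
        obtain ⟨h, hh, rfl⟩ := Lp.1 hy
        have h3 := Md.1 (Mc.1 hh).1
        have h4 : h / r ≤ h := Jl _ _
        have h5 : P < B * q ^ t := by
          rw [hB, mul_comm]; exact Nt P pv
        have h6 : P' - P ≤ (P' - P) * q := Li _ om
        exact Md.2 om
      · intro i _ _; exact Mu (nu_nonneg _ _ _ _) (g00 _)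
    have h3 := ap_g hR hr d B (q^t) hB0 hBT N A N0.le A0.le
    rw [← hGd] at h3
    have h4 : E * (P' - d : Nat) ≤ X / (Qt * G ^ 2) := by
      rw [Na pv]
      have h5 : §(P' - d) * 2 ≤ P := by
        have : (P' - d) * 2 ≤ P := (Nf hlen hq).trans hPP
        exact_mod_cast this
      have h6 : G ^ 2 ≤ R ^ 2 := by gcongr
      calc E * (P' - d : Nat) * (Qt * G ^ 2) ≤ E * (P / 2) * (Qt * R ^ 2) := by gcongr; linarith
        _ = (15 * R ^ 6 * (Qt ^ 2 * q)) * P / 2 := by rw [hE]; ring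
        _ ≤ (N / 4) * P / 2 := by gcongr; linarith
        _ ≤ X := li
    calc _ ≤ _ := h1
      _ = E * (P' - d : Nat) + 1 / G * ∑ h ∈ range (P' - d), (if r ∣ h then nu q z R (d + h) * g0 (h / r) else 0) := by
          rw [Mk, Ms, Mq, Mj, ← mul_sum]; ring
      _ ≤ X / (Qt * G^2) + 1 / G * (2 / G * (N * B + A * (1 + lg (q^t : Nat)))) := by
          refine Nc h4 (Ma (h2.trans h3) pv)
      _ ≤ X / (Qt * G^2) + 1 / G * (2 / G * (4 * X / Qt + A * (1 + Lq))) := by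
          have h7 : §N * B ≤ 4 * X / Qt := by
            calc §N * B ≤ N * (2 * (P / Qt)) := by gcongr
              _ = 2 * (N * P) / Qt := rg
              _ ≤ 2 * (2 * X) / Qt := by gcongr
              _ = _ := rg
          have h8 : lg (q^t : Nat) = Lq := by rw [Lj, Mw, hLq]
          rw [h8]; gcongr
      _ = _ := by rw [hA]; field_simp; ring
  have hsum1 : ∀ M : Nat, §R^5 ≤ M → §M / G + R ^ 4 ≤ 2 * M / G := by
    intro M hM
    have : §R^4 ≤ M / G := by
      rw [Na hG0]; refine le_trans ?_ hM; rw [pow_succ _ 4]; gcongr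
    rw [Ki]; linarith
  have hsm : ∑ m ∈ range N, nu q z R m ≤ 2 * N / G := by
    have := BT (q := q) (z := z) (r := 1) hR (Lr _) 0 N
    simp only [zero_add, one_mul, ← hGd] at this
    refine this.trans (hsum1 N ?_)
    refine le_trans ?_ hN'
    calc §R^5 ≤ R^6 := Ml R1 nm
      _ ≤ _ := by linarith [Ma Q1 (pv : 0 ≤ §R ^ 6)]
  have hsd : ∑ d ∈ Ico P P', |α d| ≤ 2 * P / G := by
    rw [sum_Ico_eq_sum_range]
    have h1 : P' - P ≤ P := (Li _ om).trans hPP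
    calc _ ≤ ∑ h ∈ range P, nu q z R (P + 1 * h) := by
          simp only [one_mul]
          exact (Mf fun h _ => hα _).trans (Mg (Kx.2 h1) fun _ _ _ => nu_nonneg _ _ _ _)
      _ ≤ _ := by
          refine (BT (q := q) (z := z) (r := 1) hR (Lr _) P P).trans ?_
          rw [← hGd]; refine hsum1 P ?_
          linarith
  calc _ ≤ _ := SS_cs α β (nu q z R) P P' N θ hβ'
    _ ≤ (2 * N / G) * (2 * ∑ d ∈ Ico P P', |α d| * (X / (Qt * G ^ 2) * (10 + Lq))) := by
        refine Mx hsm (Ma (Mf fun d hd => Ma (inner d hd) (Nl _)) nm) ?_ pv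
        positivity
    _ ≤ (2 * N / G) * (2 * ((2 * P / G) * (X / (Qt * G ^ 2) * (10 + Lq)))) := by
        rw [← sum_mul]; gcongr
    _ = 8 * (N * P) * X * (10 + Lq) / (Qt * G ^ 4) := by field_simp; ring
    _ ≤ 8 * (2 * X) * X * (10 + Lq) / (Qt * G ^ 4) := by gcongr
    _ = _ := by rw [hX, pow_mul']; ring
lemma lossy_sum {X Qt N P r : Nat} (hQ : 0 < Qt) (θ : Real) (b : Int) (hr0 : 0 < r) (hb : IsCoprime b (r:Int)) (hr1 : Qt ≤ r) (hr2 : r * Qt ≤ X)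
    (hθ : |θ - b / r| ≤ 1 / (r * r)) (hX2 : N * P ≤ 2 * X) (hN : Qt ≤ N) (hP : Qt ≤ P) :
    ∑ h ∈ range P, ‖KK (fun _ => 1) N (h * θ)‖ ≤ 22 * X * (1 + lg (2 * X)) / Qt := by
  have r0 : 0 < §r := mod_cast hr0
  have Q0 : 0 < §Qt := mod_cast hQ
  set s := (r + 1) / 2 with hs
  have hs0 : 0 < s := om
  have hrX : r ≤ X := (Li r hQ).trans hr2
  have hrX' : §r ≤ X := mod_cast hrX
  set L := 1 + lg (2 * X) with hL
  have hL1 : 1 ≤ L := by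
    have : 0 ≤ lg (2 * X) := Kz (by
      have : 1 ≤ §r := mod_cast hr0
      linarith)
    linarith
  have hblock : ∀ c ∈ range (P / s + 1), ∑ n ∈ range s, ‖KK (fun _ => 1) N ((n + s * c : Nat) * θ)‖ ≤ 2 * N + 2 * r * L := by
    intro c _
    have := spacing (range s) (fun n => §(n + s * c) * θ) (1 / (2 * r)) N pv ?_ pv ?_
      (fun n => ‖KK (fun _ => 1) N ((n + s * c : Nat) * θ)‖) ?_ ?_
    · refine this.trans ?_
      rw [one_div_one_div]
      refine Nc le_rfl (Ma ?_ pv)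
      rw [hL]
      refine Nc le_rfl (Mz pv li)
    · rw [Kb pv]
      have : 1 ≤ §r := mod_cast hr0
      linarith
    · intro i hi j hj hij
      have hi' := Md.1 hi; have hj' := Md.1 hj
      have hnd : ¬ (r:Int) ∣ ((i:Int) - j) * b := by
        intro hd
        have h1 := hb.symm.dvd_of_dvd_mul_right hd
        have h2 := Nr h1 (by rw [abs_lt]; omega)
        omega
      have h1 := nn_div _ r hr0 hnd
      have h2 := nn_lip (((((i:Int) - j) * b : Int):Real) / r) (§(i + s * c) * θ - §(j + s * c) * θ)
      have h3 : ((((i:Int) - j) * b : Int):Real) / r - (§(i + s * c) * θ - §(j + s * c) * θ) = -((§i - j) * (θ - b / r)) := by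
        push_cast; ring
      rw [h3, abs_neg, abs_mul] at h2
      have h4 : |§i - j| ≤ r / 2 := by
        have h5 : 2 * §i ≤ r := mod_cast om
        have h6 : 2 * §j ≤ r := mod_cast om
        rw [abs_le]; constructor <;> linarith [Mt (α := Real) i, Mt (α := Real) j]
      have h5 : |§i - j| * |θ - b / r| ≤ r / 2 * (1 / (r * r)) := Mx h4 hθ (Nl _) pv
      have h6 : §r / 2 * (1 / (r * r)) = 1 / (2 * r) := by field_simp
      have h7 : 1 / §r = 1 / (2 * r) + 1 / (2 * r) := by field_simp; norm_num
      linarith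
    · intro n _; unfold KK; simpa using geom_le_N N (§(n + s * c) * θ)
    · intro n _ hn; unfold KK; simpa using geom_le N (§(n + s * c) * θ) hn
  have h1 : ∑ h ∈ range P, ‖KK (fun _ => 1) N (h * θ)‖ ≤ ∑ h ∈ range (s * (P / s + 1)), ‖KK (fun _ => 1) N (h * θ)‖ :=
    Mg (Kx.2 (Nt P hs0).le) fun _ _ _ => Mi _
  rw [sum_range_mul_add] at h1
  refine (h1.trans (Mf hblock)).trans ?_
  rw [Ms, Mq, Mj]
  have h2 : §(P / s) ≤ 2 * P / r := by
    refine Tc.trans ?_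
    rw [Nx (mod_cast hs0) r0]
    have : §r ≤ 2 * s := mod_cast om
    linarith [Ma this (Mt (α := Real) P)]
  have NP : §N * P ≤ 2 * X := mod_cast hX2
  have hN' : §Qt ≤ N := mod_cast hN
  have hP' : §Qt ≤ P := mod_cast hP
  have hr2' : §r * Qt ≤ X := mod_cast hr2
  have hr1' : §Qt ≤ r := mod_cast hr1
  rw [Na Q0]; push_cast
  clear_value L
  calc (§(P / s) + 1) * (2 * N + 2 * r * L) * Qt ≤ (2 * P / r + 1) * (2 * N + 2 * r * L) * Qt := by gcongr
    _ = 4 * (N * P) * (Qt / r) + 4 * L * (Qt * P) + 2 * (N * Qt) + 2 * L * (r * Qt) := by field_simp; ring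
    _ ≤ 4 * (2 * X) * 1 + 4 * L * (2 * X) + 2 * (2 * X) + 2 * L * X := by
        have i1 : §Qt / r ≤ 1 := Jd hr1' r0.le
        have i2 := (Mb hN' (Mt (α := Real) P)).trans NP
        have i3 := (Ma hP' (Mt (α := Real) N)).trans NP
        have i4 := Mx NP i1 pv pv
        have i5 := Ma i2 (li : 0 ≤ L)
        have i6 := Ma hr2' (li : 0 ≤ L)
        linarith
    _ ≤ _ := by linarith [Ma hL1 (Mt (α := Real) X)]
open scoped Classical in
lemma lossy {q k t P P' N a : Nat} (hq : 2 ≤ q) (ht : t ≤ k) (ha : a < q ^ k) (hAp : a ∉ Ap q k t) (hPP : P' - P ≤ P) (hX2 : N * P ≤ 2 * q ^ k)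
    (hN : q ^ t ≤ N) (hP : q ^ t ≤ P) (α β : Nat → Real) (hα : ∀ d, |α d| ≤ 1) (hβ : ∀ d, |β d| ≤ 1) :
    ‖SS α β P P' N (a / q ^ k)‖ ^ 2 ≤ 88 * (§q ^ k) ^ 2 * (1 + lg (2 * q ^ k)) / q ^ t := by
  obtain ⟨u, hu1, hu2⟩ := Real.exists_rat_abs_sub_le_and_den_le ((a:Real) / q ^ k) (n := q ^ (k - t)) pv
  have hXX : §q ^ (k - t) * q ^ t = q ^ k := by rw [← pow_add]; congr 1; omega
  have hXN : q ^ (k - t) * q ^ t = q ^ k := by rw [← pow_add]; congr 1; omega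
  have huc : (u:Real) = (u.num : Real) / (u.den : Real) := mod_cast (Rat.num_div_den u).symm
  rw [huc] at hu1
  have h1 : |(a:Real) / q ^ k - u.num / u.den| ≤ 1 / (q ^ (k-t) * u.den) := by
    refine hu1.trans ?_
    push_cast; gcongr; linarith
  have hr1 : q ^ t ≤ u.den := by
    by_contra hc
    unfold Ap at hAp
    refine hAp (Mc.2 ⟨Md.2 ha, u.den, u.num, u.den_pos, (not_le.1 hc).le, ?_⟩)
    have : (u.den:Real) * a - u.num * q ^ k = (u.den * q ^ k) * ((a:Real) / q ^ k - u.num / u.den) := by field_simp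
    rw [this, abs_mul, Nu pv]
    calc _ ≤ (u.den * §q ^ k) * (1 / (q ^ (k-t) * u.den)) := Ma h1 pv
      _ = q ^ t := by rw [← hXX]; field_simp
  have hsum := lossy_sum (X := q^k) (Qt := q^t) (N := N) (P := P) pv ((a:Real) / q ^ k) u.num u.den_pos (by
      rw [Int.isCoprime_iff_gcd_eq_one]; exact u.reduced) hr1 (by rw [← hXN]; exact Mo _ hu2) (by
      refine h1.trans ?_
      have : (u.den:Real) ≤ q ^ (k-t) := mod_cast hu2
      gcongr) hX2 hN hP
  have h2 := SS_cs α β (fun _ => 1) P P' N (a / q ^ k) hβ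
  push_cast at hsum
  set Z := 22 * §q ^ k * (1 + lg (2 * q ^ k)) / q ^ t with hZ
  have hZ0 : 0 ≤ Z := (Nb fun _ _ => Mi _).trans hsum
  have NP : (N:Real) * P ≤ 2 * q ^ k := mod_cast hX2
  calc _ ≤ _ := h2
    _ ≤ (∑ m ∈ range N, (1:Real)) * (2 * ∑ d ∈ Ico P P', 1 * Z) := by
      refine Ma (Ma (Mf fun d hd => ?_) nm) pv
      refine Mx (hα d) ?_ pv nm
      have hd' := mem_Ico.1 hd
      calc _ ≤ ∑ h ∈ range (P' - d), ‖KK (fun _ => 1) N (h * (a / q ^ k))‖ := Mf fun h _ => mul_le_of_le_one_left (Mi _) (hα _)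
        _ ≤ _ := Mg (Kx.2 om) fun _ _ _ => Mi _
        _ ≤ Z := hsum
    _ = N * (2 * ((P' - P : Nat) * Z)) := by simp
    _ ≤ N * (2 * (P * Z)) := by
      have : §(P' - P) ≤ P := mod_cast hPP
      gcongr
    _ = 2 * (N * P) * Z := rg
    _ ≤ 2 * (2 * q ^ k) * Z := by gcongr
    _ = _ := by rw [hZ]; ring
lemma parsevalZ (X : Nat) (hX : 0 < X) (C : Nat → Real) : ∑ a ∈ range X, ‖∑ u ∈ range X, (C u : Complex) * ee (u * (a / X))‖ ^ 2 = X * ∑ u ∈ range X, C u ^ 2 := by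
  have : ((∑ a ∈ range X, ‖∑ u ∈ range X, (C u : Complex) * ee (u * (a / X))‖ ^ 2 : Real) : Complex) = ((X * ∑ u ∈ range X, C u ^ 2 : Real) : Complex) := by
    push_cast
    have h1 : ∀ a ∈ range X, ((‖∑ u ∈ range X, (C u : Complex) * ee (u * (a / X))‖ : Complex)) ^ 2 = ∑ u ∈ range X, ∑ u' ∈ range X, (C u : Complex) * C u' * ee (a * (((u:Int) - u' : Int) / X)) := by
      intro a _
      rw [← Complex.mul_conj', map_sum, Kp]
      refine Me rfl fun u _ => Me rfl fun u' _ => ?_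
      rw [map_mul, Ku, ← ee_neg, show §a * ((((u:Int) - u' : Int):Real) / X) = u * (a / X) + -(u' * (a / X)) by push_cast; ring, ee_add]
      ring
    rw [Me rfl h1, sum_comm, mul_sum]
    refine Me rfl fun u hu => ?_
    rw [sum_comm, sum_eq_single u]
    · rw [← mul_sum, orth X hX]; simp; ring
    · intro u' hu' hne
      rw [← mul_sum, orth X hX, if_neg, mul_zero]
      intro hd
      have := Nr hd (by have := Md.1 hu; have := Md.1 hu'; rw [abs_lt]; omega)
      omega
    · intro h; exact absurd hu h
  exact_mod_cast this
lemma mean_sq (hX : 0 < X) (hP : 1 ≤ P) (α β : Nat → Real) (hα : ∀ d, |α d| ≤ 1) (hβ : ∀ d, |β d| ≤ 1) (hβ0 : β 0 = 0)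
    (hlt : ∀ d ∈ Ico P P', ∀ m ∈ range N, d * m < 2 * X) :
    ∑ a ∈ range X, ‖SS α β P P' N (a / X)‖ ^ 2 ≤ 4 * §X ^ 2 * (1 + lg (2 * X)) ^ 4 := by
  set c : Nat → Real := fun n => ∑ d ∈ Ico P P', ∑ m ∈ range N, if d * m = n then α d * β m else 0 with hc
  have hc0 : c 0 = 0 := by
    refine Jk fun d hd => Jk fun m _ => ?_
    split_ifs with h
    · have : m = 0 := by have := (mem_Ico.1 hd).1; rcases Nat.mul_eq_zero.1 h with h | h <;> omega
      rw [this, hβ0, mul_zero]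
    · rfl
  have hcn : ∀ n, n ≠ 0 → |c n| ≤ §n.divisors.card := by
    intro n hn
    calc |c n| ≤ ∑ d ∈ Ico P P', if d ∣ n then (1:Real) else 0 := by
          refine (Jq _ _).trans (Mf fun d hd => (Jq _ _).trans ?_)
          have hd0 : 0 < d := by have := (mem_Ico.1 hd).1; omega
          calc _ ≤ ∑ m ∈ range N, if m = n / d then (if d ∣ n then (1:Real) else 0) else 0 := by
                refine Mf fun m _ => ?_
                by_cases h : d * m = n
                · rw [if_pos h, if_pos (by rw [← h, Lx _ hd0]), if_pos (h ▸ Lm _ _), abs_mul]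
                  exact mul_le_one₀ (hα d) (Nl _) (hβ m)
                · rw [if_neg h, abs_zero]; split_ifs <;> norm_num
            _ ≤ _ := by rw [sum_ite_eq']; split_ifs <;> norm_num
      _ = (((Ico P P').filter (· ∣ n)).card : Real) := by rw [sum_boole]
      _ ≤ _ := by
          refine Nat.cast_le.2 (Mn fun d hd => ?_)
          exact Jj.2 ⟨(Mc.1 hd).2, hn⟩
  have X0 : §X ≠ 0 := mod_cast hX.ne'
  have hS : ∀ a ∈ range X, SS α β P P' N (a / X) = ∑ u ∈ range X, ((c u + c (u + X) : Real) : Complex) * ee (u * (a / X)) := by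
    intro a _
    have h1 : SS α β P P' N (a / X) = ∑ n ∈ range (X + X), (c n : Complex) * ee (n * (a / X)) := by
      unfold SS; simp only [hc, Ja, sum_mul]
      symm; rw [sum_comm]; refine Me rfl fun d hd => ?_
      rw [sum_comm]; refine Me rfl fun m hm => ?_
      rw [sum_eq_single (d * m)]
      · simp
      · intro n _ hne; rw [if_neg (Ne.symm hne)]; simp
      · intro h; exact absurd (Md.2 (by have := hlt d hd m hm; omega)) h
    rw [h1, sum_range_add, ← Mk]
    refine Me rfl fun u _ => ?_
    rw [show §(X + u) * (a / X) = u * (a / X) + ((a:Int):Real) by push_cast; field_simp; ring, ee_add_int, add_comm X u]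
    push_cast; ring
  rw [Me rfl fun a ha => by rw [hS a ha], parsevalZ X hX]
  have h2 : ∑ u ∈ range X, (c u + c (u + X)) ^ 2 ≤ 2 * ∑ n ∈ range (X + X), c n ^ 2 := by
    rw [sum_range_add, ← Mk, mul_sum]
    refine Mf fun u _ => ?_
    rw [add_comm X u]; nlinarith [sq_nonneg (c u - c (u + X))]
  have h3 : ∑ n ∈ range (X + X), c n ^ 2 ≤ (2 * X) * ∑ n ∈ Icc 1 (2 * X), §n.divisors.card ^ 2 / n := by
    rw [range_eq_Ico, sum_eq_sum_Ico_succ_bot om, hc0, mul_sum, show (0:Real) ^ 2 = 0 by norm_num, zero_add]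
    calc _ ≤ ∑ n ∈ Ico (0+1) (X+X), 2 * X * (§n.divisors.card ^ 2 / n) := by
          refine Mf fun n hn => ?_
          have hn' := mem_Ico.1 hn
          have n0 : 0 < §n := mod_cast om
          have h4 : (n:Real) ≤ 2 * X := mod_cast om
          calc c n ^ 2 = |c n| ^ 2 := (sq_abs _).symm
            _ ≤ §n.divisors.card ^ 2 := by gcongr; exact hcn n om
            _ = n * (§n.divisors.card ^ 2 / n) := by field_simp
            _ ≤ _ := by gcongr
      _ ≤ _ := by
          refine Mg ?_ fun _ _ _ => pv
          intro n; simp only [mem_Ico, mem_Icc]; omega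
  have h4 := tau_sum (2 * X) 2
  calc _ ≤ §X * (2 * ((2 * X) * (1 + lg §(2 * X)) ^ (2^2))) := by
        refine Ma (h2.trans (Ma (h3.trans (Ma h4 pv)) nm)) pv
    _ = _ := by push_cast; ring
lemma dvd_pow_of (h : r ∣ q ^ n) (hr : r ≤ 2 ^ i) (hq : 0 < q) : r ∣ q ^ i := by
  have hr0 : r ≠ 0 := by rintro rfl; exact absurd (zero_dvd_iff.1 h) pv
  rw [← Nat.factorization_le_iff_dvd hr0 pv]
  intro p
  by_cases hp : r.factorization p = 0
  · rw [hp]; exact Nat.zero_le _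
  have hpr : p ∈ r.primeFactors := by rw [← Nat.support_factorization]; exact Finsupp.mem_support_iff.2 hp
  have hpp := Mp hpr
  have hpq : p ∣ q := hpp.dvd_of_dvd_pow ((Nat.dvd_of_mem_primeFactors hpr).trans h)
  have h1 : r.factorization p ≤ i := by
    have : p ^ r.factorization p ≤ 2 ^ i := (Ng (Mr hr0) (Nat.ordProj_dvd r p)).trans hr
    have h2 : 2 ^ r.factorization p ≤ 2 ^ i := (Nd hpp.two_le _).trans this
    exact (Nat.pow_le_pow_iff_right nm).1 h2
  rw [Nat.factorization_pow, Finsupp.smul_apply, smul_eq_mul]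
  have h2 : 1 ≤ q.factorization p := (hpp.dvd_iff_one_le_factorization hq.ne').1 hpq
  nlinarith
structure Rep (q k t a r : Nat) (b : Int) : Prop where
  r0 : 0 < r
  rle : r ≤ q ^ t
  cop : IsCoprime b (r:Int)
  near : |§r * a - b * q ^ k| ≤ q ^ t
lemma Rep.mono {b : Int} (h : Rep q k t a r b) (hq : 1 ≤ q) (ht : t ≤ t') : Rep q k t' a r b :=
  ⟨h.r0, h.rle.trans (Mh hq ht), h.cop, h.near.trans (Ml (mod_cast hq) ht)⟩
lemma Rep.beta {b : Int} (h : Rep q k t a r b) (hq : 1 ≤ q) :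
    |§a / q ^ k - b / r| = |§r * a - b * q ^ k| / (r * q ^ k) := by
  have hr : 0 < §r := mod_cast h.r0
  rw [eq_div_iff pv, ← Nu (pv : 0 < §r * q ^ k), ← abs_mul]
  congr 1; field_simp
lemma Rep.beta_le {b : Int} (h : Rep q k t a r b) (hq : 1 ≤ q) :
    |§a / q ^ k - b / r| ≤ q ^ t / (r * q ^ k) := by
  rw [h.beta hq]; exact Mv h.near pv
open scoped Classical in
lemma Ap_rep (h : a ∈ Ap q k t) : ∃ r b, Rep q k t a r b := by
  unfold Ap at h
  obtain ⟨ha, r, b, h1, h2, h3⟩ := Mc.1 h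
  set g := Int.gcd b r with hg
  have hg0 : 0 < g := Int.gcd_pos_of_ne_zero_right _ om
  obtain ⟨b', hb'⟩ : (g:Int) ∣ b := Int.gcd_dvd_left ..
  obtain ⟨r', hr'⟩ : g ∣ r := mod_cast (Int.gcd_dvd_right b r)
  have hgr : 1 ≤ §g := mod_cast hg0
  refine ⟨r', b', ?_, ?_, ?_, ?_⟩
  · rcases Lt r' with h | h
    · rw [h] at hr'; omega
    · exact h
  · exact le_trans (by rw [hr']; exact Nat.le_mul_of_pos_left _ hg0) h2
  · rw [Int.isCoprime_iff_gcd_eq_one]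
    have : Int.gcd b r = g * Int.gcd b' r' := by
      nth_rw 1 [hb', hr']; push_cast; rw [Int.gcd_mul_left]; simp
    exact Kn hg0 (by rw [← this, mul_one])
  · refine le_trans ?_ h3
    rw [show §r * a - b * q ^ k = g * (§r' * a - b' * q ^ k) by rw [hb', hr']; push_cast; ring, abs_mul, Jn]
    exact Ls (Nl _) hgr
open scoped Classical in
lemma rep_Ap {b : Int} (ha : a < q ^ k) (h : Rep q k t a r b) : a ∈ Ap q k t := by
  unfold Ap; exact Mc.2 ⟨Md.2 ha, r, b, h.r0, h.rle, h.near⟩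
lemma Ap_card (hq : 1 ≤ q) (ht : t ≤ k) : §(Ap q k t).card ≤ 12 * q ^ (3 * t) := by
  classical
  set Y := q ^ t with hY
  have hY1 : 1 ≤ Y := Kq _ _ hq
  have hYX : Y ≤ q ^ k := Mh hq ht
  have hsub : Ap q k t ⊆ (Icc 1 Y ×ˢ (Icc (-1:Int) (Y + 1) ×ˢ Icc (-(Y:Int)) Y)).image (fun x => ((x.2.2 + x.2.1 * (q:Int) ^ k) / (x.1:Int)).toNat) := by
    intro a ha
    obtain ⟨r, b, h⟩ := Ap_rep ha
    have haX : a < q ^ k := by unfold Ap at ha; exact Md.1 (Mc.1 ha).1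
    have hn : |(r:Int) * a - b * (q:Int) ^ k| ≤ Y := by have := h.near; rw [hY]; exact_mod_cast this
    have hn' := abs_le.1 hn
    have r0 := h.r0
    have haX' : (a:Int) < (q:Int) ^ k := mod_cast haX
    have hrY : (r:Int) ≤ Y := mod_cast h.rle
    refine Lp.2 ⟨(r, b, (r:Int) * a - b * (q:Int) ^ k), ?_, ?_⟩
    · simp only [Nk, mem_Icc]
      refine ⟨⟨r0, h.rle⟩, ⟨?_, ?_⟩, hn'.1, hn'.2⟩
      · by_contra hc
        have : b ≤ -2 := om
        nlinarith [Mu (Int.natCast_nonneg r) (Int.natCast_nonneg a)]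
      · by_contra hc
        have : (Y:Int) + 2 ≤ b := om
        nlinarith
    · simp only [sub_add_cancel]
      rw [Int.mul_ediv_cancel_left _ (mod_cast r0.ne')]; simp
  have h1 := (Mn hsub).trans card_image_le
  simp only [card_product, Nat.card_Icc, Int.card_Icc] at h1
  have h2 : (Ap q k t).card ≤ Y * ((Y + 3) * (2 * Y + 1)) := by
    refine h1.trans (Nf om (Nf om om))
  have h3 : Y * ((Y + 3) * (2 * Y + 1)) ≤ 12 * Y ^ 3 := by
    calc _ ≤ Y * ((Y + 3 * Y) * (2 * Y + Y)) := by gcongr <;> omega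
      _ = _ := rg
  calc §(Ap q k t).card ≤ §(12 * Y ^ 3) := mod_cast h2.trans h3
    _ = _ := by rw [hY]; push_cast; rw [← pow_mul, mul_comm t 3]
structure Box (q k t2 z R P P' N : Nat) (α β : Nat → Real) : Prop where
  hPP : (P' - P) * q ≤ P
  X1 : q ^ k ≤ N * P
  X2 : N * P ≤ 2 * q ^ k
  hN : q ^ t2 ≤ N
  hP : q ^ t2 ≤ P
  hR : 1 ≤ R
  R12 : R ^ 12 ≤ q ^ t2
  α1 : ∀ d, |α d| ≤ 1
  β1 : ∀ d, |β d| ≤ 1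
  αn : ∀ d, |α d| ≤ nu q z R d
  βn : ∀ d, |β d| ≤ nu q z R d
  β0 : β 0 = 0
  lt : ∀ d ∈ Ico P P', ∀ m ∈ range N, d * m < 2 * q ^ k
section
variable {q k t2 z R P P' N : Nat} {α β : Nat → Real}
lemma SS_le (α β : Nat → Real) (P P' N : Nat) (θ : Real) : ‖SS α β P P' N θ‖ ≤ (∑ d ∈ Ico P P', |α d|) * ∑ m ∈ range N, |β m| := by
  unfold SS; rw [Kp]
  refine (Nq _ _).trans (Mf fun d _ => (Nq _ _).trans (Mf fun m _ => ?_))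
  rw [norm_mul, norm_mul, norm_ee, No, No, mul_one]; rfl
lemma Box.sub (h : Box q k t2 z R P P' N α β) (hq : 1 ≤ q) : P' - P ≤ P := (Li _ hq).trans h.hPP
lemma Box.X2' (h : Box q k t2 z R P P' N α β) : §P * N ≤ 2 * q ^ k := by rw [mul_comm]; exact_mod_cast h.X2
lemma Box.triv (h : Box q k t2 z R P P' N α β) (hq : 1 ≤ q) (θ : Real) : ‖SS α β P P' N θ‖ ≤ 2 * q ^ k := by
  refine (SS_le ..).trans (le_trans (Mx (b := §P) (d := §N) ?_ ?_ (Nb fun _ _ => Nl _) pv) h.X2')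
  · refine (Kl _ _ 1 fun d _ => h.α1 d).trans ?_
    simp only [Ta, Mj, mul_one]; exact_mod_cast h.sub hq
  · refine (Kl _ _ 1 fun d _ => h.β1 d).trans ?_
    simp
lemma Box.triv_nu (h : Box q k t2 z R P P' N α β) (hq : 1 ≤ q) (θ : Real) : ‖SS α β P P' N θ‖ ≤ 8 * q ^ k / GG q z R ^ 2 := by
  have hG := GG_ge1 (q := q) (z := z) h.hR
  have hGR := GG_le q z R
  have R1 : 1 ≤ §R := mod_cast h.hR
  have key : ∀ (T a B : Nat), q ^ t2 ≤ T → B ≤ T → ∑ b ∈ range B, nu q z R (a + b) ≤ 2 * T / GG q z R := by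
    intro T a B hT hB
    have h1 := BT (q := q) (z := z) (R := R) (r := 1) h.hR (Lr _) a B
    simp only [one_mul] at h1
    refine h1.trans ?_
    rw [Na li, add_mul, div_mul_cancel₀ _ li]
    have h2 : §R ^ 12 ≤ T := mod_cast h.R12.trans hT
    have h3 : §R ^ 4 * GG q z R ≤ R ^ 12 := by
      calc _ ≤ §R ^ 4 * R := by gcongr
        _ = R ^ 5 := rg
        _ ≤ _ := Ml R1 nm
    have h4 : §B ≤ T := mod_cast hB
    linarith
  have e1 : ∑ d ∈ Ico P P', |α d| ≤ 2 * P / GG q z R := by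
    refine (Mf fun d _ => h.αn d).trans ?_
    rw [sum_Ico_eq_sum_range]; exact key P P _ h.hP (h.sub hq)
  have e2 : ∑ d ∈ range N, |β d| ≤ 2 * N / GG q z R := by
    refine (Mf fun d _ => h.βn d).trans ?_
    simpa using key N 0 N h.hN le_rfl
  refine (SS_le ..).trans ((Mx e1 e2 (Nb fun _ _ => Nl _) pv).trans ?_)
  rw [Jw, ← sq]
  exact Mv (by linarith [h.X2']) pv
lemma c1 {A1 A2 : Real} {f f' : Nat → Real → Complex} (h : DF q A1 A2 f) (h' : DF q A1 A2 f') (hq : 2 ≤ q) {b : Int} (hj : j ≤ k)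
    (hij : i1 ≤ j) (heq : ∀ l, l < j ∨ k - j ≤ l → f l = f' l) (hr : Rep q k K a r b) (hri : r ∣ q ^ i1) :
    ‖FF q f k (a / q ^ k) - FF q f' k (a / q ^ k)‖ ≤ 16 * q ^ (K + 1) / q ^ j := by
  have r1 : 1 ≤ §r := mod_cast hr.r0
  obtain ⟨c, hc⟩ := hri
  have hc' : §q ^ i1 = r * c := mod_cast hc
  have c0 : (c:Real) ≠ 0 := by rintro h0; rw [h0, mul_zero] at hc'; exact absurd hc' pv
  have h1 := h.diff h' hq k j i1 hj hij (b * c) (§a / q ^ k - b / r) heq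
  have e : (((b * c : Int)):Real) / q ^ i1 + (§a / q ^ k - b / r) = a / q ^ k := by
    rw [hc']; push_cast; rw [mul_div_mul_right _ _ c0]; ring
  rw [e] at h1
  refine h1.trans ?_
  have h2 := hr.beta_le om
  have h3 : §q ^ K / (r * q ^ k) ≤ q ^ K / q ^ k := by
    gcongr; exact Ls pv r1
  have e2 : §q ^ k = q ^ (k - j) * q ^ j := by rw [← pow_add]; congr 1; omega
  calc _ ≤ 4 * 4 * §q * q ^ (k - j) * (q ^ K / q ^ k) := by
        gcongr
        · exact Real.pi_le_four
        · exact h2.trans h3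
    _ = _ := by rw [e2]; field_simp; ring
lemma c2 {A1 A2 : Real} {f : Nat → Real → Complex} (h : DF q A1 A2 f) (hq : 2 ≤ q) {b : Int} (hs : 2 ≤ s) (hk : s ^ 4 ≤ k)
    (hr : Rep q k s a r b) (hri : ∀ n, ¬ r ∣ q ^ n) :
    ‖FF q f k (a / q ^ k)‖ ≤ (1 - 1 / (q:Real) ^ 3) ^ (s ^ 2) := by
  have q1 : 1 ≤ §q := mod_cast om
  have r0 : 0 < §r := mod_cast hr.r0
  have hs3 : s ^ 2 * s + s + 1 ≤ k := by
    have : s ^ 4 = s * (s ^ 2 * s) := rg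
    nlinarith [Nf hs (le_refl (s^2*s)), Nf (Nf hs hs) (le_refl s)]
  refine h.tiny hq k s (s ^ 2) om om _ fun l hl => ?_
  have h1 := nn_div (b * q ^ l) r hr.r0 (by
    intro hd
    refine hri l ?_
    have := (hr.cop.symm).dvd_of_dvd_mul_left hd
    exact_mod_cast this)
  have h2 := nn_lip (((b * q ^ l : Int):Real) / r) (q ^ l * (a / q ^ k))
  have h3 : |((b * q ^ l : Int):Real) / r - q ^ l * (a / q ^ k)| ≤ 1 / (2 * r) := by
    have : ((b * q ^ l : Int):Real) / r - q ^ l * (a / q ^ k) = - (q ^ l * (§a / q ^ k - b / r)) := by push_cast; ring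
    rw [this, abs_neg, abs_mul, Nu pv]
    refine (Ma (hr.beta_le om) pv).trans ?_
    rw [← Ki, Nx pv pv]
    have h4 : (q:Real) ^ l * q ^ s * 2 ≤ q ^ k := by
      calc _ ≤ (q:Real) ^ l * q ^ s * q := by gcongr; exact_mod_cast hq
        _ = q ^ (l + s + 1) := rg
        _ ≤ _ := Ml q1 om
    nlinarith
  have h5 : 1 / (2 * (q:Real) ^ s) ≤ 1 / (2 * r) := by
    gcongr; exact_mod_cast hr.rle
  have h6 : (1:Real) / r = 1 / (2 * r) + 1 / (2 * r) := by field_simp; norm_num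
  linarith
lemma c3 (h : Box q k t2 z R P P' N α β) (hq : 2 ≤ q) {b : Int} (hs : 4 * s + 14 ≤ t2) (ht : t < s) (ha : a < q ^ k)
    (hAp : a ∉ Ap q k t) (hr : Rep q k (t+1) a r b) (hri : r ∣ q ^ n) :
    ‖SS α β P P' N (a / q ^ k)‖ ^ 2 ≤ 16 * §q ^ (2*k) * (10 + t * lg q) / (q ^ t * GG q z R ^ 4) := by
  have hb : 60 * R ^ 6 * q ^ (2 * t + 1) ≤ q ^ t2 := by
    rw [← Nat.pow_le_pow_iff_left two_ne_zero]
    calc _ = 3600 * (q ^ (4 * t + 2) * R ^ 12) := rg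
      _ ≤ q ^ 12 * (q ^ (4 * t + 2) * q ^ t2) := by
        exact Nf (le_trans nm (Nd hq 12)) (Ns _ h.R12)
      _ = q ^ (4 * t + 14 + t2) := rg
      _ ≤ q ^ (t2 * 2) := Mh om om
      _ = _ := pow_mul _ _ _
  have hb2 : R ^ 5 * q ^ t ≤ 60 * R ^ 6 * q ^ (2 * t + 1) := by
    have h1 : R ^ 5 ≤ R ^ 6 := Mh h.hR nm
    exact Nf om (Mh om om)
  have hq1 : 1 ≤ q := om
  refine case3 hq h.hR (Nat.Coprime.coprime_dvd_right hri (Nat.Coprime.pow_right _ (Pi_cop q z))) hr.r0 b hr.cop _ (§a / q ^ k - b / r)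
    rg (hr.beta_le hq1) ?_ h.hPP h.X1 h.X2 (hb.trans h.hN) ((hb2.trans hb).trans h.hP) hr.rle α β h.αn h.α1 h.βn
  by_contra hc
  rw [not_or, not_lt, not_lt, hr.beta hq1] at hc
  have r0 : 0 < §r := mod_cast hr.r0
  exact hAp (rep_Ap ha ⟨hr.r0, hc.1, hr.cop, (div_le_div_iff_of_pos_right pv).1 hc.2⟩)
lemma sumApt {A1 A2 : Real} {f : Nat → Real → Complex} (h : DF q A1 A2 f) (hq : 3 ≤ q) (hA : (A1 + 7) ^ 3 ≤ √q / 2) (ht : 3 * t + 5 ≤ k) :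
    (∑ a ∈ Ap q k (t+1), ‖FF q f k (a / q ^ k)‖) / √(q ^ t) ≤ q ^ 3 / 2 * (1 / 2) ^ t := by
  have hA0 := h.A1_nonneg
  have q0 : 0 < §q := pv
  rw [Nj pv]
  refine (h.sumAp hq k (t+1) om).trans ?_
  have e : √(§q ^ t) = √q ^ t := Real.sqrt_eq_iff_mul_self_eq pv pv |>.2 (by rw [← mul_pow, Kg q0.le])
  rw [e]
  calc _ ≤ 2 * (A1 + 7) ^ (t + 2) * (q ^ 2 * (A1 + 7) ^ (2 * (t + 1))) * (A1 + 7) ^ 2 := by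
        refine le_trans ?_ (le_mul_of_one_le_right pv (Nz li))
        gcongr; linarith
    _ = 2 * q ^ 2 * ((A1 + 7) ^ 3) ^ (t + 2) := by rw [← pow_mul]; generalize A1 + 7 = y; ring
    _ ≤ 2 * q ^ 2 * (√q / 2) ^ (t + 2) := by gcongr
    _ = 2 * q ^ 2 * (√q * √q) * (1/4) * (√q ^ t * (1 / 2) ^ t) := rg
    _ = _ := by rw [Kg q0.le]; ring
end
lemma L_le (q k : Nat) (hq : 2 ≤ q) : 1 ≤ 1 + lg (2 * §q ^ k) ∧ 1 + lg (2 * §q ^ k) ≤ 2 * q * (ss k + 1) ^ 4 := by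
  have q2 : 2 ≤ §q := mod_cast hq
  have hx : (1:Real) ≤ 2 * q ^ k := by linarith [Nz (n := k) (li : 1 ≤ §q)]
  refine ⟨by linarith [Kz hx], ?_⟩
  rw [Real.log_mul nm pv, Mw]
  have h1 := Real.log_two_lt_d9
  have h2 := Real.log_le_sub_one_of_pos (li : 0 < §q)
  have h3 : §k + 1 ≤ (ss k + 1) ^ 4 := mod_cast lt_ss k
  have h4 : §k * lg q ≤ k * q := by gcongr; linarith
  have h5 : 2 * §q * (k + 1) ≤ 2 * q * (ss k + 1) ^ 4 := by gcongr
  nlinarith [Mu (Mt (α := Real) k) (Mt (α := Real) q)]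
lemma err_lim (q : Nat) (hq : 2 ≤ q) (ε : Real) (hε : 0 < ε) : ∀ᶠ k : Nat in atTop, §k ^ 2 * (48 * q ^ (3 * ss k) * (1 - 1 / §q ^ 3) ^ (ss k ^ 2) +
    (88 * k * q ^ 3 * (1 + lg (2 * q ^ k)) + 2 * q + 704 * q * (1 + lg (2 * q ^ k)) ^ 5) * (1 / 2) ^ ss k) ≤ ε := by
  have q2 : 2 ≤ §q := mod_cast hq
  set ρ : Real := 1 - 1 / §q ^ 3 with hρ
  have h8 : (1:Real) / q ^ 3 ≤ 1 / 8 := by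
    gcongr; calc (8:Real) = 2 ^ 3 := nm
      _ ≤ _ := by gcongr
  have h9 : (0:Real) < 1 / q ^ 3 := pv
  set C : Real := 88 * q ^ 3 * (2 * q) + 2 * q + 704 * q * (2 * q) ^ 5 with hC
  have L := ((lim2 8 (§q ^ 3) ρ pv li li).const_mul 48).add ((lim1 28 (1/2) nm nm).const_mul C)
  rw [mul_zero, mul_zero, add_zero] at L
  filter_upwards [(L.comp ss_tendsto).eventually (ge_mem_nhds hε)] with k hk
  refine le_trans ?_ hk
  simp only [Function.comp]
  obtain ⟨l1, l2⟩ := L_le q k hq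
  set L := 1 + lg (2 * §q ^ k)
  set y : Real := (ss k:Real) + 1 with hy
  have y1 : 1 ≤ y := by rw [hy]; linarith [Mt (α := Real) (ss k)]
  have hk4 : §k ≤ y ^ 4 := by rw [hy]; exact_mod_cast (lt_ss k).le
  have hk8 : §k ^ 2 ≤ y ^ 8 := by calc _ ≤ (y ^ 4) ^ 2 := by gcongr
                                      _ = _ := rg
  have hρ0 : 0 ≤ ρ := li
  clear_value L y ρ
  rw [mul_add]
  refine Nc ?_ ?_
  · rw [pow_mul]
    calc _ ≤ y ^ 8 * (48 * (§q ^ 3) ^ ss k * ρ ^ ss k ^ 2) := by gcongr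
      _ = _ := rg
  · have p1 : y ^ 16 ≤ y ^ 28 := Ml y1 nm
    have p2 : y ^ 8 ≤ y ^ 28 := Ml y1 nm
    calc _ ≤ y ^ 8 * ((88 * y ^ 4 * q ^ 3 * (2 * q * y ^ 4) + 2 * q + 704 * q * (2 * q * y ^ 4) ^ 5) * (1 / 2) ^ ss k) := by gcongr
      _ = (88 * q ^ 3 * (2 * q) * y ^ 16 + 2 * q * y ^ 8 + 704 * q * (2 * q) ^ 5 * y ^ 28) * (1 / 2) ^ ss k := rg
      _ ≤ (88 * q ^ 3 * (2 * q) * y ^ 28 + 2 * q * y ^ 28 + 704 * q * (2 * q) ^ 5 * y ^ 28) * (1 / 2) ^ ss k := by gcongr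
      _ = _ := by rw [hC]; ring
lemma sum_ind {s t : Finset Nat} [DecidablePred (· ∈ t)] (h : t ⊆ s) (f : Nat → Real) : ∑ i ∈ s, (if i ∈ t then f i else 0) = ∑ i ∈ t, f i := by
  classical
  rw [← Ni]; congr 1; ext i; simp only [Mc]; exact ⟨fun h => h.2, fun hi => ⟨h hi, hi⟩⟩
lemma amgm {F S lam : Real} (hF : 0 ≤ F) (hS : 0 ≤ S) (hl : 0 < lam) : F * S ≤ lam * (F * √F) + S ^ 3 / lam ^ 2 := by
  by_cases h : S ≤ lam * √F
  · have := Ma h hF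
    have : 0 ≤ S ^ 3 / lam ^ 2 := pv
    linarith
  · have h1 : F ≤ (S / lam) ^ 2 := by
      rw [← Kk pv, Na hl]; linarith
    have h2 := Mb h1 hS
    have : 0 ≤ lam * (F * √F) := pv
    have e : (S / lam) ^ 2 * S = S ^ 3 / lam ^ 2 := rg
    linarith
lemma sqrt_t (q t : Nat) (hq : 2 ≤ q) : √(10 + t * lg q) ≤ q * (t + 4) := by
  have q2 : 2 ≤ §q := mod_cast hq
  rw [Kk pv]
  have h2 := Real.log_le_sub_one_of_pos (li : 0 < §q)
  have t0 := Mt (α := Real) t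
  have h4 : §t * lg q ≤ t * q := by gcongr; linarith
  nlinarith [Mu t0 (li : 0 ≤ §q), Mu (Mu t0 t0) (sq_nonneg §q), Mu t0 (Mu (li : 0 ≤ §q) (li : 0 ≤ §q - 1))]
lemma bern (t : Nat) : (§t + 4) * (1 / 2) ^ t ≤ 4 * (3 / 4) ^ t := by
  have h := one_add_mul_le_pow (nm : (-2:Real) ≤ 1 / 2) t
  have e : ((3:Real) / 4) ^ t = (1 + 1 / 2) ^ t * (1 / 2) ^ t := by rw [← mul_pow]; norm_num
  rw [e, ← Nn]
  gcongr
  linarith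
lemma typeII_pw {α β : Nat → Real} {A1 A2 : Real} {f f' : Nat → Real → Complex} (hq : 2 ≤ q) (hf : DF q A1 A2 f) (hf' : DF q A1 A2 f')
    (hi1 : q ^ K ≤ 2 ^ i1) (hij : i1 ≤ j) (hjk : j ≤ k) (heq : ∀ l, l < j ∨ k - j ≤ l → f l = f' l) (h : Box q k t2 z R P P' N α β)
    (hKs : K ≤ s) (hs2 : 2 ≤ s) (hs4 : s ^ 4 ≤ k) (hst : 4 * s + 14 ≤ t2) (htk : t2 ≤ k) (ha : a < q ^ k) (l : Real) (hl : 0 < l) [∀ t, DecidablePred (· ∈ Ap q k t)] :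
    ‖FF q f k (a / q ^ k) - FF q f' k (a / q ^ k)‖ * ‖SS α β P P' N (a / q ^ k)‖ ≤
      (if a ∈ Ap q k K then 16 * §q ^ (K + 1) / q ^ j * (8 * q ^ k / GG q z R ^ 2) else 0) +
      (if a ∈ Ap q k s then 4 * §q ^ k * (1 - 1 / §q ^ 3) ^ (s ^ 2) else 0) +
      (∑ t ∈ Ico K t2, if a ∈ Ap q k (t+1) then (‖FF q f k (a / q ^ k)‖ + ‖FF q f' k (a / q ^ k)‖) *
        (§q ^ k * (4 * (q * (t + 4)) / GG q z R ^ 2 + if s ≤ t then 88 * (1 + lg (2 * q ^ k)) else 0) / √(q ^ t)) else 0) +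
      (l * (‖FF q f k (a / q ^ k)‖ * √‖FF q f k (a / q ^ k)‖) + l * (‖FF q f' k (a / q ^ k)‖ * √‖FF q f' k (a / q ^ k)‖) +
        2 * (‖SS α β P P' N (a / q ^ k)‖ ^ 2 * (§q ^ k * (88 * (1 + lg (2 * q ^ k))) / √(q ^ t2))) / l ^ 2) := by
  have q1 : 1 ≤ q := om
  have q2 : 2 ≤ §q := mod_cast hq
  obtain ⟨L1, -⟩ := L_le q k hq
  have D1 := norm_sub_le (FF q f k (a / q ^ k)) (FF q f' k (a / q ^ k))
  set F := ‖FF q f k (a / q ^ k)‖ with hF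
  set F' := ‖FF q f' k (a / q ^ k)‖ with hF'
  set S := ‖SS α β P P' N (a / q ^ k)‖ with hS
  have F0 : 0 ≤ F := Mi _
  have F0' : 0 ≤ F' := Mi _
  have S0 : 0 ≤ S := Mi _
  have hρ : 0 ≤ (1 - 1 / §q ^ 3) ^ (s ^ 2) := by
    refine pow_nonneg (sub_nonneg.2 (Jd (Nz li) pv)) _
  have T1 := GG_ge1 (q := q) (z := z) h.hR
  have n1 : 0 ≤ (if a ∈ Ap q k K then 16 * §q ^ (K + 1) / q ^ j * (8 * q ^ k / GG q z R ^ 2) else 0) := by split_ifs <;> positivity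
  have n2 : 0 ≤ (if a ∈ Ap q k s then 4 * §q ^ k * (1 - 1 / §q ^ 3) ^ (s ^ 2) else 0) := by split_ifs <;> positivity
  have n3 : ∀ t ∈ Ico K t2, 0 ≤ (if a ∈ Ap q k (t+1) then (F + F') * (§q ^ k * (4 * (q * (t + 4)) / GG q z R ^ 2 + if s ≤ t then 88 * (1 + lg (2 * q ^ k)) else 0) / √(q ^ t)) else 0) := by
    intro t _; split_ifs <;> positivity
  have n4 : 0 ≤ l * (F * √F) + l * (F' * √F') + 2 * (S ^ 2 * (§q ^ k * (88 * (1 + lg (2 * q ^ k))) / √(q ^ t2))) / l ^ 2 := pv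
  have n3' := Nb n3
  have sq88 : √(88 * (1 + lg (2 * §q ^ k))) ≤ 88 * (1 + lg (2 * §q ^ k)) := by
    rw [Kk pv]; nlinarith
  have hlossy : ∀ t ≤ t2, a ∉ Ap q k t → S ≤ §q ^ k * (88 * (1 + lg (2 * q ^ k))) / √(q ^ t) := by
    intro t ht hat
    have h1 := lossy hq (ht.trans htk) ha hat (h.sub q1) h.X2 ((Mh q1 ht).trans h.hN) ((Mh q1 ht).trans h.hP) α β h.α1 h.β1
    have h2 := Ld h1
    refine h2.trans ?_
    rw [Real.sqrt_div pv, show 88 * (§q ^ k) ^ 2 * (1 + lg (2 * q ^ k)) = (§q ^ k) ^ 2 * (88 * (1 + lg (2 * q ^ k))) by ring,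
      Lg pv, Tk pv]
    exact Mv (Ma sq88 pv) pv
  have fin3 : ∀ t ∈ Ico K t2, a ∈ Ap q k (t+1) → S ≤ §q ^ k * (4 * (q * (t + 4)) / GG q z R ^ 2 + if s ≤ t then 88 * (1 + lg (2 * q ^ k)) else 0) / √(q ^ t) →
      ‖FF q f k (a / q ^ k) - FF q f' k (a / q ^ k)‖ * S ≤ ∑ t ∈ Ico K t2, if a ∈ Ap q k (t+1) then (F + F') * (§q ^ k * (4 * (q * (t + 4)) / GG q z R ^ 2 + if s ≤ t then 88 * (1 + lg (2 * q ^ k)) else 0) / √(q ^ t)) else 0 := by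
    intro t ht hat hSt
    refine le_trans ?_ (Jt n3 ht)
    rw [if_pos hat]
    exact Mx D1 hSt S0 pv
  have fin2 : ∀ r b, Rep q k s a r b → (∀ n, ¬ r ∣ q ^ n) → ‖FF q f k (a / q ^ k) - FF q f' k (a / q ^ k)‖ * S ≤ if a ∈ Ap q k s then 4 * §q ^ k * (1 - 1 / §q ^ 3) ^ (s ^ 2) else 0 := by
    intro r b hr hn
    rw [if_pos (rep_Ap ha hr)]
    have h1 := c2 hf hq hs2 hs4 hr hn
    have h2 := c2 hf' hq hs2 hs4 hr hn
    calc _ ≤ ((1 - 1 / §q ^ 3) ^ (s ^ 2) + (1 - 1 / §q ^ 3) ^ (s ^ 2)) * (2 * q ^ k) :=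
          Mx (D1.trans (Nc h1 h2)) (h.triv q1 _) S0 pv
      _ = _ := rg
  clear_value F F' S
  by_cases h5 : a ∈ Ap q k t2
  swap
  · have hS5 := hlossy t2 le_rfl h5
    have h6 : S ^ 3 / l ^ 2 ≤ (S ^ 2 * (§q ^ k * (88 * (1 + lg (2 * q ^ k))) / √(q ^ t2))) / l ^ 2 := by
      rw [pow_succ]; exact Mv (Ma hS5 pv) pv
    have h7 := Mb D1 S0
    have h8 := amgm F0 S0 hl
    have h9 := amgm F0' S0 hl
    rw [add_mul] at h7
    rw [Ki (2:Real)]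
    clear fin3 fin2 hlossy n4
    linarith
  by_cases h1 : a ∈ Ap q k K
  · obtain ⟨r, b, hr⟩ := Ap_rep h1
    by_cases hri : r ∣ q ^ i1
    · have e1 := c1 hf hf' hq hjk hij heq hr hri
      have e2 := h.triv_nu q1 (a / q ^ k)
      rw [← hS] at e2
      have := Mx e1 e2 S0 pv
      rw [if_pos h1] at n1 ⊢
      linarith
    · have := fin2 r b (hr.mono q1 hKs) fun n hn => hri (dvd_pow_of hn (hr.rle.trans hi1) om)
      linarith
  · have hex : ∃ t, a ∈ Ap q k t := ⟨t2, h5⟩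
    set u := Nat.find hex with hu
    have hu1 : a ∈ Ap q k u := Nat.find_spec hex
    have hu2 : u ≤ t2 := Nat.find_min' hex h5
    have huK : K < u := by
      by_contra hc
      obtain ⟨r, b, hr⟩ := Ap_rep hu1
      exact h1 (rep_Ap ha (hr.mono q1 om))
    obtain ⟨t, ht⟩ : ∃ t, u = t + 1 := ⟨u - 1, om⟩
    have hnt : a ∉ Ap q k t := Nat.find_min hex om
    rw [ht] at hu1
    have htm : t ∈ Ico K t2 := mem_Ico.2 ⟨om, om⟩
    by_cases hts : s ≤ t
    · have := fin3 t htm hu1 (by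
        rw [if_pos hts]
        refine (hlossy t om hnt).trans (Mv (Ma ?_ pv) pv)
        have : 0 ≤ 4 * (§q * (t + 4)) / GG q z R ^ 2 := pv
        linarith)
      linarith
    · obtain ⟨r, b, hr⟩ := Ap_rep hu1
      by_cases hri : ∃ n, r ∣ q ^ n
      · obtain ⟨n, hn⟩ := hri
        have e1 := c3 h hq hst om ha hnt hr hn
        rw [← hS] at e1
        have := fin3 t htm hu1 (by
          rw [if_neg hts, add_zero]
          refine (Ld e1).trans ?_
          rw [show 16 * §q ^ (2*k) * (10 + t * lg q) / (q ^ t * GG q z R ^ 4) = (4 * q ^ k / GG q z R ^ 2) ^ 2 * ((10 + t * lg q) / q ^ t) by field_simp; ring,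
            Lg pv, Tk pv, Real.sqrt_div (by have := Kz (li : 1 ≤ §q); positivity)]
          calc _ ≤ 4 * §q ^ k / GG q z R ^ 2 * (q * (t + 4) / √(q ^ t)) :=
                Ma (Mv (sqrt_t q t hq) pv) pv
            _ = _ := rg)
        linarith
      · have := fin2 r b (hr.mono q1 om) (not_exists.1 hri)
        linarith
lemma typeII_q (q : Nat) (hq : 3 ≤ q) (A2 : Real) (hA2 : 2 ≤ A2) (N1 : Nat) (hN1 : 1 ≤ N1) (hAN : A2 ^ (16 * N1) ≤ q) (k : Nat) :
    (A2 ^ (4 * k)) * (1 / √(§q ^ (k / N1))) ≤ q * (1 / 2) ^ ss k := by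
  have q3 : 3 ≤ §q := mod_cast hq
  have h1 : A2 ^ (16 * k) ≤ §q ^ (k / N1) * q := by
    calc _ ≤ A2 ^ (16 * (N1 * (k / N1 + 1))) := by
          refine Ml li ?_
          have := Nt k (om : 0 < N1)
          omega
      _ = (A2 ^ (16 * N1)) ^ (k / N1 + 1) := by rw [← pow_mul]; congr 1; ring
      _ ≤ §q ^ (k / N1 + 1) := by gcongr
      _ = _ := pow_succ _ _
  have h2 : A2 ^ (8 * k) ≤ √(§q ^ (k / N1)) * q := by
    rw [← Real.sqrt_le_sqrt_iff pv, show A2 ^ (16 * k) = (A2 ^ (8 * k)) ^ 2 by rw [← pow_mul]; congr 1; ring, Tk pv, Lg pv] at h1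
    refine h1.trans (Ma ?_ pv)
    rw [Kk pv]; nlinarith
  have hs : ss k ≤ 4 * k := by
    have := ss_le k
    have : ss k ≤ ss k ^ 4 := Ky nm _
    omega
  have h3 : (2:Real) ^ ss k ≤ A2 ^ (4 * k) := (Ml nm hs).trans (My nm hA2 _)
  rw [one_div_pow, Tg, Tg, Nx pv pv]
  calc _ ≤ A2 ^ (4 * k) * A2 ^ (4 * k) := by gcongr
    _ = A2 ^ (8 * k) := by rw [← pow_add]; congr 1; ring
    _ ≤ _ := li
lemma typeII (q : Nat) (hq : 3 ≤ q) (A1 A2 : Real) (hA : (A1 + 7) ^ 3 ≤ √q / 2) (hA2 : 2 ≤ A2) (N1 : Nat) (hN1 : 4 ≤ N1) (hAN : A2 ^ (16 * N1) ≤ q)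
    (K j i1 : Nat) (hi1 : q ^ K ≤ 2 ^ i1) (hij : i1 ≤ j) (ε : Real) (hε : 0 < ε) :
    ∀ᶠ k : Nat in atTop, ∀ f f', DF q A1 A2 f → DF q A1 A2 f' → (∀ l, l < j ∨ k - j ≤ l → f l = f' l) →
      ∀ z R P P' N α β, Box q k (k / N1) z R P P' N α β →
      ∑ a ∈ range (q ^ k), ‖FF q f k (a / q ^ k) - FF q f' k (a / q ^ k)‖ * ‖SS α β P P' N (a / q ^ k)‖ ≤
        §q ^ k * (ε / k ^ 2 + (1536 * q ^ (4 * K + 1) / q ^ j + 64 * q ^ 4 * (3 / 4) ^ K) / GG q z R ^ 2) := by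
  classical
  filter_upwards [err_lim q om ε hε, ss_tendsto.eventually_ge_atTop (K + N1 + 8), Nm (j + 8)] with k hk hs hkj f f' hf hf' heq z R P P' N α β h
  have q3 : 3 ≤ §q := mod_cast hq
  have hss := ss_le k
  set s := ss k with hsd
  set t2 := k / N1 with ht2
  have ht2k : 4 * t2 ≤ k := by
    calc _ ≤ N1 * t2 := Mo _ hN1
      _ ≤ k := Nat.mul_div_le k N1
  have hst : 4 * s + 14 ≤ t2 := by
    rw [ht2, Jf om]
    calc (4 * s + 14) * N1 ≤ (s * s) * (s * s) := Nf (by nlinarith) (by nlinarith)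
      _ = s ^ 4 := rg
      _ ≤ k := hss
  have hq2 := typeII_q q hq A2 hA2 N1 om hAN k
  rw [← ht2, ← hsd] at hq2
  obtain ⟨L1, -⟩ := L_le q k om
  set X : Real := §q ^ k with hX
  have X0 : 0 < X := pv
  set L := 1 + lg (2 * X) with hL
  have hG := GG_ge1 (q := q) (z := z) h.hR
  set l : Real := X / A2 ^ (2 * k) with hl
  have l0 : 0 < l := pv
  have k0 : 0 < §k := mod_cast om
  have hpw := Mf fun a (ha : a ∈ range (q ^ k)) => typeII_pw om hf hf' hi1 hij (om : j ≤ k) heq h (om : K ≤ s) om hss hst om (Md.1 ha) l l0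
  rw [Mk, Mk, Mk, Mk, Mk, ← sum_div, ← mul_sum, ← mul_sum, ← mul_sum, ← sum_mul, sum_comm] at hpw
  have hsub : ∀ t, Ap q k t ⊆ range (q ^ k) := fun t => by unfold Ap; exact Ln _ _
  rw [sum_ind (hsub _), sum_ind (hsub _), Me rfl fun t _ => sum_ind (hsub (t+1)) _] at hpw
  simp only [← sum_mul, Ms, Mj, ← hX, ← hL] at hpw
  have hρ : 0 ≤ (1 - 1 / §q ^ 3) ^ (s ^ 2) := by
    refine pow_nonneg (sub_nonneg.2 (Jd (Nz li) pv)) _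
  have p1 : §(Ap q k K).card * (16 * §q ^ (K + 1) / q ^ j) * (8 * X / GG q z R ^ 2) ≤ X * (1536 * q ^ (4 * K + 1) / q ^ j / GG q z R ^ 2) := by
    rw [Nn]; refine (Mb (Ap_card om om) pv).trans (le_of_eq ?_)
    ring
  have p2 : §(Ap q k s).card * 4 * X * (1 - 1 / §q ^ 3) ^ (s ^ 2) ≤ X * (48 * q ^ (3 * s) * (1 - 1 / §q ^ 3) ^ (s ^ 2)) := by
    rw [Nn, Nn]; refine (Mb (Ap_card om om) pv).trans (le_of_eq ?_)
    ring
  have p3 : ∑ t ∈ Ico K t2, (∑ a ∈ Ap q k (t+1), (‖FF q f k (a / X)‖ + ‖FF q f' k (a / X)‖)) *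
      (X * (4 * (q * (t + 4)) / GG q z R ^ 2 + if s ≤ t then 88 * L else 0) / √(q ^ t)) ≤ X * (64 * q ^ 4 * (3 / 4) ^ K / GG q z R ^ 2 + 88 * k * q ^ 3 * L * (1 / 2) ^ s) := by
    have h1 : ∀ t ∈ Ico K t2, (∑ a ∈ Ap q k (t+1), (‖FF q f k (a / X)‖ + ‖FF q f' k (a / X)‖)) *
      (X * (4 * (q * (t + 4)) / GG q z R ^ 2 + if s ≤ t then 88 * L else 0) / √(q ^ t)) ≤ X * (16 * q ^ 4 / GG q z R ^ 2 * (3 / 4) ^ t + q ^ 3 * 88 * L * (1 / 2) ^ s) := by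
      intro t ht
      have ht' := mem_Ico.1 ht
      have i1 : (1 / 2 : Real) ^ t * (if s ≤ t then 88 * L else 0) ≤ 88 * L * (1 / 2) ^ s := by
        split_ifs with hst
        · rw [mul_comm]; exact Ma (pow_le_pow_of_le_one nm nm hst) pv
        · rw [mul_zero]; positivity
      have h2 := Nc (sumApt hf hq hA (k := k) (t := t) om) (sumApt hf' hq hA (k := k) (t := t) om)
      rw [← add_div, ← Mk, ← hX] at h2
      calc _ = (∑ a ∈ Ap q k (t+1), (‖FF q f k (a / X)‖ + ‖FF q f' k (a / X)‖)) / √(q ^ t) * (X * (4 * (q * (t + 4)) / GG q z R ^ 2 + if s ≤ t then 88 * L else 0)) := rg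
        _ ≤ _ := Mb h2 pv
        _ = X * (4 * q ^ 4 / GG q z R ^ 2 * ((t + 4) * (1 / 2) ^ t) + q ^ 3 * ((1 / 2) ^ t * if s ≤ t then 88 * L else 0)) := rg
        _ ≤ X * (4 * q ^ 4 / GG q z R ^ 2 * (4 * (3 / 4) ^ t) + q ^ 3 * (88 * L * (1 / 2) ^ s)) := by
          refine Ma (Nc (Ma (bern t) pv) (Ma i1 pv)) X0.le
        _ = _ := rg
    refine (Mf h1).trans ?_
    rw [← mul_sum, Mk, ← mul_sum, Ms, Mj, Ta]
    refine Ma (Nc ?_ ?_) X0.le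
    · have := geom_sum_Ico_le_of_lt_one (x := (3/4:Real)) (m := K) (n := t2) nm nm
      calc _ ≤ 16 * §q ^ 4 / GG q z R ^ 2 * ((3/4) ^ K / (1 - 3 / 4)) := Ma this pv
        _ = _ := rg
    · have : §(t2 - K) ≤ k := mod_cast om
      calc _ ≤ §k * (q ^ 3 * 88 * L * (1 / 2) ^ s) := Mb this pv
        _ = _ := rg
  have half : (A2 ^ k)⁻¹ ≤ (1 / 2) ^ s := by
    rw [one_div, inv_pow]
    refine inv_anti₀ pv ((Ml nm ?_).trans (My nm hA2 _))
    exact (Ky nm _).trans hss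
  have p4 : ∀ g, DF q A1 A2 g → l * ∑ a ∈ range (q ^ k), ‖FF q g k (a / X)‖ * √‖FF q g k (a / X)‖ ≤ X * (q * (1 / 2) ^ s) := by
    intro g hg
    have := hg.sum32 om k li
    calc _ ≤ l * (q * A2 ^ k) := Ma this l0.le
      _ = X * (q * (A2 ^ k)⁻¹) := by rw [hl]; field_simp; ring
      _ ≤ _ := by gcongr
  have p5 : 2 * ((∑ a ∈ range (q ^ k), ‖SS α β P P' N (a / X)‖ ^ 2) * (X * (88 * L) / √(q ^ t2))) / l ^ 2 ≤ X * (704 * q * L ^ 5 * (1 / 2) ^ s) := by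
    have := mean_sq (X := q ^ k) pv (le_trans (Kq _ _ om) h.hP) α β h.α1 h.β1 h.β0 h.lt
    rw [Lj, ← hX, ← hL] at this
    calc _ ≤ 2 * ((4 * X ^ 2 * L ^ 4) * (X * (88 * L) / √(q ^ t2))) / l ^ 2 := by
          refine Mv (Ma (Mb this pv) nm) pv
      _ = X * (704 * L ^ 5 * (A2 ^ (4 * k) * (1 / √(q ^ t2)))) := by rw [hl]; field_simp; ring
      _ ≤ X * (704 * L ^ 5 * (q * (1 / 2) ^ s)) := by gcongr
      _ = _ := rg
  have hk' : 48 * §q ^ (3 * s) * (1 - 1 / §q ^ 3) ^ s ^ 2 + (88 * k * q ^ 3 * L + 2 * q + 704 * q * L ^ 5) * (1 / 2) ^ s ≤ ε / k ^ 2 := by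
    rw [Na pv, mul_comm]; exact hk
  have hk2 := Ma hk' X0.le
  have q4 := p4 f hf
  have q5 := p4 f' hf'
  refine hpw.trans ((Nc (Nc (Nc p1 p2) p3) (Nc (Nc q4 q5) p5)).trans ?_)
  rw [mul_add X (ε / k ^ 2)]
  refine le_trans (le_of_eq ?_) (add_le_add_left hk2 _)
  ring
noncomputable def gE (q : Nat) (E : Nat → Finset Nat) (l c : Nat) : Real := if c ∈ E l then q / (E l).card else 0
noncomputable def wE (q : Nat) (E : Nat → Finset Nat) (k n : Nat) : Real := dw q (gE q E) k n
lemma gE_nonneg (q : Nat) (E : Nat → Finset Nat) (l c : Nat) : 0 ≤ gE q E l c := by unfold gE; split_ifs <;> positivity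
lemma wE_FW (q : Nat) (hq : 0 < q) (E : Nat → Finset Nat) (hE : ∀ l, E l ⊆ range q) (k : Nat) : FW q k (fun l => af (E l)) (wE q E k) := by
  refine ⟨fun n => by unfold wE dw; exact Lf fun l _ => gE_nonneg .., fun x => ?_⟩
  unfold wE; rw [dw_fourier q hq]
  congr 2; ext l y
  unfold df af gE
  have q0 : (q:Complex) ≠ 0 := mod_cast hq.ne'
  rw [← sum_subset (hE l) (fun c _ hc => by rw [if_neg hc]; simp), mul_sum, mul_sum]
  refine Me rfl fun c hc => ?_
  rw [if_pos hc]; push_cast; field_simp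
lemma wE_mod (q : Nat) (E : Nat → Finset Nat) (k n : Nat) : wE q E k (n % q ^ k) = wE q E k n := by
  unfold wE dw
  refine prod_congr rfl fun l hl => ?_
  congr 1
  have hl := Md.1 hl
  obtain ⟨i, rfl⟩ : ∃ i, k = l + (i + 1) := ⟨k - l - 1, om⟩
  rw [pow_add, Nat.mod_mul_right_div_self, pow_succ', Nat.mod_mul_right_mod]
lemma wE_zero {E : Nat → Finset Nat} (hl : l < k) (h : n / q ^ l % q ∉ E l) : wE q E k n = 0 := by
  unfold wE dw; refine prod_eq_zero (Md.2 hl) ?_; unfold gE; rw [if_neg h]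
lemma fw_inv (hq : 0 < q) {f f' : Nat → Real → Complex} {w w' : Nat → Real} (hw : FW q k f w) (hw' : FW q k f' w') (hn : n < q ^ k) :
    ((w n - w' n : Real) : Complex) = ∑ a ∈ range (q ^ k), (FF q f k (a / q ^ k) - FF q f' k (a / q ^ k)) * ee (n * -(a / q ^ k)) := by
  have X0 : ((q:Complex) ^ k) ≠ 0 := mod_cast (pow_pos hq k).ne'
  apply mul_left_cancel₀ X0
  have h1 : ∀ a ∈ range (q ^ k), (q:Complex) ^ k * ((FF q f k (a / q ^ k) - FF q f' k (a / q ^ k)) * ee (n * -(a / q ^ k))) =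
      ∑ m ∈ range (q ^ k), ((w m - w' m : Real) : Complex) * ee (a * ((((m:Int) - n : Int):Real) / (q ^ k : Nat))) := by
    intro a _
    rw [← Nn, mul_sub, ← hw.four, ← hw'.four, ← Nh, sum_mul]
    refine Me rfl fun m _ => ?_
    rw [← sub_mul, Nn, ← ee_add]; push_cast
    congr 2; ring
  rw [mul_sum, Me rfl h1, sum_comm]
  simp_rw [← mul_sum, orth _ (pow_pos hq k)]
  rw [sum_eq_single_of_mem n (Md.2 hn)]
  · simp [mul_comm]
  · intro m hm hmn
    rw [if_neg, mul_zero]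
    intro hd
    have hm := Md.1 hm
    have := Nr hd (by rw [abs_lt]; constructor <;> omega)
    omega
lemma fw_SS (hq : 0 < q) {f f' : Nat → Real → Complex} {w w' : Nat → Real} (hw : FW q k f w) (hw' : FW q k f' w') (hm : ∀ n, w (n % q ^ k) = w n) (hm' : ∀ n, w' (n % q ^ k) = w' n)
    (α β : Nat → Real) (P P' N : Nat) : |∑ d ∈ Ico P P', ∑ m ∈ range N, α d * β m * (w (d * m) - w' (d * m))| ≤
      ∑ a ∈ range (q ^ k), ‖FF q f k (a / q ^ k) - FF q f' k (a / q ^ k)‖ * ‖SS α β P P' N (a / q ^ k)‖ := by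
  have X0 : §q ^ k ≠ 0 := pv
  have h1 : ((∑ d ∈ Ico P P', ∑ m ∈ range N, α d * β m * (w (d * m) - w' (d * m)) : Real) : Complex) =
      ∑ a ∈ range (q ^ k), (FF q f k (a / q ^ k) - FF q f' k (a / q ^ k)) * SS α β P P' N (-(a / q ^ k)) := by
    unfold SS; push_cast; simp_rw [mul_sum]
    rw [sum_comm' (s := range (q ^ k)) (t' := Ico P P') (s' := fun _ => range (q ^ k)) (by simp)]
    refine Me rfl fun d _ => ?_
    rw [sum_comm]
    refine Me rfl fun m _ => ?_
    have := fw_inv hq hw hw' (Ti (d * m) (pow_pos hq k))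
    rw [hm, hm'] at this; push_cast at this; rw [this, mul_sum]
    refine Me rfl fun a _ => ?_
    have e : ee (§(d * m % q ^ k) * -(a / q ^ k)) = ee (d * m * -(a / q ^ k)) := by
      have e1 : §(d * m % q ^ k) + q ^ k * (d * m / q ^ k : Nat) = d * m := mod_cast Nat.mod_add_div (d * m) (q ^ k)
      generalize d * m % q ^ k = x, d * m / q ^ k = y at e1
      rw [← e1, ← ee_add_int _ (-(a * y))]; congr 1; push_cast; field_simp; ring
    rw [e]; ring
  rw [← Le, ← No, h1]
  refine (Nq _ _).trans (Mf fun a _ => ?_)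
  rw [norm_mul]
  refine Ma (le_of_eq ?_) (Mi _)
  rw [← RCLike.norm_conj]; congr 1
  unfold SS; simp only [map_sum, map_mul, Ku, ← ee_neg]
  refine Me rfl fun d _ => Me rfl fun m _ => ?_
  congr 2; ring
def cz (q z n : Nat) : Prop := n.Coprime q ∧ rough q z n
lemma cz_mul : cz q z (d * m) ↔ cz q z d ∧ cz q z m := by
  unfold cz rough; rw [Nat.coprime_mul_iff_left]
  constructor
  · rintro ⟨⟨a, b⟩, h⟩
    exact ⟨⟨a, fun p hp hd => h p hp (hd.mul_right m)⟩, ⟨b, fun p hp hd => h p hp (hd.mul_left d)⟩⟩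
  · rintro ⟨⟨a, h⟩, ⟨b, h'⟩⟩
    exact ⟨⟨a, b⟩, fun p hp hd => ((PP_prime hp).dvd_mul.1 hd).elim (h p hp) (h' p hp)⟩
lemma cz_ge (h : cz q z d) (hd : 1 < d) : z ≤ d := by
  by_contra hz
  have hp := Nat.minFac_prime hd.ne'
  have hl := Nat.minFac_le (om : 0 < d)
  refine h.2 d.minFac (Mc.2 ⟨Md.2 om, hp, fun hq => ?_⟩) (Nat.minFac_dvd d)
  have := Nat.dvd_gcd (Nat.minFac_dvd d) hq
  rw [h.1] at this
  exact hp.one_lt.ne' (Nat.dvd_one.1 this)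
def Pc (q z Y : Nat) : Nat → Nat
  | 0 => z
  | i + 1 => min (Pc q z Y i + Pc q z Y i / q) Y
open scoped Classical in
noncomputable def al (q z X d : Nat) : Real := if cz q z d ∧ d < X then vM d / lg X else 0
open scoped Classical in
noncomputable def be (q z m : Nat) : Real := if cz q z m ∧ 1 < m then 1 else 0
section
variable {q z Y : Nat}
lemma Pc_le (h : z ≤ Y) (i : Nat) : Pc q z Y i ≤ Y := by cases i <;> simp [Pc, h]
lemma Pc_mono (h : z ≤ Y) : Monotone (Pc q z Y) := monotone_nat_of_le_succ fun i => by
  have := Pc_le (q := q) h i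
  exact le_min (Nat.le_add_right _ _) this
lemma Pc_ge (h : z ≤ Y) (i : Nat) : z ≤ Pc q z Y i := Pc_mono h (Nat.zero_le i)
lemma Pc_grow (hq : 2 ≤ q) (hz : q ≤ z) (h : z ≤ Y) (i : Nat) : min (Y:Real) ((1 + 1 / (2 * q)) ^ i) ≤ Pc q z Y i := by
  induction i with
  | zero => refine (min_le_right _ _).trans ?_; simp only [Pc, pow_zero]; exact_mod_cast om
  | succ i ih =>
    have hP : q ≤ Pc q z Y i := hz.trans (Pc_ge h i)
    simp only [Pc]; push_cast
    refine le_min ?_ (min_le_left _ _)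
    have h2 : (Pc q z Y i : Real) / (2 * q) ≤ (Pc q z Y i / q : Nat) := by
      rw [Nj pv]
      have h3 := Nt (Pc q z Y i) (om : 0 < q)
      have h4 : 1 ≤ Pc q z Y i / q := (Nat.one_le_div_iff om).2 hP
      generalize Pc q z Y i / q = y at *
      have : Pc q z Y i ≤ y * (2 * q) := by nlinarith
      exact_mod_cast this
    generalize Pc q z Y i / q = y at *
    rcases le_total (Y:Real) ((1 + 1 / (2 * q)) ^ i) with h5 | h5
    · rw [min_eq_left h5] at ih
      exact (min_le_left _ _).trans (ih.trans (by linarith [show (0:Real) ≤ y by positivity]))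
    · rw [min_eq_right h5] at ih
      refine (min_le_right _ _).trans ?_
      have : (1 + 1 / (2 * (q:Real))) ^ (i+1) ≤ Pc q z Y i * (1 + 1 / (2 * q)) := by rw [pow_succ]; gcongr
      refine this.trans ?_
      rw [mul_add, Tg, mul_one]; gcongr
lemma Pc_end (hq : 2 ≤ q) (hz : q ≤ z) (h : z ≤ Y) (hY : Y ≤ q ^ k) : Pc q z Y (2 * q * (q * k)) = Y := by
  refine le_antisymm (Pc_le h _) ?_
  have h1 := Pc_grow hq hz h (2 * q * (q * k))
  have h2 : (2:Real) ≤ (1 + 1 / (2 * q)) ^ (2 * q) := by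
    have := one_add_mul_le_pow (a := 1 / (2 * §q)) (le_trans nm (show 0 ≤ 1 / (2 * §q) by positivity)) (2 * q)
    refine le_trans (le_of_eq ?_) this
    push_cast; field_simp; norm_num
  have h3 : §Y ≤ (1 + 1 / (2 * q)) ^ (2 * q * (q * k)) := by
    calc §Y ≤ §q ^ k := mod_cast hY
      _ ≤ ((2:Real) ^ q) ^ k := by gcongr; exact_mod_cast Nat.lt_two_pow_self.le
      _ = 2 ^ (q * k) := by rw [pow_mul]
      _ ≤ _ := by rw [pow_mul _ (2 * q)]; exact My nm h2 _
  rw [min_eq_left h3] at h1; exact_mod_cast h1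
lemma Pc_sum (h : z ≤ Y) (f : Nat → Real) (I : Nat) : ∑ d ∈ Ico z (Pc q z Y I), f d = ∑ i ∈ range I, ∑ d ∈ Ico (Pc q z Y i) (Pc q z Y (i+1)), f d := by
  induction I with
  | zero => simp [Pc]
  | succ I ih => rw [sum_range_succ, ← ih, sum_Ico_consecutive _ (Pc_ge h I) (Pc_mono h (Nat.le_succ I))]
lemma al_le (X d : Nat) (z2 R : Nat) (hz : z2 ≤ z) (hR : 1 ≤ R) : |al q z X d| ≤ 1 ∧ |al q z X d| ≤ nu q z2 R d := by
  classical
  unfold al; split_ifs with h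
  · have h0 : (0:Real) ≤ lg X := Mm X
    have hr : rough q z2 d := fun p hp => h.1.2 p (Mc.2 ⟨Md.2 ((Md.1 (Mc.1 hp).1).trans_le hz), (Mc.1 hp).2⟩)
    rw [nu_rough hR hr, and_self, Ll (div_nonneg Lc h0)]
    refine Jd (ArithmeticFunction.vonMangoldt_le_log.trans ?_) h0
    rcases Lt d with rfl | hd
    · simpa using h0
    · exact Mz (mod_cast hd) (mod_cast h.2.le)
  · simp [nu_nonneg]
lemma be_le (d : Nat) (z2 R : Nat) (hz : z2 ≤ z) (hR : 1 ≤ R) : |be q z d| ≤ 1 ∧ |be q z d| ≤ nu q z2 R d := by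
  classical
  unfold be; split_ifs with h
  · have hr : rough q z2 d := fun p hp => h.1.2 p (Mc.2 ⟨Md.2 ((Md.1 (Mc.1 hp).1).trans_le hz), (Mc.1 hp).2⟩)
    rw [nu_rough hR hr]; simp
  · simp [nu_nonneg]
lemma boxes (hq : 2 ≤ q) (ht : 2 * t ≤ k) (z2 R i : Nat) (hz : z2 ≤ q ^ t) (hR : 1 ≤ R) (hR2 : R ^ 12 ≤ q ^ t)
    (hi : Pc q (q ^ t) (q ^ (k - t)) i < q ^ (k - t)) :
    Box q k t z2 R (Pc q (q ^ t) (q ^ (k - t)) i) (Pc q (q ^ t) (q ^ (k - t)) (i + 1))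
      ((q ^ k + Pc q (q ^ t) (q ^ (k - t)) i - 1) / Pc q (q ^ t) (q ^ (k - t)) i) (al q (q ^ t) (q ^ k)) (be q (q ^ t)) := by
  have hzY : q ^ t ≤ q ^ (k - t) := Mh om om
  have hP := Pc_ge (q := q) hzY i
  have hX : q ^ k = q ^ t * q ^ (k - t) := by rw [← pow_add]; congr 1; omega
  have ht0 : 0 < q ^ t := pv
  have hYX : q ^ (k - t) ≤ q ^ k := Mh om om
  have hs : Pc q (q ^ t) (q ^ (k - t)) (i + 1) ≤ Pc q (q ^ t) (q ^ (k - t)) i + Pc q (q ^ t) (q ^ (k - t)) i / q := by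
    simp only [Pc]; omega
  generalize Pc q (q ^ t) (q ^ (k - t)) (i + 1) = P' at *
  generalize Pc q (q ^ t) (q ^ (k - t)) i = P at *
  have hP0 : 0 < P := om
  have h1 := Lz (q ^ k + P - 1) P
  have h2 := Nat.lt_div_mul_add hP0 (a := q ^ k + P - 1)
  have h3 := Lz P q
  have h4 : P / q ≤ P := Jl _ _
  generalize (q ^ k + P - 1) / P = N at *
  have hN1 : q ^ k ≤ N * P := om
  have a1 := fun d => al_le (q := q) (q ^ k) d z2 R hz hR
  have b1 := fun d => be_le (q := q) d z2 R hz hR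
  refine ⟨?_, hN1, om, ?_, hP, hR, hR2, fun d => (a1 d).1, fun d => (b1 d).1, fun d => (a1 d).2, fun d => (b1 d).2, by simp [be], ?_⟩
  · exact (Mo q (Nat.sub_le_iff_le_add'.2 hs)).trans h3
  · by_contra hc
    push Not at hc
    have : N * P < q ^ t * q ^ (k - t) := Nat.mul_lt_mul'' hc hi
    omega
  · intro d hd m hm
    have hd := mem_Ico.1 hd; have hm := Md.1 hm
    have e1 : (m + 1) * P ≤ N * P := Mo P hm
    have e2 : d * m ≤ 2 * P * m := Mo m om
    rw [add_mul] at e1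
    have e3 : 2 * P * m = 2 * (m * P) := rg
    omega
end
lemma top_zero (hq : 2 ≤ q) (hk : 1 ≤ k) (h1 : q ^ k ≤ y) (h2 : y * q < q ^ k * (q + 1)) : y / q ^ (k - 1) % q = 0 := by
  obtain ⟨k, rfl⟩ : ∃ l, k = l + 1 := ⟨k - 1, om⟩
  simp only [Nat.add_sub_cancel]
  obtain ⟨x, rfl⟩ := Nat.exists_eq_add_of_le h1
  have h0 : 0 < q ^ k := pv
  have : x < q ^ k := by rw [pow_succ] at h2; nlinarith
  rw [pow_succ, Nat.mul_add_div h0, Kr this]; simp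
lemma ident_n {q z Y X n : Nat} (hn : n < X) (hn0 : n ≠ 0) (hzY : X = z * Y) (hn1 : n.Coprime q) (hX : 1 < X) :
    lg X * ∑ d ∈ Ico z Y, ∑ m ∈ range X, (if d * m = n then al q z X d * be q z m else 0) = open scoped Classical in if rough q z n then lg n - vM n else 0 := by
  classical
  have hl : lg X ≠ 0 := (Jo (mod_cast hX)).ne'
  have hcz : ∀ d m, al q z X d * be q z m ≠ 0 → cz q z d ∧ cz q z m ∧ 1 < m ∧ 1 < d := by
    intro d m h
    have h1 := left_ne_zero_of_mul h; have h2 := right_ne_zero_of_mul h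
    unfold al at h1; unfold be at h2
    rw [ite_ne_right_iff] at h1 h2
    refine ⟨h1.1.1, h2.1.1, h2.1.2, ?_⟩
    by_contra hd
    interval_cases d <;> simp at h1
  split_ifs with hr
  · have c : cz q z n := ⟨hn1, hr⟩
    rw [← sum_product', ← Ni]
    have e1 : ∑ x ∈ Ico z Y ×ˢ range X with x.1 * x.2 = n, al q z X x.1 * be q z x.2 = ∑ x ∈ n.divisorsAntidiagonal, al q z X x.1 * be q z x.2 := by
      refine sum_subset (fun x hx => Lh.2 ⟨(Mc.1 hx).2, hn0⟩) fun x hx hx2 => ?_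
      by_contra h
      have h := hcz _ _ h
      have hx := (Lh.1 hx).1
      have g1 := cz_ge h.1 h.2.2.2
      have g2 := cz_ge h.2.1 h.2.2.1
      refine hx2 (Mc.2 ⟨Nk.2 ⟨mem_Ico.2 ⟨g1, ?_⟩, Md.2 ?_⟩, hx⟩)
      · by_contra h3
        have : Y * z ≤ x.1 * x.2 := Nf om g2
        rw [mul_comm] at this; omega
      · have : 1 * x.2 ≤ x.1 * x.2 := Mo _ om
        omega
    rw [e1, Nat.sum_divisorsAntidiagonal (fun a b => al q z X a * be q z b), ← ArithmeticFunction.vonMangoldt_sum (n := n), mul_sum,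
      ← sum_erase_add _ _ (Nat.mem_divisors_self n hn0), ← sum_erase_add n.divisors (fun i => vM i) (Nat.mem_divisors_self n hn0), Nat.div_self om]
    have : be q z 1 = 0 := by simp [be]
    rw [this, mul_zero, mul_zero, add_zero, add_sub_cancel_right]
    refine Me rfl fun d hd => ?_
    obtain ⟨hdn, hd⟩ := mem_erase.1 hd
    obtain ⟨m, rfl⟩ := Kv hd
    have hd0 : 0 < d := Mr (left_ne_zero_of_mul hn0)
    have hm0 : 0 < m := Mr (right_ne_zero_of_mul hn0)
    rw [Lx _ hd0]
    obtain ⟨c1, c2⟩ := cz_mul.1 c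
    have hm1 : 1 < m := by
      by_contra h; obtain rfl : m = 1 := om
      simp at hdn
    unfold al be; rw [if_pos ⟨c1, by nlinarith⟩, if_pos ⟨c2, hm1⟩]; field_simp
  · rw [mul_eq_zero]; right
    refine Jk fun d _ => Jk fun m _ => ?_
    split_ifs with h
    · by_contra h2
      have h2 := hcz _ _ h2
      exact hr (h ▸ (cz_mul.2 ⟨h2.1, h2.2.1⟩).2)
    · rfl
lemma ident {q k t : Nat} (hq : 2 ≤ q) (ht0 : 1 ≤ t) (ht : 2 * t ≤ k) (w : Nat → Real) (hw1 : ∀ n, w n ≠ 0 → n.Coprime q) (hw2 : ∀ n, n / q ^ (k - 1) % q = 0 → w n = 0) :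
    ∑ n ∈ range (q ^ k), (open scoped Classical in if rough q (q ^ t) n then w n * (lg n - vM n) else 0) =
    lg (q ^ k : Nat) * ∑ i ∈ range (2 * q * (q * k)), ∑ d ∈ Ico (Pc q (q ^ t) (q ^ (k - t)) i) (Pc q (q ^ t) (q ^ (k - t)) (i + 1)),
      ∑ m ∈ range ((q ^ k + Pc q (q ^ t) (q ^ (k - t)) i - 1) / Pc q (q ^ t) (q ^ (k - t)) i), al q (q ^ t) (q ^ k) d * be q (q ^ t) m * w (d * m) := by
  classical
  have hzY : q ^ t ≤ q ^ (k - t) := Mh om om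
  have hX : q ^ k = q ^ t * q ^ (k - t) := by rw [← pow_add]; congr 1; omega
  have ht0' : q ≤ q ^ t := Ky om q
  have hYX : q ^ (k - t) ≤ q ^ k := Mh om om
  have hX1 : 1 < q ^ k := Nat.one_lt_pow om om
  have step : ∀ i ∈ range (2 * q * (q * k)), ∀ d ∈ Ico (Pc q (q ^ t) (q ^ (k - t)) i) (Pc q (q ^ t) (q ^ (k - t)) (i + 1)),
      ∑ m ∈ range ((q ^ k + Pc q (q ^ t) (q ^ (k - t)) i - 1) / Pc q (q ^ t) (q ^ (k - t)) i), al q (q ^ t) (q ^ k) d * be q (q ^ t) m * w (d * m)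
       = ∑ m ∈ range (q ^ k), al q (q ^ t) (q ^ k) d * be q (q ^ t) m * (if d * m < q ^ k then w (d * m) else 0) := by
    intro i _ d hd
    have hP := Pc_ge (q := q) hzY i
    have hs : Pc q (q ^ t) (q ^ (k - t)) (i + 1) ≤ Pc q (q ^ t) (q ^ (k - t)) i + Pc q (q ^ t) (q ^ (k - t)) i / q := by
      simp only [Pc]; omega
    generalize Pc q (q ^ t) (q ^ (k - t)) (i + 1) = P' at *
    generalize Pc q (q ^ t) (q ^ (k - t)) i = P at *
    have hd := mem_Ico.1 hd
    have hP0 : 0 < P := om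
    have h1 := Lz (q ^ k + P - 1) P
    have h2 := Nat.lt_div_mul_add hP0 (a := q ^ k + P - 1)
    have h3 := Lz P q
    generalize (q ^ k + P - 1) / P = N at *
    generalize P / q = y at *
    have hNX : N ≤ q ^ k := by
      by_contra h
      have : (q ^ k + 1) * P ≤ N * P := Mo P om
      have h5 : q ^ k * 1 ≤ q ^ k * P := Ns _ om
      rw [add_mul] at this; omega
    rw [← sum_subset (Kx.2 hNX)]
    · refine Me rfl fun m hm => ?_
      have hm := Md.1 hm
      split_ifs with hlt
      · rfl
      · rw [hw2 _ (top_zero hq om (not_lt.1 hlt) ?_)]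
        have e1 : (m + 1) * P ≤ N * P := Mo P hm
        rw [add_mul] at e1
        have e2 : d * q ≤ P * (q + 1) := by
          have : d * q ≤ (P + y) * q := Mo q om
          rw [add_mul] at this; rw [mul_add]; omega
        calc d * m * q = d * q * m := rg
          _ ≤ P * (q + 1) * m := Mo m e2
          _ = m * P * (q + 1) := rg
          _ < q ^ k * (q + 1) := Nat.mul_lt_mul_of_pos_right om om
    · intro m _ hm
      rw [if_neg, mul_zero]
      have : P * N ≤ d * m := Nf hd.1 (by simpa using hm)
      rw [mul_comm] at this; omega
  rw [Me rfl fun i hi => Me rfl (step i hi), ← Pc_sum hzY (fun d => ∑ m ∈ range (q ^ k), al q (q ^ t) (q ^ k) d * be q (q ^ t) m * (if d * m < q ^ k then w (d * m) else 0)),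
    Pc_end hq ht0' hzY hYX]
  have e2 : ∀ d ∈ Ico (q ^ t) (q ^ (k - t)), ∑ m ∈ range (q ^ k), al q (q ^ t) (q ^ k) d * be q (q ^ t) m * (if d * m < q ^ k then w (d * m) else 0) =
      ∑ n ∈ range (q ^ k), w n * ∑ m ∈ range (q ^ k), (if d * m = n then al q (q ^ t) (q ^ k) d * be q (q ^ t) m else 0) := by
    intro d _
    simp_rw [mul_sum]; rw [sum_comm]
    refine Me rfl fun m _ => ?_
    simp_rw [mul_ite, mul_zero, sum_ite_eq, Md]
    simp only [mul_comm]
  rw [Me rfl e2, sum_comm, mul_sum]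
  refine Me rfl fun n hn => ?_
  rw [← mul_sum, mul_left_comm]
  by_cases h0 : w n = 0
  · simp [h0]
  have hn0 : n ≠ 0 := by rintro rfl; exact h0 (hw2 0 (by simp))
  rw [ident_n (Md.1 hn) hn0 hX (hw1 n h0) hX1]
  split_ifs <;> simp
open scoped Classical in
noncomputable def TL (q k z : Nat) (w : Nat → Real) : Real := ∑ n ∈ range (q ^ k), if rough q z n then w n * (lg n - vM n) else 0
lemma G_lower {q k N2 : Nat} (hq : 4 ≤ q) (hN : 1 ≤ N2) (hk : N2 ≤ k) :
    §q.totient * k * lg q / (4 * q * N2) ≤ GG q (q ^ (k / N2)) ((q ^ (k / N2)) ^ 8) := by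
  have h1 : 1 ≤ k / N2 := (Nat.one_le_div_iff om).2 hk
  have hz : q ≤ q ^ (k / N2) := Ky om q
  have h2 := GG_ge (q := q) (z := q ^ (k / N2)) (R := (q ^ (k / N2)) ^ 8) om le_rfl
  have h3 := WW_ge (q := q) (z := q ^ (k / N2)) om om
  have h4 : §k ≤ 2 * N2 * (k / N2 : Nat) := by
    have := Nt k (om : 0 < N2)
    generalize k / N2 = y at *
    have : k ≤ 2 * N2 * y := by nlinarith
    exact_mod_cast this
  rw [Lj, Mw] at h3
  generalize k / N2 = y at *
  have hl : 0 ≤ lg q := Mm q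
  have h5 : §q.totient * k * lg q / (4 * q * N2) ≤ §q.totient / q * (y * lg q) / 2 := by
    rw [Nj pv]
    have : §q.totient / q * (y * lg q) / 2 * (4 * q * N2) = q.totient * lg q * (2 * N2 * y) := by field_simp; ring
    rw [this]
    have := Ma h4 (Mu (Mt q.totient) hl)
    linarith
  linarith
lemma T_diff (q : Nat) (hq : 4 ≤ q) (A1 A2 : Real) (hA : (A1 + 7) ^ 3 ≤ √q / 2) (hA2 : 2 ≤ A2) (N1 : Nat) (hN1 : 4 ≤ N1) (hAN : A2 ^ (16 * N1) ≤ q)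
    (K j i1 : Nat) (hi1 : q ^ K ≤ 2 ^ i1) (hij : i1 ≤ j) (hj : 1 ≤ j) (ε : Real) (hε : 0 < ε) :
    ∀ᶠ k : Nat in atTop, ∀ E E' : Nat → Finset Nat, (∀ l, E l ⊆ range q) → (∀ l, E' l ⊆ range q) → DF q A1 A2 (fun l => af (E l)) → DF q A1 A2 (fun l => af (E' l)) →
      (∀ l, l < j ∨ k - j ≤ l → E l = E' l) → (∀ n ∈ E 0, n.Coprime q) → 0 ∉ E (k - 1) →
      |TL q k (q ^ (k / N1)) (wE q E k) - TL q k (q ^ (k / N1)) (wE q E' k)| ≤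
        §q ^ k * (ε + 32 * q ^ 4 * (96 * N1 : Nat) ^ 2 * (1536 * q ^ (4 * K + 1) / q ^ j + 64 * q ^ 4 * (3 / 4) ^ K)) := by
  have q4 : 4 ≤ §q := mod_cast hq
  have hl1 : 1 ≤ lg q := by
    rw [Lk li]; linarith [Kh]
  set c := 1536 * §q ^ (4 * K + 1) / q ^ j + 64 * q ^ 4 * (3 / 4) ^ K with hc
  have hc0 : 0 ≤ c := pv
  clear_value c
  filter_upwards [typeII q om A1 A2 hA hA2 N1 hN1 hAN K j i1 hi1 hij (ε / (2 * q * q * lg q)) pv, Nm (96 * N1 + 2)]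
    with k hk hkN E E' hE hE' hf hf' heq hE0 hEk
  rw [← hc] at hk
  have ht1 : 1 ≤ k / N1 := (Nat.one_le_div_iff om).2 om
  have ht2 : 2 * (k / N1) ≤ k := by
    have : k / N1 ≤ k / 2 := Nat.div_le_div_left om om
    omega
  have hkt : q ^ (k / N1) ≤ q ^ (k - k / N1) := Mh om om
  have w1 : ∀ E : Nat → Finset Nat, (∀ n ∈ E 0, n.Coprime q) → ∀ n, wE q E k n ≠ 0 → n.Coprime q := by
    intro E h n hn
    have : n % q ∈ E 0 := by
      by_contra h2
      exact hn (wE_zero (l := 0) om (by simpa using h2))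
    have := h _ this
    unfold Nat.Coprime at *
    rwa [Nat.gcd_comm, Nat.gcd_rec]
  have w2 : ∀ E : Nat → Finset Nat, 0 ∉ E (k - 1) → ∀ n, n / q ^ (k - 1) % q = 0 → wE q E k n = 0 :=
    fun E h n hn => wE_zero (l := k - 1) om (by rwa [hn])
  have e0 := heq 0 (Or.inl hj)
  have ek := heq (k - 1) (Or.inr om)
  unfold TL
  rw [ident om ht1 ht2 _ (w1 E hE0) (w2 E hEk), ident om ht1 ht2 _ (w1 E' (e0 ▸ hE0)) (w2 E' (ek ▸ hEk)), ← mul_sub, abs_mul]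
  have hdiv : 96 * (k / (96 * N1)) ≤ k / N1 := by
    rw [mul_comm 96 N1, ← Nat.div_div_eq_div_mul]; exact Nat.mul_div_le _ _
  have hR2 : ((q ^ (k / (96 * N1))) ^ 8) ^ 12 ≤ q ^ (k / N1) := by
    rw [← pow_mul, ← pow_mul]; exact Mh om om
  have hz2 : q ^ (k / (96 * N1)) ≤ q ^ (k / N1) := Mh om om
  have hR1 : 1 ≤ (q ^ (k / (96 * N1))) ^ 8 := Kq _ _ (pow_pos om _)
  have hG := G_lower (q := q) (k := k) (N2 := 96 * N1) hq om om
  set G := GG q (q ^ (k / (96 * N1))) ((q ^ (k / (96 * N1))) ^ 8) with hGdef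
  have hbd : |∑ i ∈ range (2 * q * (q * k)), ∑ d ∈ Ico (Pc q (q ^ (k / N1)) (q ^ (k - k / N1)) i) (Pc q (q ^ (k / N1)) (q ^ (k - k / N1)) (i + 1)),
      ∑ m ∈ range ((q ^ k + Pc q (q ^ (k / N1)) (q ^ (k - k / N1)) i - 1) / Pc q (q ^ (k / N1)) (q ^ (k - k / N1)) i), al q (q ^ (k / N1)) (q ^ k) d * be q (q ^ (k / N1)) m * wE q E k (d * m) -
      ∑ i ∈ range (2 * q * (q * k)), ∑ d ∈ Ico (Pc q (q ^ (k / N1)) (q ^ (k - k / N1)) i) (Pc q (q ^ (k / N1)) (q ^ (k - k / N1)) (i + 1)),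
      ∑ m ∈ range ((q ^ k + Pc q (q ^ (k / N1)) (q ^ (k - k / N1)) i - 1) / Pc q (q ^ (k / N1)) (q ^ (k - k / N1)) i), al q (q ^ (k / N1)) (q ^ k) d * be q (q ^ (k / N1)) m * wE q E' k (d * m)|
      ≤ (2 * q * (q * k)) * (§q ^ k * (ε / (2 * q * q * lg q) / k ^ 2 + c / G ^ 2)) := by
    have hB : 0 ≤ §q ^ k * (ε / (2 * q * q * lg q) / k ^ 2 + c / G ^ 2) := by clear_value G; positivity
    rw [← Nh]
    refine (Jq _ _).trans ((Kl _ _ (§q ^ k * (ε / (2 * q * q * lg q) / k ^ 2 + c / G ^ 2)) ?_).trans (le_of_eq (by simp)))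
    intro i _
    rw [← Nh]
    simp_rw [← Nh, ← mul_sub]
    rcases (Pc_le (q := q) hkt i).eq_or_lt with h | h
    · have h2 := Pc_le (q := q) hkt (i + 1)
      rw [Ico_eq_empty (by rw [h]; exact not_lt.2 h2)]; simp only [sum_empty, abs_zero]; exact hB
    · refine (fw_SS om (wE_FW q om E hE k) (wE_FW q om E' hE' k) (wE_mod q E k) (wE_mod q E' k) _ _ _ _ _).trans ?_
      exact hk _ _ hf hf' (fun l hl => by simp only [heq l hl]) _ _ _ _ _ _ _ (boxes om ht2 _ _ i hz2 hR1 hR2 h)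
  refine (Ma hbd (Nl _)).trans ?_
  rw [Lj, Mw, Ll pv]
  have k0 : 0 < §k := mod_cast om
  have N0 : (0:Real) < (96 * N1 : Nat) := mod_cast om
  have hφ : (1:Real) ≤ q.totient := mod_cast Np.2 om
  clear_value G
  generalize §(96 * N1) = N2 at *
  have hG2 : §k * lg q / (4 * q * N2) ≤ G := by
    refine le_trans (Mv ?_ pv) hG
    have := Mb hφ (pv : 0 ≤ §k * lg q)
    linarith
  generalize lg q = L at *
  have L0 : 0 < L := li
  have hD : 0 < §k * L / (4 * q * N2) := pv
  have h5 : c / G ^ 2 ≤ c / (§k * L / (4 * q * N2)) ^ 2 := Ko hc0 pv (My hD.le hG2 2)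
  have h6 : k * L * (2 * q * (q * k) * (§q ^ k * (ε / (2 * q * q * L) / k ^ 2 + c / G ^ 2))) ≤
      k * L * (2 * q * (q * k) * (§q ^ k * (ε / (2 * q * q * L) / k ^ 2 + c / (§k * L / (4 * q * N2)) ^ 2))) := by
    refine Ma (Ma (Ma li pv) pv) pv
  refine h6.trans ?_
  have h7 : k * L * (2 * q * (q * k) * (§q ^ k * (ε / (2 * q * q * L) / k ^ 2 + c / (§k * L / (4 * q * N2)) ^ 2))) = q ^ k * (ε + 32 * q ^ 4 * N2 ^ 2 * c * (1 / L)) := by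
    field_simp; ring
  rw [h7]
  refine Ma ?_ pv
  have h8 : 1 / L ≤ 1 := by rw [Kb L0]; exact hl1
  have := Ma h8 (pv : 0 ≤ 32 * §q ^ 4 * N2 ^ 2 * c)
  linarith
open scoped Classical in
noncomputable def LL (q k z : Nat) (w : Nat → Real) : Real := ∑ n ∈ range (q ^ k), if rough q z n then w n else 0
lemma S_bound {q k I : Nat} (hq : 4 ≤ q) (hk : 800 ≤ k) (hI1 : 2 ^ I ≤ q ^ (k / 20)) (hI2 : q ^ (k / 20) < 2 ^ (I + 1)) :
    k * lg q * (24 * xp 5 * xp (-(I * lg 2 / lg (q ^ (k / 400) : Nat))) * (q / q.totient) / I) ≤ (q / q.totient) / 300 := by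
  have q4 : 4 ≤ §q := mod_cast hq
  have hl1 : 1 ≤ lg q := by
    rw [Lk li]; linarith [Kh]
  have k8 : 800 ≤ §k := mod_cast hk
  have h1 : (k / 20 : Nat) * lg q ≤ (I + 1) * lg 2 := by
    have : §(q ^ (k / 20)) ≤ (2 ^ (I + 1) : Nat) := mod_cast hI2.le
    have := Mz pv this
    rw [Lj, Lj, Mw, Mw] at this; exact_mod_cast this
  have h2 : §k / 20 - 1 ≤ (k / 20 : Nat) := by
    have := Nt k (om : 0 < 20)
    have : §k ≤ 20 * ((k / 20 : Nat) + 1) := mod_cast this.le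
    linarith
  have h3 : §(k / 400) ≤ k / 400 := Tc
  have h30 : (1:Real) ≤ (k / 400 : Nat) := mod_cast om
  rw [Lj, Mw]
  have l2 := Real.log_two_lt_d9
  have l20 := Jp
  set L := lg q
  clear_value L
  generalize §(k / 20) = y at *
  generalize §(k / 400) = v at *
  have h4 : (k / 20 - 2) * L ≤ I * lg 2 := by nlinarith
  have h5 : 19 ≤ I * lg 2 / (v * L) := by
    rw [Na pv]
    nlinarith
  have h6 : k * L ≤ 28 * I := by nlinarith
  have I0 : 0 < §I := by nlinarith
  have h7 : xp 5 * xp (-(I * lg 2 / (v * L))) ≤ 1 / 201600 := by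
    rw [← Tj]
    refine (Real.exp_le_exp.2 (li : _ ≤ -(14:Real))).trans ?_
    rw [Real.exp_neg, ← one_div]
    refine Lv nm ?_
    have : xp 14 = xp 1 ^ 14 := by rw [← Real.exp_nat_mul]; norm_num
    rw [this]
    exact le_trans nm (My nm (show (2.7:Real) ≤ xp 1 by linarith [Real.exp_one_gt_d9]) 14)
  have h8 : 0 ≤ §q / q.totient := pv
  generalize §q / q.totient = r at *
  calc k * L * (24 * xp 5 * xp (-(I * lg 2 / (v * L))) * r / I) = (k * L) / I * (24 * (xp 5 * xp (-(I * lg 2 / (v * L))) * r)) := rg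
    _ ≤ 28 * (24 * (1 / 201600 * r)) := by
      refine Mx ((Nj I0).2 h6) ?_ pv nm
      have h9 : xp 5 * xp (-(I * lg 2 / (v * L))) * r ≤ 1 / 201600 * r := Mb h7 h8
      linarith
    _ ≤ r / 300 := li
lemma L_diff (q : Nat) (hq : 4 ≤ q) (A1 A2 : Real) (hA : (A1 + 7) ^ 3 ≤ √q / 2) (ε : Real) (hε : 0 < ε) :
    ∀ᶠ k : Nat in atTop, ∀ f f' w w', DF q A1 A2 f → DF q A1 A2 f' → FW q k f w → FW q k f' w' →
      k * lg q * |LL q k (q ^ (k / 400)) w - LL q k (q ^ (k / 400)) w'| + lg q * LL q k (q ^ (k / 400)) w ≤ §q ^ k * (ε + (q / q.totient) / 100) := by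
  have q4 : 4 ≤ §q := mod_cast hq
  have hl1 : 1 ≤ lg q := by
    rw [Lk li]; linarith [Kh]
  have hφ : (1:Real) ≤ q.totient := mod_cast Np.2 om
  filter_upwards [rough_diff q om A1 A2 hA (ε / (6 * lg q)) pv, Nm 800, Nm ⌈3200 * q / ε⌉₊]
    with k hk k8 kε f f' w w' hf hf' hw hw'
  have kε : 3200 * q / ε ≤ k := Nat.ceil_le.1 kε
  have k1 : 800 ≤ §k := mod_cast k8
  have hI1 : 2 ^ Nat.log 2 (q ^ (k / 20)) ≤ q ^ (k / 20) := Nat.pow_log_le_self 2 pv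
  have hI2 : q ^ (k / 20) < 2 ^ (Nat.log 2 (q ^ (k / 20)) + 1) := Nat.lt_pow_succ_log_self om _
  have hS := S_bound hq k8 hI1 hI2
  generalize Nat.log 2 (q ^ (k / 20)) = I at *
  have hqz : q ≤ q ^ (k / 400) := Ky om q
  have hz8 : (q ^ (k / 400)) ^ 8 ≤ 2 ^ I := by
    have h1 : q ^ (8 * (k / 400) + 1) ≤ q ^ (k / 20) := Mh om om
    rw [← pow_mul, mul_comm]
    have h2 : q ^ (8 * (k / 400)) * q < 2 ^ I * 2 := by rw [← pow_succ, ← pow_succ]; omega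
    by_contra h3
    have : 2 ^ I * 2 ≤ q ^ (8 * (k / 400)) * q := Nf om om
    omega
  obtain ⟨i, i1, i2, i3⟩ := sieve_ex (q := q) om om hz8
  have hzR : (q ^ (k / 400) * (2 ^ i) ^ 2) ^ 4 ≤ q ^ k := by
    have h1 : (2 ^ i) ^ 2 ≤ q ^ (4 * (k / 20)) := by
      calc (2 ^ i) ^ 2 ≤ (2 ^ (2 * I)) ^ 2 := Nd (Mh om om) 2
        _ = (2 ^ I) ^ 4 := by rw [← pow_mul, ← pow_mul]; congr 1; ring
        _ ≤ (q ^ (k / 20)) ^ 4 := Nd hI1 4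
        _ = _ := by rw [← pow_mul, mul_comm]
    calc _ ≤ (q ^ (k / 400) * q ^ (4 * (k / 20))) ^ 4 := Nd (Ns _ h1) 4
      _ = q ^ ((k / 400 + 4 * (k / 20)) * 4) := by rw [← pow_add, ← pow_mul]
      _ ≤ _ := Mh om om
  have hR1 : 1 ≤ 2 ^ i := Kq _ _ om
  have ha := hk f w hf hw (q ^ (k / 400)) (2 ^ i) hR1 om hzR
  have hb := hk f' w' hf' hw' (q ^ (k / 400)) (2 ^ i) hR1 om hzR
  rw [UU_one hR1] at ha hb
  have hG := GG_ge (q := q) (z := q ^ (k / 400)) (R := 2 ^ i) om (hz8.trans (Mh om i1))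
  have hW := WW_ge (q := q) (z := q ^ (k / 400)) om om
  have h400 : §k / 800 ≤ (k / 400 : Nat) := by
    have := Nt k (om : 0 < 400)
    have : §k ≤ 400 * ((k / 400 : Nat) + 1) := mod_cast this.le
    linarith
  rw [Lj, Mw] at hW
  have hsum := (Ma i3 (pv : 0 ≤ k * lg q)).trans hS
  obtain ⟨ha, s0⟩ := ha
  obtain ⟨hb, -⟩ := hb
  change |LL q k (q ^ (k / 400)) w - _| ≤ _ at ha
  change |LL q k (q ^ (k / 400)) w' - _| ≤ _ at hb
  set La := LL q k (q ^ (k / 400)) w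
  set Lb := LL q k (q ^ (k / 400)) w'
  set U := ∑ p ∈ PP q (q ^ (k / 400)), UU q (q ^ (k / 400)) (2 ^ i) p
  set G := GG q (q ^ (k / 400)) (2 ^ i)
  clear_value La Lb U G
  have q0 : 0 < §q := li
  have hG2 : k * lg q / (1600 * q) ≤ G := by
    have h1 : §q.totient / q * ((k / 400 : Nat) * lg q) ≥ 1 / q * (k / 800 * lg q) := by
      refine Mx (Mv hφ q0.le) (Mb h400 li) pv pv
    have : 1 / q * (k / 800 * lg q) = 2 * (k * lg q / (1600 * q)) := by field_simp; ring
    linarith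
  clear hG hW h400 hk hS i3 hz8 hzR hI1 hI2
  set L := lg q
  clear_value L
  have X0 : 0 < §q ^ k := pv
  have hG3 : L * (1 / G) ≤ ε / 2 := by
    have h1 : 1 / G ≤ 1 / (k * L / (1600 * q)) := Lv pv hG2
    have h2 : L * (1 / (k * L / (1600 * q))) = 1600 * q / k := by field_simp
    have h3 := Ma h1 (li : 0 ≤ L)
    rw [h2] at h3
    refine h3.trans ?_
    rw [Nj li]; rw [Nj hε] at kε; linarith
  have d1 : |La - Lb| ≤ 2 * (§q ^ k * (U + ε / (6 * L) / k)) := by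
    rw [abs_le] at ha hb ⊢; constructor <;> linarith
  have d2 : La ≤ §q ^ k * (1 / G + U + ε / (6 * L) / k) := by
    have := (abs_le.1 ha).2; linarith
  have e1 := Ma d1 (pv : 0 ≤ k * L)
  have e2 := Ma d2 (li : 0 ≤ L)
  have e3 : k * L * (2 * (§q ^ k * (U + ε / (6 * L) / k))) = q ^ k * (2 * (k * L * U) + ε / 3) := by field_simp; ring
  have e4 : L * (§q ^ k * (1 / G + U + ε / (6 * L) / k)) ≤ q ^ k * (ε / 2 + k * L * U + ε / 6) := by
    have : L * (§q ^ k * (1 / G + U + ε / (6 * L) / k)) = q ^ k * (L * (1 / G) + L * U + ε / 6 / k) := by field_simp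
    rw [this]
    refine Ma ?_ X0.le
    have f1 : L * U ≤ k * L * U := Mb (by nlinarith) s0
    have f2 : ε / 6 / k ≤ ε / 6 := div_le_self li li
    linarith
  have e5 := Ma hsum X0.le
  rw [e3] at e1
  linarith
open scoped Classical in
noncomputable def VV (q k z : Nat) (w : Nat → Real) : Real := ∑ n ∈ range (q ^ k), if rough q z n then w n * vM n else 0
lemma V_cmp (hq : 2 ≤ q) (hk : 1 ≤ k) {w w' : Nat → Real} (h0 : ∀ n, 0 ≤ w n) (h0' : ∀ n, 0 ≤ w' n) (hw : ∀ n, n / q ^ (k - 1) % q = 0 → w n = 0) :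
    VV q k z w' - (k * lg q * |LL q k z w - LL q k z w'| + lg q * LL q k z w) - |TL q k z w - TL q k z w'| ≤ VV q k z w := by
  classical
  have a1 : (k - 1) * lg q * LL q k z w ≤ TL q k z w + VV q k z w := by
    unfold LL TL VV; rw [mul_sum, ← Mk]
    refine Mf fun n hn => ?_
    split_ifs
    · rw [← mul_add, sub_add_cancel, mul_comm]
      by_cases h : w n = 0
      · simp [h]
      refine Ma ?_ (h0 n)
      have : q ^ (k - 1) ≤ n := by
        by_contra h2
        exact h (hw n (by rw [Kr om]; simp))
      have h2 : §(q ^ (k - 1)) ≤ n := mod_cast this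
      have := Mz pv h2
      rw [Lj, Mw, Nat.cast_sub hk] at this
      simpa using this
    · simp
  have a2 : TL q k z w' + VV q k z w' ≤ k * lg q * LL q k z w' := by
    unfold LL TL VV; rw [mul_sum, ← Mk]
    refine Mf fun n hn => ?_
    split_ifs
    · rw [← mul_add, sub_add_cancel, mul_comm]
      refine Mb ?_ (h0' n)
      rcases Lt n with rfl | hn0
      · simp only [CharP.cast_eq_zero, Real.log_zero]; have := Mm q; positivity
      have h2 : §n ≤ (q ^ k : Nat) := mod_cast (Md.1 hn).le
      have := Mz pv h2
      rwa [Lj, Mw] at this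
    · simp
  have l0 : 0 ≤ k * lg q := by have := Mm q; positivity
  have b1 := Ma (neg_abs_le (LL q k z w - LL q k z w')) l0
  have b2 := le_abs_self (TL q k z w - TL q k z w')
  linarith
lemma dig_sum {q l k e : Nat} (hl : l < k) (he : e < q) (f : Nat → Real) :
    ∑ n ∈ range (q ^ k), (if n / q ^ l % q = e then f n else 0) = ∑ b ∈ range (q ^ (k - l - 1)), ∑ a ∈ range (q ^ l), f (a + q ^ l * (e + q * b)) := by
  have q0 : 0 < q := om
  have h1 : q ^ k = q ^ l * (q * q ^ (k - l - 1)) := by rw [← pow_succ', ← pow_add]; congr 1; omega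
  rw [h1, sum_range_mul_add, sum_range_mul_add]
  refine Me rfl fun b _ => ?_
  rw [sum_eq_single_of_mem e (Md.2 he)]
  · refine Me rfl fun a ha => ?_
    rw [if_pos]
    rw [Jh _ _ pv, Kr (Md.1 ha), zero_add, Km, Ju he]
  · intro c hc hce
    refine Jk fun a ha => ?_
    rw [if_neg]
    rwa [Jh _ _ pv, Kr (Md.1 ha), zero_add, Km, Ju (Md.1 hc)]
lemma bad_dig (hq : 2 ≤ q) (hR : 1 ≤ R) (hl : l < k) (he : e < q) (hlj : l < j ∨ k - j ≤ l) :
    ∑ n ∈ range (q ^ k), (if n / q ^ l % q = e then nu q z R n else 0) ≤ q ^ k / (q * GG q z R) + q ^ j * R ^ 4 := by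
  have q1 : 1 ≤ §q := mod_cast om
  have G1 := GG_ge1 (q := q) (z := z) hR
  have hX : §q ^ k = q ^ l * q ^ (k - l - 1) * q := by rw [← pow_add, ← pow_succ]; congr 1; omega
  have hX2 : §q ^ k / (q * GG q z R) = q ^ l * q ^ (k - l - 1) / GG q z R := by rw [hX]; field_simp
  rw [dig_sum hl he, hX2]
  rcases hlj with h | h
  · rw [sum_comm]
    have : ∀ a ∈ range (q ^ l), ∑ b ∈ range (q ^ (k - l - 1)), nu q z R (a + q ^ l * (e + q * b)) ≤ (q ^ (k - l - 1) : Nat) / GG q z R + R ^ 4 := by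
      intro a _
      refine le_trans (le_of_eq (Me rfl fun b _ => ?_)) (BT (r := q ^ (l + 1)) hR ((Pi_cop q z).pow_right _) (a + q ^ l * e) _)
      congr 1; ring
    refine (Mf this).trans ?_
    rw [Ms, Mq, Mj]; push_cast
    have h2 : §q ^ l * R ^ 4 ≤ q ^ j * R ^ 4 := Mb (Ml q1 h.le) pv
    rw [mul_add, Ki]; linarith
  · have : ∀ b ∈ range (q ^ (k - l - 1)), ∑ a ∈ range (q ^ l), nu q z R (a + q ^ l * (e + q * b)) ≤ (q ^ l : Nat) / GG q z R + R ^ 4 := by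
      intro b _
      refine le_trans (le_of_eq (Me rfl fun a _ => ?_)) (BT (r := 1) hR (Lr _) (q ^ l * (e + q * b)) _)
      congr 1; ring
    refine (Mf this).trans ?_
    rw [Ms, Mq, Mj]; push_cast
    have h2 : §q ^ (k - l - 1) * R ^ 4 ≤ q ^ j * R ^ 4 := Mb (Ml q1 om) pv
    rw [mul_add, mul_comm (§q ^ l), Ki]; linarith
lemma endprimes (q : Nat) (hq : 5 ≤ q) (j : Nat) (ε : Real) (hε : 0 < ε) : ∀ᶠ k : Nat in atTop, ∀ Z : Finset Nat, Z ⊆ range q →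
    §q ^ k * (lg 2 - ε - 512 * j * Z.card / q.totient) ≤
      ∑ p ∈ range (q ^ k) with p.Prime ∧ q ^ (k / 400) ≤ p ∧ q < p ∧ ∀ l < k, (l < j ∨ k - j ≤ l) → p / q ^ l % q ∉ Z, lg p := by
  classical
  have q5 : 5 ≤ §q := mod_cast hq
  have q1 : 1 ≤ §q := li
  have hl1 : 1 ≤ lg q := by
    rw [Lk li]; linarith [Kh]
  set C : Real := 10 + 2 * j * q * q ^ j with hC
  have lim : Tendsto (fun k : Nat => C * lg q * (k * (2 / 3 : Real) ^ k)) atTop (nhds 0) := by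
    have := (tendsto_self_mul_const_pow_of_lt_one (r := (2 / 3 : Real)) nm nm).const_mul (C * lg q)
    simpa using this
  filter_upwards [lim.eventually_le_const hε, Nm 800] with k hk k8 Z hZ
  have hs : √(§q ^ k) ≤ (2 / 3) ^ k * q ^ k := by
    rw [← Tk (pv : 0 ≤ (2 / 3 : Real) ^ k * q ^ k)]
    refine Real.sqrt_le_sqrt ?_
    rw [← mul_pow, ← pow_mul, mul_comm k 2, pow_mul]
    refine My li ?_ k
    nlinarith
  have X0 : 0 < §q ^ k := pv
  set S := √(§q ^ k) with hS
  have kk : 800 ≤ §k := mod_cast k8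
  have small : ∀ i, 2 * i ≤ k → §q ^ i ≤ S := fun i hi => by
    rw [hS]; refine Ld ?_
    rw [← pow_mul]; exact Ml q1 om
  have S1 : 1 ≤ S := by simpa using small 0 om
  have Sq : §q ≤ S := by simpa using small 1 om
  set J := (range k).filter (fun l => l < j ∨ k - j ≤ l) with hJ
  have hJc : §J.card ≤ 2 * j := by
    have : J ⊆ range j ∪ Ico (k - j) k := by
      intro l hl; simp only [hJ, Mc, Md] at hl
      simp only [mem_union, Md, mem_Ico]; omega
    have := (Mn this).trans (card_union_le _ _)
    simp only [Mq, Ta] at this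
    exact_mod_cast om
  have hZc : §Z.card ≤ q := mod_cast (Mn hZ).trans_eq (Mq q)
  have hG := G_lower (q := q) (k := k) (N2 := 64) om om om
  have hR4 : (§((q ^ (k / 64)) ^ 8)) ^ 4 ≤ S := by
    push_cast; rw [← pow_mul, ← pow_mul]; exact small _ om
  have hz4 : q ^ (k / 400) ≤ q ^ (k / 64) := Mh om om
  have hzq : q < q ^ (k / 64) := (Nat.pow_lt_pow_right om (om : 1 < k / 64)).trans_eq' (pow_one q)
  have hzS : §(q ^ (k / 64)) ≤ S := by push_cast; exact small _ om
  have hR1 : 1 ≤ (q ^ (k / 64)) ^ 8 := Kq _ _ (pow_pos om _)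
  generalize (q ^ (k / 64)) ^ 8 = R at *
  generalize q ^ (k / 64) = z at *
  set L := lg q with hL
  have lgX : ∀ p : Nat, p < q ^ k → lg p ≤ k * L := by
    intro p hp
    rcases Lt p with rfl | hp0
    · simp only [CharP.cast_eq_zero, Real.log_zero]; positivity
    · have h2 : §p ≤ §q ^ k := mod_cast hp.le
      have := Mz (mod_cast hp0) h2
      rwa [Mw] at this
  set good : Nat → Prop := fun p => p.Prime ∧ q ^ (k / 400) ≤ p ∧ q < p ∧ ∀ l < k, (l < j ∨ k - j ≤ l) → p / q ^ l % q ∉ Z with hgood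
  have kL : 0 ≤ k * L := pv
  have pt : ∀ p ∈ range (q ^ k), (if p.Prime then lg p else 0) ≤ (if good p then lg p else 0) + (if p < z then k * L else 0) +
      ∑ x ∈ J ×ˢ Z, k * L * (if p / q ^ x.1 % q = x.2 then nu q z R p else 0) := by
    intro p hp
    have hp := Md.1 hp
    have n0 : ∀ x ∈ J ×ˢ Z, 0 ≤ k * L * (if p / q ^ x.1 % q = x.2 then nu q z R p else 0) := fun x _ => Mu kL (by split_ifs; exacts [nu_nonneg .., le_rfl])
    have l0 : 0 ≤ lg p := Mm p
    have g0 : 0 ≤ (if good p then lg p else 0) := by split_ifs <;> simp [l0]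
    have g1 : 0 ≤ (if p < z then k * L else 0) := by split_ifs <;> simp [kL]
    by_cases pp : p.Prime
    swap
    · rw [if_neg pp]; linarith [Nb n0]
    rw [if_pos pp]
    by_cases hpz : p < z
    · rw [if_pos hpz]; linarith [Nb n0, lgX p hp]
    by_cases hg : good p
    · rw [if_pos hg]; linarith [Nb n0]
    have : ∃ l < k, (l < j ∨ k - j ≤ l) ∧ p / q ^ l % q ∈ Z := by
      by_contra hh; push Not at hh
      exact hg ⟨pp, om, om, hh⟩
    obtain ⟨l, hl, hlj, hlZ⟩ := this
    have h1 := Jt n0 (Nk.2 ⟨Mc.2 ⟨Md.2 hl, hlj⟩, hlZ⟩ : (l, p / q ^ l % q) ∈ J ×ˢ Z)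
    have hr : rough q z p := by
      intro r hr hd
      have := (Kj (PP_prime hr) pp).1 hd
      have := Md.1 (Mc.1 hr).1
      omega
    have e : k * L = k * L * (if p / q ^ l % q = p / q ^ l % q then nu q z R p else 0) := by rw [if_pos rfl, nu_rough hR1 hr, mul_one]
    linarith [lgX p hp, e.le.trans h1]
  have tot := Mf pt
  rw [Mk, Mk, sum_comm, ← Ni, ← Ni] at tot
  have t1 : ∑ x ∈ J ×ˢ Z, ∑ p ∈ range (q ^ k), k * L * (if p / q ^ x.1 % q = x.2 then nu q z R p else 0) ≤ 2 * j * Z.card * (k * L * (q ^ k / (q * GG q z R) + q ^ j * S)) := by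
    have h0 : 0 ≤ §k * L * (q ^ k / (q * GG q z R) + q ^ j * S) := by
      have := GG_ge1 (q := q) (z := z) hR1
      positivity
    refine (Kl _ _ (k * L * (q ^ k / (q * GG q z R) + q ^ j * S)) fun x hx => ?_).trans ?_
    · rw [← mul_sum]
      refine Ma ?_ kL
      obtain ⟨h1, h2⟩ := Nk.1 hx
      refine (bad_dig om hR1 (Md.1 (Mc.1 h1).1) (Md.1 (hZ h2)) (Mc.1 h1).2).trans ?_
      have := Ma hR4 (pv : 0 ≤ §q ^ j)
      linarith
    · rw [card_product, Mj, Nat.cast_mul]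
      exact Mb (Mb hJc pv) h0
  have t2 : ∑ p ∈ range (q ^ k), (if p < z then k * L else 0) ≤ S * (k * L) := by
    rw [← Ni, Ms, Mj]
    refine Mb (le_trans ?_ hzS) kL
    have : (range (q ^ k)).filter (· < z) ⊆ range z := fun x hx => Md.2 (Mc.1 hx).2
    exact_mod_cast (Mn this).trans_eq (Mq z)
  have t3 : Chebyshev.theta (q ^ k : Nat) ≤ ∑ p ∈ range (q ^ k) with p.Prime, lg p := by
    rw [Chebyshev.theta_eq_sum_Icc, Nat.floor_natCast]
    refine Mg (fun p hp => ?_) fun p _ _ => Mm p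
    obtain ⟨h1, h2⟩ := Mc.1 hp
    have h1 := (mem_Icc.1 h1).2
    refine Mc.2 ⟨Md.2 (lt_of_le_of_ne h1 ?_), h2⟩
    rintro rfl
    exact Nat.Prime.not_prime_pow om h2
  have t4 := Chebyshev.theta_ge (q ^ k)
  have t5 : lg ((q ^ k : Nat) + 1) ≤ 2 * (k * L) := by
    have : §(q ^ k) + 1 ≤ (§q ^ k) ^ 2 := by 
      have h5 : 5 ≤ §q ^ k := q5.trans (Td q1 om)
      have := Mb h5 X0.le
      rw [sq, Lj]; linarith
    refine (Mz pv this).trans (le_of_eq ?_)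
    rw [Mw, Mw]; push_cast; ring
  push_cast at t4 t5 t3
  rw [Mw, ← hS, ← hL] at t4
  have t6 : 2 * j * Z.card * (k * L * (q ^ k / (q * GG q z R))) ≤ q ^ k * (512 * j * Z.card / q.totient) := by
    have h1 : §q ^ k / (q * GG q z R) ≤ q ^ k / (q * (q.totient * k * L / (4 * q * (64 : Nat)))) :=
      Ko X0.le pv (Ma hG li)
    have h2 := Ma (Ma h1 kL) (pv : 0 ≤ 2 * §j * Z.card)
    refine h2.trans (le_of_eq ?_)
    push_cast; field_simp; ring
  have t7 : 2 * j * Z.card * (k * L * (q ^ j * S)) ≤ 2 * j * q * q ^ j * (k * L * S) := by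
    have h2 := Ma hZc (pv : 0 ≤ 2 * j * (q ^ j) * (k * L * S))
    linarith
  have t8 : C * (k * L * S) ≤ ε * q ^ k := by
    have h1 := Ma hs (pv : 0 ≤ C * (k * L))
    have h2 := Mb hk X0.le
    linarith
  have t9 : k * L ≤ k * L * S := le_mul_of_one_le_right kL S1
  rw [hC] at t8
  have := Mu kL (li : 0 ≤ S)
  linarith
def E1 (q : Nat) (D : Finset Nat) : Finset Nat := range q \ insert 0 D
def E0 (q : Nat) (D : Finset Nat) : Finset Nat := (E1 q D).filter (·.Coprime q)
def EA (q : Nat) (D : Finset Nat) (l : Nat) : Finset Nat := if l = 0 then E0 q D else E1 q D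
def EB (q : Nat) (D : Finset Nat) (j k l : Nat) : Finset Nat := if l = 0 then E0 q D else if l < j ∨ k - j ≤ l then E1 q D else range q
lemma EB_sub (q : Nat) (D : Finset Nat) (j k l : Nat) : EB q D j k l ⊆ range q := by
  unfold EB E0 E1; split_ifs; exacts [(Ln _ _).trans sdiff_subset, sdiff_subset, subset_rfl]
lemma EA_sub (q : Nat) (D : Finset Nat) (l : Nat) : EA q D l ⊆ range q := by
  unfold EA E0 E1; split_ifs; exacts [(Ln _ _).trans sdiff_subset, sdiff_subset]
lemma VB_ge {D : Finset Nat} (hq : 2 ≤ q) (hk : 800 ≤ k) (hj : 1 ≤ j) :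
    §q / (E0 q D).card * ∑ p ∈ range (q ^ k) with p.Prime ∧ q ^ (k / 400) ≤ p ∧ q < p ∧ ∀ l < k, (l < j ∨ k - j ≤ l) → p / q ^ l % q ∉ insert 0 D, lg p
     ≤ VV q k (q ^ (k / 400)) (wE q (EB q D j k) k) := by
  classical
  unfold VV; rw [Ni, mul_sum]
  refine Mf fun p _ => ?_
  have w0 := (wE_FW q om (EB q D j k) (EB_sub q D j k) k).nonneg p
  split_ifs with h1 h2 h2
  · rw [ArithmeticFunction.vonMangoldt_apply_prime h1.1]
    refine Mb ?_ (Mm p)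
    obtain ⟨k, rfl⟩ : ∃ m, k = m + 1 := ⟨k - 1, om⟩
    unfold wE dw; rw [prod_range_succ']
    have hcop : p.Coprime q := (Nat.Prime.coprime_iff_not_dvd h1.1).2 fun hd => by have := Ng om hd; omega
    have e1 : ∀ l, l < k + 1 → (l < j ∨ k + 1 - j ≤ l) → p / q ^ l % q ∈ E1 q D := fun l hl hlj => mem_sdiff.2 ⟨Md.2 (Ti _ om), h1.2.2.2 l hl hlj⟩
    have a0 : gE q (EB q D j (k+1)) 0 (p / q ^ 0 % q) = q / (E0 q D).card := by
      have hm0 : p / q ^ 0 % q ∈ E0 q D := Mc.2 ⟨e1 0 om (Or.inl om), by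
        rw [pow_zero, Nat.div_one]; unfold Nat.Coprime; rw [← Nat.gcd_rec, Nat.gcd_comm]; exact hcop⟩
      unfold gE EB; rw [if_pos rfl, if_pos hm0]
    rw [a0]
    refine Ls pv ?_
    refine Finset.one_le_prod fun l hl => ?_
    have hl := Md.1 hl
    have hm : p / q ^ (l+1) % q ∈ EB q D j (k+1) (l+1) := by
      unfold EB; rw [if_neg om]; split_ifs with h3
      · exact e1 (l+1) om h3
      · exact Md.2 (Ti _ om)
    unfold gE; rw [if_pos hm, one_le_div (mod_cast card_pos.2 ⟨_, hm⟩)]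
    exact_mod_cast (Mn (EB_sub ..)).trans_eq (Mq q)
  · exact absurd (fun r hr hd => by
      have := (Kj (PP_prime hr) h1.1).1 hd
      have := Md.1 (Mc.1 hr).1
      omega) h2
  · rw [mul_zero]; exact Mu w0 Lc
  · simp
lemma VA_le {D : Finset Nat} (hq : 2 ≤ q) (hk : 1 ≤ k) (hE : q ≤ 2 * (E1 q D).card) (z : Nat) :
    VV q k z (wE q (EA q D) k) ≤ q * 2 ^ k * (((range (q ^ k)).filter (fun p => p.Prime ∧ ∀ l < k, p / q ^ l % q ∈ E1 q D)).card * (k * lg q) + 2 * √(§q ^ k) * (k * lg q)) := by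
  classical
  have q0 : 0 < §q := pv
  have wb : ∀ n, wE q (EA q D) k n ≤ q * 2 ^ k := by
    intro n
    obtain ⟨k, rfl⟩ : ∃ m, k = m + 1 := ⟨k - 1, om⟩
    unfold wE dw; rw [prod_range_succ', mul_comm]
    have b0 : gE q (EA q D) 0 (n / q ^ 0 % q) ≤ q := by
      unfold gE; split_ifs with h
      · exact div_le_self q0.le (mod_cast card_pos.2 ⟨_, h⟩)
      · exact q0.le
    have b1 : ∏ l ∈ range k, gE q (EA q D) (l+1) (n / q ^ (l+1) % q) ≤ ∏ l ∈ range k, 2 := by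
      refine Ly (fun l _ => gE_nonneg ..) fun l _ => ?_
      unfold gE EA; rw [if_neg (Nat.succ_ne_zero l)]; split_ifs with h
      · rw [Nj (mod_cast card_pos.2 ⟨_, h⟩)]; exact_mod_cast hE
      · norm_num
    rw [prod_const, Mq] at b1
    refine Mx b0 (b1.trans (Ml nm om)) (Lf fun l _ => gE_nonneg ..) q0.le
  have w0 : ∀ n, 0 ≤ wE q (EA q D) k n := fun n => by unfold wE dw; exact Lf fun l _ => gE_nonneg ..
  set A : Nat → Prop := fun p => p.Prime ∧ ∀ l < k, p / q ^ l % q ∈ E1 q D with hA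
  have pt : ∀ n ∈ range (q ^ k), (if rough q z n then wE q (EA q D) k n * vM n else 0) ≤
      q * 2 ^ k * ((if A n then k * lg q else 0) + (if ¬ n.Prime then vM n else 0)) := by
    intro n hn
    have v0 : 0 ≤ vM n := Lc
    have t0 : 0 ≤ (if A n then k * lg q else 0) := by split_ifs <;> positivity
    have t1 : 0 ≤ (if ¬ n.Prime then vM n else 0) := by split_ifs <;> simp [v0]
    have t2 : (if rough q z n then wE q (EA q D) k n * vM n else 0) ≤ wE q (EA q D) k n * vM n := by
      split_ifs; exacts [le_rfl, Mu (w0 n) v0]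
    refine t2.trans ?_
    by_cases hw : wE q (EA q D) k n = 0
    · rw [hw, zero_mul]; positivity
    refine Mx (wb n) ?_ v0 pv
    by_cases hp : n.Prime
    · have : A n := ⟨hp, fun l hl => by
        by_contra h
        refine hw (wE_zero hl fun h2 => h ?_)
        unfold EA E0 at h2; split_ifs at h2; exacts [(Mc.1 h2).1, h2]⟩
      rw [if_pos this]
      refine le_trans ?_ (le_add_of_nonneg_right t1)
      refine ArithmeticFunction.vonMangoldt_le_log.trans ?_
      have h2 : §n ≤ §q ^ k := mod_cast (Md.1 hn).le
      have := Mz (mod_cast hp.pos) h2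
      rwa [Mw] at this
    · rw [if_pos hp]; linarith
  refine (Mf pt).trans ?_
  rw [← mul_sum, Mk, ← Ni, ← Ni, Ms, Mj]
  refine Ma (add_le_add_right ?_ _) pv
  have h1 := Chebyshev.psi_sub_theta_le (x := (q ^ k : Nat)) (mod_cast Kq _ _ om)
  rw [Chebyshev.psi_sub_theta_eq_sum_not_prime, Nat.floor_natCast] at h1
  push_cast at h1
  rw [Mw] at h1
  refine le_trans ?_ h1
  refine le_trans (le_of_eq ?_) (Mg (s := ((range (q ^ k)).filter (fun n => ¬ n.Prime)).erase 0) ?_ fun n _ _ => Lc)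
  · rw [sum_erase]; simp
  · intro n hn
    obtain ⟨h1, h2⟩ := mem_erase.1 hn
    obtain ⟨h2, h3⟩ := Mc.1 h2
    exact Mc.2 ⟨mem_Ioc.2 ⟨om, (Md.1 h2).le⟩, h3⟩
lemma E0_card (D : Finset Nat) : q.totient ≤ (E0 q D).card + (insert 0 D).card := by
  classical
  rw [Nat.totient_eq_card_coprime]
  refine (Mn (t := E0 q D ∪ insert 0 D) fun a ha => ?_).trans (card_union_le _ _)
  obtain ⟨h1, h2⟩ := Mc.1 ha
  by_cases h : a ∈ insert 0 D
  · exact mem_union_right _ h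
  · exact mem_union_left _ (Mc.2 ⟨mem_sdiff.2 ⟨h1, h⟩, h2.symm⟩)
lemma E0_le (D : Finset Nat) : (E0 q D).card ≤ q.totient := by
  rw [Nat.totient_eq_card_coprime]
  refine Mn fun a ha => ?_
  obtain ⟨h1, h2⟩ := Mc.1 ha
  exact Mc.2 ⟨(mem_sdiff.1 h1).1, h2.symm⟩
lemma PR_ar {M L Y g : Real} {q k : Nat} (hM : 0 ≤ M) (q0 : 0 < §q) (L0 : 0 < L) (hk : 800 ≤ k) (h8 : (8:Real) ^ k ≤ Y)
    (key : Y * Y / 4 ≤ q * 2 ^ k * (g * (k * L) + 2 * Y * (k * L))) (hlim : (M + 2) * (4 * q * L) * (k * (1 / 4 : Real) ^ k) ≤ 1) : M ≤ g := by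
  have p4 : (0:Real) < 4 ^ k := pv
  have p84 : (8:Real) ^ k = 2 ^ k * 4 ^ k := by rw [← mul_pow]; norm_num
  have hlim2 : (M + 2) * (4 * q * L * k) ≤ 4 ^ k := by
    have : (M + 2) * (4 * q * L) * (k * (1 / 4 : Real) ^ k) * 4 ^ k ≤ 1 * 4 ^ k := Mb hlim p4.le
    have h2 : (1 / 4 : Real) ^ k * 4 ^ k = 1 := by rw [← mul_pow]; norm_num
    calc _ = (M + 2) * (4 * q * L) * k * ((1 / 4 : Real) ^ k * 4 ^ k) := by rw [h2]; ring
      _ ≤ _ := li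
  by_contra! hg
  have Y1 : 1 ≤ Y := (Nz nm).trans h8
  have B0 : 0 < 4 * q * L * k := pv
  generalize hBd : 4 * q * L * k = B at *
  have key2 : Y * Y ≤ 2 ^ k * B * (g + 2 * Y) := by rw [← hBd]; linarith
  have h3 : g + 2 * Y < (M + 2) * Y := by nlinarith [Ma Y1 hM]
  have h4 : 2 ^ k * B * (g + 2 * Y) < 2 ^ k * B * ((M + 2) * Y) := mul_lt_mul_of_pos_left h3 pv
  have h5 : 2 ^ k * Y * ((M + 2) * B) ≤ 2 ^ k * Y * 4 ^ k := Ma hlim2 pv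
  have h6 : Y * (2 ^ k * 4 ^ k) ≤ Y * Y := Ma li li
  linarith
lemma PR {q : Nat} (hq : 64 ≤ q) {D : Finset Nat} (hD : D ⊆ range q) {s : Real} (hs : §(insert 0 D).card ≤ s) (hs3 : 2 * s + 1 < q)
    (hA : (2 * (3 + lg q + √s) + 7) ^ 3 ≤ √q / 2) {n : Nat} (hn : n = 16 * 400) (hAN : (9 * (√(3 + lg q) + √(√s * s / q))) ^ n ≤ q)
    {K j i1 : Nat} (hi1 : q ^ K ≤ 2 ^ i1) (hij : i1 ≤ j) (hj : 1 ≤ j) (hjs : 512 * j * s / q.totient ≤ 1 / 10)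
    (hfin : 32 * §q ^ 4 * 38400 ^ 2 * (1536 * q ^ (4 * K + 1) / q ^ j + 64 * q ^ 4 * (3 / 4) ^ K) ≤ 1 / 100) {M : Real} (hM : 0 ≤ M) :
    ∀ᶠ k : Nat in atTop, M ≤ ((range (q ^ k)).filter (fun p => p.Prime ∧ ∀ l < k, p / q ^ l % q ∈ E1 q D)).card := by
  classical
  have q64 : 64 ≤ §q := mod_cast hq
  have hl1 : 1 ≤ lg q := by
    rw [Lk li]; linarith [Kh]
  have hφ : (1:Real) ≤ q.totient := mod_cast Np.2 om
  have hφq : (q.totient:Real) ≤ q := mod_cast Nat.totient_le q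
  have s1 : (1:Real) ≤ (insert 0 D).card := mod_cast card_pos.2 (insert_nonempty 0 D)
  have j1 : 1 ≤ §j := mod_cast hj
  have hjs' := (Nj li).1 hjs
  have e0 : (E0 q D).Nonempty := by
    rw [← card_pos]
    by_contra h
    have h1 := E0_card (q := q) D
    have h2 : (q.totient:Real) ≤ (insert 0 D).card := mod_cast (om : q.totient ≤ (insert 0 D).card)
    nlinarith
  have e1 : (E1 q D).Nonempty := e0.mono (Ln _ _)
  have hZ : insert 0 D ⊆ range q := insert_subset (Md.2 om) hD
  have c1 : (range q \ E1 q D).card ≤ (insert 0 D).card := Mn fun a ha => by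
    by_contra h
    obtain ⟨h1, h2⟩ := mem_sdiff.1 ha
    exact h2 (mem_sdiff.2 ⟨h1, h⟩)
  have c1' : §(range q \ E1 q D).card ≤ s := le_trans (mod_cast c1) hs
  have e2 : q ≤ 2 * (E1 q D).card := by
    have h1 : (E1 q D).card + (insert 0 D).card = q := by
      unfold E1; rw [card_sdiff_of_subset hZ, Mq]; have := Mn hZ; rw [Mq] at this; omega
    have h2 : 2 * ((insert 0 D).card:Real) ≤ q := li
    have h3 : 2 * (insert 0 D).card ≤ q := mod_cast h2
    omega
  have hfA : DF q _ _ (fun l => af (EA q D l)) := mkDF q om (EA q D) (EA_sub q D) (fun l => by unfold EA; split_ifs; exacts [e0, e1]) s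
    (fun l hl => by unfold EA; rw [if_neg om]; exact c1') hs3
  have hfB : ∀ k, DF q _ _ (fun l => af (EB q D j k l)) := fun k => mkDF q om (EB q D j k) (EB_sub q D j k)
    (fun l => by unfold EB; split_ifs; exacts [e0, e1, ⟨0, Md.2 om⟩]) s
    (fun l hl => by unfold EB; rw [if_neg om]; split_ifs; exacts [c1', by simp; linarith]) hs3
  have hA2 : 2 ≤ 9 * (√(3 + lg q) + √(√s * s / q)) := by
    have : 1 ≤ √(3 + lg q) := Real.one_le_sqrt.2 li
    linarith [Lo (√s * s / q)]
  have lim : Tendsto (fun k : Nat => (M + 2) * (4 * q * lg q) * (k * (1 / 4 : Real) ^ k)) atTop (nhds 0) := by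
    have := (tendsto_self_mul_const_pow_of_lt_one (r := (1 / 4 : Real)) nm nm).const_mul ((M + 2) * (4 * q * lg q))
    simpa using this
  filter_upwards [T_diff q om _ _ hA hA2 400 nm (hn ▸ hAN) K j i1 hi1 hij hj (1 / 100) nm, L_diff q om _ (9 * (√(3 + lg q) + √(√s * s / q))) hA (1 / 100) nm,
    endprimes q om j (1 / 100) nm, Nm 800, Nm (2 * j + 2), lim.eventually_le_const (nm : (0:Real) < 1)] with k hT hL hE hk hkj hlim
  have hT := hT (EA q D) (EB q D j k) (EA_sub q D) (EB_sub q D j k) hfA (hfB k)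
    (fun l hl => by unfold EA EB; split_ifs; exacts [rfl, rfl]) (fun n hn => by unfold EA at hn; rw [if_pos rfl] at hn; exact (Mc.1 hn).2)
    (fun h => by unfold EA at h; rw [if_neg om] at h; exact (mem_sdiff.1 h).2 (mem_insert_self 0 D))
  have wA := wE_FW q om (EA q D) (EA_sub q D) k
  have wB := wE_FW q om (EB q D j k) (EB_sub q D j k) k
  have hL := hL _ _ _ _ hfA (hfB k) wA wB
  have hV := V_cmp (q := q) (k := k) (z := q ^ (k / 400)) om om wA.nonneg wB.nonneg (fun n hn => wE_zero (l := k - 1) om (by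
    rw [hn]; intro h; unfold EA at h; rw [if_neg om] at h; exact (mem_sdiff.1 h).2 (mem_insert_self 0 D)))
  have hE := hE (insert 0 D) hZ
  have hB := VB_ge (D := D) (j := j) (q := q) om hk hj
  have hAl := VA_le (D := D) (q := q) (k := k) om om e2 (q ^ (k / 400))
  generalize VV q k (q ^ (k / 400)) (wE q (EA q D) k) = vA at *
  generalize VV q k (q ^ (k / 400)) (wE q (EB q D j k) k) = vB at *
  generalize (∑ p ∈ range (q ^ k) with p.Prime ∧ q ^ (k / 400) ≤ p ∧ q < p ∧ ∀ l < k, (l < j ∨ k - j ≤ l) → p / q ^ l % q ∉ insert 0 D, lg p) = S at *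
  generalize (((range (q ^ k)).filter (fun p => p.Prime ∧ ∀ l < k, p / q ^ l % q ∈ E1 q D)).card : Real) = g at *
  generalize |TL q k (q ^ (k / 400)) (wE q (EA q D) k) - TL q k (q ^ (k / 400)) (wE q (EB q D j k) k)| = tt at *
  generalize k * lg q * |LL q k (q ^ (k / 400)) (wE q (EA q D) k) - LL q k (q ^ (k / 400)) (wE q (EB q D j k) k)| + lg q * LL q k (q ^ (k / 400)) (wE q (EA q D) k) = ll at *
  have ec : §(96 * 400) = 38400 := nm
  rw [ec] at hT
  have X0 : (0:Real) < §q ^ k := pv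
  have hT2 : tt ≤ §q ^ k * (1 / 50) := hT.trans (Ma li X0.le)
  have hr : §q / q.totient ≤ q / (E0 q D).card := Ko li (mod_cast card_pos.2 e0) (mod_cast E0_le D)
  have hr1 : 1 ≤ §q / q.totient := (one_le_div li).2 hφq
  have hz : 512 * j * §(insert 0 D).card / q.totient ≤ 1 / 10 := le_trans (Mv (Ma hs pv) li) hjs
  have hS : §q ^ k * (1 / 2) ≤ S := le_trans (Ma (by linarith [Jp]) X0.le) hE
  generalize §q / (E0 q D).card = r at *
  generalize §q / q.totient = r' at *
  have hB2 : r * (§q ^ k * (1 / 2)) ≤ vB := (Ma hS li).trans hB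
  have hvA : §q ^ k / 4 ≤ vA := by
    have h1 := Mb hr X0.le
    have h2 := Mb (hr1.trans hr) X0.le
    linarith
  have key := hvA.trans hAl
  have h8 : (8:Real) ^ k ≤ √(§q ^ k) := by
    apply Ld
    rw [← pow_mul, mul_comm, pow_mul]; exact My nm li k
  have hX := Kg X0.le
  generalize √(§q ^ k) = Y at *
  rw [← hX] at key
  exact PR_ar hM li li hk h8 key hlim
lemma prod_pred (S : Finset Nat) (h : ∀ p ∈ S, 2 ≤ p) : ∏ p ∈ S, p ≤ (∏ p ∈ S, (p - 1)) * (S.card + 1) := by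
  classical
  induction S using Finset.induction_on_max with
  | empty => simp
  | insert p S hS ih =>
    have hp : p ∉ S := fun hp => lt_irrefl _ (hS p hp)
    rw [prod_insert hp, prod_insert hp, card_insert_of_notMem hp]
    have ih := ih fun x hx => h x (mem_insert_of_mem hx)
    have hc : S.card ≤ p - 2 := by
      refine (Mn (t := Ico 2 p) fun x hx => mem_Ico.2 ⟨h x (mem_insert_of_mem hx), hS x hx⟩).trans (by simp)
    have h2 := h p (mem_insert_self _ _)
    obtain ⟨m, rfl⟩ : ∃ m, p = m + 2 := ⟨p - 2, om⟩
    have e : m + 2 - 1 = m + 1 := om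
    rw [e]; have hc : S.card ≤ m := by simpa using hc
    generalize S.card = n at *
    generalize ∏ p ∈ S, p = A at *
    generalize ∏ p ∈ S, (p - 1) = B at *
    calc (m + 2) * A ≤ (m + 2) * (B * (n + 1)) := Ns _ ih
      _ ≤ (m + 1) * B * (n + 1 + 1) := by nlinarith [Ns B hc]
lemma tot_ge (hq : 2 ≤ q) : q ≤ q.totient * (Nat.clog 2 q + 1) := by
  have h1 := prod_pred q.primeFactors fun p hp => (Mp hp).two_le
  have h2 := Nat.totient_mul_prod_primeFactors q
  have h3 : q.primeFactors.card ≤ Nat.clog 2 q := by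
    have a : 2 ^ q.primeFactors.card ≤ ∏ p ∈ q.primeFactors, p := by
      rw [← prod_const]; exact Ly (fun _ _ => om) fun p hp => (Mp hp).two_le
    have b := Ng om (Nat.prod_primeFactors_dvd q)
    exact (Nat.pow_le_pow_iff_right (a := 2) om).1 ((a.trans b).trans (Tb om q))
  have h4 : 0 < ∏ p ∈ q.primeFactors, p := prod_pos fun p hp => (Mp hp).pos
  generalize ∏ p ∈ q.primeFactors, p = A at *
  generalize ∏ p ∈ q.primeFactors, (p - 1) = B at *
  refine Jc ?_ h4
  calc q * A ≤ q * (B * (q.primeFactors.card + 1)) := Ns _ h1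
    _ = q.totient * (q.primeFactors.card + 1) * A := by rw [← Nn, ← h2]; ring
    _ ≤ _ := by gcongr
lemma PR' : ∃ q₀ : Nat, ∀ q : Nat, q₀ ≤ q → ∀ D : Finset Nat, D ⊆ range q → §D.card ≤ §q ^ ((23 : Real) / 80) → 64 ≤ q ∧
    ∀ M : Real, 0 ≤ M → ∀ᶠ k : Nat in atTop, M ≤ ((range (q ^ k)).filter (fun p => p.Prime ∧ ∀ l < k, p / q ^ l % q ∈ E1 q D)).card := by
  have ev : ∀ᶠ q : Nat in atTop, 1000 * (lg q + 10) ≤ §q ^ ((1:Real) / 6400) := by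
    have h1 := (isLittleO_log_rpow_atTop (r := (1:Real) / 6400) nm).bound (nm : (0:Real) < 1 / 2000)
    have h2 := (tendsto_rpow_atTop (y := (1:Real) / 6400) nm).eventually_ge_atTop 20000
    filter_upwards [tendsto_natCast_atTop_atTop.eventually h1, tendsto_natCast_atTop_atTop.eventually h2, Nm 1] with q h1 h2 hq
    rw [Real.norm_of_nonneg (Mm q), Real.norm_of_nonneg pv] at h1
    linarith
  obtain ⟨q₀, h₀⟩ := eventually_atTop.1 ev
  refine ⟨max q₀ 10000, fun q hq D hD hc => ⟨om, fun M hM => ?_⟩⟩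
  have ht := h₀ q om
  have q4 : 10000 ≤ q := om
  have q4' : 10000 ≤ §q := mod_cast q4
  have q0 : 0 ≤ §q := li
  have hl1 : 1 ≤ lg q := by
    rw [Lk li]; linarith [Kh]
  set t := §q ^ ((1:Real) / 6400) with htd
  have tp : ∀ m : Nat, t ^ m = §q ^ (§m / 6400) := fun m => by
    rw [htd, ← Real.rpow_natCast, ← Real.rpow_mul q0]; congr 1; ring
  have tq : ∀ n : Nat, n = 16 * 400 → t ^ n = q := fun n hn => by
    rw [tp, hn]; norm_num
  obtain ⟨a, ha⟩ : ∃ a, a = t ^ 920 := ⟨_, rfl⟩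
  have t1 : 1 ≤ t := li
  have at1 : t ≤ a := by rw [ha]; exact Td t1 nm
  have hs2 : §q ^ ((23:Real) / 80) = a ^ 2 := by
    rw [ha, ← pow_mul, tp]; congr 1; norm_num
  have hsq : a ^ 3 * t ≤ √q := by
    rw [Real.sqrt_eq_rpow, show (1:Real) / 2 = §(3200) / 6400 by norm_num, ← tp, ha, ← pow_mul, ← pow_succ]
    exact Ml t1 nm
  rw [hs2] at hc
  clear_value t
  clear ha tp
  have hqs := Jm q0
  have a1 : 1 ≤ a := t1.trans at1
  have hq6 : a ^ 6 * t ^ 2 ≤ q := by rw [← hqs]; exact (rg : a ^ 6 * t ^ 2 = (a ^ 3 * t) ^ 2).le.trans (My pv hsq 2)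
  have a2 : 1 ≤ a ^ 2 := Nz a1
  have hs : √(a ^ 2 + 1) ≤ 2 * a := Jx.2 ⟨li, by nlinarith⟩
  have a36 : a ^ 3 ≤ a ^ 6 := Ml a1 nm
  have a26 : a ^ 2 ≤ a ^ 6 := Ml a1 nm
  have t100 : 1000 ≤ t := li
  have t10 : 10000 ≤ t := li
  have tt : 1000000 ≤ t ^ 2 := by linarith [My nm t100 2]
  set c := Nat.clog 2 q with hcd
  have hc1 : 1 ≤ c := Nat.clog_pos nm om
  have hq2c : q ≤ 2 ^ c := Tb om q
  have hcl : §c ≤ 2 * lg q + 1 := by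
    have h1 : 2 ^ (c - 1) < q := Nat.pow_pred_clog_lt_self nm om
    have h2 : ((2:Real) ^ (c - 1)) ≤ q := mod_cast h1.le
    have h3 := Mz pv h2
    rw [Mw] at h3
    have h4 : §(c - 1) = c - 1 := by rw [Nat.cast_sub hc1]; simp
    rw [h4] at h3
    have h5 : 1 ≤ §c := mod_cast hc1
    linarith [Ma Jp.le (sub_nonneg.2 h5)]
  have hct : 10 * (§c + 1) ≤ t := li
  have hφ := tot_ge (q := q) om
  rw [← hcd] at hφ
  have hφ' : §q ≤ q.totient * (c + 1) := mod_cast hφ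
  have hφ0 : (0:Real) < q.totient := mod_cast Np.2 om
  have hc1' : 1 ≤ §c := mod_cast hc1
  clear_value c
  have hbig : (4 * a ^ 2) * 1000000 ≤ 4 * q := by
    have := Mx a26 tt nm pv
    linarith
  refine PR (n := 16 * 400) (s := a ^ 2 + 1) (K := 36 * c) (i1 := 36 * c * c) (j := 36 * c * c + 144 * c + 13) om hD ?_ ?_ ?_ rfl ?_ ?_ om om ?_ ?_ hM
  · have : §(insert 0 D).card ≤ D.card + 1 := mod_cast card_insert_le 0 D
    linarith
  · linarith
  · calc (2 * (3 + lg q + √(a ^ 2 + 1)) + 7) ^ 3 ≤ (5 * a) ^ 3 := My pv li 3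
      _ ≤ a ^ 3 * t / 2 := by linarith [Ma t100 (pv : 0 ≤ a ^ 3), pow_pos (li : 0 < a) 3]
      _ ≤ _ := li
  · have h1 : 9 * (√(3 + lg q) + √(√(a ^ 2 + 1) * (a ^ 2 + 1) / q)) ≤ t := by
      have b1 : √(3 + lg q) ≤ 3 + lg q := Jx.2 ⟨li, Td li nm⟩
      have b2 : √(√(a ^ 2 + 1) * (a ^ 2 + 1) / q) ≤ 1 := by
        refine Jx.2 ⟨zero_le_one, ?_⟩; rw [one_pow, Kb li]
        calc √(a ^ 2 + 1) * (a ^ 2 + 1) ≤ 2 * a * (2 * a ^ 2) := Mx hs li pv li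
          _ = 4 * a ^ 3 := rg
          _ ≤ a ^ 6 * t ^ 2 := by linarith [Ma tt (pv : 0 ≤ a ^ 6), pow_pos (li : 0 < a) 3]
          _ ≤ _ := hq6
      linarith
    calc _ ≤ t ^ (16 * 400) := My pv h1 _
      _ = q := tq _ rfl
      _ ≤ _ := le_rfl
  · calc q ^ (36 * c) ≤ (2 ^ c) ^ (36 * c) := Nd hq2c _
      _ = _ := by rw [← pow_mul]; congr 1; ring
  · rw [Nj hφ0]
    push_cast
    have b1 : 36 * §c * c + 144 * c + 13 ≤ 2 * t ^ 2 := by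
      have := Mx hct hct li li
      linarith [Mb hc1' (li : 0 ≤ §c)]
    have b2 : 512 * (36 * §c * c + 144 * c + 13) * (a ^ 2 + 1) ≤ 512 * (2 * t ^ 2) * (2 * a ^ 2) := by gcongr; linarith
    have b3 : a ^ 2 * (t * (t * t ^ 2)) ≤ a ^ 2 * (a * (a * t ^ 2)) := by gcongr
    have b4 : a ^ 4 * t ^ 2 ≤ a ^ 6 * t ^ 2 := by gcongr; norm_num
    have b5 : 20480 * (a ^ 2 * t ^ 2) * (c + 1) ≤ q.totient * (c + 1) := by
      have : 20480 * (c + 1) * (a ^ 2 * t ^ 2) ≤ t * t * (a ^ 2 * t ^ 2) := Mb (by linarith [Mb t10 (li : 0 ≤ t)]) pv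
      linarith
    have b6 := Jc b5 li
    linarith
  · have q1 : 1 ≤ §q := li
    have d1 : §q ^ (4 * (36 * c) + 1) / q ^ (36 * c * c + 144 * c + 13) ≤ 1 / q ^ 12 := by
      rw [Nx pv pv, one_mul, ← pow_add]
      exact Ml q1 (by linarith [Nat.zero_le (36 * c * c)])
    have d2 : (3 / 4 : Real) ^ (36 * c) ≤ 1 / q ^ 12 := by
      have e1 : (3 / 4 : Real) ^ (36 * c) = (((3/4:Real) ^ 3) ^ c) ^ 12 := by rw [← pow_mul, ← pow_mul]; congr 1; ring
      have e2 : ((3/4:Real) ^ 3) ^ c ≤ (1/2) ^ c := My nm nm c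
      have e3 : (1/2:Real) ^ c ≤ 1 / q := by
        rw [one_div_pow]; exact Lv li (mod_cast hq2c)
      rw [e1, ← one_div_pow]; exact My pv (e2.trans e3) 12
    have q8 : (10000:Real) ^ 4 ≤ q ^ 4 := My nm q4' 4
    rw [Ki]
    calc _ ≤ 32 * §q ^ 4 * 38400 ^ 2 * (1536 * q ^ 4 * (1 / q ^ 12) + 64 * q ^ 4 * (1 / q ^ 12)) := by
          refine Ma (Nc ?_ (Ma d2 pv)) pv
          refine (Ma d1 nm).trans (Mb ?_ pv)
          linarith [Nz (n := 4) q1]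
      _ = 32 * 38400 ^ 2 * 1600 / q ^ 4 := by field_simp; ring
      _ ≤ _ := by rw [Nx pv nm]; linarith
lemma ints_le (p : Nat) (x L : Real) (hL : 0 ≤ L) (T : Finset Nat) (hT : T ⊆ range p)
    (h : ∀ a ∈ T, ∃ k : Int, x < a + k * p ∧ a + k * p < x + L) : §T.card ≤ L + 1 := by
  classical
  have h1 : T ⊆ (Icc (⌊x⌋ + 1) (⌈x + L⌉ - 1)).image (fun n : Int => (n % p).toNat) := fun a ha => by
    obtain ⟨k, h1, h2⟩ := h a ha
    have ha := Md.1 (hT ha)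
    refine Lp.2 ⟨a + k * p, mem_Icc.2 ⟨?_, ?_⟩, ?_⟩
    · exact Int.add_one_le_iff.2 (Int.floor_lt.2 (mod_cast h1))
    · exact Int.le_sub_one_iff.2 (Int.lt_ceil.2 (mod_cast h2))
    · rw [Int.add_mul_emod_self_right, Int.emod_eq_of_lt om om]; rfl
  have h2 := (Mn h1).trans card_image_le
  rw [Int.card_Icc] at h2
  have h6 := Int.lt_floor_add_one x
  have h7 := Int.ceil_lt_add_one (x + L)
  rcases le_total (⌈x + L⌉ - 1 + 1 - (⌊x⌋ + 1)) 0 with h | h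
  · rw [Int.toNat_of_nonpos h] at h2
    rw [Nat.le_zero.1 h2, Th]; linarith
  · have h8 : (T.card : Int) ≤ ⌈x + L⌉ - 1 + 1 - (⌊x⌋ + 1) := by rw [← Int.toNat_of_nonneg h]; exact_mod_cast h2
    have h9 : §T.card ≤ ⌈x + L⌉ - 1 + 1 - (⌊x⌋ + 1) := mod_cast h8
    linarith
def near (δ x y : Real) : Prop := ∃ k : Int, 0 < x - y - k ∧ x - y - k < δ
open scoped Classical in
lemma full_card (hp : 0 < p) (hp' : 0 < p') (hc : p.Coprime p') {δ : Real} (h0 : 0 < δ) (h1 : δ < 1) :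
    let c := (((range p ×ˢ range p').filter (fun a => near δ (a.1 / p) (a.2 / p'))).card : Real)
    δ * (p * p') - 1 ≤ c ∧ c ≤ δ * (p * p') := by
  classical
  intro c
  set φ : Nat × Nat → Nat := fun a => ((a.1 * p' - a.2 * p : Int) % (p * p' : Nat)).toNat with hφ
  have P0 : (0:Int) < (p * p' : Nat) := mod_cast Nat.mul_pos hp hp'
  have hφc : ∀ a, ((φ a : Nat):Int) = (a.1 * p' - a.2 * p : Int) % (p * p' : Nat) := fun a => Int.toNat_of_nonneg (Int.emod_nonneg _ P0.ne')
  have hφl : ∀ a, φ a < p * p' := fun a => by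
    have := Int.emod_lt_of_pos (a.1 * p' - a.2 * p : Int) P0
    rw [← hφc] at this; exact_mod_cast this
  have hinj : Set.InjOn φ (range p ×ˢ range p' : Finset (Nat × Nat)) := by
    rintro ⟨a, b⟩ ha ⟨a', b'⟩ ha' h
    simp only [coe_product, Set.mem_prod, mem_coe, Md] at ha ha'
    have h2 : (a * p' - b * p : Int) % (p * p' : Nat) = (a' * p' - b' * p : Int) % (p * p' : Nat) := by
      rw [← hφc (a, b), ← hφc (a', b'), h]
    have h3 : ((p * p' : Nat):Int) ∣ (a' * p' - b' * p) - (a * p' - b * p) := Int.ModEq.dvd h2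
    have e : ((a' * p' - b' * p) - (a * p' - b * p) : Int) = (a' - a) * p' - (b' - b) * p := rg
    rw [e] at h3
    have h4 : (p:Int) ∣ (a' - a) * p' := by
      have := (Int.natCast_dvd_natCast.2 (Lm p p')).trans h3
      exact (dvd_sub_left (Je _ _)).1 this
    have h5 : (p':Int) ∣ (b' - b) * p := by
      have := (Int.natCast_dvd_natCast.2 (Je p' p)).trans h3
      exact (dvd_sub_right (Je _ _)).1 this
    have h6 := Nr (IsCoprime.dvd_of_dvd_mul_right (Nat.isCoprime_iff_coprime.2 hc) h4) (by rw [abs_lt]; omega)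
    have h7 := Nr (IsCoprime.dvd_of_dvd_mul_right (Nat.isCoprime_iff_coprime.2 hc.symm) h5) (by rw [abs_lt]; omega)
    rw [Prod.mk.injEq]; omega
  have himg : (range p ×ˢ range p').image φ = range (p * p') := by
    refine eq_of_subset_of_card_le (fun r hr => ?_) ?_
    · obtain ⟨a, -, rfl⟩ := Lp.1 hr; exact Md.2 (hφl a)
    · rw [card_image_of_injOn hinj, card_product]; simp
  have heq : ∀ a : Nat × Nat, near δ (a.1 / p) (a.2 / p') ↔ 0 < φ a ∧ (φ a : Real) < δ * (p * p') := by
    intro a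
    have p0 : 0 < §p := mod_cast hp
    have p0' : 0 < §p' := mod_cast hp'
    have e : ∀ k : Int, (a.1 / p - a.2 / p' - k : Real) = ((a.1 * p' - a.2 * p - k * (p * p' : Nat) : Int) : Real) / (p * p') := fun k => by
      push_cast; field_simp
    unfold near; simp only [e, div_pos_iff_of_pos_right (mul_pos p0 p0'), div_lt_iff₀ (mul_pos p0 p0')]
    constructor
    · rintro ⟨k, h2, h3⟩
      have h2 : 0 < (a.1 * p' - a.2 * p - k * (p * p' : Nat) : Int) := mod_cast h2
      have h4 : (a.1 * p' - a.2 * p - k * (p * p' : Nat) : Int) < (p * p' : Nat) := by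
        have : ((a.1 * p' - a.2 * p - k * (p * p' : Nat) : Int):Real) < (p * p' : Nat) := h3.trans (by push_cast; exact mul_lt_of_lt_one_left (mul_pos p0 p0') h1)
        exact_mod_cast this
      have h5 : ((φ a : Nat):Int) = a.1 * p' - a.2 * p - k * (p * p' : Nat) := by
        rw [hφc, ← Int.emod_eq_of_lt h2.le h4, Int.sub_mul_emod_self_right]
      rw [← h5] at h2 h3
      exact ⟨mod_cast h2, mod_cast h3⟩
    · rintro ⟨h2, h3⟩
      have h5 : (a.1 * p' - a.2 * p - ((a.1 * p' - a.2 * p : Int) / (p * p' : Nat)) * (p * p' : Nat) : Int) = (φ a : Nat) := by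
        rw [hφc, Int.emod_def]; ring
      refine ⟨(a.1 * p' - a.2 * p : Int) / (p * p' : Nat), ?_⟩
      rw [h5]; exact ⟨mod_cast h2, mod_cast h3⟩
  have hc2 : c = ((range (p * p')).filter (fun r : Nat => 0 < r ∧ §r < δ * (p * p'))).card := by
    rw [← himg, filter_image, card_image_of_injOn (hinj.mono (coe_subset.2 (Ln _ _)))]
    simp only [c, heq]
  have x0 : 0 < δ * (p * p') := pv
  have x1 : δ * (p * p') ≤ (p * p' : Nat) := by push_cast; exact mul_le_of_le_one_left pv h1.le
  rw [hc2]
  generalize δ * (p * p') = x at *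
  constructor
  · have : Ico 1 ⌈x⌉₊ ⊆ (range (p * p')).filter (fun r : Nat => 0 < r ∧ §r < x) := fun r hr => by
      have hr := mem_Ico.1 hr
      have h := Nat.lt_ceil.1 hr.2
      exact Mc.2 ⟨Md.2 (mod_cast h.trans_le x1), hr.1, h⟩
    have := Mn this
    rw [Ta] at this
    have h2 := Nat.le_ceil x
    have h3 : (⌈x⌉₊ : Real) ≤ ((range (p * p')).filter (fun r : Nat => 0 < r ∧ §r < x)).card + 1 := by
      have h4 : ⌈x⌉₊ ≤ ((range (p * p')).filter (fun r : Nat => 0 < r ∧ §r < x)).card + 1 := om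
      exact_mod_cast h4
    linarith
  · have : (range (p * p')).filter (fun r : Nat => 0 < r ∧ §r < x) ⊆ Ioc 0 ⌊x⌋₊ := fun r hr => by
      obtain ⟨-, h2, h3⟩ := Mc.1 hr
      exact mem_Ioc.2 ⟨h2, Nat.le_floor h3.le⟩
    have := Mn this
    rw [Nat.card_Ioc, Nat.sub_zero] at this
    exact (mod_cast this : (_:Real) ≤ (⌊x⌋₊:Real)).trans (Kd x0.le)
open scoped Classical in
noncomputable def NW (δ : Real) (p p' : Nat) (A A' : Finset Nat) : Real := ((A ×ˢ A').filter (fun a : Nat × Nat => near δ (a.1 / p) (a.2 / p'))).card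
lemma NW_eq (δ : Real) (p p' : Nat) (A A' : Finset Nat) [∀ x y : Real, Decidable (near δ x y)] : NW δ p p' A A' = ∑ a ∈ A, ∑ a' ∈ A', if near δ (a / p) (a' / p') then 1 else 0 := by
  classical
  unfold NW; rw [← sum_product' (f := fun a a' : Nat => if near δ (a / p) (a' / p') then (1:Real) else 0), card_filter]; push_cast
  refine Me rfl fun x _ => ?_
  split_ifs <;> rfl
lemma NW_bd (hp : 0 < p) (hp' : 0 < p') (hc : p.Coprime p') {δ C : Real} (h0 : 0 < δ) (h1 : δ < 1) {A A' : Finset Nat}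
    (hA : A ⊆ range p) (hA' : A' ⊆ range p') (hC : §(range p \ A).card ≤ C) (hC' : §(range p' \ A').card ≤ C) :
    δ * (p * p') - 1 - C * (δ * p' + 1) - C * (δ * p + 1) ≤ NW δ p p' A A' ∧ NW δ p p' A A' ≤ δ * (p * p') := by
  classical
  have hf := full_card hp hp' hc h0 h1
  rw [show (((range p ×ˢ range p').filter (fun a : Nat × Nat => near δ (a.1 / p) (a.2 / p'))).card : Real) = NW δ p p' (range p) (range p') by rfl] at hf
  have p0 : 0 < §p := mod_cast hp
  have p0' : 0 < §p' := mod_cast hp'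
  have row : ∀ a : Nat, (∑ a' ∈ range p', if near δ (a / p) (a' / p') then (1:Real) else 0) ≤ δ * p' + 1 := fun a => by
    rw [sum_boole]
    refine ints_le p' ((a / p : Real) * p' - δ * p') _ pv _ (Ln _ _) fun b hb => ?_
    obtain ⟨k, h2, h3⟩ := (Mc.1 hb).2
    have e : ((a / p : Real) - b / p' - k) * p' = a / p * p' - (b + k * p') := by field_simp; ring
    have h2 := mul_pos h2 p0'
    have h3 := mul_lt_mul_of_pos_right h3 p0'
    rw [e] at h2 h3
    exact ⟨k, li, li⟩
  have col : ∀ b : Nat, (∑ a ∈ range p, if near δ (a / p) (b / p') then (1:Real) else 0) ≤ δ * p + 1 := fun b => by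
    rw [sum_boole]
    refine ints_le p ((b / p' : Real) * p) _ pv _ (Ln _ _) fun a ha => ?_
    obtain ⟨k, h2, h3⟩ := (Mc.1 ha).2
    have e : ((a / p : Real) - b / p' - k) * p = a - k * p - b / p' * p := by field_simp; ring
    have h2 := mul_pos h2 p0
    have h3 := mul_lt_mul_of_pos_right h3 p0
    rw [e] at h2 h3
    exact ⟨-k, by push_cast; linarith, by push_cast; linarith⟩
  have g0 : ∀ a b : Nat, (0:Real) ≤ if near δ (a / p) (b / p') then (1:Real) else 0 := fun a b => by split_ifs <;> norm_num
  have up : NW δ p p' A A' ≤ NW δ p p' (range p) (range p') := by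
    unfold NW; exact_mod_cast Mn (filter_subset_filter _ (product_subset_product hA hA'))
  refine ⟨?_, up.trans hf.2⟩
  have key : NW δ p p' (range p) (range p') ≤ NW δ p p' A A' + C * (δ * p' + 1) + C * (δ * p + 1) := by
    have s1 : NW δ p p' (range p) (range p') = NW δ p p' (range p \ A) (range p') + (NW δ p p' A (range p' \ A') + NW δ p p' A A') := by
      simp only [NW_eq]
      rw [← sum_sdiff hA, ← Mk]
      congr 1
      exact Me rfl fun a _ => (sum_sdiff hA').symm
    have s2 : NW δ p p' (range p \ A) (range p') ≤ C * (δ * p' + 1) := by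
      rw [NW_eq]
      refine (Mf fun a _ => row a).trans ?_
      rw [Ms, Mj]; exact Mb hC pv
    have s3 : NW δ p p' A (range p' \ A') ≤ C * (δ * p + 1) := by
      rw [NW_eq, sum_comm]
      refine (Mf fun b _ => (Mg hA fun a _ _ => g0 a b).trans (col b)).trans ?_
      rw [Ms, Mj]; exact Mb hC' pv
    linarith
  linarith [hf.1]
lemma NW_diag {p : Nat} (hp : 0 < p) {δ : Real} (h1 : δ * p ≤ 1) (A A' : Finset Nat) : NW δ p p A A' = 0 := by
  classical
  unfold NW; rw [Nat.cast_eq_zero, card_eq_zero, filter_eq_empty_iff]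
  rintro ⟨a, b⟩ - ⟨k, h2, h3⟩
  have p0 : 0 < §p := mod_cast hp
  have e : ((a / p : Real) - b / p - k) * p = ((a - b - k * p : Int):Real) := by push_cast; field_simp
  have h2 := mul_pos h2 p0
  have h3 := mul_lt_mul_of_pos_right h3 p0
  simp only at h2 h3
  rw [e] at h2 h3
  have h4 := h3.trans_le h1
  have h2 : 0 < (a - b - k * p : Int) := mod_cast h2
  have h4 : (a - b - k * p : Int) < 1 := mod_cast h4
  omega
def AA (P : Polynomial Int) (p : Nat) : Finset Nat := (Icc 1 p).filter fun a : Nat => Int.gcd (P.eval (a : Int)) (p : Int) = 1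
lemma AA_sub {P : Polynomial Int} (hP : P.eval 0 = 0) (hp : p.Prime) : AA P p ⊆ range p := fun a ha => by
  obtain ⟨h1, h2⟩ := Mc.1 ha
  obtain ⟨h1, h3⟩ := mem_Icc.1 h1
  refine Md.2 (lt_of_le_of_ne h3 ?_)
  rintro rfl
  have : (a:Int) ∣ P.eval (a:Int) := by
    have := Polynomial.sub_dvd_eval_sub (a:Int) 0 P
    rwa [hP, sub_zero, sub_zero] at this
  have := Int.dvd_gcd this dvd_rfl
  rw [h2] at this
  have := hp.two_le
  have := Ng nm ‹a ∣ 1›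
  omega
lemma sumF {P : Polynomial Int} (hP : P.eval 0 = 0) {B : Finset Nat} (hB : ∀ p ∈ B, p.Prime) (g : ℚ → Real) :
    ∑ x ∈ fareyPrimeSet P B, g x = ∑ p ∈ B, ∑ a ∈ AA P p, g (a / p) := by
  have cr : ∀ p ∈ B, ∀ p' ∈ B, ∀ a ∈ AA P p, ∀ a' ∈ AA P p', (a / p : ℚ) = a' / p' → p = p' ∧ a = a' := by
    intro p hp p' hp' a ha a' ha' h
    have p0 := (hB p hp).pos
    have p0' := (hB p' hp').pos
    have l1 := Md.1 (AA_sub hP (hB p hp) ha)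
    have l2 := Md.1 (AA_sub hP (hB p' hp') ha')
    have a0 := (mem_Icc.1 (Mc.1 ha).1).1
    rw [div_eq_div_iff (mod_cast p0.ne') (mod_cast p0'.ne')] at h
    have h : a * p' = a' * p := mod_cast h
    have e : p = p' := by
      have : p ∣ a * p' := h ▸ Je p a'
      rcases (hB p hp).dvd_mul.1 this with h2 | h2
      · have := Ng a0 h2; omega
      · exact (Kj (hB p hp) (hB p' hp')).1 h2
    subst e
    exact ⟨rfl, Nat.eq_of_mul_eq_mul_right p0 h⟩
  unfold fareyPrimeSet
  rw [sum_biUnion]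
  · refine Me rfl fun p hp => ?_
    rw [sum_image]
    · rfl
    · exact fun a ha a' ha' h => (cr p hp p hp a ha a' ha' h).2
  · intro p hp p' hp' hne
    rw [Function.onFun, disjoint_left]
    intro x hx hx'
    obtain ⟨a, ha, rfl⟩ := Lp.1 hx
    obtain ⟨a', ha', h⟩ := Lp.1 hx'
    exact hne (cr p hp p' hp' a ha a' ha' h.symm).1
lemma pc_ar {Λ C M S N n R : Real} (hΛ : 0 < Λ) (hC : 1 ≤ C) (hM : 2 * C ≤ M) (n0 : 1 ≤ n) (hS : M * n ^ 2 ≤ S)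
    (hN : S - C * n ≤ N) (hN2 : N ≤ S) (hR : R ≤ Λ / N * S ^ 2) (hR2 : Λ / N * S ^ 2 - n ^ 2 - 2 * C * (Λ / N * S * n + n ^ 2) - Λ / N * S * (S / M) ≤ R) :
    |R / N - Λ| ≤ (14 * C * Λ + 6 * C + Λ) / M := by
  have M0 : 0 < M := li
  have n1 : n ≤ n ^ 2 := Td n0 nm
  have hS1 : M * n ≤ S := (Ma n1 M0.le).trans hS
  have hS0 : 0 < S := Jg pv hS1
  have hn : n ≤ S / M := by rw [Na M0]; linarith
  have hn2 : n ^ 2 ≤ S / M := by rw [Na M0]; linarith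
  obtain ⟨x, hx⟩ : ∃ x, x = C / M := ⟨_, rfl⟩
  have x0 : 0 < x := by rw [hx]; positivity
  have x1 : x ≤ 1 / 2 := by rw [hx, Nx M0 nm]; linarith
  have hN1 : S * (1 - x) ≤ N := by
    have : C * n ≤ C * (S / M) := Ma hn li
    have e : C * (S / M) = S * x := by rw [hx]; ring
    linarith
  have N0 : 0 < N := Jg (mul_pos hS0 li) hN1
  obtain ⟨r, hr⟩ : ∃ r, r = S / N := ⟨_, rfl⟩
  have r1 : 1 ≤ r := by rw [hr, one_le_div N0]; exact hN2
  have rx : r * (1 - x) ≤ 1 := by rw [hr, div_mul_eq_mul_div, Kb N0]; exact hN1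
  have r2 : r ≤ 2 := by nlinarith
  have rr : r ^ 2 ≤ 1 + 6 * x := by nlinarith
  have u1 : R / N ≤ Λ * r ^ 2 := by
    rw [Nj N0]; refine hR.trans (le_of_eq ?_); rw [hr]; field_simp
  have l1 : Λ * r ^ 2 - (1 + 2 * C) * (r / M) - 2 * C * Λ * r ^ 2 / M - Λ * r ^ 2 / M ≤ R / N := by
    rw [Na N0]
    refine le_trans ?_ hR2
    have e1 : (Λ * r ^ 2 - (1 + 2 * C) * (r / M) - 2 * C * Λ * r ^ 2 / M - Λ * r ^ 2 / M) * N = Λ / N * S ^ 2 - (1 + 2 * C) * (S / M) - 2 * C * (Λ / N * S * (S / M)) - Λ / N * S * (S / M) := by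
      rw [hr]; field_simp
    rw [e1]
    have e2 : 2 * C * (Λ / N * S * n) ≤ 2 * C * (Λ / N * S * (S / M)) := by gcongr
    have e3 : (1 + 2 * C) * n ^ 2 ≤ (1 + 2 * C) * (S / M) := by gcongr
    linarith
  have i0 : 0 < 1 / M := pv
  obtain ⟨i, hi⟩ : ∃ i, i = 1 / M := ⟨_, rfl⟩
  have hxi : x = C * i := by rw [hx, hi]; ring
  rw [← hi] at i0
  rw [abs_le, show (14 * C * Λ + 6 * C + Λ) / M = (14 * C * Λ + 6 * C + Λ) * i by rw [hi]; ring]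
  have e4 : Λ * r ^ 2 - (1 + 2 * C) * (r / M) - 2 * C * Λ * r ^ 2 / M - Λ * r ^ 2 / M = Λ * r ^ 2 - (1 + 2 * C) * r * i - 2 * C * Λ * r ^ 2 * i - Λ * r ^ 2 * i := by rw [hi]; ring
  rw [e4] at l1
  have v1 : Λ * r ^ 2 ≤ Λ * (1 + 6 * x) := Ma rr hΛ.le
  have v2 : Λ * 1 ≤ Λ * r ^ 2 := Ma (Nz r1) hΛ.le
  have v3 : (1 + 2 * C) * r * i ≤ (3 * C) * 2 * i := by gcongr; linarith
  have r4 : r ^ 2 ≤ 4 := by nlinarith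
  have v4 : 2 * C * Λ * r ^ 2 * i ≤ 2 * C * Λ * 4 * i := by gcongr
  have v5 : Λ * r ^ 2 * i ≤ Λ * (1 + 6 * x) * i := by gcongr
  have v6 : Λ * (6 * x) * i ≤ Λ * (6 * C) * i := by gcongr; linarith
  have v7 : 0 < C * Λ * i := pv
  have v9 : 0 < Λ * i := pv
  constructor
  · linarith
  · rw [hxi] at v1; linarith
lemma PC {P : Polynomial Int} (hP : P.eval 0 = 0) {B : Finset Nat} (hB : ∀ p ∈ B, p.Prime) (hne : B.Nonempty) {Λ C M : Real} (hΛ : 0 < Λ) (hC : 1 ≤ C)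
    (hAC : ∀ p ∈ B, ((range p \ AA P p).card : Real) ≤ C) (hM : 2 * C ≤ M) (hM2 : 2 * Λ ≤ M) (hp : ∀ p ∈ B, M * p ≤ ∑ p ∈ B, (p:Real))
    (hn : M * (B.card : Real) ^ 2 ≤ ∑ p ∈ B, (p:Real)) :
    |pairCorr (fareyPrimeSet P B) Λ - Λ| ≤ (14 * C * Λ + 6 * C + Λ) / M := by
  classical
  set F := fareyPrimeSet P B with hF
  set S := ∑ p ∈ B, (p:Real) with hS
  have M0 : 0 < M := li
  have n0 : (1:Real) ≤ B.card := mod_cast card_pos.2 hne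
  have hA1 : ∀ p ∈ B, ((AA P p).card : Real) = p - (range p \ AA P p).card := fun p hp => by
    have := Ke (AA_sub hP (hB p hp))
    rw [Mq] at this
    have h2 : ((range p \ AA P p).card : Real) + (AA P p).card = p := mod_cast this
    linarith
  have hNe : (F.card : Real) = ∑ p ∈ B, ((AA P p).card : Real) := by
    have := sumF hP hB (fun _ => 1)
    simpa using this
  have hN : S - C * B.card ≤ F.card := by
    rw [hNe, hS, mul_comm, ← Mj, ← Ms, ← Nh]
    exact Mf fun p hp => by rw [hA1 p hp]; linarith [hAC p hp]
  have hN2 : (F.card : Real) ≤ S := by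
    rw [hNe, hS]
    exact Mf fun p hp => by rw [hA1 p hp]; linarith [Mt (α := Real) (range p \ AA P p).card]
  have hSn : M * B.card ≤ S := le_trans (Ma (Td n0 nm) M0.le) hn
  have S0 : 0 < S := Jg pv hSn
  have hNS : S ≤ 2 * F.card := by
    have : 2 * C * B.card ≤ M * B.card := Mb hM li
    linarith
  have N0 : (0:Real) < F.card := li
  set δ := Λ / F.card with hδ
  have δ0 : 0 < δ := pv
  have hδp : ∀ p ∈ B, δ * p ≤ 1 := fun p hp' => by
    rw [hδ, div_mul_eq_mul_div, Kb N0]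
    have := hp p hp'
    have h2 : 2 * Λ * p ≤ M * p := Mb hM2 pv
    linarith
  have δ1 : δ < 1 := by
    obtain ⟨p, hpB⟩ := hne
    have h2 : (2:Real) ≤ p := mod_cast (hB p hpB).two_le
    nlinarith [hδp p hpB]
  have hcond : ∀ x y : ℚ, (x ≠ y ∧ ∃ k : Int, ((x : Real) - (y : Real) - (k : Real)) * (F.card : Real) ∈ Set.Ioo 0 Λ) ↔ near δ x y := by
    intro x y
    have e : ∀ k : Int, ((x : Real) - (y : Real) - (k : Real)) * (F.card : Real) ∈ Set.Ioo 0 Λ ↔ 0 < (x:Real) - y - k ∧ (x:Real) - y - k < δ := fun k => by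
      rw [Set.mem_Ioo, hδ, lt_div_iff₀ N0, mul_pos_iff_of_pos_right N0]
    simp only [e]
    refine ⟨fun h => h.2, fun h => ⟨?_, h⟩⟩
    rintro rfl
    obtain ⟨k, h1, h2⟩ := h
    rw [sub_self, zero_sub] at h1 h2
    have h2 := h2.trans δ1
    have h1 : 0 < -k := mod_cast h1
    have h2 : -k < 1 := mod_cast h2
    omega
  have hR : (((F ×ˢ F).filter (fun x => x.1 ≠ x.2 ∧
      ∃ k : Int, ((x.1 : Real) - (x.2 : Real) - (k : Real)) * (F.card : Real) ∈ Set.Ioo 0 Λ)).card : Real) = ∑ p ∈ B, ∑ p' ∈ B, NW δ p p' (AA P p) (AA P p') := by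
    simp only [hcond]
    rw [card_filter]; push_cast
    rw [sum_product' (f := fun x y : ℚ => if near δ x y then (1:Real) else 0), sumF hP hB]
    refine Me rfl fun p _ => ?_
    simp only [NW_eq]
    rw [eq_comm, sum_comm]
    refine Me rfl fun a _ => ?_
    rw [sumF hP hB]
    refine Me rfl fun p' _ => ?_
    refine Me rfl fun a' _ => ?_
    push_cast; rfl
  have hpc : pairCorr F Λ = (∑ p ∈ B, ∑ p' ∈ B, NW δ p p' (AA P p) (AA P p')) / F.card := by
    rw [← hR]; unfold pairCorr; congr!
  rw [hpc]
  have hbd : ∀ p ∈ B, ∀ p' ∈ B, δ * (p * p') - 1 - C * (δ * p' + 1) - C * (δ * p + 1) - (if p = p' then δ * (p * p') else 0) ≤ NW δ p p' (AA P p) (AA P p') ∧ NW δ p p' (AA P p) (AA P p') ≤ δ * (p * p') := by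
    intro p hp p' hp'
    by_cases h : p = p'
    · subst h
      rw [NW_diag (hB p hp).pos (hδp p hp), if_pos rfl]
      have : 0 ≤ C * (δ * p + 1) := pv
      exact ⟨li, pv⟩
    · rw [if_neg h, sub_zero]
      exact NW_bd (hB p hp).pos (hB p' hp').pos ((Nat.coprime_primes (hB p hp) (hB p' hp')).2 h) δ0 δ1 (AA_sub hP (hB p hp)) (AA_sub hP (hB p' hp')) (hAC p hp) (hAC p' hp')
  have e1 : ∑ p ∈ B, ∑ p' ∈ B, δ * ((p:Real) * p') = δ * S ^ 2 := by
    simp only [← mul_sum]; rw [← sum_mul, ← hS]; ring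
  refine pc_ar (S := S) (N := F.card) (n := B.card) hΛ hC hM n0 hn hN hN2 ?_ ?_
  · rw [← hδ, ← e1]
    exact Mf fun p hp => Mf fun p' hp' => (hbd p hp p' hp').2
  · rw [← hδ]
    refine le_trans ?_ (Mf fun p hp => Mf fun p' hp' => (hbd p hp p' hp').1)
    have e2 : ∑ p ∈ B, ∑ p' ∈ B, (if p = p' then δ * ((p:Real) * p') else 0) ≤ δ * S * (S / M) := by
      calc _ = ∑ p ∈ B, δ * ((p:Real) * p) := Me rfl fun p hp => by rw [sum_ite_eq, if_pos hp]
        _ ≤ ∑ p ∈ B, δ * ((p:Real) * (S / M)) := Mf fun p hp' => by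
            have : (p:Real) ≤ S / M := by rw [Na M0]; linarith [hp p hp']
            gcongr
        _ = _ := by rw [← mul_sum, ← sum_mul, ← hS]; ring
    have e3 : ∑ p ∈ B, ∑ p' ∈ B, C * (δ * (p':Real) + 1) = C * (δ * S * B.card + (B.card:Real) ^ 2) := by
      rw [Ms]; simp only [← mul_sum, Mk]; rw [← hS]; simp; ring
    have e4 : ∑ p ∈ B, ∑ p' ∈ B, C * (δ * (p:Real) + 1) = C * (δ * S * B.card + (B.card:Real) ^ 2) := by rw [sum_comm, e3]
    simp only [Nh]
    rw [e1, e3, e4]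
    have e5 : ∑ p ∈ B, ∑ p' ∈ B, (1:Real) = (B.card:Real) ^ 2 := by simp; ring
    rw [e5]; linarith
lemma root_bd {c : Nat → Int} (hc : c ν ≠ 0) (hν : 1 ≤ ν) {P : Polynomial Int}
    (hP : P = ∑ i ∈ Icc 1 ν, Polynomial.C (c i) * Polynomial.X ^ i) :
    P.eval 0 = 0 ∧ ∀ p : Nat, p.Prime → (range p \ AA P p).card ≤ ν + (c ν).natAbs := by
  have h0 : P.eval 0 = 0 := by
    rw [hP, Polynomial.eval_finsetSum]
    refine Jk fun i hi => ?_
    have := (mem_Icc.1 hi).1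
    simp [show i ≠ 0 by omega]
  refine ⟨h0, fun p hp => ?_⟩
  haveI := Fact.mk hp
  by_cases hd : p ∣ (c ν).natAbs
  · have := Ng (Int.natAbs_pos.2 hc) hd
    refine (Mn sdiff_subset).trans ?_
    rw [Mq]; omega
  have hd' : ((c ν : Int) : ZMod p) ≠ 0 := by
    rw [Ne, ZMod.intCast_zmod_eq_zero_iff_dvd, Int.natCast_dvd]; exact hd
  have hco : P.coeff ν = c ν := by
    rw [hP, Polynomial.finsetSum_coeff]
    simp [Polynomial.coeff_X_pow, hν]
  set R := P.map (Int.castRingHom (ZMod p)) with hR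
  have hR0 : R ≠ 0 := by
    intro h
    apply hd'
    have := congrArg (fun r => r.coeff ν) h
    simpa [hR, hco] using this
  have hdeg : R.natDegree ≤ ν := by
    refine Polynomial.natDegree_map_le.trans ?_
    rw [hP]
    refine Polynomial.natDegree_sum_le_of_forall_le _ _ fun i hi => ?_
    exact (Polynomial.natDegree_C_mul_X_pow_le _ _).trans (mem_Icc.1 hi).2
  have : (range p \ AA P p).card ≤ R.roots.toFinset.card := by
    refine card_le_card_of_injOn (fun a : Nat => (a : ZMod p)) (fun a ha => ?_) ?_
    · rw [mem_coe, Ji, Md] at ha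
      rw [mem_coe, Multiset.mem_toFinset, Polynomial.mem_roots hR0, Polynomial.IsRoot.def]
      have e : R.eval (a : ZMod p) = ((P.eval (a : Int) : Int) : ZMod p) := by
        rw [hR, Polynomial.eval_map, ← Jv a]
        exact Polynomial.eval₂_at_apply (Int.castRingHom (ZMod p)) (a : Int)
      show R.eval (a : ZMod p) = 0
      rw [e, ZMod.intCast_zmod_eq_zero_iff_dvd]
      rcases Lt a with rfl | h
      · simp [h0]
      · have h2 := ha.2
        rw [AA, Mc, mem_Icc, not_and] at h2
        have h3 := h2 ⟨h, ha.1.le⟩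
        by_contra h4
        apply h3
        rw [Int.gcd_comm]
        exact Int.isCoprime_iff_gcd_eq_one.1 (((Nat.prime_iff_prime_int.1 hp).coprime_iff_not_dvd).2 h4)
    · intro a ha b hb h
      rw [mem_coe, Ji, Md] at ha hb
      have := (ZMod.natCast_eq_natCast_iff _ _ _).1 h
      exact Nat.ModEq.eq_of_lt_of_lt this ha.1 hb.1
  have := R.roots.toFinset_card_le
  have := R.card_roots'
  omega
lemma dens {M : Real} (hM : 0 < M) : ∃ n0 : Real, ∀ B : Finset Nat, (∀ p ∈ B, p.Prime) → n0 ≤ B.card →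
    M * §B.card ^ 2 ≤ ∑ p ∈ B, (p : Real) := by
  have h2 := Real.tendsto_log_atTop.eventually_ge_atTop (8 * M * (lg 4 + 1))
  obtain ⟨x0, hx0⟩ := eventually_atTop.1 ((Chebyshev.eventually_primeCounting_le one_pos).and (h2.and (eventually_gt_atTop 1)))
  refine ⟨x0 / (4 * M), fun B hB hn => ?_⟩
  rw [Nj pv] at hn
  obtain ⟨h1, h3, h4⟩ := hx0 _ hn
  obtain ⟨n, hn'⟩ : ∃ n : Real, n = B.card := ⟨_, rfl⟩
  rw [← hn'] at h1 h3 h4 hn ⊢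
  set x := n * (4 * M) with hx
  have lx : 0 < lg x := Jo h4
  have hpi : §(Nat.primeCounting ⌊x⌋₊) ≤ n / 2 := by
    refine h1.trans ?_
    rw [Nj lx]
    have : 0 ≤ n := by rw [hn']; positivity
    calc (lg 4 + 1) * x = n / 2 * (8 * M * (lg 4 + 1)) := by rw [hx]; ring
      _ ≤ _ := Ma h3 pv
  have hs : ((B.filter (fun p : Nat => §p ≤ x)).card : Real) ≤ n / 2 := by
    refine le_trans ?_ hpi
    rw [← Nat.primesLE_card_eq_primeCounting]
    refine Nat.cast_le.2 (Mn fun p hp => ?_)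
    rw [Mc] at hp
    rw [Nat.mem_primesLE]
    exact ⟨Nat.le_floor hp.2, hB p hp.1⟩
  have hc := card_filter_add_card_filter_not (s := B) (fun p : Nat => §p ≤ x)
  have hc' : ((B.filter (fun p : Nat => §p ≤ x)).card : Real) + (B.filter (fun p : Nat => ¬ §p ≤ x)).card = n := by
    rw [hn']; exact_mod_cast hc
  have hb : (B.filter (fun p : Nat => ¬ §p ≤ x)).card * x ≤ ∑ p ∈ B, (p : Real) := by
    refine le_trans ?_ (Mg (Ln (fun p : Nat => ¬ §p ≤ x) B) fun _ _ _ => Mt _)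
    rw [← Mj]
    exact card_nsmul_le_sum _ _ _ fun p hp => (not_le.1 (Mc.1 hp).2).le
  refine le_trans ?_ hb
  have : n / 2 * x ≤ (B.filter (fun p : Nat => ¬ §p ≤ x)).card * x :=
    Mb li li
  have : 0 ≤ M * n ^ 2 := pv
  linarith
def GP (q : Nat) (D : Finset Nat) (k : Nat) : Finset Nat :=
  (range (q^k)).filter (fun p => p.Prime ∧ ∀ l < k, p / q^l % q ∈ E1 q D)
lemma GP_sub {D : Finset Nat} (hq : 2 ≤ q) (hk : q ^ k ≤ Q) : GP q D k ⊆ restrictedDigitPrimes q D Q := by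
  intro p hp
  rw [GP, Mc, Md] at hp
  obtain ⟨h1, h2, h3⟩ := hp
  rw [restrictedDigitPrimes, Mc, mem_Icc]
  refine ⟨⟨h2.one_lt.le, om⟩, h2, fun d hd => ?_⟩
  obtain ⟨i, hi, rfl⟩ := List.mem_iff_getElem.1 hd
  have hl := (Nat.digits_length_le_iff om p).2 h1
  have := h3 i om
  rw [← Nat.getD_digits p i hq, List.getD_eq_getElem _ _ hi, E1, Ji, mem_insert, not_or] at this
  exact this.2.2
lemma GP_ge {D : Finset Nat} (hq : 2 ≤ q) (hp : p ∈ GP q D (k + 1)) : q ^ k ≤ p := by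
  rw [GP, Mc] at hp
  have := hp.2.2 k om
  rw [E1, Ji, mem_insert, not_or] at this
  by_contra h
  exact this.2.1 (by rw [Kr om, Nat.zero_mod])
theorem main {D : Finset Nat} (hq : 64 ≤ q) (h : ∀ M : Real, 0 ≤ M → ∀ᶠ k in atTop, M ≤ (GP q D k).card)
    {P : Polynomial Int} (hP : P.eval 0 = 0) {C : Real} (hC : 1 ≤ C)
    (hAC : ∀ p : Nat, p.Prime → §(range p \ AA P p).card ≤ C) {Λ : Real} (hΛ : 0 < Λ) :
    Tendsto (fun Q : Nat => pairCorr (fareyPrimeSet P (restrictedDigitPrimes q D Q)) Λ) atTop (nhds Λ) := by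
  rw [Metric.tendsto_atTop]
  intro ε hε
  obtain ⟨K, hK⟩ : ∃ K, K = 14 * C * Λ + 6 * C + Λ := ⟨_, rfl⟩
  obtain ⟨M, m1, m2, m3⟩ : ∃ M : Real, 2 * C ≤ M ∧ 2 * Λ ≤ M ∧ K / ε + 1 ≤ M :=
    ⟨max (2 * C) (max (2 * Λ) (K / ε + 1)), le_max_left _ _, (le_max_left _ _).trans (Te _ _),
      (Te _ _).trans (Te _ _)⟩
  have M0 : 0 < M := li
  obtain ⟨n0, hn0⟩ := dens M0
  obtain ⟨k0, hk0⟩ := eventually_atTop.1 (h (max (max n0 1) (M * q ^ 2)) pv)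
  refine ⟨q ^ (k0 + 1), fun Q hQ => ?_⟩
  have Q0 : Q ≠ 0 := ((pv : 0 < q ^ (k0 + 1)).trans_le hQ).ne'
  obtain ⟨k, hk⟩ : ∃ k, Nat.log q Q = k + 1 := Nat.exists_eq_succ_of_ne_zero (by
    have := Nat.le_log_of_pow_le om hQ
    omega)
  have hkk : k0 ≤ k + 1 := by
    have := Nat.le_log_of_pow_le om hQ
    omega
  have hc := hk0 _ hkk
  have g1 : q ^ (k + 1) ≤ Q := hk ▸ Nat.pow_log_le_self q Q0
  have g2 : Q < q ^ (k + 2) := by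
    have := Nat.lt_pow_succ_log_self (b := q) om Q
    rwa [hk] at this
  set B := restrictedDigitPrimes q D Q with hB
  have hs : GP q D (k + 1) ⊆ B := GP_sub om g1
  have hBp : ∀ p ∈ B, p.Prime ∧ p ≤ Q := fun p hp => by
    rw [hB, restrictedDigitPrimes, Mc, mem_Icc] at hp
    exact ⟨hp.2.1, hp.1.2⟩
  have hcc : ((GP q D (k + 1)).card : Real) ≤ B.card := Nat.cast_le.2 (Mn hs)
  have c1 : max n0 1 ≤ ((GP q D (k + 1)).card : Real) := (le_max_left _ _).trans hc
  have c2 : M * q ^ 2 ≤ ((GP q D (k + 1)).card : Real) := (Te _ _).trans hc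
  have hne : B.Nonempty := by
    rw [← card_pos]
    have : (1 : Real) ≤ B.card := (Te _ _).trans (c1.trans hcc)
    exact_mod_cast this
  have hS : M * q ^ (k + 2) ≤ ∑ p ∈ B, (p : Real) := by
    refine le_trans ?_ (Mg hs fun _ _ _ => Mt _)
    refine le_trans ?_ (card_nsmul_le_sum _ _ (§q ^ k) fun p hp => mod_cast GP_ge om hp)
    rw [Mj]
    calc M * §q ^ (k + 2) = M * q ^ 2 * q ^ k := rg
      _ ≤ _ := Mb c2 pv
  have := PC hP (fun p hp => (hBp p hp).1) hne hΛ hC (fun p hp => hAC p (hBp p hp).1) m1 m2 (fun p hp => by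
    refine le_trans (Ma ?_ M0.le) hS
    exact_mod_cast (hBp p hp).2.trans g2.le) (hn0 B (fun p hp => (hBp p hp).1) ((le_max_left _ _).trans (c1.trans hcc)))
  rw [Real.dist_eq]
  refine this.trans_lt ?_
  rw [← hK, div_lt_iff₀ M0, ← div_lt_iff₀' hε]
  linarith
end RD

/-- **Corollary.** For all sufficiently large bases `q` and any digit set
`D ⊆ {0,…,q-1}` with `#D ≤ q^{23/80}`, the limiting pair correlation of the polynomial
Farey fractions whose denominators are primes with restricted digits exists and is
Poissonian. -/
theorem pairCorr_restrictedDigits_poissonian :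
    ∃ q₀ : ℕ, ∀ q : ℕ, q₀ ≤ q → ∀ D : Finset ℕ, D ⊆ Finset.range q →
      (D.card : ℝ) ≤ (q : ℝ) ^ ((23 : ℝ) / 80) →
      ∀ (ν : ℕ), 2 ≤ ν → ∀ (c : ℕ → ℤ), c ν ≠ 0 →
      ∀ (P : Polynomial ℤ),
        P = ∑ i ∈ Finset.Icc 1 ν, Polynomial.C (c i) * Polynomial.X ^ i →
        (P.map (Int.castRingHom ℚ)).Separable →
      ∀ Λ : ℝ, 0 < Λ →
        Tendsto (fun Q : ℕ => pairCorr (fareyPrimeSet P (restrictedDigitPrimes q D Q)) Λ)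
          atTop (nhds Λ) := by
  obtain ⟨q₀, h⟩ := RD.PR'
  refine ⟨q₀, fun q hq D hD hc ν hν c hcν P hP _ Λ hΛ => ?_⟩
  obtain ⟨h1, h2⟩ := h q hq D hD hc
  obtain ⟨h3, h4⟩ := RD.root_bd hcν (by omega) hP
  refine RD.main (C := ((ν + (c ν).natAbs : ℕ) : ℝ)) h1 h2 h3 ?_ (fun p hp => Nat.cast_le.2 (h4 p hp)) hΛ
  exact_mod_cast (show 1 ≤ ν + (c ν).natAbs by omega)
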